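/- Let f ∈ ℤ[X] be a monic irreducible cubic polynomial. Then there exist constants c > 0, C > 0 and x₀ ≥ 1 such that for every real x ≥ x₀ there exist an integer n with 1 ≤ n ≤ x and a prime p with p ∣ f(n) and p ≥ C·x^{1+c}; equivalently, the largest prime factor P(x,f) of ∏_{n ≤ x} f(n) satisfies P(x,f) ≥ C·x^{1+c}. -/

import Mathlib

notation:max "®" x:max => (x : ℝ)
notation:max "¡" x:max => (x : ℤ)
notation:max "¢" x:max => (x : ℂ)
notation:lead "mc" t:min => by exact_mod_cast t
notation "pv" => by positivity
notation "om" => by omega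
notation "ln" => by linarith
notation "nn" => by norm_num
notation "gc" => by gcongr
notation "rg" => by ring
notation "sm" => by simp
notation "nl" => by nlinarith
section
open Finset Real ComplexConjugate
lemma shift_err (G : ℤ → ℂ) (hG : ∀ s, ‖G s‖ ≤ 1) (a : ℤ) (len δ : ℕ) :
    ‖∑ i ∈ range len, G (a + i) - ∑ i ∈ range len, G (a + i + δ)‖ ≤ 2 * δ := by
  induction δ with
  | zero => simp
  | succ k ih =>
    have h1 : ∑ i ∈ range len, G (a + i + k) - ∑ i ∈ range len, G (a + i + (k + 1 : ℕ))
        = G (a + k) - G (a + len + k) := by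
      have := Finset.sum_range_sub' (fun i : ℕ => G (a + i + k)) len
      simp only [Finset.sum_sub_distrib] at this
      have e : ∀ i : ℕ, G (a + i + (k + 1 : ℕ)) = G (a + (i + 1 : ℕ) + k) := fun i => by
        congr 1; push_cast; ring
      simp only [e, this]; simp
    have h2 : ‖G (a + k) - G (a + len + k)‖ ≤ 2 :=
      (norm_sub_le _ _).trans (by linarith [hG (a + k), hG (a + len + k)])
    rw [← h1] at h2
    have := norm_add_le (∑ i ∈ range len, G (a + i) - ∑ i ∈ range len, G (a + i + k))
      (∑ i ∈ range len, G (a + i + k) - ∑ i ∈ range len, G (a + i + (k + 1 : ℕ)))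
    rw [sub_add_sub_cancel] at this
    push_cast at *
    linarith
lemma vdc (F χ : ℤ → ℂ) (hF : ∀ s, ‖F s‖ ≤ 1) (hχ : ∀ s, ‖χ s‖ ≤ 1) (m : ℕ)
    (hper : ∀ s, χ (s + m) = χ s) (a : ℤ) (len K : ℕ) (hK : 1 ≤ K) (B : ℝ) (hB0 : 0 ≤ B)
    (hB : ∀ k < K, ∀ k' < K, k ≠ k' →
      ‖∑ i ∈ range len, F (a + i + (m * k : ℕ)) * conj (F (a + i + (m * k' : ℕ)))‖ ≤ B) :
    ‖∑ i ∈ range len, χ (a + i) * F (a + i)‖ ≤ 2 * m * K + √(len ^ 2 / K + len * B) := by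
  have hKr : ®0 < K := mc hK
  have hper' : ∀ (k : ℕ) s, χ (s + (m * k : ℕ)) = χ s := by
    intro k; induction k with
    | zero => simp
    | succ k ih =>
      intro s
      have : s + (m * (k + 1) : ℕ) = s + (m * k : ℕ) + m := by push_cast; ring
      rw [this, hper, ih]
  set S := ∑ i ∈ range len, χ (a + i) * F (a + i) with hS
  set H : ℕ → ℂ := fun i => ∑ k ∈ range K, F (a + i + (m * k : ℕ)) with hH
  have hnorm : ∀ s, ‖χ s * F s‖ ≤ 1 := fun s => by
    rw [norm_mul]; exact mul_le_one₀ (hχ s) (norm_nonneg _) (hF s)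
  have h1 : ‖K * S - ∑ i ∈ range len, χ (a + i) * H i‖ ≤ K * (2 * m * K) := by
    have : K * S - ∑ i ∈ range len, χ (a + i) * H i = ∑ k ∈ range K,
        (S - ∑ i ∈ range len, χ (a + i + (m * k : ℕ)) * F (a + i + (m * k : ℕ))) := by
      simp only [hper', Finset.sum_sub_distrib, Finset.sum_const, card_range, nsmul_eq_mul, hH,
        Finset.mul_sum]
      rw [Finset.sum_comm]
    rw [this]
    refine (norm_sum_le _ _).trans ((Finset.sum_le_card_nsmul _ _ (2 * ®m * K) ?_).trans_eq sm)
    intro k hk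
    have hk' : ®k ≤ K := mc (mem_range.1 hk).le
    refine (shift_err (fun s => χ s * F s) hnorm a len (m * k)).trans ?_
    push_cast
    nlinarith [mul_le_mul_of_nonneg_left hk' (Nat.cast_nonneg (α := ℝ) m)]
  have h2 : ‖∑ i ∈ range len, χ (a + i) * H i‖ ≤ ∑ i ∈ range len, ‖H i‖ := by
    refine (norm_sum_le _ _).trans (Finset.sum_le_sum fun i _ => ?_)
    rw [norm_mul]; exact mul_le_of_le_one_left (norm_nonneg _) (hχ _)
  have h3 : (∑ i ∈ range len, ‖H i‖) ^ 2 ≤ len * ∑ i ∈ range len, ‖H i‖ ^ 2 := by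
    simpa using sq_sum_le_card_mul_sum_sq (s := range len) (f := fun i => ‖H i‖)
  have h4 : ∑ i ∈ range len, ‖H i‖ ^ 2 ≤ K * len + K ^ 2 * B := by
    have e : ((∑ i ∈ range len, ‖H i‖ ^ 2 : ℝ) : ℂ) = ∑ k ∈ range K, ∑ k' ∈ range K,
        ∑ i ∈ range len, F (a + i + (m * k : ℕ)) * conj (F (a + i + (m * k' : ℕ))) := by
      push_cast
      have : ∀ i, ¢(‖H i‖) ^ 2 = ∑ k ∈ range K, ∑ k' ∈ range K,
          F (a + i + (m * k : ℕ)) * conj (F (a + i + (m * k' : ℕ))) := by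
        intro i
        rw [← Complex.mul_conj', hH, map_sum, Finset.sum_mul_sum]
      simp only [this]
      rw [Finset.sum_comm]
      exact Finset.sum_congr rfl fun k _ => Finset.sum_comm
    have e2 : ∑ i ∈ range len, ‖H i‖ ^ 2 = ‖((∑ i ∈ range len, ‖H i‖ ^ 2 : ℝ) : ℂ)‖ := by
      rw [Complex.norm_real, Real.norm_of_nonneg pv]
    rw [e2, e]
    have : ∀ k ∈ range K, ‖∑ k' ∈ range K, ∑ i ∈ range len, F (a + i + (m * k : ℕ)) *
        conj (F (a + i + (m * k' : ℕ)))‖ ≤ len + K * B := by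
      intro k hk
      rw [← Finset.add_sum_erase _ _ hk]
      refine (norm_add_le _ _).trans (add_le_add ?_ ?_)
      · refine (norm_sum_le _ _).trans ((Finset.sum_le_card_nsmul _ _ 1 ?_).trans_eq sm)
        intro i _
        rw [norm_mul, RCLike.norm_conj]
        exact mul_le_one₀ (hF _) (norm_nonneg _) (hF _)
      · refine (norm_sum_le _ _).trans ((Finset.sum_le_card_nsmul _ _ B ?_).trans ?_)
        · intro k' hk'
          rw [mem_erase, mem_range] at hk'
          exact hB k (mem_range.1 hk) k' hk'.2 (Ne.symm hk'.1)
        · rw [nsmul_eq_mul]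
          refine mul_le_mul_of_nonneg_right ?_ hB0
          exact_mod_cast (card_erase_le).trans (card_range K).le
    refine (norm_sum_le _ _).trans ((Finset.sum_le_card_nsmul _ _ _ this).trans_eq ?_)
    simp; ring
  have h5 : ∑ i ∈ range len, ‖H i‖ ≤ K * √(len ^ 2 / K + len * B) := by
    refine (sq_le_sq₀ pv pv).1 ?_
    rw [mul_pow, Real.sq_sqrt pv]
    refine h3.trans ((mul_le_mul_of_nonneg_left h4 pv).trans_eq ?_)
    field_simp
  have h6 : K * ‖S‖ ≤ K * (2 * m * K + √(len ^ 2 / K + len * B)) := by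
    have : ‖¢K * S‖ = K * ‖S‖ := sm
    rw [← this]
    have := norm_add_le (K * S - ∑ i ∈ range len, χ (a + i) * H i) (∑ i ∈ range len, χ (a + i) * H i)
    rw [sub_add_cancel] at this
    linarith
  exact le_of_mul_le_mul_left h6 hKr
noncomputable def ec (m : ℕ) (a : ℤ) : ℂ := Complex.exp (2 * Real.pi * Complex.I * (a / m))
lemma ec_add (m a b) : ec m (a + b) = ec m a * ec m b := by
  rw [ec, ec, ec, ← Complex.exp_add]; congr 1; push_cast; ring
@[simp] lemma ec_zero (m) : ec m 0 = 1 := by simp [ec]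
@[simp] lemma ec_norm (m a) : ‖ec m a‖ = 1 := by
  rw [ec, show (2 * Real.pi * Complex.I * (a / m) : ℂ) = ((2 * Real.pi * (a / m) : ℝ) : ℂ) * Complex.I by
    push_cast; ring, Complex.norm_exp_ofReal_mul_I]
lemma ec_conj (m a) : conj (ec m a) = ec m (-a) := by
  rw [ec, ec, ← Complex.exp_conj]; congr 1; simp [map_ofNat]; ring
lemma ec_self {m : ℕ} (hm : m ≠ 0) (k : ℤ) : ec m (m * k) = 1 := by
  rw [ec, Complex.exp_eq_one_iff]; refine ⟨k, ?_⟩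
  have : ¢m ≠ 0 := mc hm
  push_cast; field_simp
lemma ec_congr {m : ℕ} (hm : m ≠ 0) {a b : ℤ} (h : ¡m ∣ a - b) : ec m a = ec m b := by
  obtain ⟨k, hk⟩ := h
  rw [show a = b + m * k by linarith, ec_add, ec_self hm, mul_one]
lemma ec_mul {m n : ℕ} (hn : n ≠ 0) (a : ℤ) : ec (m * n) (n * a) = ec m a := by
  rw [ec, ec]; congr 2
  have : ¢n ≠ 0 := mc hn
  push_cast; rw [mul_comm ¢m, mul_div_mul_left _ _ this]
lemma ec_pow (m : ℕ) (a : ℤ) (j : ℕ) : ec m (a * j) = ec m a ^ j := by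
  rw [ec, ec, ← Complex.exp_nat_mul]; congr 1; push_cast; ring
lemma ec_eq_one {m : ℕ} (hm : m ≠ 0) {a : ℤ} (h : ec m a = 1) : ¡m ∣ a := by
  rw [ec, Complex.exp_eq_one_iff] at h
  obtain ⟨n, hn⟩ := h
  have h0 : ¢(2 * Real.pi * Complex.I) ≠ 0 := by simp [Real.pi_ne_zero]
  have hm' : ¢m ≠ 0 := mc hm
  rw [mul_comm ¢n] at hn
  have := mul_left_cancel₀ h0 hn
  rw [div_eq_iff hm'] at this
  exact ⟨n, by rw [mul_comm]; exact_mod_cast this⟩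
lemma ec_sum {m : ℕ} (hm : m ≠ 0) (k : ℤ) :
    ∑ a ∈ range m, ec m (k * a) = if ¡m ∣ k then (m : ℂ) else 0 := by
  simp only [ec_pow]
  split_ifs with h
  · have : ec m k = 1 := by rw [ec_congr hm (b := 0) (by simpa using h), ec_zero]
    simp [this]
  · have h1 : ec m k ≠ 1 := fun h' => h (ec_eq_one hm h')
    rw [geom_sum_eq h1, ← ec_pow, mul_comm, ec_self hm]; simp
lemma fibre_poly {K : Type*} [Field K] [Fintype K] [DecidableEq K] (T : Finset K) (a : K → K)
    (x₀ : K) (hx₀ : x₀ ∈ T) (ha : a x₀ ≠ 0) (α : K) :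
    #{X : K | (∀ x ∈ T, X + x ≠ 0) ∧ ∑ x ∈ T, a x * ((X + x) ^ 2)⁻¹ = α} ≤ 2 * #T := by
  classical
  open Polynomial in
  set P : K[X] := ∑ x ∈ T, C (a x) * ∏ y ∈ T.erase x, (X + C y) ^ 2
    - C α * ∏ y ∈ T, (X + C y) ^ 2 with hP
  have hev : ∀ z, P.eval z = ∑ x ∈ T, a x * ∏ y ∈ T.erase x, (z + y) ^ 2
      - α * ∏ y ∈ T, (z + y) ^ 2 := by
    intro z; simp [hP, Polynomial.eval_finsetSum, Polynomial.eval_prod]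
  have hne : P ≠ 0 := by
    intro h0
    have h := hev (-x₀)
    rw [h0, Polynomial.eval_zero, Finset.prod_eq_zero hx₀ sm, mul_zero, sub_zero,
      Finset.sum_eq_single x₀] at h
    · rcases mul_eq_zero.1 h.symm with h | h
      · exact ha h
      · obtain ⟨y, hy, h⟩ := Finset.prod_eq_zero_iff.1 h
        rw [mem_erase] at hy
        have := pow_eq_zero_iff (two_ne_zero) |>.1 h
        exact hy.1 (by linear_combination this)
    · intro b hb hbx
      rw [Finset.prod_eq_zero (i := x₀) (by simp [hx₀, Ne.symm hbx]) sm, mul_zero]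
    · exact fun h => absurd hx₀ h
  have hpr : ∀ S : Finset K, (∏ y ∈ S, (Polynomial.X + Polynomial.C y) ^ 2).natDegree ≤ 2 * #S := by
    intro S
    refine (Polynomial.natDegree_prod_le _ _).trans ?_
    refine (Finset.sum_le_card_nsmul _ _ 2 fun y _ => ?_).trans_eq (by simp [mul_comm])
    refine Polynomial.natDegree_pow_le.trans ?_
    simp
  have hdeg : P.natDegree ≤ 2 * #T := by
    refine (Polynomial.natDegree_sub_le _ _).trans (max_le ?_ ?_)
    · refine Polynomial.natDegree_sum_le_of_forall_le _ _ fun x hx => ?_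
      refine (Polynomial.natDegree_C_mul_le _ _).trans ((hpr _).trans ?_)
      exact Nat.mul_le_mul_left _ (card_erase_le)
    · exact (Polynomial.natDegree_C_mul_le _ _).trans (hpr _)
  refine le_trans ?_ ((Polynomial.card_roots' P).trans hdeg)
  refine le_trans (card_le_card (t := P.roots.toFinset) ?_) (Multiset.toFinset_card_le _)
  intro z hz
  rw [mem_filter] at hz
  rw [Multiset.mem_toFinset, Polynomial.mem_roots hne, Polynomial.IsRoot, hev, ← hz.2.2,
    Finset.sum_mul, sub_eq_zero]
  refine Finset.sum_congr rfl fun x hx => ?_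
  rw [← Finset.mul_prod_erase T _ hx]
  have := hz.2.1 x hx
  field_simp
def iv (m : ℕ) (w : ℤ) : ℤ := Int.gcdA w m
lemma iv_spec {m : ℕ} {w : ℤ} (h : IsCoprime w m) : ¡m ∣ w * iv m w - 1 := by
  have h1 := Int.gcd_eq_gcd_ab w m
  rw [Int.isCoprime_iff_gcd_eq_one.1 h] at h1
  exact ⟨-Int.gcdB w m, by rw [iv]; push_cast at h1; linarith⟩
section
variable (t : ℕ) (c w₀ h : ℤ)
noncomputable def psi (s : ℤ) : ℂ :=
  if ¡t ∣ c * s + w₀ then 0 else ec (t ^ 2) (h * iv (t ^ 2) (c * s + w₀))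
noncomputable def psb (b : Bool) (s : ℤ) : ℂ := if b then psi t c w₀ h s else conj (psi t c w₀ h s)
noncomputable def psl (l : List (ℤ × Bool)) (s : ℤ) : ℂ :=
  (l.map fun q => psb t c w₀ h q.2 (s + q.1)).prod
def sg (b : Bool) : ℤ := if b then 1 else -1
def fr (l : List (ℤ × Bool)) (s : ℤ) : ℤ :=
  -(h * c) * (l.map fun q => sg q.2 * iv (t ^ 2) (c * (s + q.1) + w₀) ^ 2).sum
end
variable {t : ℕ} {c w₀ h : ℤ}
lemma psb_norm (b s) : ‖psb t c w₀ h b s‖ ≤ 1 := by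
  have : ‖psi t c w₀ h s‖ ≤ 1 := by rw [psi]; split_ifs <;> simp
  rw [psb]; split_ifs <;> simpa using this
lemma psl_norm (l s) : ‖psl t c w₀ h l s‖ ≤ 1 := by
  induction l with
  | nil => simp [psl]
  | cons q l ih =>
    rw [psl, List.map_cons, List.prod_cons, norm_mul]
    exact mul_le_one₀ (psb_norm _ _) (norm_nonneg _) ih
lemma psb_stat (ht : t.Prime) (b s) (hs : ¬ ¡t ∣ c * s + w₀) (j : ℤ) :
    psb t c w₀ h b (s + t * j) = psb t c w₀ h b s *
      ec t (-(h * c) * (sg b * iv (t ^ 2) (c * s + w₀) ^ 2) * j) := by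
  have ht0 : t ≠ 0 := ht.ne_zero
  have hp : Prime ¡t := Nat.prime_iff_prime_int.1 ht
  have cop : ∀ w : ℤ, ¬ ¡t ∣ w → IsCoprime w ¡((t ^ 2 : ℕ)) := fun w hw => by
    push_cast; exact IsCoprime.pow_right ((hp.coprime_iff_not_dvd.2 hw).symm)
  have hs' : ¬ ¡t ∣ c * (s + t * j) + w₀ := fun h' => hs (by
    rw [show c * s + w₀ = c * (s + t * j) + w₀ - t * (c * j) by ring]
    exact dvd_sub h' (Dvd.intro _ rfl))
  obtain ⟨k, hk⟩ := iv_spec (cop _ hs)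
  obtain ⟨k', hk'⟩ := iv_spec (cop _ hs')
  have key : psi t c w₀ h (s + t * j) = psi t c w₀ h s *
      ec t (-(h * c) * (iv (t ^ 2) (c * s + w₀) ^ 2) * j) := by
    rw [psi, psi, if_neg hs, if_neg hs', ← ec_mul (m := t) (n := t) ht0, ← pow_two, ← ec_add]
    apply ec_congr (pow_ne_zero 2 ht0)
    set w := c * s + w₀ with hw
    set i := iv (t ^ 2) w
    set i' := iv (t ^ 2) (c * (s + t * j) + w₀)
    have hww : c * (s + t * j) + w₀ = w + c * t * j := by rw [hw]; ring
    rw [hww] at hk'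
    push_cast at hk hk' ⊢
    have h1 : ¡t ^ 2 ∣ (w + c * t * j) * (i' - (i - t * c * j * i ^ 2)) :=
      ⟨k' - k + t * c * j * i * k + c ^ 2 * j ^ 2 * i ^ 2, by linear_combination hk' - hk + t * c * j * i * hk⟩
    rw [← hww] at h1
    have h2 := (show IsCoprime (¡t ^ 2) _ by exact_mod_cast (cop _ hs').symm).dvd_of_dvd_mul_left h1
    obtain ⟨q, hq⟩ := h2
    exact ⟨h * q, by linear_combination h * hq⟩
  cases b with
  | true => simpa [psb, sg] using key
  | false =>
    simp only [psb, sg, Bool.false_eq_true, if_false, key, map_mul, ec_conj]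
    congr 2; ring
lemma psl_stat (ht : t.Prime) (l : List (ℤ × Bool)) (s)
    (hs : ∀ q ∈ l, ¬ ¡t ∣ c * (s + q.1) + w₀) (j : ℤ) :
    psl t c w₀ h l (s + t * j) = psl t c w₀ h l s * ec t (fr t c w₀ h l s * j) := by
  induction l with
  | nil => simp [psl, fr]
  | cons q l ih =>
    have ih := ih fun q' hq' => hs q' (List.mem_cons_of_mem _ hq')
    have h1 := psb_stat (h := h) ht q.2 (s + q.1) (hs q (List.mem_cons_self)) j
    simp only [psl, fr, List.map_cons, List.prod_cons, List.sum_cons] at ih ⊢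
    rw [ih, show s + t * j + q.1 = s + q.1 + t * j by ring, h1]
    rw [mul_add (-(h * c)), add_mul (-(h * c) * _), ec_add]; ring
lemma psl_pole (l : List (ℤ × Bool)) (s)
    (hs : ¬ ∀ q ∈ l, ¬ ¡t ∣ c * (s + q.1) + w₀) : psl t c w₀ h l s = 0 := by
  push Not at hs
  obtain ⟨q, hq, hd⟩ := hs
  rw [psl, List.prod_eq_zero_iff, List.mem_map]
  exact ⟨q, hq, by simp [psb, psi, hd]⟩
def cf (t : ℕ) (l : List (ℤ × Bool)) (x : ZMod t) : ℤ :=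
  (l.map fun q => if (q.1 : ZMod t) = x then sg q.2 else 0).sum
lemma cf_abs (l : List (ℤ × Bool)) (x : ZMod t) : |cf t l x| ≤ l.length := by
  induction l with
  | nil => simp [cf]
  | cons q l ih =>
    simp only [cf, List.map_cons, List.sum_cons, List.length_cons] at ih ⊢
    refine (abs_add_le _ _).trans ?_
    have : |if (q.1 : ZMod t) = x then sg q.2 else 0| ≤ 1 := by
      split_ifs <;> simp [sg]; split_ifs <;> simp
    push_cast; linarith
lemma cf_supp [NeZero t] (l : List (ℤ × Bool)) (hl : l.length < t) : ∃ x : ZMod t, cf t l x = 0 := by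
  by_contra! hne
  have : (univ : Finset (ZMod t)) ⊆ (l.map fun q => (q.1 : ZMod t)).toFinset := by
    intro x _
    by_contra hx
    refine hne x ?_
    rw [cf]
    apply List.sum_eq_zero
    simp only [List.mem_map, forall_exists_index, and_imp]
    rintro y q hq rfl
    rw [if_neg]; rintro rfl
    exact hx (by simp only [List.mem_toFinset, List.mem_map]; exact ⟨q, hq, rfl⟩)
  have := (card_le_card this).trans (List.toFinset_card_le _)
  rw [card_univ, ZMod.card, List.length_map] at this
  omega
def dl (l : List (ℤ × Bool)) (p p' : ℤ) : List (ℤ × Bool) :=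
  (l.map fun q => (q.1 + p, q.2)) ++ l.map fun q => (q.1 + p', !q.2)
lemma psl_dl (l : List (ℤ × Bool)) (p p' s : ℤ) :
    psl t c w₀ h (dl l p p') s = psl t c w₀ h l (s + p) * conj (psl t c w₀ h l (s + p')) := by
  rw [psl, dl, List.map_append, List.prod_append]
  congr 1
  · rw [psl, List.map_map]; congr 1; refine List.map_congr_left fun q _ => ?_
    simp only [Function.comp]; congr 1; ring
  · rw [psl, map_list_prod, List.map_map, List.map_map]; congr 1; refine List.map_congr_left fun q _ => ?_
    simp only [Function.comp, psb, show s + (q.1 + p') = s + p' + q.1 by ring]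
    cases q.2 <;> simp
lemma cf_dl [Fact t.Prime] (l : List (ℤ × Bool)) (hl : l.length < t) (p p' : ℤ)
    (hp : (p : ZMod t) ≠ p') (hc : ∃ x, cf t l x ≠ 0) : ∃ x, cf t (dl l p p') x ≠ 0 := by
  by_contra! h0
  have e : ∀ x, cf t (dl l p p') x = cf t l (x - p) - cf t l (x - p') := by
    intro x
    rw [cf, dl, List.map_append, List.sum_append, List.map_map, List.map_map, sub_eq_add_neg]
    congr 1
    · rw [cf]; congr 1; refine List.map_congr_left fun q _ => ?_
      simp only [Function.comp]; push_cast
      exact if_congr eq_sub_iff_add_eq.symm rfl rfl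
    · rw [cf, List.sum_neg, List.map_map]
      congr 1; refine List.map_congr_left fun q _ => ?_
      simp only [Function.comp]; push_cast
      simp only [← eq_sub_iff_add_eq]
      split_ifs <;> simp [sg]
      cases q.2 <;> simp
  have per : ∀ x, cf t l (x + (p - p')) = cf t l x := by
    intro x
    have := e (x + p); rw [h0] at this
    rw [show x + (p - p') = x + p - (p' : ZMod t) by ring]
    simp at this; linarith
  have perk : ∀ (k : ℕ) x, cf t l (x + k * (p - p')) = cf t l x := by
    intro k; induction k with
    | zero => simp
    | succ k ih => intro x; rw [show x + ((k + 1 : ℕ) : ZMod t) * (p - p') = x + k * (p - p') + (p - p') by push_cast; ring, per, ih]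
  have hne : (p - p' : ZMod t) ≠ 0 := sub_ne_zero.2 hp
  obtain ⟨x₁, hx₁⟩ := hc
  obtain ⟨x₂, hx₂⟩ := cf_supp l hl
  apply hx₁
  have := perk ((x₂ - x₁) / (p - p')).val x₁
  rw [ZMod.natCast_zmod_val, div_mul_cancel₀ _ hne, add_sub_cancel] at this
  rw [← this, hx₂]
end
section
open Finset Real ComplexConjugate
variable {t : ℕ} {c w₀ h : ℤ}
lemma sum_cf {K : Type*} [Field K] (l : List (ℤ × Bool)) (T : Finset (ZMod t)) (G : ZMod t → K)
    (hT : ∀ q ∈ l, (q.1 : ZMod t) ∈ T) :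
    (l.map fun q => (sg q.2 : K) * G (q.1 : ZMod t)).sum = ∑ x ∈ T, (cf t l x : K) * G x := by
  induction l with
  | nil => simp [cf]
  | cons q l ih =>
    rw [List.map_cons, List.sum_cons, ih fun q' hq' => hT q' (List.mem_cons_of_mem _ hq')]
    have : ∀ x, (cf t (q :: l) x : K) * G x = (if (q.1 : ZMod t) = x then (sg q.2 : K) * G x else 0)
        + (cf t l x : K) * G x := by
      intro x; simp only [cf, List.map_cons, List.sum_cons]; push_cast; rw [add_mul]; congr 1
      split_ifs <;> simp
    simp only [this, Finset.sum_add_distrib, Finset.sum_ite_eq, hT q List.mem_cons_self, if_true]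
lemma fr_fibre [Fact t.Prime] (hc : ¬ ¡t ∣ c) (hh : ¬ ¡t ∣ h) (l : List (ℤ × Bool))
    (hl : l.length < t) (hcf : ∃ x, cf t l x ≠ 0) (a : ℤ) (α : ZMod t) :
    #{i ∈ range t | (∀ q ∈ l, ¬ ¡t ∣ c * (a + (i : ℕ) + q.1) + w₀) ∧
      (fr t c w₀ h l (a + (i : ℕ)) : ZMod t) = α} ≤ 2 * l.length := by
  have ht := (Fact.out : t.Prime)
  have hc' : (c : ZMod t) ≠ 0 := fun h => hc ((ZMod.intCast_zmod_eq_zero_iff_dvd _ _).1 h)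
  have hh' : (h : ZMod t) ≠ 0 := fun h => hh ((ZMod.intCast_zmod_eq_zero_iff_dvd _ _).1 h)
  obtain ⟨x₀, hx₀⟩ := hcf
  set T := (l.map fun q => (q.1 : ZMod t)).toFinset with hT
  have hTm : ∀ q ∈ l, (q.1 : ZMod t) ∈ T := fun q hq => by
    simp only [hT, List.mem_toFinset, List.mem_map]; exact ⟨q, hq, rfl⟩
  have hx₀T : x₀ ∈ T := by
    by_contra hx
    refine hx₀ (List.sum_eq_zero ?_)
    simp only [List.mem_map, forall_exists_index, and_imp]
    rintro y q hq rfl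
    rw [if_neg]; rintro rfl
    exact hx (hTm q hq)
  have hax : (¡(cf t l x₀) : ZMod t) ≠ 0 := by
    intro h0
    rw [ZMod.intCast_zmod_eq_zero_iff_dvd] at h0
    have h1 := cf_abs l x₀
    exact hx₀ (Int.eq_zero_of_abs_lt_dvd h0 om)
  have key := fibre_poly T (fun x => (cf t l x : ZMod t)) x₀ hx₀T hax (-(c / h) * α)
  refine le_trans ?_ (key.trans (Nat.mul_le_mul_left 2 ?_))
  swap
  · exact (List.toFinset_card_le _).trans sm
  refine card_le_card_of_injOn (fun i : ℕ => (¡(a + i) : ZMod t) + w₀ / c) ?_ ?_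
  · intro i hi
    simp only [coe_filter, mem_range, Set.mem_ofPred_eq, mem_univ, true_and] at hi ⊢
    obtain ⟨-, hi1, hi2⟩ := hi
    set X := (¡(a + i) : ZMod t) + w₀ / c with hX
    have hw : ∀ q ∈ l, (¡(c * (a + i + q.1) + w₀) : ZMod t) = c * (X + q.1) := by
      intro q _; rw [hX]; push_cast; field_simp; ring
    have hw0 : ∀ q ∈ l, X + q.1 ≠ 0 := by
      intro q hq h0
      have := hw q hq
      rw [h0, mul_zero, ZMod.intCast_zmod_eq_zero_iff_dvd] at this
      exact hi1 q hq this
    refine ⟨?_, ?_⟩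
    · intro x hx
      simp only [hT, List.mem_toFinset, List.mem_map] at hx
      obtain ⟨q, hq, rfl⟩ := hx
      exact hw0 q hq
    · rw [← sum_cf (K := ZMod t) l T (fun x => ((X + x) ^ 2)⁻¹) hTm, ← hi2, fr]
      have : ((l.map fun q => sg q.2 * iv (t ^ 2) (c * (a + i + q.1) + w₀) ^ 2).sum : ZMod t) =
          (c ^ 2 : ZMod t)⁻¹ * (l.map fun q => (sg q.2 : ZMod t) * ((X + q.1) ^ 2)⁻¹).sum := by
        rw [← List.sum_map_mul_left, Int.cast_list_sum, List.map_map]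
        congr 1; refine List.map_congr_left fun q hq => ?_
        have hcop : IsCoprime (c * (a + i + q.1) + w₀) ¡((t ^ 2 : ℕ)) := by
          push_cast
          exact IsCoprime.pow_right
            (((Nat.prime_iff_prime_int.1 ht).coprime_iff_not_dvd.2 (hi1 q hq)).symm)
        have h2 := iv_spec hcop
        have h3 : ¡t ∣ (c * (a + i + q.1) + w₀) * iv (t ^ 2) (c * (a + i + q.1) + w₀) - 1 :=
          dvd_trans (by push_cast; exact dvd_pow_self _ two_ne_zero) h2
        rw [← ZMod.intCast_zmod_eq_zero_iff_dvd] at h3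
        rw [Int.cast_sub, Int.cast_mul, hw q hq] at h3
        have h4 : ((iv (t ^ 2) (c * (a + i + q.1) + w₀) : ℤ) : ZMod t) = (c * (X + q.1))⁻¹ := by
          refine eq_inv_of_mul_eq_one_right ?_
          simpa [sub_eq_zero] using h3
        have := hw0 q hq
        simp only [Function.comp]
        push_cast at h4 ⊢
        rw [h4]; field_simp
      rw [Int.cast_mul, this]; push_cast; field_simp
  · intro i hi j hj hij
    simp only [coe_filter, mem_range, Set.mem_ofPred_eq] at hi hj hij
    have : (¡i : ZMod t) = ¡j := by
      have := add_right_cancel hij; push_cast at this ⊢; exact add_left_cancel this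
    have := (ZMod.natCast_eq_natCast_iff' i j t).1 (mc this)
    rwa [Nat.mod_eq_of_lt hi.1, Nat.mod_eq_of_lt hj.1] at this
lemma sum_range_mul' {M : Type*} [AddCommMonoid M] (f : ℕ → M) (t K : ℕ) :
    ∑ i ∈ range (t * K), f i = ∑ j ∈ range K, ∑ i ∈ range t, f (i + t * j) := by
  induction K with
  | zero => simp
  | succ K ih =>
    rw [Nat.mul_succ, Finset.sum_range_add, ih, Finset.sum_range_succ]
    congr 1; exact Finset.sum_congr rfl fun i _ => by rw [add_comm]
lemma parseval (ht : t ≠ 0) {K : ℕ} (hK : K ≤ t) :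
    ∑ α ∈ range t, ‖∑ j ∈ range K, ec t (α * j)‖ ^ 2 = t * K := by
  have e : ((∑ α ∈ range t, ‖∑ j ∈ range K, ec t (α * j)‖ ^ 2 : ℝ) : ℂ) = ®(t * K) := by
    push_cast
    have : ∀ α : ℕ, (‖∑ j ∈ range K, ec t (α * j)‖ : ℂ) ^ 2 = ∑ j ∈ range K, ∑ j' ∈ range K,
        ec t ((j - j') * α) := by
      intro α
      rw [← Complex.mul_conj', map_sum, Finset.sum_mul_sum]
      refine Finset.sum_congr rfl fun j _ => Finset.sum_congr rfl fun j' _ => ?_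
      rw [ec_conj, ← ec_add]; congr 1; ring
    simp only [this]
    rw [Finset.sum_comm]
    have : ∀ j ∈ range K, ∑ α ∈ range t, ∑ j' ∈ range K, ec t ((j - j') * α) = t := by
      intro j hj
      rw [Finset.sum_comm]
      simp only [ec_sum ht]
      rw [Finset.sum_eq_single j]
      · simp
      · intro j' hj' hne
        rw [if_neg]
        intro hd
        rw [mem_range] at hj hj'
        have := Int.eq_zero_of_abs_lt_dvd hd (by rw [abs_lt]; constructor <;> omega)
        omega
      · exact fun h => absurd hj h
    rw [Finset.sum_congr rfl this]; simp; ring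
  exact_mod_cast e
lemma block [Fact t.Prime] (hc : ¬ ¡t ∣ c) (hh : ¬ ¡t ∣ h) (l : List (ℤ × Bool))
    (hl : l.length ≤ 8) (ht8 : 8 < t) (hcf : ∃ x, cf t l x ≠ 0) (a : ℤ) {K : ℕ} (hK : K ≤ t) :
    ‖∑ i ∈ range (t * K), psl t c w₀ h l (a + i)‖ ≤ 4 * t * √K := by
  classical
  have ht := (Fact.out : t.Prime)
  set np := fun i : ℕ => ∀ q ∈ l, ¬ ¡t ∣ c * (a + i + q.1) + w₀ with hnp
  set D : ZMod t → ℝ := fun α => ‖∑ j ∈ range K, ec t (α.val * j)‖ with hD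
  set S := (range t).filter np with hS
  have h1 : ‖∑ i ∈ range (t * K), psl t c w₀ h l (a + i)‖ ≤
      ∑ i ∈ S, D (fr t c w₀ h l (a + i) : ZMod t) := by
    rw [sum_range_mul', Finset.sum_comm, hS, Finset.sum_filter]
    refine (norm_sum_le _ _).trans (Finset.sum_le_sum fun i _ => ?_)
    have e : ∀ j : ℕ, a + ¡((i + t * j : ℕ)) = a + i + t * ¡j := fun j => by push_cast; ring
    split_ifs with hp
    · simp only [e, psl_stat (h := h) ht l (a + i) hp, ← Finset.mul_sum]
      rw [norm_mul]
      refine (mul_le_of_le_one_left (norm_nonneg _) (psl_norm _ _)).trans_eq ?_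
      simp only [hD]; congr 1
      refine Finset.sum_congr rfl fun j _ => ec_congr ht.ne_zero ?_
      rw [← sub_mul]
      refine Dvd.dvd.mul_right ?_ _
      rw [← ZMod.intCast_zmod_eq_zero_iff_dvd]; simp
    · refine le_of_eq ?_
      rw [norm_eq_zero]
      refine Finset.sum_eq_zero fun j _ => ?_
      rw [e]
      refine psl_pole l _ ?_
      push Not at hp ⊢
      obtain ⟨q, hq, hd⟩ := hp
      refine ⟨q, hq, ?_⟩
      rw [show c * (a + i + t * j + q.1) + w₀ = c * (a + i + q.1) + w₀ + t * (c * j) by ring]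
      exact dvd_add hd (Dvd.intro _ rfl)
  have h2 : (∑ i ∈ S, D (fr t c w₀ h l (a + i) : ZMod t)) ^ 2 ≤ t * (16 * (t * K)) := by
    refine (sq_sum_le_card_mul_sum_sq).trans ?_
    have hcard : (#S : ℝ) ≤ t := mc (card_filter_le _ _).trans (card_range t).le
    refine mul_le_mul hcard ?_ (Finset.sum_nonneg fun _ _ => sq_nonneg _) pv
    rw [← Finset.sum_fiberwise S (fun i : ℕ => (fr t c w₀ h l (a + i) : ZMod t))]
    have h3 : ∑ α : ZMod t, D α ^ 2 = t * K := by
      rw [← parseval ht.ne_zero hK]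
      refine Finset.sum_bij (fun α _ => α.val) (fun α _ => by simp [ZMod.val_lt]) ?_ ?_ ?_
      · intro a _ b _ h; exact ZMod.val_injective t h
      · intro b hb; rw [mem_range] at hb
        exact ⟨b, mem_univ _, ZMod.val_natCast_of_lt hb⟩
      · intro α _; rfl
    rw [← h3, Finset.mul_sum]
    refine Finset.sum_le_sum fun α _ => ?_
    have h4 : ∀ i ∈ S.filter (fun i : ℕ => (fr t c w₀ h l (a + i) : ZMod t) = α),
        D (fr t c w₀ h l (a + i) : ZMod t) ^ 2 ≤ D α ^ 2 := fun i hi => by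
      rw [(mem_filter.1 hi).2]
    refine (Finset.sum_le_card_nsmul _ _ _ h4).trans ?_
    rw [nsmul_eq_mul]
    refine mul_le_mul_of_nonneg_right ?_ (sq_nonneg _)
    have := fr_fibre (w₀ := w₀) hc hh l om hcf a α
    rw [hS, Finset.filter_filter]
    exact_mod_cast this.trans om
  refine h1.trans ?_
  refine (sq_le_sq₀ (Finset.sum_nonneg fun _ _ => norm_nonneg _) pv).1 (h2.trans_eq ?_)
  rw [mul_pow, Real.sq_sqrt pv]; ring
lemma longsum [Fact t.Prime] (hc : ¬ ¡t ∣ c) (hh : ¬ ¡t ∣ h) (l : List (ℤ × Bool))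
    (hl : l.length ≤ 8) (ht8 : 8 < t) (hcf : ∃ x, cf t l x ≠ 0) (a : ℤ) {K : ℕ} (hK1 : 1 ≤ K)
    (hK : K ≤ t) (len : ℕ) :
    ‖∑ i ∈ range len, psl t c w₀ h l (a + i)‖ ≤ 4 * len / √K + t * K := by
  have hKr : ®0 < K := mc hK1
  have htr : ®0 < t := mc (om : 0 < t)
  obtain ⟨q, r, hr, hqr⟩ : ∃ q r, r < t * K ∧ len = t * K * q + r :=
    ⟨len / (t * K), len % (t * K), Nat.mod_lt _ pv, (Nat.div_add_mod _ _).symm⟩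
  have hle : ®(t * K * q) ≤ len := by rw [hqr]; push_cast; linarith [Nat.cast_nonneg (α := ℝ) r]
  rw [hqr, Finset.sum_range_add, sum_range_mul', ← hqr]
  refine (norm_add_le _ _).trans (add_le_add ?_ ?_)
  · refine (norm_sum_le _ _).trans ((Finset.sum_le_card_nsmul _ _ (4 * t * √K) ?_).trans ?_)
    · intro j _
      have := block (w₀ := w₀) hc hh l hl ht8 hcf (a + (t * K * j : ℕ)) hK
      refine le_of_eq_of_le ?_ this
      congr 1; refine Finset.sum_congr rfl fun i _ => ?_
      congr 1; push_cast; ring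
    · rw [card_range, nsmul_eq_mul, le_div_iff₀ pv]
      nlinarith [Real.mul_self_sqrt hKr.le]
  · refine (norm_sum_le _ _).trans ((Finset.sum_le_card_nsmul _ _ 1 fun i _ => psl_norm _ _).trans ?_)
    rw [card_range, nsmul_eq_mul, mul_one]; exact_mod_cast hr.le
lemma vdc' (F χ : ℤ → ℂ) (hF : ∀ s, ‖F s‖ ≤ 1) (hχ : ∀ s, ‖χ s‖ ≤ 1) (m : ℕ)
    (hper : ∀ s, χ (s + m) = χ s) (a : ℤ) (len K : ℕ) (R : ℝ) (hR : 1 ≤ R) (hRK : R ^ 2 ≤ K)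
    (hm : 2 * m * K ^ 2 ≤ len)
    (hB : ∀ k < K, ∀ k' < K, k ≠ k' → ‖∑ i ∈ range len, F (a + i + (m * k : ℕ)) *
        conj (F (a + i + (m * k' : ℕ)))‖ ≤ 5 * len / R ^ 2) :
    ‖∑ i ∈ range len, χ (a + i) * F (a + i)‖ ≤ 4 * len / R := by
  have hKr : ®1 ≤ K := nl
  have hR0 : 0 < R := ln
  have hK : 1 ≤ K := mc hKr
  refine (vdc F χ hF hχ m hper a len K hK (5 * len / R ^ 2) pv hB).trans ?_
  have h1 : ®(2 * m * K) ≤ len / R := by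
    rw [le_div_iff₀ hR0]
    have : ®(2 * m * K ^ 2) ≤ len := mc hm
    have : R ≤ K := nl
    nlinarith [mul_le_mul_of_nonneg_left this (pv : ®0 ≤ 2 * m * K)]
  have h2 : √(len ^ 2 / K + len * (5 * len / R ^ 2)) ≤ 3 * len / R := by
    rw [sqrt_le_left pv]
    have : ®(len ^ 2 / K) ≤ len ^ 2 / R ^ 2 := gc
    have e : ®(3 * len / R) ^ 2 = 9 * (len ^ 2 / R ^ 2) := rg
    have e' : ®(len * (5 * len / R ^ 2)) = 5 * (len ^ 2 / R ^ 2) := rg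
    rw [e, e']
    have : ®0 ≤ len ^ 2 / R ^ 2 := pv
    linarith
  have : ®(4 * len / R) = len / R + 3 * len / R := rg
  linarith
lemma expsum [Fact t.Prime] (hc : ¬ ¡t ∣ c) (hh : ¬ ¡t ∣ h) (ht8 : 8 < t)
    (χ : Fin 3 → ℤ → ℂ) (m : Fin 3 → ℕ) (hχ : ∀ i s, ‖χ i s‖ ≤ 1)
    (hper : ∀ i s, χ i (s + m i) = χ i s) (a : ℤ) (len Q : ℕ) (hQ : 1 ≤ Q)
    (hK : Q ^ 16 ≤ t) (hl : t * (Q ^ 16) ^ 2 ≤ len) (hm : ∀ i, 2 * m i * (Q ^ 16) ^ 2 ≤ len)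
    (hmt : ∀ i, ¬ t ∣ m i) :
    ‖∑ i ∈ range len, χ 0 (a + i) * (χ 1 (a + i) * (χ 2 (a + i) * psi t c w₀ h (a + i)))‖
      ≤ 4 * len / Q := by
  have ht := (Fact.out : t.Prime)
  set K := Q ^ 16 with hKd
  have hQr : ®1 ≤ Q := mc hQ
  have hK1 : 1 ≤ K := Nat.one_le_pow _ _ hQ
  have hKr : ®K = ®Q ^ 16 := by rw [hKd]; push_cast; rfl
  have hmon : ∀ {i j : ℕ}, i ≤ j → ®Q ^ i ≤ ®Q ^ j := fun h => pow_le_pow_right₀ hQr h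
  have hsh : ∀ (i : Fin 3) (k k' : ℕ), k < K → k' < K → k ≠ k' →
      (¡((m i * k : ℕ)) : ZMod t) ≠ ¡((m i * k' : ℕ)) := by
    intro i k k' hk hk' hne he
    rw [Int.cast_natCast, Int.cast_natCast, Nat.cast_mul, Nat.cast_mul] at he
    have h0 : (m i : ZMod t) ≠ 0 := fun h => hmt i ((ZMod.natCast_eq_zero_iff _ _).1 h)
    have := (ZMod.natCast_eq_natCast_iff' _ _ _).1 (mul_left_cancel₀ h0 he)
    rw [Nat.mod_eq_of_lt om, Nat.mod_eq_of_lt om] at this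
    exact hne this
  have nmul : ∀ x y : ℂ, ‖x‖ ≤ 1 → ‖y‖ ≤ 1 → ‖x * y‖ ≤ 1 := fun x y hx hy => by
    rw [norm_mul]; exact mul_le_one₀ hx (norm_nonneg _) hy
  have ncj : ∀ x : ℂ, ‖x‖ ≤ 1 → ‖conj x‖ ≤ 1 := fun x hx => by simpa using hx
  have perk : ∀ (χ' : ℤ → ℂ) (n : ℕ), (∀ s, χ' (s + n) = χ' s) → ∀ (p p' s : ℤ),
      χ' (s + n + p) * conj (χ' (s + n + p')) = χ' (s + p) * conj (χ' (s + p')) := by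
    intro χ' n h p p' s
    rw [show s + n + p = s + p + n by ring, show s + n + p' = s + p' + n by ring, h, h]
  have L3 : ∀ l : List (ℤ × Bool), l.length ≤ 8 → (∃ x, cf t l x ≠ 0) →
      ‖∑ i ∈ range len, psl t c w₀ h l (a + i)‖ ≤ 5 * len / (®Q ^ 4) ^ 2 := by
    intro l hl8 hcf
    refine (longsum (w₀ := w₀) hc hh l hl8 ht8 hcf a hK1 hK len).trans ?_
    have h1 : √®K = (®Q ^ 4) ^ 2 := by
      rw [hKr, show ®Q ^ 16 = ((®Q ^ 4) ^ 2) ^ 2 by ring, sqrt_sq pv]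
    rw [h1]
    have h2 : ®(t * K) ≤ len / (®Q ^ 4) ^ 2 := by
      rw [le_div_iff₀ pv]
      have h3 : (t * ®K ^ 2) ≤ len := mc hl
      have h4 : (®Q ^ 4) ^ 2 ≤ K := by rw [hKr, ← pow_mul]; exact hmon nn
      nlinarith [mul_le_mul_of_nonneg_left h4 (pv : ®0 ≤ t * K)]
    have : ®(5 * len / (®Q ^ 4) ^ 2) = 4 * len / (®Q ^ 4) ^ 2 + len / (®Q ^ 4) ^ 2 := by
      ring
    linarith
  have up : ∀ R : ℝ, 0 < R → ®(4 * len / R) ≤ 5 * len / R := fun R hR => by gcongr; norm_num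
  have dlen : ∀ l p p', (dl l p p').length = 2 * l.length := fun l p p' => by simp [dl]; ring
  have L2 : ∀ χ₂ : ℤ → ℂ, (∀ s, ‖χ₂ s‖ ≤ 1) → (∀ s, χ₂ (s + m 2) = χ₂ s) →
      ∀ l : List (ℤ × Bool), l.length ≤ 4 → (∃ x, cf t l x ≠ 0) →
      ‖∑ i ∈ range len, χ₂ (a + i) * psl t c w₀ h l (a + i)‖ ≤ 5 * len / (®Q ^ 2) ^ 2 := by
    intro χ₂ h1 h2 l hl4 hcf
    refine (vdc' _ χ₂ (psl_norm l) h1 (m 2) h2 a len K (®Q ^ 4) (one_le_pow₀ hQr) ?_ (hm 2)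
      ?_).trans ?_
    · rw [hKr, ← pow_mul]; exact hmon nn
    · intro k hk k' hk' hne
      simp only [← psl_dl]
      exact L3 _ (by rw [dlen]; omega) (cf_dl l om _ _ (hsh 2 k k' hk hk' hne) hcf)
    · rw [← pow_mul]; exact up _ pv
  have L1 : ∀ χ₁ χ₂ : ℤ → ℂ, (∀ s, ‖χ₁ s‖ ≤ 1) → (∀ s, χ₁ (s + m 1) = χ₁ s) →
      (∀ s, ‖χ₂ s‖ ≤ 1) → (∀ s, χ₂ (s + m 2) = χ₂ s) →
      ∀ l : List (ℤ × Bool), l.length ≤ 2 → (∃ x, cf t l x ≠ 0) →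
      ‖∑ i ∈ range len, χ₁ (a + i) * (χ₂ (a + i) * psl t c w₀ h l (a + i))‖ ≤
        5 * len / ®Q ^ 2 := by
    intro χ₁ χ₂ h1 h1' h2 h2' l hl2 hcf
    refine (vdc' (fun s => χ₂ s * psl t c w₀ h l s) χ₁ (fun s => nmul _ _ (h2 s) (psl_norm l s)) h1
      (m 1) h1' a len K (®Q ^ 2) (one_le_pow₀ hQr) ?_ (hm 1) ?_).trans ?_
    · rw [hKr, ← pow_mul]; exact hmon nn
    · intro k hk k' hk' hne
      refine le_of_eq_of_le ?_ (L2 (fun s => χ₂ (s + (m 1 * k : ℕ)) * conj (χ₂ (s + (m 1 * k' : ℕ))))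
        (fun s => nmul _ _ (h2 _) (ncj _ (h2 _))) (fun s => perk χ₂ _ h2' _ _ s)
        (dl l (m 1 * k : ℕ) (m 1 * k' : ℕ)) (by rw [dlen]; omega)
        (cf_dl l om _ _ (hsh 1 k k' hk hk' hne) hcf))
      congr 1; refine Finset.sum_congr rfl fun i _ => ?_
      simp only [psl_dl, map_mul]; ring
    · exact up _ pv
  have hpsi : ∀ s, psi t c w₀ h s = psl t c w₀ h [(0, true)] s := fun s => by simp [psl, psb]
  simp only [hpsi]
  refine vdc' (fun s => χ 1 s * (χ 2 s * psl t c w₀ h [(0, true)] s)) (χ 0)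
    (fun s => nmul _ _ (hχ 1 s) (nmul _ _ (hχ 2 s) (psl_norm _ s))) (hχ 0)
    (m 0) (hper 0) a len K Q hQr ?_ (hm 0) ?_
  · rw [hKr]; exact hmon nn
  · intro k hk k' hk' hne
    refine le_of_eq_of_le ?_ (L1 (fun s => χ 1 (s + (m 0 * k : ℕ)) * conj (χ 1 (s + (m 0 * k' : ℕ))))
      (fun s => χ 2 (s + (m 0 * k : ℕ)) * conj (χ 2 (s + (m 0 * k' : ℕ))))
      (fun s => nmul _ _ (hχ 1 _) (ncj _ (hχ 1 _))) (fun s => perk (χ 1) _ (hper 1) _ _ s)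
      (fun s => nmul _ _ (hχ 2 _) (ncj _ (hχ 2 _))) (fun s => perk (χ 2) _ (hper 2) _ _ s)
      (dl [(0, true)] (m 0 * k : ℕ) (m 0 * k' : ℕ)) (by rw [dlen]; simp)
      (cf_dl _ (by simp; omega) _ _ (hsh 0 k k' hk hk' hne) ⟨0, by simp [cf, sg]⟩))
    congr 1; refine Finset.sum_congr rfl fun i _ => ?_
    simp only [psl_dl, map_mul]; ring
end
section
open Finset Real ComplexConjugate
lemma geom_bound {M : ℕ} {h : ℕ} (h0 : 0 < h) (hM : h < M) (L : ℕ) :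
    ‖∑ i ∈ range L, ec M (h * i)‖ ^ 2 ≤ M ^ 2 / 4 * (®h ^ 2)⁻¹ + M ^ 2 / 4 * (®((M - h : ℕ)) ^ 2)⁻¹ := by
  have hMr : ®0 < M := mc (om : 0 < M)
  have base : ∀ h : ℕ, 0 < h → 2 * h ≤ M →
      ‖∑ i ∈ range L, ec M (h * i)‖ ^ 2 ≤ M ^ 2 / 4 * (®h ^ 2)⁻¹ := by
    intro h h0 h2
    have hr : ®0 < h := mc h0
    have hle : ®(2 * h) ≤ M := mc h2
    have e1 : ‖ec M h - 1‖ = 2 * Real.sin (Real.pi * h / M) := by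
      have : ec M h = Complex.exp (Complex.I * ¢(®(2 * Real.pi * h / M))) := by
        rw [ec]; congr 1; push_cast; ring
      rw [this, Complex.norm_exp_I_mul_ofReal_sub_one,
        show 2 * Real.pi * h / M / 2 = Real.pi * h / M by ring, Real.norm_of_nonneg]
      refine mul_nonneg nn (Real.sin_nonneg_of_nonneg_of_le_pi pv ?_)
      rw [div_le_iff₀ hMr]; nlinarith [Real.pi_pos]
    have e2 : 2 / Real.pi * (Real.pi * h / M) ≤ Real.sin (Real.pi * h / M) := by
      refine Real.mul_le_sin pv ?_
      rw [div_le_iff₀ hMr]; nlinarith [Real.pi_pos]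
    have e3 : 2 / Real.pi * (Real.pi * h / M) = 2 * h / M := by
      have := Real.pi_ne_zero; field_simp
    rw [e3] at e2
    have hpos : 0 < 2 * ®h / M := pv
    have hne : ec M h ≠ 1 := by
      intro h'; rw [h', sub_self, norm_zero] at e1; linarith
    simp only [ec_pow]
    rw [geom_sum_eq hne, norm_div, e1]
    have e4 : ‖ec M h ^ L - 1‖ ≤ 2 := (norm_sub_le _ _).trans (by simp; norm_num)
    have e5 : ‖ec M h ^ L - 1‖ / (2 * Real.sin (Real.pi * h / M)) ≤ M / (2 * h) := by
      rw [div_le_div_iff₀ ln pv]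
      rw [div_le_iff₀ hMr] at e2
      nlinarith
    calc _ ≤ (®M / (2 * h)) ^ 2 := by
          refine pow_le_pow_left₀ (div_nonneg (norm_nonneg _) ln) e5 2
      _ = _ := by field_simp; ring
  rcases le_total (2 * h) M with h2 | h2
  · exact (base h h0 h2).trans (le_add_of_nonneg_right pv)
  · refine le_trans (le_of_eq ?_) ((base (M - h) om om).trans
      (le_add_of_nonneg_left pv))
    congr 1
    rw [← RCLike.norm_conj, map_sum]
    congr 1; refine Finset.sum_congr rfl fun i _ => ?_
    rw [ec_conj]; refine ec_congr om ⟨-i, ?_⟩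
    push_cast [Nat.cast_sub hM.le]; ring
noncomputable def wt (M L : ℕ) (a₀ u : ℤ) : ℝ :=
  M / L ^ 2 * #{q ∈ range L ×ˢ range L | ¡M ∣ a₀ + (q.1 : ℕ) + (q.2 : ℕ) - u}
lemma window {ι : Type*} (J : Finset ι) (u : ι → ℤ) (M L H : ℕ) (hL : 1 ≤ L) (hLM : L ≤ M)
    (hH : 1 ≤ H) (a₀ : ℤ) (B : ℝ) (hB0 : 0 ≤ B)
    (hB : ∀ h : ℤ, h ≠ 0 → |h| < H → ‖∑ i ∈ J, ec M (h * u i)‖ ≤ B) :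
    |∑ i ∈ J, wt M L a₀ (u i) - #J| ≤ B * (M / L) + #J * ((M / L) ^ 2 / H) := by
  have hM : M ≠ 0 := om
  have hMr : ®0 < M := mc (om : 0 < M)
  have hLr : ®0 < L := mc hL
  have hHr : ®0 < H := mc hH
  set D : ℕ → ℂ := fun h => ∑ i ∈ range L, ec M (h * i) with hD
  set S : ℕ → ℂ := fun h => ∑ i ∈ J, ec M (-h * u i) with hS
  have e1 : ∀ u : ℤ, ¢(wt M L a₀ u) = 1 / L ^ 2 * ∑ h ∈ range M, ec M (h * a₀) * D h ^ 2 *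
      ec M (-h * u) := by
    intro u
    have : ∀ h : ℕ, ec M (h * a₀) * D h ^ 2 * ec M (-h * u) = ∑ q ∈ range L ×ˢ range L,
        ec M ((a₀ + (q.1 : ℕ) + (q.2 : ℕ) - u) * h) := by
      intro h
      rw [pow_two, hD, Finset.sum_mul_sum, ← Finset.sum_product', Finset.mul_sum, Finset.sum_mul]
      refine Finset.sum_congr rfl fun q _ => ?_
      rw [← ec_add, ← ec_add, ← ec_add]; congr 1; ring
    simp only [this]
    rw [Finset.sum_comm]
    simp only [ec_sum hM]
    rw [← Finset.sum_filter, Finset.sum_const, nsmul_eq_mul, wt]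
    push_cast; ring
  have e2 : ((∑ i ∈ J, wt M L a₀ (u i) - #J : ℝ) : ℂ) =
      1 / L ^ 2 * ∑ h ∈ (range M).erase 0, ec M (h * a₀) * D h ^ 2 * S h := by
    push_cast
    simp only [e1]
    rw [← Finset.mul_sum, Finset.sum_comm]
    simp only [← Finset.mul_sum]
    rw [← Finset.add_sum_erase (range M) _ (mem_range.2 (om : 0 < M))]
    have hL0 : ¢L ≠ 0 := mc hLr.ne'
    simp [hD, hS]; field_simp; ring
  rw [← Real.norm_eq_abs, ← Complex.norm_real, e2, norm_mul]
  have e3 : ‖¢(1 / L ^ 2)‖ = 1 / ®L ^ 2 := sm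
  have hJ : ∀ h, ‖S h‖ ≤ #J := fun h => (norm_sum_le _ _).trans sm
  have hpt : ∀ h ∈ (range M).erase 0, ‖ec M (h * a₀) * D h ^ 2 * S h‖ ≤
      ‖D h‖ ^ 2 * B + #J * (if H ≤ h ∧ h ≤ M - H then ‖D h‖ ^ 2 else 0) := by
    intro h hh
    rw [mem_erase, mem_range] at hh
    rw [norm_mul, norm_mul, ec_norm, one_mul, norm_pow]
    split_ifs with hc
    · have := mul_le_mul_of_nonneg_left (hJ h) (sq_nonneg ‖D h‖)
      nlinarith [sq_nonneg ‖D h‖, mul_nonneg (sq_nonneg ‖D h‖) hB0]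
    · rw [mul_zero, add_zero]
      refine mul_le_mul_of_nonneg_left ?_ (sq_nonneg _)
      rw [not_and_or] at hc
      rcases lt_or_ge h H with hlt | hge
      · exact hB (-h) om (by rw [abs_neg, Nat.abs_cast]; exact_mod_cast hlt)
      · have e : S h = ∑ i ∈ J, ec M (¡((M - h : ℕ)) * u i) := by
          refine Finset.sum_congr rfl fun i _ => ec_congr hM ⟨-u i, ?_⟩
          push_cast [Nat.cast_sub hh.2.le]; ring
        rw [e]
        exact hB _ om (by rw [Nat.abs_cast]; exact_mod_cast (om : M - h < H))
  have htail : ∑ h ∈ (range M).erase 0, (if H ≤ h ∧ h ≤ M - H then ‖D h‖ ^ 2 else 0) ≤ M ^ 2 / H := by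
    rw [← Finset.sum_filter]
    have h1 : ∀ h ∈ ((range M).erase 0).filter (fun h => H ≤ h ∧ h ≤ M - H), ‖D h‖ ^ 2 ≤
        M ^ 2 / 4 * (®h ^ 2)⁻¹ + M ^ 2 / 4 * (®((M - h : ℕ)) ^ 2)⁻¹ := by
      intro h hh
      simp only [mem_filter, mem_erase, mem_range] at hh
      exact geom_bound om hh.1.2 L
    refine (Finset.sum_le_sum h1).trans ?_
    have hsub : ((range M).erase 0).filter (fun h => H ≤ h ∧ h ≤ M - H) ⊆ Ioo (H - 1) (M - H + 1) := by
      intro h; simp only [mem_filter, mem_erase, mem_range, mem_Ioo]; omega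
    refine (Finset.sum_le_sum_of_subset_of_nonneg hsub fun _ _ _ => pv).trans ?_
    have h2 := sum_Ioo_inv_sq_le (α := ℝ) (H - 1) (M - H + 1)
    have h3 : ∑ h ∈ Ioo (H - 1) (M - H + 1), (®((M - h : ℕ)) ^ 2)⁻¹ ≤
        ∑ h ∈ Ioo (H - 1) (M - H + 1), (®h ^ 2)⁻¹ := by
      refine le_of_eq (Finset.sum_nbij' (fun h => M - h) (fun h => M - h) ?_ ?_ ?_ ?_ ?_)
      · intro h; simp only [mem_Ioo]; omega
      · intro h; simp only [mem_Ioo]; omega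
      · intro h; simp only [mem_Ioo]; omega
      · intro h; simp only [mem_Ioo]; omega
      · intro h _; rfl
    have h4 : ®((H - 1 : ℕ)) + 1 = H := by push_cast [Nat.cast_sub hH]; ring
    rw [h4] at h2
    rw [Finset.sum_add_distrib, ← Finset.mul_sum, ← Finset.mul_sum]
    have h5 : ®M ^ 2 / 4 * (2 / H) + M ^ 2 / 4 * (2 / H) = M ^ 2 / H := rg
    rw [← h5]
    gcongr
    exact h3.trans h2
  have hpars : ∑ h ∈ (range M).erase 0, ‖D h‖ ^ 2 ≤ M * L := by
    rw [← parseval hM hLM]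
    exact Finset.sum_le_sum_of_subset_of_nonneg (erase_subset _ _) fun _ _ _ => sq_nonneg _
  have hsum : ‖∑ h ∈ (range M).erase 0, ec M (h * a₀) * D h ^ 2 * S h‖ ≤ M * L * B + #J * (M ^ 2 / H) := by
    refine (norm_sum_le _ _).trans ((Finset.sum_le_sum hpt).trans ?_)
    rw [Finset.sum_add_distrib, ← Finset.sum_mul, ← Finset.mul_sum]
    gcongr
  rw [e3]
  refine (mul_le_mul_of_nonneg_left hsum pv).trans_eq ?_
  field_simp
noncomputable def Em (m : ℕ) (h κ d : ℤ) : ℂ :=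
  open Classical in if IsCoprime d m then ec m (h * (-κ * iv m d)) else 0
lemma Em_norm (m h κ d) : ‖Em m h κ d‖ ≤ 1 := by rw [Em]; split_ifs <;> simp
lemma iv_uniq {m : ℕ} {d x y : ℤ} (hd : IsCoprime d m) (h : ¡m ∣ d * x - d * y) : ¡m ∣ x - y := by
  rw [← mul_sub] at h; exact hd.symm.dvd_of_dvd_mul_left h
lemma Em_eq {m : ℕ} (hm : m ≠ 0) {h κ d u : ℤ} (hd : IsCoprime d m) (hu : ¡m ∣ d * u + κ) :
    Em m h κ d = ec m (h * u) := by
  rw [Em, if_pos hd]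
  refine ec_congr hm ?_
  rw [← mul_sub]
  refine Dvd.dvd.mul_left (iv_uniq hd ?_) _
  obtain ⟨k, hk⟩ := iv_spec hd
  obtain ⟨k', hk'⟩ := hu
  exact ⟨-κ * k - k', by linear_combination -κ * hk - hk'⟩
lemma Em_spec {m : ℕ} {d : ℤ} (hd : IsCoprime d m) (κ : ℤ) : ¡m ∣ d * (-κ * iv m d) + κ := by
  obtain ⟨k, hk⟩ := iv_spec hd
  exact ⟨-κ * k, by linear_combination -κ * hk⟩
lemma Em_mul {m n : ℕ} (hm : m ≠ 0) (hn : n ≠ 0) {a b : ℤ} (hab : a * n + b * m = 1) (h κ d : ℤ) :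
    Em (m * n) h κ d = Em m (h * a) κ d * Em n (h * b) κ d := by
  by_cases hd : IsCoprime d ¡((m * n : ℕ))
  · have hd' := hd
    push_cast at hd'
    rw [IsCoprime.mul_right_iff] at hd'
    have hs := Em_spec hd κ
    set u := -κ * iv (m * n) d
    rw [Em_eq (mul_ne_zero hm hn) hd hs, Em_eq hm hd'.1 (dvd_trans sm hs),
      Em_eq hn hd'.2 (dvd_trans sm hs), ← ec_mul (m := m) hn, ← ec_mul (m := n) hm,
      mul_comm n m, ← ec_add]
    congr 1; linear_combination -(h * u) * hab
  · rw [Em, if_neg hd]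
    push_cast at hd
    rw [IsCoprime.mul_right_iff, not_and_or] at hd
    rcases hd with hd | hd
    · rw [Em, if_neg hd, zero_mul]
    · rw [Em, Em, if_neg hd, mul_zero]
lemma cop_congr {m : ℕ} {d d' : ℤ} (h : ¡m ∣ d' - d) : IsCoprime d' m ↔ IsCoprime d m := by
  obtain ⟨k, hk⟩ := h
  rw [show d' = d + m * k by linarith]
  exact IsCoprime.add_mul_left_left_iff
lemma Em_congr {m : ℕ} (hm : m ≠ 0) {h κ κ' d d' : ℤ} (hκ : ¡m ∣ κ' - κ) (hd : ¡m ∣ d' - d) :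
    Em m h κ' d' = Em m h κ d := by
  by_cases hc : IsCoprime d m
  · have hs := Em_spec hc κ
    rw [Em_eq hm hc hs, Em_eq hm ((cop_congr hd).2 hc)]
    obtain ⟨k, hk⟩ := hκ; obtain ⟨k', hk'⟩ := hd; obtain ⟨k'', hk''⟩ := hs
    exact ⟨k + k' * (-κ * iv m d) + k'', by linear_combination hk + hk' * (-κ * iv m d) + hk''⟩
  · rw [Em, Em, if_neg hc, if_neg (by rwa [cop_congr hd])]
lemma Em_psi {t : ℕ} (ht : t.Prime) {h c κ d w₀ s : ℤ}
    (hk : ¡((t ^ 2 : ℕ)) ∣ (c * s + w₀) * κ + c ^ 2 * d) (htd : ¡t ∣ d ↔ ¡t ∣ c * s + w₀) :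
    Em (t ^ 2) h κ d = psi t c w₀ (h * c ^ 2) s := by
  have cop : ∀ w : ℤ, IsCoprime w ¡((t ^ 2 : ℕ)) ↔ ¬ ¡t ∣ w := fun w => by
    push_cast
    rw [IsCoprime.pow_right_iff nn, isCoprime_comm,
      (Nat.prime_iff_prime_int.1 ht).coprime_iff_not_dvd]
  rw [psi]
  by_cases hd : ¡t ∣ d
  · rw [if_pos (htd.1 hd), Em, if_neg (by rw [cop]; simpa using hd)]
  · have hd2 := mt htd.2 hd
    rw [if_neg hd2, mul_assoc]
    obtain ⟨k, hk⟩ := hk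
    obtain ⟨k', hk'⟩ := iv_spec ((cop _).2 hd2)
    have := iv_uniq ((cop _).2 hd2) (y := 0) (x := d * (c ^ 2 * iv (t ^ 2) (c * s + w₀)) + κ)
      ⟨k + d * c ^ 2 * k', by linear_combination hk + d * c ^ 2 * hk'⟩
    exact Em_eq (pow_ne_zero 2 ht.ne_zero) ((cop d).2 hd) (by simpa using this)
lemma cop_exists {m n : ℕ} (h : m.Coprime n) : ∃ a b : ℤ, a * n + b * m = 1 := by
  obtain ⟨a, b, h⟩ := Nat.isCoprime_iff_coprime.2 h; exact ⟨b, a, ln⟩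
lemma Sh_bound {t : ℕ} (ht : t.Prime) (ht8 : 8 < t) {c w₀ : ℤ} (hc : ¬ ¡t ∣ c) (κ d : ℤ → ℤ)
    (hκp : ∀ (m : ℕ) s, ¡m ∣ κ (s + m) - κ s) (hdp : ∀ (m : ℕ) s, ¡m ∣ d (s + m) - d s)
    (M₁ g₂ g₃ e : ℕ) (hM₁ : M₁ ≠ 0) (hg₂ : g₂ ≠ 0) (hg₃ : g₃ ≠ 0)
    (c1 : M₁.Coprime g₂) (c2 : (M₁ * g₂).Coprime g₃) (c3 : (M₁ * g₂ * g₃).Coprime (t ^ 2))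
    (hte : ¬ t ∣ e)
    (hid : ∀ s, ¡((t ^ 2 : ℕ)) ∣ (c * s + w₀) * κ s + c ^ 2 * d s)
    (htd : ∀ s, ¡t ∣ d s ↔ ¡t ∣ c * s + w₀)
    (a : ℤ) (len Q : ℕ) (hQ : 1 ≤ Q) (hK : Q ^ 16 ≤ t) (hl : t * (Q ^ 16) ^ 2 ≤ len)
    (hm0 : 2 * (e * M₁) * (Q ^ 16) ^ 2 ≤ len) (hm1 : 2 * g₂ * (Q ^ 16) ^ 2 ≤ len)
    (hm2 : 2 * g₃ * (Q ^ 16) ^ 2 ≤ len) (h : ℤ) (hh0 : h ≠ 0) (hh : |h| < t) :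
    ‖∑ i ∈ range len, (if ¡e ∣ d (a + i) then
      Em (M₁ * g₂ * g₃ * t ^ 2) h (κ (a + i)) (d (a + i)) else 0)‖ ≤ 4 * len / Q := by
  have htf : Fact t.Prime := ⟨ht⟩
  have hp := Nat.prime_iff_prime_int.1 ht
  obtain ⟨a₁, b₁, h₁⟩ := cop_exists c1
  obtain ⟨a₂, b₂, h₂⟩ := cop_exists c2
  obtain ⟨a₃, b₃, h₃⟩ := cop_exists c3
  have hb₃ : ¬ ¡t ∣ h * b₃ * c ^ 2 := by
    intro hd
    rcases hp.dvd_mul.1 hd with hd | hd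
    · rcases hp.dvd_mul.1 hd with hd | hd
      · exact hh0 (Int.eq_zero_of_abs_lt_dvd hd hh)
      · refine hp.not_isUnit (isUnit_of_dvd_one ?_)
        rw [← h₃]; refine dvd_add ?_ (hd.mul_right _)
        push_cast; exact Dvd.dvd.mul_left (dvd_pow_self _ two_ne_zero) _
    · exact hc (hp.dvd_of_dvd_pow hd)
  have ht3 : ¬ t ∣ M₁ * g₂ * g₃ := fun hd =>
    (Nat.Prime.coprime_iff_not_dvd ht).1 (Nat.Coprime.coprime_dvd_right (dvd_pow_self _ two_ne_zero) c3).symm hd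
  have key := expsum (w₀ := w₀) hc hb₃ ht8
    ![fun s => (if ¡e ∣ d s then 1 else 0) * Em M₁ (h * a₃ * a₂ * a₁) (κ s) (d s),
      fun s => Em g₂ (h * a₃ * a₂ * b₁) (κ s) (d s), fun s => Em g₃ (h * a₃ * b₂) (κ s) (d s)]
    ![e * M₁, g₂, g₃] ?_ ?_ a len Q hQ hK hl ?_ ?_
  · refine le_of_eq_of_le ?_ key
    congr 1; refine Finset.sum_congr rfl fun i _ => ?_
    simp only [Matrix.cons_val_zero, Matrix.cons_val_one, Matrix.cons_val]
    split_ifs with hd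
    · rw [Em_mul pv (pow_ne_zero _ ht.ne_zero) h₃, Em_mul pv hg₃ h₂,
        Em_mul hM₁ hg₂ h₁, Em_psi ht (hid _) (htd _)]; ring
    · ring
  · intro i s
    fin_cases i
    · simp only [Fin.zero_eta, Matrix.cons_val_zero]
      split_ifs
      · rw [one_mul]; exact Em_norm _ _ _ _
      · simp
    · exact Em_norm _ _ _ _
    · exact Em_norm _ _ _ _
  · intro i s
    fin_cases i
    · simp only [Fin.zero_eta, Matrix.cons_val_zero]
      have hp1 := hdp (e * M₁) s
      have hp2 := hκp (e * M₁) s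
      rw [Em_congr hM₁ (dvd_trans sm hp2) (dvd_trans sm hp1)]
      congr 1
      have : ¡e ∣ d (s + (e * M₁ : ℕ)) - d s := dvd_trans sm hp1
      exact if_congr (dvd_iff_dvd_of_dvd_sub this) rfl rfl
    · exact Em_congr hg₂ (hκp _ _) (hdp _ _)
    · exact Em_congr hg₃ (hκp _ _) (hdp _ _)
  · intro i; fin_cases i
    · exact hm0
    · exact hm1
    · exact hm2
  · intro i; fin_cases i
    · intro hd; rcases (Nat.Prime.dvd_mul ht).1 hd with hd | hd
      · exact hte hd
      · exact ht3 (dvd_mul_of_dvd_left (dvd_mul_of_dvd_left hd _) _)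
    · exact fun hd => ht3 (dvd_mul_of_dvd_left (dvd_mul_of_dvd_right hd _) _)
    · exact fun hd => ht3 (dvd_mul_of_dvd_right hd _)
noncomputable def Wt (M L : ℕ) (a₀ κ d : ℤ) : ℝ :=
  open Classical in if IsCoprime d M then wt M L a₀ (-κ * iv M d) else 1
lemma wsum {t : ℕ} (ht : t.Prime) (ht8 : 8 < t) {c w₀ : ℤ} (hc : ¬ ¡t ∣ c) (κ d : ℤ → ℤ)
    (hκp : ∀ (m : ℕ) s, ¡m ∣ κ (s + m) - κ s) (hdp : ∀ (m : ℕ) s, ¡m ∣ d (s + m) - d s)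
    (M₁ g₂ g₃ e : ℕ) (hM₁ : M₁ ≠ 0) (hg₂ : g₂ ≠ 0) (hg₃ : g₃ ≠ 0)
    (c1 : M₁.Coprime g₂) (c2 : (M₁ * g₂).Coprime g₃) (c3 : (M₁ * g₂ * g₃).Coprime (t ^ 2))
    (hte : ¬ t ∣ e)
    (hid : ∀ s, ¡((t ^ 2 : ℕ)) ∣ (c * s + w₀) * κ s + c ^ 2 * d s)
    (htd : ∀ s, ¡t ∣ d s ↔ ¡t ∣ c * s + w₀)
    (a : ℤ) (len Q : ℕ) (hQ : 1 ≤ Q) (hK : Q ^ 16 ≤ t) (hl : t * (Q ^ 16) ^ 2 ≤ len)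
    (hm0 : 2 * (e * M₁) * (Q ^ 16) ^ 2 ≤ len) (hm1 : 2 * g₂ * (Q ^ 16) ^ 2 ≤ len)
    (hm2 : 2 * g₃ * (Q ^ 16) ^ 2 ≤ len) (M L : ℕ) (hM : M = M₁ * g₂ * g₃ * t ^ 2)
    (hL : 1 ≤ L) (hLM : L ≤ M) (a₀ : ℤ) :
    |∑ i ∈ range len, (if ¡e ∣ d (a + i) then
      (Wt M L a₀ (κ (a + i)) (d (a + i)) - 1) else 0)| ≤
        4 * len / Q * (M / L) + len * ((®M / L) ^ 2 / t) := by
  classical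
  set J := (range len).filter fun i : ℕ => ¡e ∣ d (a + i) ∧ IsCoprime (d (a + i)) ¡M with hJ
  have h0 := window J (fun i => -κ (a + i) * iv M (d (a + i))) M L t hL hLM om a₀ (4 * len / Q)
    pv (fun h hh0 hh => by
      refine le_of_eq_of_le ?_ (Sh_bound ht ht8 hc κ d hκp hdp M₁ g₂ g₃ e hM₁ hg₂ hg₃ c1 c2 c3 hte hid htd a
        len Q hQ hK hl hm0 hm1 hm2 h hh0 hh)
      rw [hJ, sum_filter, ← hM]
      congr 1; refine sum_congr rfl fun i _ => ?_
      by_cases h1 : ¡e ∣ d (a + i) <;> by_cases h2 : IsCoprime (d (a + i)) ¡M <;> simp [h1, h2, Em])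
  have h1 : ∑ i ∈ range len, (if ¡e ∣ d (a + i) then
      (Wt M L a₀ (κ (a + i)) (d (a + i)) - 1) else 0) =
      ∑ i ∈ J, wt M L a₀ (-κ (a + i) * iv M (d (a + i))) - #J := by
    rw [card_eq_sum_ones, Nat.cast_sum, ← sum_sub_distrib, hJ, sum_filter]
    refine sum_congr rfl fun i _ => ?_
    by_cases h1 : ¡e ∣ d (a + i) <;> by_cases h2 : IsCoprime (d (a + i)) ¡M <;> simp [h1, h2, Wt]
  rw [h1]
  refine h0.trans ?_
  gcongr
  exact (card_filter_le _ _).trans sm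
lemma wt_nonneg (M L a₀ u) : 0 ≤ wt M L a₀ u := by unfold wt; positivity
lemma wt_le (M L : ℕ) (hLM : L ≤ M) (a₀ u : ℤ) : wt M L a₀ u ≤ M / L := by
  rcases Nat.eq_zero_or_pos L with rfl | hL
  · simp [wt]
  have hc : #{q ∈ range L ×ˢ range L | ¡M ∣ a₀ + (q.1 : ℕ) + (q.2 : ℕ) - u} ≤ L := by
    conv_rhs => rw [← card_range L]
    refine card_le_card_of_injOn Prod.fst (fun q hq => ?_) ?_
    · simp at hq; simpa using hq.1.1
    · rintro ⟨q, b⟩ hq ⟨q', b'⟩ hq' h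
      simp only [coe_filter, mem_product, mem_range, Set.mem_ofPred_eq] at hq hq' h
      subst h
      have := dvd_sub hq.2 hq'.2
      have h2 : ¡b - b' = 0 := Int.eq_zero_of_abs_lt_dvd (m := M) (by obtain ⟨k, hk⟩ := this; exact ⟨k, ln⟩)
        (by rw [abs_lt]; omega)
      simp; omega
  unfold wt
  have : ®0 < L := mc hL
  calc _ ≤ ®M / L ^ 2 * L := gc
    _ = _ := by field_simp
lemma wt_pos {M L : ℕ} {a₀ u : ℤ} (h : 0 < wt M L a₀ u) : ∃ q : ℕ, q ≤ 2 * L ∧ ¡M ∣ a₀ + q - u := by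
  by_contra! hq
  refine h.ne' ?_
  unfold wt
  rw [filter_false_of_mem, card_empty]; · simp
  rintro ⟨q, b⟩ hb hd
  simp at hb
  exact hq (q + b) om (by push_cast; rw [← add_assoc]; exact hd)
end
section
open Finset Real
noncomputable def es (P : Finset ℕ) (β : ℕ → ℝ) (k : ℕ) : ℝ := ∑ A ∈ P.powersetCard k, ∏ p ∈ A, β p
noncomputable def Tk (P : Finset ℕ) (β : ℕ → ℝ) (k : ℕ) : ℝ := ∑ i ∈ range (k + 1), (-1) ^ i * es P β i
lemma es_zero (P β) : es P β 0 = 1 := by simp [es]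
lemma Tk_zero (P β) : Tk P β 0 = 1 := by simp [Tk, es_zero]
lemma Tk_succ (P β k) : Tk P β (k + 1) = Tk P β k + (-1) ^ (k + 1) * es P β (k + 1) := by
  rw [Tk, sum_range_succ, ← Tk]
lemma es_insert {p : ℕ} {P : Finset ℕ} (hp : p ∉ P) (β : ℕ → ℝ) (k : ℕ) :
    es (insert p P) β (k + 1) = es P β (k + 1) + β p * es P β k := by
  have hn : ∀ A ∈ P.powersetCard k, p ∉ A := fun A hA h => hp ((mem_powersetCard.1 hA).1 h)
  rw [es, powersetCard_succ_insert hp, sum_union, sum_image, es, es, mul_sum]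
  · congr 1; refine sum_congr rfl fun A hA => ?_
    rw [prod_insert (hn A hA)]
  · intro A hA B hB h
    rw [← erase_insert (hn A hA), ← erase_insert (hn B hB), h]
  · rw [disjoint_left]
    intro A hA hA'
    obtain ⟨B, _, rfl⟩ := mem_image.1 hA'
    exact hp ((mem_powersetCard.1 hA).1 (mem_insert_self _ _))
lemma Tk_insert {p : ℕ} {P : Finset ℕ} (hp : p ∉ P) (β : ℕ → ℝ) (k : ℕ) :
    Tk (insert p P) β (k + 1) = Tk P β (k + 1) - β p * Tk P β k := by
  induction k with
  | zero => simp [Tk_succ, Tk_zero, es_insert hp, es_zero]; ring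
  | succ k ih => rw [Tk_succ, ih, es_insert hp, Tk_succ P β (k + 1), Tk_succ P β k]; ring
lemma bonf (P : Finset ℕ) (β : ℕ → ℝ) (h0 : ∀ p ∈ P, 0 ≤ β p) (h1 : ∀ p ∈ P, β p ≤ 1) (k : ℕ) :
    0 ≤ (-1) ^ k * (Tk P β k - ∏ p ∈ P, (1 - β p)) := by
  induction P using Finset.induction_on generalizing k with
  | empty =>
    have : Tk ∅ β k = 1 := by
      induction k with
      | zero => exact Tk_zero _ _
      | succ k ih => rw [Tk_succ, ih, es, powersetCard_eq_empty.2 sm]; simp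
    simp [this]
  | insert p P hp ih =>
    have ih := ih (fun q hq => h0 q (mem_insert_of_mem hq)) (fun q hq => h1 q (mem_insert_of_mem hq))
    have hp0 := h0 p (mem_insert_self _ _)
    rw [prod_insert hp]
    cases k with
    | zero =>
      rw [Tk_zero]
      have h2 := ih 0
      rw [Tk_zero] at h2
      have hV : 0 ≤ ∏ p ∈ P, (1 - β p) := prod_nonneg fun q hq => sub_nonneg.2 (h1 q (mem_insert_of_mem hq))
      simp at h2 ⊢; nlinarith
    | succ k =>
      rw [Tk_insert hp]
      have h2 := ih (k + 1)
      have h3 := mul_nonneg hp0 (ih k)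
      rw [pow_succ] at h2 ⊢
      nlinarith
lemma es_nonneg (P : Finset ℕ) (β : ℕ → ℝ) (h0 : ∀ p ∈ P, 0 ≤ β p) (k) : 0 ≤ es P β k :=
  sum_nonneg fun A hA => prod_nonneg fun p hp => h0 p ((mem_powersetCard.1 hA).1 hp)
lemma Tk_ge (P : Finset ℕ) (β : ℕ → ℝ) (h0 : ∀ p ∈ P, 0 ≤ β p) (h1 : ∀ p ∈ P, β p ≤ 1) {k : ℕ} (hk : Even k) :
    ∏ p ∈ P, (1 - β p) ≤ Tk P β k := by
  have := bonf P β h0 h1 k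
  rw [hk.neg_one_pow] at this; linarith
lemma Tk_le (P : Finset ℕ) (β : ℕ → ℝ) (h0 : ∀ p ∈ P, 0 ≤ β p) (h1 : ∀ p ∈ P, β p ≤ 1) {k : ℕ} (hk : Even k) :
    Tk P β k ≤ ∏ p ∈ P, (1 - β p) + es P β (k + 1) := by
  have := bonf P β h0 h1 (k + 1)
  rw [Tk_succ, pow_succ, hk.neg_one_pow] at this; linarith
lemma es_le (P : Finset ℕ) (β : ℕ → ℝ) (h0 : ∀ p ∈ P, 0 ≤ β p) (k : ℕ) :
    es P β k ≤ (∑ p ∈ P, β p) ^ k / k.factorial := by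
  induction P using Finset.induction_on generalizing k with
  | empty =>
    cases k with
    | zero => simp [es]
    | succ k => rw [es, powersetCard_eq_empty.2 sm]; simp
  | insert p P hp ih =>
    have h0' : ∀ q ∈ P, 0 ≤ β q := fun q hq => h0 q (mem_insert_of_mem hq)
    have ih := ih h0'
    have hp0 := h0 p (mem_insert_self _ _)
    cases k with
    | zero => simp [es]
    | succ k =>
      rw [es_insert hp, sum_insert hp]
      set S := ∑ p ∈ P, β p
      have hS : 0 ≤ S := sum_nonneg h0'
      have hb : S ^ (k + 1) + (k + 1) * β p * S ^ k ≤ (β p + S) ^ (k + 1) := by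
        have hpow : S ^ k ≤ (β p + S) ^ k := pow_le_pow_left₀ hS ln _
        clear ih
        induction k with
        | zero => simp; linarith
        | succ k ihk =>
          have := ihk (pow_le_pow_left₀ hS ln _)
          have h3 : 0 ≤ β p * (β p) * S ^ k * (k + 1) := pv
          calc _ ≤ (β p + S) * (S ^ (k + 1) + (k + 1) * β p * S ^ k) := by
                push_cast; ring_nf; ring_nf at h3; nlinarith
            _ ≤ (β p + S) * (β p + S) ^ (k + 1) := gc
            _ = _ := rg
      calc _ ≤ S ^ (k + 1) / (k + 1).factorial + β p * (S ^ k / k.factorial) := by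
            gcongr; exacts [ih _, ih _]
        _ = (S ^ (k + 1) + (k + 1) * β p * S ^ k) / (k + 1).factorial := by
            rw [Nat.factorial_succ]; push_cast; field_simp
        _ ≤ _ := gc
def MRep (P : Finset ℕ) (D B : ℝ) (Φ : (ℕ → ℝ) → ℝ) : Prop :=
  ∃ lam : Finset ℕ → ℝ, (∀ β, Φ β = ∑ A ∈ P.powerset, lam A * ∏ p ∈ A, β p) ∧
    (∀ A ∈ P.powerset, lam A ≠ 0 → ∏ p ∈ A, ®p ≤ D) ∧ ∀ A ∈ P.powerset, |lam A| ≤ B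
lemma Rep_mono {P D D' B Φ} (h : MRep P D B Φ) (hD : D ≤ D') : MRep P D' B Φ := by
  obtain ⟨l, h1, h2, h3⟩ := h
  exact ⟨l, h1, fun A hA hl => (h2 A hA hl).trans hD, h3⟩
lemma Rep_mul {P P' D D' B B' Φ Φ'} (hd : Disjoint P P') (hB0 : 0 ≤ B) (h : MRep P D B Φ) (h' : MRep P' D' B' Φ') :
    MRep (P ∪ P') (D * D') (B * B') (fun β => Φ β * Φ' β) := by
  obtain ⟨l, h1, h2, h3⟩ := h
  obtain ⟨l', h1', h2', h3'⟩ := h'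
  have key : ∀ A ∈ P.powerset, ∀ A' ∈ P'.powerset, (A ∪ A') ∩ P = A ∧ (A ∪ A') ∩ P' = A' := by
    intro A hA A' hA'
    rw [mem_powerset] at hA hA'
    rw [disjoint_left] at hd
    constructor <;> ext p <;> simp only [mem_inter, mem_union] <;> constructor
    · rintro ⟨h | h, hp⟩
      exacts [h, (hd hp (hA' h)).elim]
    · exact fun h => ⟨Or.inl h, hA h⟩
    · rintro ⟨h | h, hp⟩
      exacts [(hd (hA h) hp).elim, h]
    · exact fun h => ⟨Or.inr h, hA' h⟩
  have key2 : ∀ B ∈ (P ∪ P').powerset, B = (B ∩ P) ∪ (B ∩ P') := by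
    intro B hB
    rw [← inter_union_distrib_left, inter_eq_left.2 (mem_powerset.1 hB)]
  have key3 : ∀ B : Finset ℕ, Disjoint (B ∩ P) (B ∩ P') := fun B =>
    hd.mono inter_subset_right inter_subset_right
  have m1 : ∀ B Q : Finset ℕ, B ∩ Q ∈ Q.powerset := fun B Q => mem_powerset.2 inter_subset_right
  refine ⟨fun B => l (B ∩ P) * l' (B ∩ P'), fun β => ?_, fun B hB hl => ?_, fun B hB => ?_⟩
  · beta_reduce; rw [h1, h1', sum_mul_sum, ← sum_product']
    refine sum_bij' (fun q _ => q.1 ∪ q.2) (fun B _ => (B ∩ P, B ∩ P')) ?_ ?_ ?_ ?_ ?_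
    · intro q hq; rw [mem_product] at hq
      exact mem_powerset.2 (union_subset_union (mem_powerset.1 hq.1) (mem_powerset.1 hq.2))
    · intro B _; exact mem_product.2 ⟨m1 _ _, m1 _ _⟩
    · intro q hq; rw [mem_product] at hq
      obtain ⟨a, b⟩ := key _ hq.1 _ hq.2
      rw [a, b]
    · intro B hB; exact (key2 B hB).symm
    · intro q hq; rw [mem_product] at hq
      obtain ⟨a, b⟩ := key _ hq.1 _ hq.2
      rw [a, b, prod_union (hd.mono (mem_powerset.1 hq.1) (mem_powerset.1 hq.2))]; ring
  · rw [key2 B hB, prod_union (key3 B)]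
    have e1 := h2 _ (m1 B P) (left_ne_zero_of_mul hl)
    have e2 := h2' _ (m1 B P') (right_ne_zero_of_mul hl)
    have e3 : 0 ≤ ∏ p ∈ B ∩ P', ®p := pv
    have e4 : 0 ≤ ∏ p ∈ B ∩ P, ®p := pv
    exact mul_le_mul e1 e2 e3 (e4.trans e1)
  · rw [abs_mul]
    exact mul_le_mul (h3 _ (m1 _ _)) (h3' _ (m1 _ _)) (abs_nonneg _) hB0
lemma Rep_sub {P D B B' Φ Φ'} (h : MRep P D B Φ) (h' : MRep P D B' Φ') : MRep P D (B + B') (fun β => Φ β - Φ' β) := by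
  obtain ⟨l, h1, h2, h3⟩ := h
  obtain ⟨l', h1', h2', h3'⟩ := h'
  refine ⟨fun A => l A - l' A, fun β => ?_, fun A hA hl => ?_, fun A hA => ?_⟩
  · beta_reduce; rw [h1, h1', ← sum_sub_distrib]; exact sum_congr rfl fun _ _ => rg
  · by_cases hh : l A = 0
    · exact h2' A hA (fun h => hl (by simp [hh, h]))
    · exact h2 A hA hh
  · exact (abs_sub _ _).trans (add_le_add (h3 A hA) (h3' A hA))
lemma Rep_sum {P : Finset ℕ} {D : ℝ} (J : ℕ) (Φ : ℕ → (ℕ → ℝ) → ℝ) (h : ∀ j < J, MRep P D 1 (Φ j)) :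
    MRep P D J (fun β => ∑ j ∈ range J, Φ j β) := by
  choose! l h1 h2 h3 using h
  refine ⟨fun A => ∑ j ∈ range J, l j A, fun β => ?_, fun A hA hl => ?_, fun A hA => ?_⟩
  · simp_rw [sum_mul]; rw [sum_comm]
    exact sum_congr rfl fun j hj => h1 j (mem_range.1 hj) β
  · obtain ⟨j, hj, hn⟩ := exists_ne_zero_of_sum_ne_zero hl
    exact h2 j (mem_range.1 hj) A hA hn
  · refine (abs_sum_le_sum_abs _ _).trans ((sum_le_sum fun j hj => h3 j (mem_range.1 hj) A hA).trans ?_)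
    simp
lemma Rep_prod (J : ℕ) (P : ℕ → Finset ℕ) (hd : ∀ i j, i < j → Disjoint (P i) (P j)) (D : ℕ → ℝ)
    (Φ : ℕ → (ℕ → ℝ) → ℝ) (h : ∀ j < J, MRep (P j) (D j) 1 (Φ j)) :
    MRep ((range J).biUnion P) (∏ j ∈ range J, D j) 1 (fun β => ∏ j ∈ range J, Φ j β) := by
  induction J with
  | zero => exact ⟨fun _ => 1, sm, sm, sm⟩
  | succ J ih =>
    simp_rw [prod_range_succ, range_add_one, biUnion_insert]
    rw [union_comm, show ®1 = 1 * 1 by norm_num]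
    refine Rep_mul ?_ zero_le_one (ih fun j hj => h j om) (h J om)
    rw [disjoint_biUnion_left]
    exact fun i hi => hd i J (mem_range.1 hi)
lemma Rep_card (P : Finset ℕ) (y : ℝ) (hy1 : 1 ≤ y) (hy : ∀ p ∈ P, ®p ≤ y) (k : ℕ) (c : ℕ → ℝ)
    (hc : ∀ i, |c i| ≤ 1) (hck : ∀ i, k < i → c i = 0) :
    MRep P (y ^ k) 1 (fun β => ∑ i ∈ range (k + 1), c i * es P β i) := by
  refine ⟨fun A => c #A, fun β => ?_, fun A hA hl => ?_, fun A _ => hc _⟩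
  · have : ∀ A ∈ P.powerset, c #A * ∏ p ∈ A, β p =
        ∑ i ∈ range (k + 1), if #A = i then c i * ∏ p ∈ A, β p else 0 := by
      intro A _
      rw [sum_ite_eq]
      split_ifs with h
      · rfl
      · rw [hck _ (by simpa using h), zero_mul]
    rw [sum_congr rfl this, sum_comm]
    refine sum_congr rfl fun i _ => ?_
    rw [← sum_filter, es, mul_sum, powersetCard_eq_filter]
  · have hk : #A ≤ k := by by_contra! h; exact hl (hck _ h)
    calc _ ≤ ∏ p ∈ A, y := prod_le_prod (fun _ _ => pv) fun p hp => hy p (mem_powerset.1 hA hp)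
      _ = y ^ #A := sm
      _ ≤ _ := pow_le_pow_right₀ hy1 hk
noncomputable def LB (P : ℕ → Finset ℕ) (k : ℕ → ℕ) (J : ℕ) (β : ℕ → ℝ) : ℝ :=
  ∏ j ∈ range J, Tk (P j) β (k j) -
    ∑ l ∈ range J, ∏ j ∈ range J, (if j = l then es (P j) β (k j + 1) else Tk (P j) β (k j))
lemma LB_rep (P : ℕ → Finset ℕ) (hd : ∀ i j, i < j → Disjoint (P i) (P j)) (k : ℕ → ℕ) (J : ℕ) (y : ℕ → ℝ)
    (hy1 : ∀ j, 1 ≤ y j) (hy : ∀ j, ∀ p ∈ P j, ®p ≤ y j) :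
    MRep ((range J).biUnion P) (∏ j ∈ range J, y j ^ (k j + 1)) (1 + J) (LB P k J) := by
  have hT : ∀ j, MRep (P j) (y j ^ (k j + 1)) 1 (fun β => Tk (P j) β (k j)) := fun j => by
    have := Rep_card (P j) (y j) (hy1 j) (hy j) (k j) (fun i => if i ≤ k j then (-1) ^ i else 0)
      (fun i => by split_ifs <;> simp) (fun i hi => if_neg om)
    refine Rep_mono ?_ (pow_le_pow_right₀ (hy1 j) (Nat.le_succ _))
    convert this using 2 with β
    refine sum_congr rfl fun i hi => ?_
    rw [if_pos (by simp at hi; omega)]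
  have hE : ∀ j, MRep (P j) (y j ^ (k j + 1)) 1 (fun β => es (P j) β (k j + 1)) := fun j => by
    have := Rep_card (P j) (y j) (hy1 j) (hy j) (k j + 1) (fun i => if i = k j + 1 then 1 else 0)
      (fun i => by split_ifs <;> simp) (fun i hi => if_neg om)
    convert this using 2 with β
    rw [sum_eq_single (k j + 1)] <;> simp +contextual
  refine Rep_sub (Rep_prod J P hd _ _ fun j _ => hT j) (Rep_sum J _ fun l _ => ?_)
  refine Rep_prod J P hd _ _ fun j _ => ?_
  by_cases h : j = l
  · simpa [h] using hE l
  · simpa [h] using hT j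
lemma LB_ge (P : ℕ → Finset ℕ) (k : ℕ → ℕ) (hk : ∀ j, Even (k j)) (J : ℕ) (β : ℕ → ℝ)
    (h0 : ∀ j, ∀ p ∈ P j, 0 ≤ β p) (h1 : ∀ j, ∀ p ∈ P j, β p < 1)
    (hs : ∑ j ∈ range J, es (P j) β (k j + 1) / (∏ p ∈ P j, (1 - β p)) ≤ 1 / 2) :
    1 / 2 * ∏ j ∈ range J, ∏ p ∈ P j, (1 - β p) ≤ LB P k J β := by
  have hV : ∀ j, 0 < ∏ p ∈ P j, (1 - β p) := fun j => prod_pos fun p hp => sub_pos.2 (h1 j p hp)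
  have hT := fun j => Tk_ge (P j) β (h0 j) (fun p hp => (h1 j p hp).le) (hk j)
  have hT0 := fun j => (hV j).trans_le (hT j)
  have hl : ∀ l ∈ range J, ∏ j ∈ range J, (if j = l then es (P j) β (k j + 1) else Tk (P j) β (k j)) =
      (∏ j ∈ range J, Tk (P j) β (k j)) * (es (P l) β (k l + 1) / Tk (P l) β (k l)) := by
    intro l hl
    rw [← mul_prod_erase _ _ hl, ← mul_prod_erase _ _ hl, if_pos rfl,
      prod_congr rfl (fun j hj => if_neg (ne_of_mem_erase hj))]
    have := (hT0 l).ne'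
    field_simp
  rw [LB, sum_congr rfl hl, ← mul_sum]
  have h2 : ∑ l ∈ range J, es (P l) β (k l + 1) / Tk (P l) β (k l) ≤ 1 / 2 := by
    refine (sum_le_sum fun l _ => ?_).trans hs
    exact div_le_div_of_nonneg_left (es_nonneg _ _ (h0 l) _) (hV l) (hT l)
  have h3 : ∏ j ∈ range J, ∏ p ∈ P j, (1 - β p) ≤ ∏ j ∈ range J, Tk (P j) β (k j) :=
    prod_le_prod (fun j _ => (hV j).le) fun j _ => hT j
  have h4 : 0 < ∏ j ∈ range J, Tk (P j) β (k j) := prod_pos fun j _ => hT0 j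
  nlinarith
lemma LB_le (P : ℕ → Finset ℕ) (k : ℕ → ℕ) (hk : ∀ j, Even (k j)) (J : ℕ) (β : ℕ → ℝ)
    (h01 : ∀ p, β p = 0 ∨ β p = 1) :
    LB P k J β ≤ ∏ j ∈ range J, ∏ p ∈ P j, (1 - β p) := by
  have h0 : ∀ p, 0 ≤ β p := fun p => by rcases h01 p with h | h <;> simp [h]
  have h1 : ∀ p, β p ≤ 1 := fun p => by rcases h01 p with h | h <;> simp [h]
  have hT := fun j => Tk_ge (P j) β (fun p _ => h0 p) (fun p _ => h1 p) (hk j)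
  have hT' := fun j => Tk_le (P j) β (fun p _ => h0 p) (fun p _ => h1 p) (hk j)
  have hV : ∀ j, 0 ≤ ∏ p ∈ P j, (1 - β p) := fun j => prod_nonneg fun p _ => sub_nonneg.2 (h1 p)
  have hT0 := fun j => (hV j).trans (hT j)
  have hE := fun j => es_nonneg (P j) β (fun p _ => h0 p) (k j + 1)
  have hterm : ∀ l ∈ range J, 0 ≤ ∏ j ∈ range J,
      (if j = l then es (P j) β (k j + 1) else Tk (P j) β (k j)) := fun l _ =>
    prod_nonneg fun j _ => by split_ifs <;> [exact hE j; exact hT0 j]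
  unfold LB
  by_cases h : ∃ l ∈ range J, ∏ p ∈ P l, (1 - β p) = 0
  · obtain ⟨l, hl, hz⟩ := h
    have hle := single_le_sum hterm hl
    have : ∏ j ∈ range J, Tk (P j) β (k j) ≤
        ∏ j ∈ range J, (if j = l then es (P j) β (k j + 1) else Tk (P j) β (k j)) := by
      refine prod_le_prod (fun j _ => hT0 j) fun j _ => ?_
      split_ifs with h
      · subst h; have := hT' j; linarith
      · exact le_rfl
    have h0 : ∏ j ∈ range J, ∏ p ∈ P j, (1 - β p) = 0 := prod_eq_zero hl hz
    linarith
  · push Not at h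
    have hone : ∀ l ∈ range J, ∀ p ∈ P l, β p = 0 := fun l hl p hp => by
      rcases h01 p with h' | h'
      · exact h'
      · exact (h l hl (prod_eq_zero hp (by simp [h']))).elim
    have hz : ∀ l ∈ range J, ∀ i, es (P l) β (i + 1) = 0 := fun l hl i => by
      refine sum_eq_zero fun A hA => ?_
      obtain ⟨hA, hc⟩ := mem_powersetCard.1 hA
      obtain ⟨p, hp⟩ : A.Nonempty := card_pos.1 om
      exact prod_eq_zero hp (hone l hl p (hA hp))
    have hT1 : ∀ l ∈ range J, ∏ p ∈ P l, (1 - β p) = Tk (P l) β (k l) := fun l hl =>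
      le_antisymm (hT l) (by have := hT' l; rw [hz l hl] at this; linarith)
    rw [prod_congr rfl hT1]
    have := sum_nonneg hterm; linarith
lemma log_sum_le (n : ℕ) (hn : 0 < n) :
    ∑ p ∈ (range (n + 1)).filter Nat.Prime, log p / p ≤ log n + log 4 := by
  have hn' : ®0 < n := mc hn
  have hθ : ∑ p ∈ (range (n + 1)).filter Nat.Prime, log p ≤ log 4 * n := by
    have := Chebyshev.theta_le_log4_mul_x (x := n) hn'.le
    rw [Chebyshev.theta_eq_sum_Icc, Nat.floor_natCast] at this
    convert this using 2
    ext p; simp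
  have h1 : ∑ p ∈ (range (n + 1)).filter Nat.Prime, log p * (n / p : ℕ) ≤ n * log n := by
    have e : ∀ p ∈ (range (n + 1)).filter Nat.Prime, log p * (n / p : ℕ) =
        ∑ m ∈ Ioc 0 n, if p ∣ m then log p else 0 := fun p hp => by
      rw [← sum_filter, sum_const, Nat.Ioc_filter_dvd_card_eq_div, nsmul_eq_mul, mul_comm]
    rw [sum_congr rfl e, sum_comm]
    calc _ ≤ ∑ m ∈ Ioc 0 n, log n := by
          refine sum_le_sum fun m hm => ?_
          rw [mem_Ioc] at hm
          rw [← sum_filter, ← log_prod (fun p hp => by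
            simp at hp; exact_mod_cast hp.1.2.ne_zero)]
          have hsub : (((range (n + 1)).filter Nat.Prime).filter (· ∣ m)) ⊆ m.primeFactors := fun p hp => by
            simp at hp ⊢; exact ⟨hp.1.2, hp.2, om⟩
          have : ∏ p ∈ (((range (n + 1)).filter Nat.Prime).filter (· ∣ m)), p ≤ n :=
            (Nat.le_of_dvd hm.1 ((prod_dvd_prod_of_subset _ _ _ hsub).trans (Nat.prod_primeFactors_dvd m))).trans hm.2
          have h0 : 0 < ∏ p ∈ (((range (n + 1)).filter Nat.Prime).filter (· ∣ m)), p :=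
            prod_pos fun p hp => by simp at hp; exact hp.1.2.pos
          refine log_le_log ?_ ?_
          · rw [← Nat.cast_prod]; exact_mod_cast h0
          · rw [← Nat.cast_prod]; exact_mod_cast this
      _ = _ := sm
  have h2 : n * ∑ p ∈ (range (n + 1)).filter Nat.Prime, log p / p ≤
      ∑ p ∈ (range (n + 1)).filter Nat.Prime, log p * (n / p : ℕ) +
      ∑ p ∈ (range (n + 1)).filter Nat.Prime, log p := by
    rw [mul_sum, ← sum_add_distrib]
    refine sum_le_sum fun p hp => ?_
    simp at hp
    have hp0 : ®0 < p := mc hp.2.pos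
    have hl : 0 ≤ log p := log_natCast_nonneg _
    have := Nat.lt_floor_add_one (®n / p)
    rw [Nat.floor_div_eq_div] at this
    calc _ = log p * (n / p) := rg
      _ ≤ log p * ((n / p : ℕ) + 1) := gc
      _ = _ := rg
  have : ®n * ∑ p ∈ (range (n + 1)).filter Nat.Prime, log p / p ≤ n * (log n + log 4) := by
    linarith
  exact le_of_mul_le_mul_left this hn'
lemma inv_sum_le (y : ℝ) (hy : 2 ≤ y) (S : Finset ℕ) (hS : ∀ p ∈ S, p.Prime ∧ ®p ≤ y ∧ y ≤ p ^ 2) :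
    ∑ p ∈ S, ®1 / p ≤ 6 := by
  have hl2 : 0 < log 2 := log_pos nn
  have hly : log 2 ≤ log y := log_le_log nn hy
  have hly0 : 0 < log y := hl2.trans_le hly
  have h1 : ∀ p ∈ S, ®1 / p ≤ 2 / log y * (log p / p) := fun p hp => by
    obtain ⟨a, b, c⟩ := hS p hp
    have hp0 : ®0 < p := mc a.pos
    have : log y ≤ 2 * log p := by
      have := log_le_log ln c
      rwa [log_pow] at this
    rw [div_mul_div_comm, div_le_div_iff₀ hp0 pv]
    nlinarith
  have h2 := log_sum_le ⌊y⌋₊ (Nat.floor_pos.2 ln)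
  have h3 : log ⌊y⌋₊ ≤ log y :=
    log_le_log (mc Nat.floor_pos.2 ln) (Nat.floor_le ln)
  have h4 : ∑ p ∈ S, log p / p ≤ log y + log 4 := by
    refine le_trans (sum_le_sum_of_subset_of_nonneg (fun p hp => ?_) fun p _ _ => ?_) (h2.trans ln)
    · obtain ⟨a, b, c⟩ := hS p hp
      simp [a, Nat.lt_succ_iff, Nat.le_floor b]
    · have := log_natCast_nonneg p; positivity
  rw [show ®4 = 2 ^ 2 by norm_num, log_pow] at h4
  calc _ ≤ 2 / log y * ∑ p ∈ S, log p / p := by rw [mul_sum]; exact sum_le_sum h1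
    _ ≤ 2 / log y * (3 * log y) := by
        gcongr
        push_cast at h4; linarith
    _ = 6 := by field_simp; norm_num
noncomputable def pz (z : ℝ) : Finset ℕ := (range ⌈z⌉₊).filter Nat.Prime
lemma mem_pz {z : ℝ} {p : ℕ} : p ∈ pz z ↔ p.Prime ∧ ®p < z := by
  rw [pz, mem_filter, mem_range, Nat.lt_ceil, and_comm]
noncomputable def PP (z : ℝ) : ℕ → Finset ℕ
  | 0 => (pz z).filter (· < 6)
  | j + 1 => (pz z).filter fun p => 6 ≤ p ∧ z ≤ ®p ^ (2 ^ (j + 1)) ∧ ®p ^ (2 ^ j) < z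
lemma PP_disj (z : ℝ) (i j : ℕ) (h : i < j) : Disjoint (PP z i) (PP z j) := by
  rw [disjoint_left]
  intro p hi hj
  obtain ⟨j, rfl⟩ := Nat.exists_eq_succ_of_ne_zero (om : j ≠ 0)
  simp only [PP, mem_filter] at hj
  cases i with
  | zero => simp only [PP, mem_filter] at hi; omega
  | succ i =>
    simp only [PP, mem_filter] at hi
    have : ®p ^ (2 ^ (i + 1)) ≤ ®p ^ (2 ^ j) :=
      pow_le_pow_right₀ (mc (om : 1 ≤ p)) (Nat.pow_le_pow_right nn om)
    linarith [hi.2.2.1, hj.2.2.2]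
lemma PP_union (z : ℝ) (hz : 6 ≤ z) (J : ℕ) (hJ : log z ≤ J) : (range (J + 1)).biUnion (PP z) = pz z := by
  ext p
  rw [mem_biUnion]
  constructor
  · rintro ⟨j, _, hj⟩
    cases j <;> simp only [PP, mem_filter] at hj <;> exact hj.1
  · intro hp
    by_cases h6 : p < 6
    · exact ⟨0, sm, by simp [PP, hp, h6]⟩
    · push Not at h6
      have h6r : ®6 ≤ p := mc h6
      have hex : ∃ j, z ≤ ®p ^ (2 ^ j) := ⟨J, by
        have hJ2 : ®J ≤ (2 ^ J : ℕ) := mc Nat.lt_two_pow_self.le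
        calc z = exp (log z) := (exp_log ln).symm
          _ ≤ exp (2 ^ J : ℕ) := exp_le_exp.2 (hJ.trans hJ2)
          _ = exp 1 ^ (2 ^ J) := by rw [← exp_nat_mul]; simp
          _ ≤ _ := by gcongr; linarith [exp_one_lt_d9]⟩
      have hle : Nat.find hex ≤ J := Nat.find_min' hex (by
        have hJ2 : ®J ≤ (2 ^ J : ℕ) := mc Nat.lt_two_pow_self.le
        calc z = exp (log z) := (exp_log ln).symm
          _ ≤ exp (2 ^ J : ℕ) := exp_le_exp.2 (hJ.trans hJ2)
          _ = exp 1 ^ (2 ^ J) := by rw [← exp_nat_mul]; simp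
          _ ≤ _ := by gcongr; linarith [exp_one_lt_d9])
      have hs := Nat.find_spec hex
      have hmin := fun m => Nat.find_min hex (m := m)
      set j := Nat.find hex
      cases hj : j with
      | zero => rw [hj] at hs; simp at hs; linarith [(mem_pz.1 hp).2]
      | succ i =>
        refine ⟨i + 1, by simp; omega, ?_⟩
        simp only [PP, mem_filter]
        rw [hj] at hs
        exact ⟨hp, h6, hs, not_le.1 (hmin i om)⟩
lemma xpsum (j₀ : ℝ) (J : ℕ) : ∑ j ∈ range J, ®(1 / 2) ^ j * (2 * (j₀ + j) + 1) =
    4 * j₀ + 6 - (4 * j₀ + 6 + 4 * J) * (1 / 2) ^ J := by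
  induction J with
  | zero => simp
  | succ J ih => rw [sum_range_succ, ih]; push_cast; ring
theorem sieve : ∃ C1 : ℕ, ∀ z : ℝ, 6 ≤ z → ∃ lam : Finset ℕ → ℝ,
    (∀ β : ℕ → ℝ, (∀ p, β p = 0 ∨ β p = 1) →
      ∑ A ∈ (pz z).powerset, lam A * ∏ p ∈ A, β p ≤ ∏ p ∈ pz z, (1 - β p)) ∧
    (∀ A ∈ (pz z).powerset, lam A ≠ 0 → ∏ p ∈ A, ®p ≤ z ^ C1) ∧
    ∑ A ∈ (pz z).powerset, |lam A| ≤ z ^ C1 ∧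
    ∀ β : ℕ → ℝ, (∀ p ∈ pz z, 0 ≤ β p ∧ β p < 1 ∧ β p ≤ 3 / p) →
      1 / 2 * ∏ p ∈ pz z, (1 - β p) ≤ ∑ A ∈ (pz z).powerset, lam A * ∏ p ∈ A, β p := by
  obtain ⟨j₀, hj₀⟩ := pow_unbounded_of_one_lt (2 * exp 72) (nn : ®1 < 4)
  refine ⟨4 * j₀ + 6 + 5 + 2, fun z hz => ?_⟩
  obtain ⟨J, hJ, hJ'⟩ : ∃ J : ℕ, log z ≤ J ∧ ®J ≤ z :=
    ⟨⌈log z⌉₊, Nat.le_ceil _, by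
      have h1 := Nat.ceil_lt_add_one (log_nonneg (ln : 1 ≤ z))
      have h2 := log_le_sub_one_of_pos (ln : 0 < z)
      linarith⟩
  have hz0 : 0 < z := ln
  have hz1 : 1 ≤ z := ln
  set k : ℕ → ℕ := fun j => match j with | 0 => 4 | j + 1 => 2 * (j₀ + j) with hk
  have hke : ∀ j, Even (k j) := fun j => by cases j <;> simp [hk]; decide
  set y : ℕ → ℝ := fun j => match j with | 0 => 6 | j + 1 => z ^ (®(1 / 2) ^ j) with hy
  have hU := PP_union z hz J hJ
  have hy1 : ∀ j, 1 ≤ y j := fun j => by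
    cases j with
    | zero => simp [hy]
    | succ j => exact Real.one_le_rpow hz1 pv
  have hyp : ∀ j, y (j + 1) ^ (2 ^ j) = z := fun j => by
    simp only [hy]
    rw [← rpow_natCast, ← rpow_mul hz0.le]; push_cast
    rw [← mul_pow]; norm_num
  have hyP : ∀ j, ∀ p ∈ PP z j, ®p ≤ y j := fun j p hp => by
    cases j with
    | zero => simp only [PP, mem_filter] at hp; simp only [hy]; exact_mod_cast hp.2.le
    | succ j =>
      simp only [PP, mem_filter] at hp
      refine le_of_pow_le_pow_left₀ (n := 2 ^ j) pv (by linarith [hy1 (j + 1)]) ?_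
      rw [hyp]; exact hp.2.2.2.le
  obtain ⟨lam, h1, h2, h3⟩ := LB_rep (PP z) (PP_disj z) k (J + 1) y hy1 hyP
  have hD : ∏ j ∈ range (J + 1), y j ^ (k j + 1) ≤ z ^ (4 * j₀ + 6 + 5) := by
    rw [prod_range_succ', pow_add z (4 * j₀ + 6) 5]
    refine mul_le_mul (c := y 0 ^ (k 0 + 1)) (d := z ^ 5) ?_ (pow_le_pow_left₀ nn hz 5) pv pv
    have : ∀ j ∈ range J, y (j + 1) ^ (k (j + 1) + 1) = z ^ (®(1 / 2) ^ j * (2 * (j₀ + j) + 1)) := fun j _ => by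
      simp only [hy, hk]
      rw [← rpow_natCast, ← rpow_mul hz0.le]; push_cast; ring_nf
    rw [prod_congr rfl this, ← rpow_sum_of_pos hz0, xpsum]
    refine (rpow_le_rpow_of_exponent_le hz1 ?_).trans_eq (rpow_natCast z (4 * j₀ + 6))
    push_cast
    have : 0 ≤ (4 * ®j₀ + 6 + 4 * J) * (1 / 2) ^ J := pv
    linarith
  rw [hU] at h1 h2 h3
  have hprod : ∀ F : ℕ → ℝ, ∏ j ∈ range (J + 1), ∏ p ∈ PP z j, F p = ∏ p ∈ pz z, F p := fun F => by
    rw [← hU, prod_biUnion]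
    intro i _ j _ hij
    rcases lt_or_gt_of_ne hij with h | h
    exacts [PP_disj z i j h, (PP_disj z j i h).symm]
  have hsub : ∀ j, ∀ p ∈ PP z j, p ∈ pz z := fun j p hp => by
    cases j <;> simp only [PP, mem_filter] at hp <;> exact hp.1
  refine ⟨lam, fun β hβ => ?_, fun A hA hl => ?_, ?_, fun β hβ => ?_⟩
  · rw [← h1, ← hprod]; exact LB_le _ k hke _ β hβ
  · exact (h2 A hA hl).trans (hD.trans (pow_le_pow_right₀ hz1 om))
  · set T := (pz z).powerset.filter (fun A => lam A ≠ 0) with hT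
    have e1 : ∑ A ∈ (pz z).powerset, |lam A| = ∑ A ∈ T, |lam A| := by
      rw [hT, sum_filter]; refine sum_congr rfl fun A _ => ?_
      split_ifs with h
      · rfl
      · push Not at h; simp [h]
    have e2 : #T ≤ ⌊z ^ (4 * j₀ + 6 + 5)⌋₊ := by
      rw [← Nat.card_Icc 1 ⌊z ^ (4 * j₀ + 6 + 5)⌋₊ |>.trans (Nat.add_sub_cancel _ _)]
      have hpr : ∀ A ∈ T, ∀ p ∈ A, p.Prime := fun A hA p hp =>
        (mem_pz.1 (mem_powerset.1 (mem_filter.1 hA).1 hp)).1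
      refine card_le_card_of_injOn (fun A => ∏ p ∈ A, p) (fun A hA => ?_) (fun A hA B hB h => ?_)
      · have hA' := mem_filter.1 hA
        rw [coe_Icc, Set.mem_Icc]
        refine ⟨Nat.one_le_iff_ne_zero.2 (prod_ne_zero_iff.2 fun p hp => (hpr A hA p hp).ne_zero), Nat.le_floor ?_⟩
        rw [Nat.cast_prod]; exact (h2 A hA'.1 hA'.2).trans hD
      · rw [← Nat.primeFactors_prod (hpr A hA), ← Nat.primeFactors_prod (hpr B hB)]
        exact congrArg _ h
    have e3 : (#T : ℝ) ≤ z ^ (4 * j₀ + 6 + 5) := le_trans (mc e2) (Nat.floor_le pv)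
    calc _ ≤ ∑ A ∈ T, (1 + ®((J + 1 : ℕ))) := by
          rw [e1]; exact sum_le_sum fun A hA => h3 A (mem_filter.1 hA).1
      _ = #T * (1 + ®((J + 1 : ℕ))) := by simp; ring
      _ ≤ z ^ (4 * j₀ + 6 + 5) * z ^ 2 := by
          refine mul_le_mul e3 ?_ pv pv
          push_cast; nlinarith
      _ = _ := by rw [← pow_add]
  · rw [← h1, ← hprod]
    refine LB_ge _ k hke _ β (fun j p hp => (hβ p (hsub j p hp)).1) (fun j p hp => (hβ p (hsub j p hp)).2.1) ?_
    rw [sum_range_succ']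
    have hz0' : es (PP z 0) β (k 0 + 1) = 0 := by
      rw [es, powersetCard_eq_empty.2, sum_empty]
      have : PP z 0 ⊆ {2, 3, 5} := fun p hp => by
        simp only [PP, mem_filter, mem_pz] at hp
        obtain ⟨⟨hp1, _⟩, hp2⟩ := hp
        interval_cases p <;> first | decide | (exfalso; revert hp1; decide)
      exact (card_le_card this).trans_lt (by simp [hk])
    rw [hz0', zero_div, add_zero]
    have hterm : ∀ j ∈ range J, es (PP z (j + 1)) β (k (j + 1) + 1) / ∏ p ∈ PP z (j + 1), (1 - β p) ≤
        1 / 4 * (1 / 2) ^ j := fun j _ => by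
      have hb : ∀ p ∈ PP z (j + 1), 0 ≤ β p ∧ β p ≤ 1 / 2 ∧ β p ≤ 3 * (1 / p) := fun p hp => by
        have hh := hβ p (hsub _ p hp)
        simp only [PP, mem_filter] at hp
        have h6 : ®6 ≤ p := mc hp.2.1
        refine ⟨hh.1, hh.2.2.trans ?_, hh.2.2.trans (le_of_eq rg)⟩
        rw [div_le_div_iff₀ ln nn]; linarith
      have hS : ∑ p ∈ PP z (j + 1), β p ≤ 18 := by
        by_cases hne : (PP z (j + 1)).Nonempty
        · obtain ⟨q, hq⟩ := hne
          have hq2 : 2 ≤ y (j + 1) := by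
            refine le_trans ?_ (hyP _ q hq)
            simp only [PP, mem_filter] at hq
            exact_mod_cast (om : 2 ≤ q)
          have := inv_sum_le (y (j + 1)) hq2 (PP z (j + 1)) fun p hp => by
            refine ⟨(mem_pz.1 (hsub _ p hp)).1, hyP _ p hp, ?_⟩
            refine le_of_pow_le_pow_left₀ (n := 2 ^ j) pv pv ?_
            rw [hyp, ← pow_mul, ← pow_succ']
            simp only [PP, mem_filter] at hp; exact hp.2.2.1
          calc _ ≤ ∑ p ∈ PP z (j + 1), 3 * (1 / ®p) := sum_le_sum fun p hp => (hb p hp).2.2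
            _ ≤ 18 := by rw [← mul_sum]; linarith
        · rw [not_nonempty_iff_eq_empty.1 hne]; simp
      have hS0 : 0 ≤ ∑ p ∈ PP z (j + 1), β p := sum_nonneg fun p hp => (hb p hp).1
      have hV : exp (-36) ≤ ∏ p ∈ PP z (j + 1), (1 - β p) := by
        calc _ ≤ exp (∑ p ∈ PP z (j + 1), (-2 * β p)) := by
              rw [← mul_sum]; exact exp_le_exp.2 ln
          _ = ∏ p ∈ PP z (j + 1), exp (-2 * β p) := exp_sum _ _
          _ ≤ _ := prod_le_prod (fun _ _ => (exp_pos _).le) fun p hp => by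
              obtain ⟨a, b, _⟩ := hb p hp
              have h3 : 1 / (1 - β p) ≤ exp (2 * β p) := by
                refine le_trans ?_ (add_one_le_exp _)
                rw [div_le_iff₀ ln]; nlinarith
              rw [neg_mul, exp_neg]
              rw [inv_le_comm₀ (exp_pos _) ln]
              simpa using h3
      set n := k (j + 1) + 1 with hn
      have hn' : n = 2 * j₀ + 2 * j + 1 := by simp [hn, hk]; ring
      have hE : es (PP z (j + 1)) β n ≤ exp 36 * (1 / 2) ^ n := by
        refine (es_le _ β (fun p hp => (hb p hp).1) n).trans ?_
        have := pow_div_factorial_le_exp ®36 nn n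
        calc _ ≤ ®18 ^ n / n.factorial := gc
          _ = 36 ^ n / n.factorial * (1 / 2) ^ n := by
              rw [div_mul_eq_mul_div, ← mul_pow]; norm_num
          _ ≤ _ := gc
      calc _ ≤ exp 36 * (1 / 2) ^ n / exp (-36) :=
            div_le_div₀ pv hE (exp_pos _) hV
        _ = exp 72 * (1 / 2) ^ n := by
            rw [exp_neg, div_inv_eq_mul, mul_right_comm, ← exp_add]; norm_num
        _ = exp 72 / 4 ^ j₀ * (1 / 2 * (1 / 4) ^ j) := by
            rw [hn', pow_add, pow_add, pow_mul, pow_mul]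
            have : (®(1 / 2) ^ 2) = 1 / 4 := nn
            rw [this, one_div_pow, one_div_pow 4 j]; field_simp
        _ ≤ 1 / 2 * (1 / 2 * (1 / 2) ^ j) := by
            refine mul_le_mul ?_ ?_ pv nn
            · rw [div_le_div_iff₀ pv nn]; linarith
            · gcongr; norm_num
        _ = _ := rg
    refine (sum_le_sum hterm).trans ?_
    rw [← mul_sum, geom_sum_eq nn]
    have : ®0 ≤ (1 / 2) ^ J := pv
    have h' : (®(1 / 2) ^ J - 1) / (1 / 2 - 1) = 2 * (1 - (1 / 2) ^ J) := rg
    rw [h']; linarith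
lemma ap_count (e : ℕ) (he : 0 < e) (a : ℤ) (l : ℕ) :
    |(#{i ∈ range l | ¡e ∣ a + (i : ℕ)} : ℝ) - l / e| ≤ 1 := by
  have heq : #{i ∈ range l | ¡e ∣ a + (i : ℕ)} = #{x ∈ Ico a (a + l) | ¡e ∣ x} := by
    refine card_bij' (fun i _ => a + i) (fun x _ => (x - a).toNat) ?_ ?_ ?_ ?_
    · intro i hi; simp at hi ⊢; exact hi
    · intro x hx; simp at hx ⊢
      refine ⟨om, ?_⟩
      rw [max_eq_left om]; simpa using hx.2
    · intro i hi; simp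
    · intro x hx; simp at hx; simp only [Int.ofNat_toNat]; rw [max_eq_left om]; ring
  have he' : ®0 < e := mc he
  have hc := Int.Ico_filter_dvd_card a (a + l) (mc he : ¡0 < e)
  rw [← heq] at hc
  set n := #{i ∈ range l | ¡e ∣ a + (i : ℕ)}
  have hR : ¡n = ⌈(®a + l) / e⌉ - ⌈®a / e⌉ := by
    rw [hc, max_eq_left]
    · congr 1
      · rw [← Rat.ceil_cast (α := ℝ)]; push_cast; rfl
      · rw [← Rat.ceil_cast (α := ℝ)]; push_cast; rfl
    · rw [sub_nonneg]; refine Int.ceil_le_ceil ?_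
      gcongr; simp
  have hn : ®n = ®(⌈(®a + l) / e⌉) - ⌈®a / e⌉ := mc hR
  have h1 := Int.le_ceil ((®a + l) / e)
  have h2 := Int.ceil_lt_add_one ((®a + l) / e)
  have h3 := Int.le_ceil (®a / e)
  have h4 := Int.ceil_lt_add_one (®a / e)
  rw [add_div] at h1 h2 hn
  rw [abs_le]; constructor <;> linarith
lemma ap_count_le (e : ℕ) (he : 0 < e) (a : ℤ) (l : ℕ) :
    (#{i ∈ range l | ¡e ∣ a + (i : ℕ)} : ℝ) ≤ l / e + 1 := by
  have := (abs_le.1 (ap_count e he a l)).2; linarith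
def cnt (d : ℤ → ℤ → ℤ) (e : ℕ) : ℕ := #{q ∈ range e ×ˢ range e | ¡e ∣ d (q.1 : ℕ) (q.2 : ℕ)}
def Per (d : ℤ → ℤ → ℤ) : Prop := ∀ m s t s' t' : ℤ, m ∣ s - s' → m ∣ t - t' → m ∣ d s t - d s' t'
lemma Per.iff {d : ℤ → ℤ → ℤ} (h : Per d) {m s t s' t' : ℤ} (h1 : m ∣ s - s') (h2 : m ∣ t - t') :
    m ∣ d s t ↔ m ∣ d s' t' := (dvd_iff_dvd_of_dvd_sub (h m s t s' t' h1 h2))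
lemma emod_dvd' (e a : ℤ) : e ∣ a % e - a := by
  rw [← Int.modEq_iff_dvd]; exact (Int.mod_modEq a e).symm
lemma cnt_mul {d : ℤ → ℤ → ℤ} (hd : Per d) {m n : ℕ} (hm : m ≠ 0) (hn : n ≠ 0) (h : m.Coprime n) :
    cnt d (m * n) = cnt d m * cnt d n := by
  unfold cnt
  rw [← card_product]
  have hmn := mul_ne_zero hm hn
  have md : ∀ k i : ℕ, ¡k ∣ ¡((i % k : ℕ)) - i := fun k i => by
    push_cast; exact emod_dvd' _ _
  have md' : ∀ k i : ℕ, ¡k ∣ ¡i - ¡((i % k : ℕ)) := fun k i => by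
    rw [dvd_sub_comm]; exact md k i
  have hcr : ∀ a b : ℕ, ¡m ∣ ¡((Nat.chineseRemainder h a b : ℕ)) - a ∧
      ¡n ∣ ¡((Nat.chineseRemainder h a b : ℕ)) - b := fun a b => by
    have := (Nat.chineseRemainder h a b).2
    exact ⟨(Nat.modEq_iff_dvd.1 this.1.symm), (Nat.modEq_iff_dvd.1 this.2.symm)⟩
  refine card_bij' (fun q _ => ((q.1 % m, q.2 % m), (q.1 % n, q.2 % n)))
    (fun q _ => ((Nat.chineseRemainder h q.1.1 q.2.1 : ℕ), (Nat.chineseRemainder h q.1.2 q.2.2 : ℕ))) ?_ ?_ ?_ ?_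
  · rintro ⟨i, j⟩ hq
    simp only [mem_filter, mem_product, mem_range] at hq ⊢
    refine ⟨⟨⟨Nat.mod_lt _ om, Nat.mod_lt _ om⟩, (hd.iff (md _ _) (md _ _)).2 (dvd_trans sm hq.2)⟩,
      ⟨⟨Nat.mod_lt _ om, Nat.mod_lt _ om⟩, (hd.iff (md _ _) (md _ _)).2 (dvd_trans sm hq.2)⟩⟩
  · rintro ⟨⟨a, b⟩, ⟨a', b'⟩⟩ hq
    simp only [mem_filter, mem_product, mem_range] at hq ⊢
    refine ⟨⟨Nat.chineseRemainder_lt_mul h _ _ hm hn, Nat.chineseRemainder_lt_mul h _ _ hm hn⟩, ?_⟩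
    push_cast
    refine (Nat.isCoprime_iff_coprime.2 h).mul_dvd ?_ ?_
    · exact (hd.iff (hcr _ _).1 (hcr _ _).1).2 hq.1.2
    · exact (hd.iff (hcr _ _).2 (hcr _ _).2).2 hq.2.2
  · rintro ⟨i, j⟩ hq
    simp only [mem_filter, mem_product, mem_range] at hq
    have key : ∀ i < m * n, (Nat.chineseRemainder h (i % m) (i % n) : ℕ) = i := fun i hi => by
      refine Nat.ModEq.eq_of_lt_of_lt (m := m * n) ?_ (Nat.chineseRemainder_lt_mul h _ _ hm hn) hi
      rw [← Nat.modEq_and_modEq_iff_modEq_mul h]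
      have := (Nat.chineseRemainder h (i % m) (i % n)).2
      exact ⟨this.1.trans (Nat.mod_modEq _ _), this.2.trans (Nat.mod_modEq _ _)⟩
    simp only [Prod.mk.injEq]
    exact ⟨key i hq.1.1, key j hq.1.2⟩
  · rintro ⟨⟨a, b⟩, ⟨a', b'⟩⟩ hq
    simp only [mem_filter, mem_product, mem_range] at hq
    have k1 : ∀ a b, (Nat.chineseRemainder h a b : ℕ) % m = a % m := fun a b => (Nat.chineseRemainder h a b).2.1
    have k2 : ∀ a b, (Nat.chineseRemainder h a b : ℕ) % n = b % n := fun a b => (Nat.chineseRemainder h a b).2.2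
    simp only [Prod.mk.injEq]
    refine ⟨⟨?_, ?_⟩, ⟨?_, ?_⟩⟩
    · rw [k1, Nat.mod_eq_of_lt hq.1.1.1]
    · rw [k1, Nat.mod_eq_of_lt hq.1.1.2]
    · rw [k2, Nat.mod_eq_of_lt hq.2.1.1]
    · rw [k2, Nat.mod_eq_of_lt hq.2.1.2]
lemma cnt_prod {d : ℤ → ℤ → ℤ} (hd : Per d) (A : Finset ℕ) (hA : ∀ p ∈ A, p.Prime) :
    cnt d (∏ p ∈ A, p) = ∏ p ∈ A, cnt d p := by
  induction A using Finset.induction_on with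
  | empty => simp [cnt]
  | insert p A hp ih =>
    have hA' := fun q hq => hA q (mem_insert_of_mem hq)
    rw [prod_insert hp, prod_insert hp, cnt_mul hd (hA p (mem_insert_self _ _)).ne_zero
      (prod_ne_zero_iff.2 fun q hq => (hA' q hq).ne_zero), ih hA']
    refine Nat.Coprime.prod_right fun q hq => (Nat.coprime_primes (hA p (mem_insert_self _ _)) (hA' q hq)).2 ?_
    rintro rfl; exact hp hq
lemma box_count {d : ℤ → ℤ → ℤ} (hd : Per d) (e : ℕ) (he : 0 < e) (a₁ a₂ : ℤ) (l₁ l₂ : ℕ) :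
    |(#{q ∈ range l₁ ×ˢ range l₂ | ¡e ∣ d (a₁ + (q.1 : ℕ)) (a₂ + (q.2 : ℕ))} : ℝ) - l₁ * l₂ * (cnt d e / e ^ 2)|
      ≤ e * (l₁ + l₂) + e ^ 2 := by
  have he' : ®0 < e := mc he
  have hez : ¡e ≠ 0 := mc he.ne'
  set R := {q ∈ range e ×ˢ range e | ¡e ∣ d (q.1 : ℕ) (q.2 : ℕ)} with hR
  set n : ℤ → ℕ → ℕ → ℕ := fun a l r => #{i ∈ range l | ¡e ∣ (a - r) + (i : ℕ)} with hn
  have hred : ∀ a : ℤ, ¡e ∣ a - ¡((a % e).toNat) ∧ (a % e).toNat < e := fun a => by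
    have h0 := Int.emod_nonneg a hez
    have h1 := Int.emod_lt_of_pos a (mc he : ¡0 < e)
    refine ⟨?_, om⟩
    rw [Int.toNat_of_nonneg h0, dvd_sub_comm]; exact emod_dvd' _ _
  have huni : ∀ (a : ℤ) (r : ℕ), r < e → ¡e ∣ a - r → (a % e).toNat = r := fun a r hr h => by
    have := dvd_sub h (hred a).1
    have h2 := Int.eq_zero_of_abs_lt_dvd (m := e) (x := (a % e).toNat - ¡r) (by
      obtain ⟨k, hk⟩ := this; exact ⟨k, ln⟩) (by
      have := (hred a).2; rw [abs_lt]; constructor <;> omega)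
    omega
  have hX : #{q ∈ range l₁ ×ˢ range l₂ | ¡e ∣ d (a₁ + (q.1 : ℕ)) (a₂ + (q.2 : ℕ))} =
      ∑ q ∈ R, n a₁ l₁ q.1 * n a₂ l₂ q.2 := by
    rw [card_eq_sum_card_fiberwise (f := fun q : ℕ × ℕ => (((a₁ + q.1) % e).toNat, ((a₂ + q.2) % e).toNat)) (t := R)]
    · refine sum_congr rfl fun q hq => ?_
      simp only [hR, mem_filter, mem_product, mem_range] at hq
      rw [hn, ← card_product]
      congr 1; ext ⟨i, j⟩
      simp only [mem_filter, mem_product, mem_range, Prod.ext_iff]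
      have e1 : a₁ - q.1 + ¡i = a₁ + i - q.1 := rg
      have e2 : a₂ - q.2 + ¡j = a₂ + j - q.2 := rg
      rw [e1, e2]
      constructor
      · rintro ⟨⟨⟨h1, h2⟩, h3⟩, h4, h5⟩
        rw [← h4, ← h5]
        exact ⟨⟨h1, (hred _).1⟩, ⟨h2, (hred _).1⟩⟩
      · rintro ⟨⟨h1, h2⟩, ⟨h3, h4⟩⟩
        exact ⟨⟨⟨h1, h3⟩, (hd.iff h2 h4).2 hq.2⟩, huni _ _ hq.1.1 h2, huni _ _ hq.1.2 h4⟩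
    · rintro ⟨i, j⟩ hq
      simp only [hR, coe_filter, mem_product, mem_range, Set.mem_ofPred_eq] at hq ⊢
      exact ⟨⟨(hred _).2, (hred _).2⟩, (hd.iff (hred _).1 (hred _).1).1 hq.2⟩
  have hcR : ®(cnt d e) = ∑ q ∈ R, ®1 := by rw [sum_const, nsmul_eq_mul, mul_one, hR, cnt]
  have hcle : (#R : ℝ) ≤ e ^ 2 := by
    have := card_filter_le (range e ×ˢ range e) (fun q : ℕ × ℕ => ¡e ∣ d (q.1 : ℕ) (q.2 : ℕ))
    rw [card_product, card_range, ← sq] at this; exact_mod_cast this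
  have hsum : (∑ q ∈ R, (®(n a₁ l₁ q.1) * n a₂ l₂ q.2)) - l₁ * l₂ * (cnt d e / e ^ 2) =
      ∑ q ∈ R, (®(n a₁ l₁ q.1) * n a₂ l₂ q.2 - (l₁ / e) * (l₂ / e)) := by
    rw [sum_sub_distrib, sum_const, nsmul_eq_mul]
    have : ®(cnt d e) = #R := rfl
    rw [this]; field_simp
  rw [hX]; push_cast; rw [hsum]
  calc _ ≤ ∑ q ∈ R, |(®(n a₁ l₁ q.1) * n a₂ l₂ q.2 - (l₁ / e) * (l₂ / e))| := abs_sum_le_sum_abs _ _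
    _ ≤ ∑ q ∈ R, (®l₁ / e + l₂ / e + 1) := by
        refine sum_le_sum fun q _ => ?_
        have h1 := ap_count e he (a₁ - q.1) l₁
        have h2 := ap_count e he (a₂ - q.2) l₂
        change |®(n a₁ l₁ q.1) - l₁ / e| ≤ 1 at h1
        change |®(n a₂ l₂ q.2) - l₂ / e| ≤ 1 at h2
        set u := ®(n a₁ l₁ q.1)
        set v := ®(n a₂ l₂ q.2)
        have hx : ®0 ≤ l₁ / e := pv
        have hy : ®0 ≤ l₂ / e := pv
        rw [show u * v - l₁ / e * (l₂ / e) = (u - l₁ / e) * (v - l₂ / e) + (u - l₁ / e) * (l₂ / e)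
          + (v - l₂ / e) * (l₁ / e) by ring]
        refine (abs_add_three _ _ _).trans ?_
        rw [abs_mul, abs_mul, abs_mul, abs_of_nonneg hx, abs_of_nonneg hy]
        have := mul_le_mul h1 h2 (abs_nonneg _) zero_le_one
        have := mul_le_mul_of_nonneg_right h1 hy
        have := mul_le_mul_of_nonneg_right h2 hx
        linarith
    _ = #R * (®l₁ / e + l₂ / e + 1) := by rw [sum_const, nsmul_eq_mul]
    _ ≤ e ^ 2 * (®l₁ / e + l₂ / e + 1) := gc
    _ = _ := by field_simp
lemma wsieve : ∃ C1 : ℕ, ∀ z : ℝ, 6 ≤ z → ∀ (d : ℤ → ℤ → ℤ) (_ : Per d) (a₁ a₂ : ℤ) (l₁ l₂ : ℕ) (W : ℕ × ℕ → ℝ)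
    (_ : ∀ q, 0 ≤ W q) (Err : ℝ) (_ : 0 ≤ Err)
    (_ : ∀ e : ℕ, 0 < e → (e : ℝ) ≤ z ^ C1 → (∀ p, p.Prime → p ∣ e → (p : ℝ) < z) →
      |∑ q ∈ range l₁ ×ˢ range l₂, if (e : ℤ) ∣ d (a₁ + (q.1 : ℕ)) (a₂ + (q.2 : ℕ)) then W q - 1 else 0| ≤ Err)
    (_ : ∀ p ∈ pz z, (cnt d p : ℝ) < p ^ 2 ∧ (cnt d p : ℝ) ≤ 3 * p),
    1 / 2 * (∏ p ∈ pz z, (1 - (cnt d p : ℝ) / p ^ 2)) * (l₁ * l₂) - z ^ C1 * (Err + (z ^ C1 * (l₁ + l₂) + (z ^ C1) ^ 2)) ≤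
      ∑ q ∈ range l₁ ×ˢ range l₂ with ∀ p ∈ pz z, ¬ (p : ℤ) ∣ d (a₁ + (q.1 : ℕ)) (a₂ + (q.2 : ℕ)), W q := by
  obtain ⟨C1, hC1⟩ := sieve
  refine ⟨C1, fun z hz d hd a₁ a₂ l₁ l₂ W hW Err hErr hE hβ => ?_⟩
  classical
  obtain ⟨lam, s1, s2, s3, s4⟩ := hC1 z hz
  have hz0 : 0 < z := ln
  set Ω := range l₁ ×ˢ range l₂
  set D : ℕ × ℕ → ℤ := fun q => d (a₁ + (q.1 : ℕ)) (a₂ + (q.2 : ℕ)) with hD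
  set β : ℕ → ℝ := fun p => ®(cnt d p) / p ^ 2 with hβdef
  have hpos : ∀ p ∈ pz z, ®0 < p := fun p hp => mc (mem_pz.1 hp).1.pos
  have hmain := s4 β fun p hp => by
    have hp0 := hpos p hp
    refine ⟨pv, ?_, ?_⟩
    · rw [hβdef, div_lt_one pv]; exact (hβ p hp).1
    · rw [hβdef]; simp only; rw [div_le_div_iff₀ pv hp0]; nlinarith [(hβ p hp).2]
  have hdv : ∀ A ∈ (pz z).powerset, ∀ n : ℤ, ((∏ p ∈ A, p : ℕ) : ℤ) ∣ n ↔ ∀ p ∈ A, ¡p ∣ n := fun A hA n => by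
    have hA' := mem_powerset.1 hA
    constructor
    · intro h p hp
      exact dvd_trans (mc dvd_prod_of_mem _ hp) h
    · intro h
      push_cast
      refine Finset.prod_dvd_of_coprime (fun p hp q hq hpq => ?_) h
      exact Nat.isCoprime_iff_coprime.2 ((Nat.coprime_primes (mem_pz.1 (hA' hp)).1 (mem_pz.1 (hA' hq)).1).2 hpq)
  have hpt : ∀ q ∈ Ω, W q * ∑ A ∈ (pz z).powerset, lam A * (if ((∏ p ∈ A, p : ℕ) : ℤ) ∣ D q then 1 else 0) ≤
      if ∀ p ∈ pz z, ¬ ¡p ∣ D q then W q else 0 := fun q _ => by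
    have h1 := s1 (fun p => if ¡p ∣ D q then 1 else 0) (fun p => by split_ifs <;> simp)
    have h2 : ∑ A ∈ (pz z).powerset, lam A * (if ((∏ p ∈ A, p : ℕ) : ℤ) ∣ D q then (1 : ℝ) else 0) =
        ∑ A ∈ (pz z).powerset, lam A * ∏ p ∈ A, (if ¡p ∣ D q then (1 : ℝ) else 0) := by
      refine sum_congr rfl fun A hA => ?_
      congr 1
      rw [prod_ite_zero]
      exact if_congr (hdv A hA _) sm rfl
    rw [h2]
    refine (mul_le_mul_of_nonneg_left h1 (hW q)).trans ?_
    split_ifs with h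
    · rw [prod_eq_one]
      · simp
      · intro p hp; simp [h p hp]
    · push Not at h
      obtain ⟨p, hp, hpd⟩ := h
      rw [prod_eq_zero hp (by simp [hpd])]; simp
  rw [sum_filter]
  refine le_trans ?_ (sum_le_sum hpt)
  have hswap : ∑ q ∈ Ω, W q * ∑ A ∈ (pz z).powerset, lam A * (if ((∏ p ∈ A, p : ℕ) : ℤ) ∣ D q then 1 else 0) =
      ∑ A ∈ (pz z).powerset, lam A * ∑ q ∈ Ω, (if ((∏ p ∈ A, p : ℕ) : ℤ) ∣ D q then W q else 0) := by
    simp_rw [mul_sum]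
    rw [sum_comm]
    refine sum_congr rfl fun A _ => sum_congr rfl fun q _ => ?_
    split_ifs <;> ring
  rw [hswap]
  set E := Err + (z ^ C1 * (l₁ + l₂) + (z ^ C1) ^ 2) with hEdef
  have hterm : ∀ A ∈ (pz z).powerset, ®(l₁ * l₂) * (lam A * ∏ p ∈ A, β p) - |lam A| * E ≤
      lam A * ∑ q ∈ Ω, (if ((∏ p ∈ A, p : ℕ) : ℤ) ∣ D q then W q else 0) := fun A hA => by
    by_cases hl : lam A = 0
    · simp [hl]
    have hA' := mem_powerset.1 hA
    have hpr : ∀ p ∈ A, p.Prime := fun p hp => (mem_pz.1 (hA' hp)).1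
    set e := ∏ p ∈ A, p with he
    have he0 : 0 < e := prod_pos fun p hp => (hpr p hp).pos
    have hez : ®e ≤ z ^ C1 := by rw [he, Nat.cast_prod]; exact s2 A hA hl
    have h1 := hE e he0 hez fun p hp hpe => by
      rw [he, hp.prime.dvd_finsetProd_iff] at hpe
      obtain ⟨q, hq, hpq⟩ := hpe
      rw [(Nat.prime_dvd_prime_iff_eq hp (hpr q hq)).1 hpq]
      exact (mem_pz.1 (hA' hq)).2
    have h2 := box_count hd e he0 a₁ a₂ l₁ l₂
    have h3 : ®(cnt d e) / e ^ 2 = ∏ p ∈ A, β p := by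
      rw [he, cnt_prod hd A hpr]; push_cast; rw [← prod_pow, ← prod_div_distrib]
    rw [h3] at h2
    have h4 : ∑ q ∈ Ω, (if ¡e ∣ D q then W q else 0) =
        (∑ q ∈ Ω, if ¡e ∣ D q then W q - 1 else 0) + #{q ∈ Ω | ¡e ∣ D q} := by
      rw [card_eq_sum_ones, Nat.cast_sum, sum_filter, ← sum_add_distrib]
      refine sum_congr rfl fun q _ => ?_
      split_ifs <;> simp
    have h5 : |∑ q ∈ Ω, (if ¡e ∣ D q then W q else 0) - l₁ * l₂ * ∏ p ∈ A, β p| ≤ E := by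
      rw [h4, add_sub_assoc]
      refine (abs_add_le _ _).trans (add_le_add h1 (h2.trans ?_))
      gcongr
    have h6 : |lam A * (∑ q ∈ Ω, (if ¡e ∣ D q then W q else 0) - l₁ * l₂ * ∏ p ∈ A, β p)| ≤ |lam A| * E := by
      rw [abs_mul]; gcongr
    have h7 := (abs_le.1 h6).1
    linarith
  refine le_trans ?_ (sum_le_sum hterm)
  rw [sum_sub_distrib, ← mul_sum, ← sum_mul]
  have hE0 : 0 ≤ E := pv
  have h8 := mul_le_mul_of_nonneg_right s3 hE0
  have h9 := mul_le_mul_of_nonneg_left hmain (pv : ®0 ≤ l₁ * l₂)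
  linarith
end
section
open Finset Real
variable {c₀ c₁ c₂ : ℤ}
def ff (c₀ c₁ c₂ n : ℤ) : ℤ := n ^ 3 + c₂ * n ^ 2 + c₁ * n + c₀
def fp (c₁ c₂ n : ℤ) : ℤ := 3 * n ^ 2 + 2 * c₂ * n + c₁
def FF (c₀ c₁ c₂ v w : ℤ) : ℤ := v ^ 3 + c₂ * v ^ 2 * w + c₁ * v * w ^ 2 + c₀ * w ^ 3
def dd (c₁ c₂ g r φ y w : ℤ) : ℤ := φ * w ^ 3 + fp c₁ c₂ r * y * w ^ 2 + (3 * r + c₂) * g * y ^ 2 * w + g ^ 2 * y ^ 3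
def kk (c₁ c₂ g r φ y₁ c y w : ℤ) : ℤ := r * g * (c * y - y₁ * w) ^ 2 + g ^ 2 * y * (y₁ ^ 2 * w - 2 * c * y * y₁)
  - c ^ 2 * (φ * w ^ 2 + fp c₁ c₂ r * y * w + (3 * r + c₂) * g * y ^ 2)
open Polynomial in
set_option hygiene false in
notation "IrQ" => Irreducible (X ^ 3 + C c₂ * X ^ 2 + C c₁ * X + C c₀ : ℤ[X])
set_option hygiene false in
notation "fQ" => ff c₀ c₁ c₂
set_option hygiene false in
notation "FQ" => FF c₀ c₁ c₂
set_option hygiene false in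
notation "dQ" => dd c₁ c₂
set_option hygiene false in
notation "pQ" => fp c₁ c₂
set_option hygiene false in
notation "kQ" => kk c₁ c₂
lemma FF_dd {c₀ c₁ c₂ g r φ : ℤ} (h : fQ r = g * φ) (y w : ℤ) :
    FQ (r * w + g * y) w = g * dQ g r φ y w := by
  unfold FF dd fp; unfold ff at h; linear_combination w ^ 3 * h
lemma kk_id (c₁ c₂ g r φ y₁ c y w : ℤ) : w * kQ g r φ y₁ c y w =
    (r * w + g * y) * (g * (c * y - y₁ * w) ^ 2) - c ^ 2 * dQ g r φ y w := by
  unfold kk dd; ring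
lemma dd_congr (c₁ c₂ g r φ : ℤ) {m y w y' w' : ℤ} (hy : m ∣ y - y') (hw : m ∣ w - w') :
    m ∣ dQ g r φ y w - dQ g r φ y' w' := by
  rw [← Int.modEq_iff_dvd] at hy hw ⊢
  unfold dd; gcongr
lemma kk_congr (c₁ c₂ g r φ y₁ c : ℤ) {m y w y' w' : ℤ} (hy : m ∣ y - y') (hw : m ∣ w - w') :
    m ∣ kQ g r φ y₁ c y w - kQ g r φ y₁ c y' w' := by
  rw [← Int.modEq_iff_dvd] at hy hw ⊢
  unfold kk; gcongr
lemma dvd_ff {c₀ c₁ c₂ g r φ y₁ c y w u n : ℤ} (h : fQ r = g * φ)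
    (hM : g * (c * y - y₁ * w) ^ 2 ≠ 0)
    (hcop : IsCoprime (dQ g r φ y w) (g * (c * y - y₁ * w) ^ 2))
    (hn : dQ g r φ y w * u + kQ g r φ y₁ c y w = g * (c * y - y₁ * w) ^ 2 * n) :
    dQ g r φ y w ∣ w * n - (r * w + g * y) := by
  set d := dQ g r φ y w
  set M := g * (c * y - y₁ * w) ^ 2
  have h1 : M * (w * n - (r * w + g * y)) = d * (w * u - c ^ 2) := by
    linear_combination -w * hn + kk_id c₁ c₂ g r φ y₁ c y w
  exact hcop.dvd_of_dvd_mul_left ⟨_, h1⟩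
lemma dvd_ff' {c₀ c₁ c₂ d w v n : ℤ} (hd : d ∣ w * n - v) (hF : d ∣ FQ v w) (hw : IsCoprime d w) :
    d ∣ fQ n := by
  have h1 : d ∣ w ^ 3 * fQ n := by
    have h2 : d ∣ FQ (w * n) w - FQ v w := by
      rw [← Int.modEq_iff_dvd] at hd ⊢; unfold FF; gcongr
    rw [show w ^ 3 * fQ n = FQ (w * n) w by unfold FF ff; ring]
    simpa using dvd_add h2 hF
  exact (hw.pow_right).dvd_of_dvd_mul_left h1
lemma dd_mod (c₁ c₂ g r φ y w : ℤ) {p : ℤ} (hp : p ∣ g) :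
    p ∣ dQ g r φ y w ↔ p ∣ w ^ 2 * (φ * w + pQ r * y) := by
  refine dvd_iff_dvd_of_dvd_sub ?_
  obtain ⟨k, rfl⟩ := hp
  exact ⟨k * ((3 * r + c₂) * y ^ 2 * w + p * k * y ^ 3), by unfold dd; ring⟩
lemma cop_w {c₀ c₁ c₂ g r φ y₁ c y₂ w₂ s τ : ℤ} (h : fQ r = g * φ) (hdet : c * y₂ - y₁ * w₂ = 1)
    (hcop : IsCoprime (dQ g r φ (y₁ * s + τ * y₂) (c * s + τ * w₂)) (g * τ ^ 2)) :
    IsCoprime (dQ g r φ (y₁ * s + τ * y₂) (c * s + τ * w₂)) (c * s + τ * w₂) := by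
  set y := y₁ * s + τ * y₂ with hy
  set w := c * s + τ * w₂ with hw
  have hτ : c * y - y₁ * w = τ := by rw [hy, hw]; linear_combination τ * hdet
  rw [Int.isCoprime_iff_gcd_eq_one]
  by_contra hne
  obtain ⟨p, hp, hpg⟩ := Nat.exists_prime_and_dvd hne
  have hpd : ¡p ∣ dQ g r φ y w := (Int.natCast_dvd_natCast.2 hpg).trans (Int.gcd_dvd_left _ _)
  have hpw : ¡p ∣ w := (Int.natCast_dvd_natCast.2 hpg).trans (Int.gcd_dvd_right _ _)
  have hP := Nat.prime_iff_prime_int.1 hp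
  have hnot : ¬ ¡p ∣ g * τ ^ 2 := fun hh => by
    obtain ⟨a, b, hab⟩ := hcop
    exact hP.not_isUnit (isUnit_of_dvd_one (hab ▸ dvd_add (hpd.mul_left a) (hh.mul_left b)))
  have h2 : ¡p ∣ g ^ 2 * y ^ 3 := by
    have : g ^ 2 * y ^ 3 = dQ g r φ y w - w * (φ * w ^ 2 + pQ r * y * w + (3 * r + c₂) * g * y ^ 2) := by
      unfold dd; ring
    rw [this]; exact dvd_sub hpd (hpw.mul_right _)
  rcases hP.dvd_mul.1 h2 with h3 | h3
  · exact hnot ((hP.dvd_of_dvd_pow h3).mul_right _)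
  · have h4 := hP.dvd_of_dvd_pow h3
    refine hnot (Dvd.dvd.mul_left (dvd_pow ?_ two_ne_zero) _)
    rw [← hτ]; exact dvd_sub (h4.mul_left _) (hpw.mul_left _)
lemma pigeon (g : ℕ) (hg : 0 < g) (r : ℤ) : ∃ y c : ℤ, ¬ (y = 0 ∧ c = 0) ∧ |c| ≤ Nat.sqrt g ∧ |r * c + g * y| ≤ Nat.sqrt g := by
  set K := Nat.sqrt g
  have hK : g < (K + 1) * (K + 1) := Nat.lt_succ_sqrt g
  have hgz : ¡0 < g := mc hg
  obtain ⟨q, hq, q', hq', hne, heq⟩ := Finset.exists_ne_map_eq_of_card_lt_of_maps_to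
    (s := range (K + 1) ×ˢ range (K + 1)) (t := range g)
    (f := fun q => ((¡(q.1) - r * q.2) % g).toNat) (by simpa using hK) (fun q _ => by
      have h1 := Int.emod_nonneg (¡(q.1) - r * q.2) hgz.ne'
      have h2 := Int.emod_lt_of_pos (¡(q.1) - r * q.2) hgz
      simp only [coe_range, Set.mem_Iio]; omega)
  simp only [mem_product, mem_range] at hq hq'
  have h1 := Int.emod_nonneg (¡(q.1) - r * q.2) hgz.ne'
  have h1' := Int.emod_nonneg (¡(q'.1) - r * q'.2) hgz.ne'
  have heq' : (¡(q.1) - r * q.2) % g = (¡(q'.1) - r * q'.2) % g := by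
    have := congrArg (fun n : ℕ => ¡n) heq
    simp only [Int.toNat_of_nonneg h1, Int.toNat_of_nonneg h1'] at this
    exact this
  obtain ⟨y, hy⟩ := Int.ModEq.dvd (show _ ≡ _ [ZMOD g] from heq'.symm)
  have hy2 : r * (¡(q.2) - q'.2) + g * y = ¡(q.1) - q'.1 := by rw [← hy]; ring
  refine ⟨y, ¡(q.2) - q'.2, fun ⟨h3, h4⟩ => hne ?_, ?_, ?_⟩
  · rw [h3, h4] at hy2
    apply Prod.ext <;> omega
  · rw [abs_le]; omega
  · rw [hy2, abs_le]; omega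
lemma prim (g : ℕ) (hg : 2 ≤ g) (r : ℤ) : ∃ y c : ℤ, IsCoprime c y ∧ c ≠ 0 ∧ |c| ≤ Nat.sqrt g ∧ |r * c + g * y| ≤ Nat.sqrt g := by
  obtain ⟨y, c, h0, h1, h2⟩ := pigeon g om r
  have hgcd : 0 < Int.gcd c y := by
    rw [Int.gcd_pos_iff]; by_contra! hh; exact h0 ⟨hh.2, hh.1⟩
  obtain ⟨c', y', hcop, hc, hy⟩ := Int.exists_gcd_one hgcd
  set h : ℤ := ¡(Int.gcd c y)
  have hh : ¡1 ≤ h := by simp only [h]; exact_mod_cast hgcd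
  have key : ∀ a : ℤ, |a| ≤ |a * h| := fun a => by
    rw [abs_mul, abs_of_pos (show 0 < h by omega)]; nlinarith [abs_nonneg a]
  have hb : r * c + g * y = (r * c' + g * y') * h := by rw [hc, hy]; ring
  have h2' : |r * c' + g * y'| ≤ Nat.sqrt g := (key _).trans (hb ▸ h2)
  have hcop' : IsCoprime c' y' := Int.isCoprime_iff_gcd_eq_one.2 hcop
  refine ⟨y', c', hcop', ?_, (key _).trans (hc ▸ h1), h2'⟩
  rintro rfl
  have hlt : ¡(Nat.sqrt g) < g := mc Nat.sqrt_lt_self om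
  have : r * 0 + g * y' = 0 := by
    refine Int.eq_zero_of_abs_lt_dvd (m := g) ⟨y', rg⟩ (lt_of_le_of_lt h2' hlt)
  have hy0 : y' = 0 := by
    have : ¡g * y' = 0 := ln
    rcases mul_eq_zero.1 this with h | h
    · omega
    · exact h
  rw [hy0] at hcop'
  simp [IsCoprime] at hcop'
lemma basis (g : ℕ) (hg : 2 ≤ g) (r : ℤ) : ∃ y₁ c y₂ w₂ E : ℤ, c * y₂ - y₁ * w₂ = 1 ∧ c ≠ 0 ∧ 1 ≤ E ∧ E ^ 2 ≤ g ∧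
    |c| ≤ E ∧ |r * c + g * y₁| ≤ E ∧ (|c| = E ∨ |r * c + g * y₁| = E) ∧ E * |w₂| ≤ 2 * g ∧ E * |r * w₂ + g * y₂| ≤ 2 * g := by
  obtain ⟨y₁, c, ⟨p, q, hpq⟩, hc0, h1, h2⟩ := prim g hg r
  set b := r * c + g * y₁ with hb
  have hE2 : (max |c| |b|) ^ 2 ≤ ¡g := by
    have h3 : max |c| |b| ≤ Nat.sqrt g := max_le h1 h2
    have h4 : ¡0 ≤ max |c| |b| := (abs_nonneg c).trans (le_max_left _ _)
    have h5 : ¡(Nat.sqrt g) ^ 2 ≤ g := by rw [sq]; exact_mod_cast Nat.sqrt_le g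
    nlinarith
  have hc1 : 1 ≤ |c| := Int.one_le_abs hc0
  have hE1 : 1 ≤ max |c| |b| := hc1.trans (le_max_left _ _)
  set E := max |c| |b| with hE
  have hcE : |c| ≤ E := le_max_left _ _
  have hbE : |b| ≤ E := le_max_right _ _
  have hor : |c| = E ∨ |b| = E := by
    rcases max_choice |c| |b| with h | h
    · left; rw [hE, h]
    · right; rw [hE, h]
  rcases hor with h | h
  · have hd := Int.emod_add_mul_ediv (-q) c
    set k := (-q) / c
    set w₂ := (-q) % c
    have hw0 : 0 ≤ w₂ := Int.emod_nonneg _ hc0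
    have hw1 : w₂ < |c| := Int.emod_lt_abs _ hc0
    have hdet : c * (p - k * y₁) - y₁ * w₂ = 1 := by linear_combination hpq - y₁ * hd
    have hgg : c * (r * w₂ + g * (p - k * y₁)) = g + b * w₂ := by rw [hb]; linear_combination (g : ℤ) * hdet
    refine ⟨y₁, c, p - k * y₁, w₂, E, hdet, hc0, hE1, hE2, hcE, hbE, Or.inl h, ?_, ?_⟩
    · rw [abs_of_nonneg hw0]; nlinarith
    · have h6 : |c * (r * w₂ + g * (p - k * y₁))| ≤ g + E * E := by
        rw [hgg]
        refine (abs_add_le _ _).trans (add_le_add sm ?_)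
        rw [abs_mul, abs_of_nonneg hw0]
        exact mul_le_mul hbE om hw0 om
      rw [abs_mul, h] at h6; nlinarith
  · set b₂' := r * (-q) + g * p with hb2
    have hb0 : b ≠ 0 := fun h0 => by rw [h0, abs_zero] at h; omega
    have hd := Int.emod_add_mul_ediv b₂' b
    set k := b₂' / b
    set B := b₂' % b
    have hB0 : 0 ≤ B := Int.emod_nonneg _ hb0
    have hB1 : B < |b| := Int.emod_lt_abs _ hb0
    have hdet : c * (p - k * y₁) - y₁ * (-q - k * c) = 1 := by linear_combination hpq
    have hBB : r * (-q - k * c) + g * (p - k * y₁) = B := by linear_combination -hd + hb2 - k * hb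
    have hgg : b * (-q - k * c) = c * B - g := by rw [← hBB, hb]; linear_combination (-g : ℤ) * hdet
    refine ⟨y₁, c, p - k * y₁, -q - k * c, E, hdet, hc0, hE1, hE2, hcE, hbE, Or.inr h, ?_, ?_⟩
    · have h6 : |b * (-q - k * c)| ≤ E * E + g := by
        rw [hgg]
        refine (abs_sub _ _).trans (add_le_add ?_ sm)
        rw [abs_mul, abs_of_nonneg hB0]
        exact mul_le_mul hcE om hB0 om
      rw [abs_mul, h] at h6; nlinarith
    · rw [hBB, abs_of_nonneg hB0]; nlinarith
lemma cubic_roots (c₀ c₁ c₂ : ℂ) : ∃ θ : Fin 3 → ℂ, ∀ v w : ℂ,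
    v ^ 3 + c₂ * v ^ 2 * w + c₁ * v * w ^ 2 + c₀ * w ^ 3 = (v - θ 0 * w) * (v - θ 1 * w) * (v - θ 2 * w) := by
  obtain ⟨a, ha⟩ : ∃ a : ℂ, a ^ 3 + c₂ * a ^ 2 + c₁ * a + c₀ = 0 := by
    obtain ⟨a, ha⟩ := IsAlgClosed.exists_root
      (Polynomial.X ^ 3 + Polynomial.C c₂ * Polynomial.X ^ 2 + Polynomial.C c₁ * Polynomial.X + Polynomial.C c₀ : Polynomial ℂ)
      (by
        have h : (Polynomial.X ^ 3 + Polynomial.C c₂ * Polynomial.X ^ 2 + Polynomial.C c₁ * Polynomial.X + Polynomial.C c₀ : Polynomial ℂ).degree = 3 := by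
          compute_degree!
        rw [h]; norm_num)
    exact ⟨a, by simpa [Polynomial.IsRoot.def] using ha⟩
  obtain ⟨δ, hδ⟩ := IsAlgClosed.exists_pow_nat_eq ((c₂ + a) ^ 2 - 4 * (c₁ + c₂ * a + a ^ 2)) (n := 2) nn
  refine ⟨![a, (-(c₂ + a) + δ) / 2, (-(c₂ + a) - δ) / 2], fun v w => ?_⟩
  simp only [Matrix.cons_val_zero, Matrix.cons_val_one, Matrix.cons_val]
  linear_combination (v - a * w) * (w ^ 2 / 4) * hδ + w ^ 3 * ha
lemma form_sep {A B : ℂ} (h : 1 ≤ ‖B‖ + 2 * ‖A‖) {m n : ℕ} (hm : 1 ≤ m ∧ m ≤ 5) (hn : 1 ≤ n ∧ n ≤ 5)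
    (h1 : ‖A + m * B‖ < 1 / 25) (h2 : ‖A + n * B‖ < 1 / 25) : m = n := by
  by_contra hne
  have h3 : ‖¢(¡(¡m - n)) * B‖ < 2 / 25 := by
    have : ¢(¡(¡m - n)) * B = (A + m * B) - (A + n * B) := by push_cast; ring
    rw [this]; exact lt_of_le_of_lt (norm_sub_le _ _) ln
  rw [norm_mul, Complex.norm_intCast] at h3
  have h4 : ®1 ≤ |(¡(¡m - n) : ℝ)| := by
    exact_mod_cast Int.one_le_abs (show ¡m - n ≠ 0 by omega)
  have h5 : ‖B‖ < 2 / 25 := by nlinarith [norm_nonneg B]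
  have h6 : ‖A‖ ≤ ‖A + m * B‖ + m * ‖B‖ := by
    calc ‖A‖ = ‖(A + m * B) - m * B‖ := by ring_nf
      _ ≤ _ := (norm_sub_le _ _).trans (by rw [norm_mul, Complex.norm_natCast])
  have h7 : ®m ≤ 5 := mc hm.2
  nlinarith [norm_nonneg B]
lemma form_m {A B : Fin 4 → ℂ} (h : ∀ i, 1 ≤ ‖B i‖ + 2 * ‖A i‖) :
    ∃ m : ℕ, 1 ≤ m ∧ m ≤ 5 ∧ ∀ i, 1 / 25 ≤ ‖A i + m * B i‖ := by
  by_contra! hcon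
  have : ∀ j : Fin 5, ∃ i : Fin 4, ‖A i + ((j : ℕ) + 1 : ℕ) * B i‖ < 1 / 25 := fun j =>
    hcon (j + 1) om om
  choose F hF using this
  obtain ⟨a, b, hab, hEq⟩ := Fintype.exists_ne_map_eq_of_card_lt F sm
  have h1 := hF a
  have h2 := hF b
  rw [← hEq] at h2
  have := form_sep (h (F a)) (m := a + 1) (n := b + 1) om om h1 h2
  omega
lemma form_var {a a' : ℂ} {R E g κ s τ : ℝ} {m : ℕ} (hR : 1 ≤ R) (hE : 0 < E) (hg : 0 < g)
    (ha : ‖a‖ ≤ R * E) (ha' : E * ‖a'‖ ≤ 2 * R * g) (hm : m ≤ 5) (hκ : κ * (2750 * R) = 1)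
    (hs : g ≤ E * s) (hs' : E * s ≤ (1 + κ) * g) (ht : m * E ≤ τ) (ht' : τ ≤ (1 + κ) * (m * E))
    (hlow : 1 / 25 ≤ ‖a / E + m * (a' * E / g)‖) :
    ∃ ε : ℂ, ‖ε‖ ≤ 1 / 10 ∧ a * s + a' * τ = (a * ®(g / E) + a' * ®(m * E)) * (1 + ε) ∧
      g / 50 ≤ ‖a * s + a' * τ‖ ∧ ‖a * s + a' * τ‖ ≤ 22 * R * g := by
  have hmR : ®m ≤ 5 := mc hm
  have hκ0 : 0 < κ := by
    by_contra! hh; nlinarith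
  have hκ1 : κ ≤ 1 / 2750 := nl
  have hE' : ¢E ≠ 0 := mc hE.ne'
  have hg' : ¢g ≠ 0 := mc hg.ne'
  set l₀ := a * ®(g / E) + a' * ®(m * E) with hl₀
  have hl : l₀ = g * (a / E + m * (a' * E / g)) := by rw [hl₀]; push_cast; field_simp
  have hl1 : g / 25 ≤ ‖l₀‖ := by
    rw [hl, norm_mul, Complex.norm_real, Real.norm_of_nonneg hg.le]; nlinarith
  have hl0 : l₀ ≠ 0 := fun h0 => by rw [h0, norm_zero] at hl1; linarith
  set l := a * s + a' * τ with hldef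
  have hsd : |s - g / E| ≤ κ * g / E := by
    rw [abs_le]; constructor
    · have : g / E ≤ s := by rw [div_le_iff₀ hE]; linarith
      have : 0 ≤ κ * g / E := pv
      linarith
    · have : s ≤ (1 + κ) * g / E := by rw [le_div_iff₀ hE]; linarith
      have h2 : (1 + κ) * g / E = g / E + κ * g / E := rg
      linarith
  have htd : |τ - m * E| ≤ κ * (m * E) := by
    rw [abs_le]; constructor
    · have : 0 ≤ κ * (m * E) := pv
      linarith
    · linarith
  have hdiff : ‖l - l₀‖ ≤ g / 250 := by
    have h1 : l - l₀ = a * ¢(®(s - g / E)) + a' * ¢(®(τ - m * E)) := by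
      rw [hldef, hl₀]; push_cast; ring
    have h2 : ‖a * ¢(®(s - g / E))‖ ≤ R * κ * g := by
      rw [norm_mul, Complex.norm_real, Real.norm_eq_abs]
      calc _ ≤ (R * E) * (κ * g / E) := mul_le_mul ha hsd (abs_nonneg _) pv
        _ = _ := by field_simp
    have h3 : ‖a' * ¢(®(τ - m * E))‖ ≤ 10 * R * κ * g := by
      rw [norm_mul, Complex.norm_real, Real.norm_eq_abs]
      calc _ ≤ ‖a'‖ * (κ * (m * E)) := gc
        _ = κ * m * (E * ‖a'‖) := rg
        _ ≤ κ * 5 * (2 * R * g) := gc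
        _ = _ := rg
    rw [h1]
    refine (norm_add_le _ _).trans ?_
    have : 11 * R * κ * g = g / 250 := by linear_combination (11 / 2750 * g) * hκ
    linarith
  refine ⟨(l - l₀) / l₀, ?_, by field_simp; ring, ?_, ?_⟩
  · rw [norm_div, div_le_iff₀ ln]; linarith
  · have := norm_sub_norm_le l₀ (l₀ - l)
    rw [norm_sub_rev l₀ l, show l₀ - (l₀ - l) = l by ring] at this
    linarith
  · have hs0 : 0 ≤ s := by by_contra! hh; nlinarith
    have ht0 : 0 ≤ τ := le_trans pv ht
    rw [hldef]
    refine (norm_add_le _ _).trans ?_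
    rw [norm_mul, norm_mul, Complex.norm_real, Complex.norm_real, Real.norm_of_nonneg hs0, Real.norm_of_nonneg ht0]
    have h1 : ‖a‖ * s ≤ R * (2 * g) := by
      calc _ ≤ (R * E) * s := gc
        _ = R * (E * s) := rg
        _ ≤ _ := mul_le_mul_of_nonneg_left nl ln
    have h2 : ‖a'‖ * τ ≤ 20 * R * g := by
      calc _ ≤ ‖a'‖ * (2 * (5 * E)) := by
            gcongr
            refine ht'.trans ?_
            have : ®m * E ≤ 5 * E := gc
            nlinarith
        _ = 10 * (E * ‖a'‖) := rg
        _ ≤ _ := nl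
    linarith
lemma FF_neg (c₀ c₁ c₂ v w : ℤ) : FQ (-v) (-w) = - FQ v w := by unfold FF; ring
set_option maxHeartbeats 2000000 in
lemma geom0 : ∃ κ C : ℝ, 0 < κ ∧ κ ≤ 1 ∧ 1 ≤ C ∧ ∀ (g E b c b₂ w₂ : ℤ), 0 < g → 1 ≤ E →
    |c| ≤ E → |b| ≤ E → E * |w₂| ≤ 2 * g → E * |b₂| ≤ 2 * g → c * b₂ - b * w₂ = g →
    (|FQ b c| : ℝ) ≤ C * E ^ 3 ∧
    ∃ m : ℕ, 1 ≤ m ∧ m ≤ 5 ∧ ∃ σ : ℤ, (σ = 1 ∨ σ = -1) ∧ ∀ s τ : ℤ, ®g ≤ E * s → ®(E * s) ≤ (1 + κ) * g →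
      ®(m * E) ≤ τ → ®τ ≤ (1 + κ) * (m * E) →
      ®g ^ 3 / C ≤ σ * FQ (b * s + b₂ * τ) (c * s + w₂ * τ) ∧
      ®(σ * FQ (b * s + b₂ * τ) (c * s + w₂ * τ)) ≤ C * g ^ 3 ∧
      (|b * s + b₂ * τ| : ℝ) ≤ C * g ∧ (|c * s + w₂ * τ| : ℝ) ≤ C * g ∧ ®g / C ≤ |®(c * s + w₂ * τ)| := by
  obtain ⟨θ, hθ⟩ := cubic_roots c₀ c₁ c₂
  set R : ℝ := 1 + (‖θ 0‖ + ‖θ 1‖ + ‖θ 2‖) with hR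
  have hRθ : ∀ i, 1 + ‖θ i‖ ≤ R := fun i => by
    have := norm_nonneg (θ 0); have := norm_nonneg (θ 1); have := norm_nonneg (θ 2)
    fin_cases i <;> simp [hR] <;> linarith
  have hR1 : 1 ≤ R := by have := hRθ 0; have := norm_nonneg (θ 0); linarith
  have hFc : ∀ v w : ℝ, ¢(®(v ^ 3 + c₂ * v ^ 2 * w + c₁ * v * w ^ 2 + c₀ * w ^ 3)) = (v - θ 0 * w) * (v - θ 1 * w) * (v - θ 2 * w) :=
    fun v w => by rw [← hθ]; push_cast; ring
  refine ⟨1 / (2750 * R), 125000 * R ^ 3, pv, by rw [div_le_one pv]; linarith, ?_, ?_⟩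
  · nlinarith [pow_le_pow_left₀ zero_le_one hR1 3]
  intro g E b c b₂ w₂ hg hE hc hb hw2 hb2 hdet
  have hgR : ®0 < g := mc hg
  have hER : ®0 < E := mc (om : ¡0 < E)
  have hcR : |®c| ≤ E := mc hc
  have hbR : |®b| ≤ E := mc hb
  have hw2R : E * |®w₂| ≤ 2 * g := mc hw2
  have hb2R : E * |®b₂| ≤ 2 * g := mc hb2
  have hdetC : ¢c * b₂ - b * w₂ = g := mc hdet
  have hEC : ¢E ≠ 0 := mc (om : E ≠ 0)
  have hgC : ¢g ≠ 0 := mc hg.ne'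
  have nI : ∀ k : ℤ, ‖¢k‖ = |®k| := Complex.norm_intCast
  have hform : ∀ i, ‖¢b - θ i * c‖ ≤ R * E ∧ E * ‖¢b₂ - θ i * w₂‖ ≤ 2 * R * g := fun i => by
    have := hRθ i
    have h0 := norm_nonneg (θ i)
    constructor
    · refine (norm_sub_le _ _).trans ?_
      rw [norm_mul, nI, nI]
      nlinarith [mul_le_mul_of_nonneg_left hcR h0]
    · have : ‖¢b₂ - θ i * w₂‖ ≤ |®b₂| + ‖θ i‖ * |®w₂| := by
        refine (norm_sub_le _ _).trans ?_
        rw [norm_mul, nI, nI]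
      calc _ ≤ E * (|®b₂| + ‖θ i‖ * |®w₂|) := gc
        _ = E * |®b₂| + ‖θ i‖ * (E * |®w₂|) := rg
        _ ≤ 2 * g + ‖θ i‖ * (2 * g) := gc
        _ ≤ _ := nl
  constructor
  · have h1 : ¢(®(FQ b c)) = (b - θ 0 * c) * (b - θ 1 * c) * (b - θ 2 * c) := by
      rw [← hθ]; unfold FF; push_cast; ring
    rw [← Real.norm_eq_abs, ← Complex.norm_real, h1, norm_mul, norm_mul]
    calc _ ≤ (R * E) * (R * E) * (R * E) := by gcongr <;> exact (hform _).1
      _ = R ^ 3 * E ^ 3 := rg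
      _ ≤ _ := by gcongr; nlinarith [pow_pos (show 0 < R by linarith) 3]
  set a : Fin 4 → ℂ := ![b - θ 0 * c, b - θ 1 * c, b - θ 2 * c, c] with ha
  set a' : Fin 4 → ℂ := ![b₂ - θ 0 * w₂, b₂ - θ 1 * w₂, b₂ - θ 2 * w₂, w₂] with ha'
  have hA : ∀ i, ‖a i‖ ≤ R * E := fun i => by
    fin_cases i
    · exact (hform 0).1
    · exact (hform 1).1
    · exact (hform 2).1
    · show ‖¢c‖ ≤ R * E
      rw [nI]; nlinarith
  have hA' : ∀ i, E * ‖a' i‖ ≤ 2 * R * g := fun i => by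
    fin_cases i
    · exact (hform 0).2
    · exact (hform 1).2
    · exact (hform 2).2
    · show E * ‖¢w₂‖ ≤ 2 * R * g
      rw [nI]; nlinarith
  have hsep : ∀ i, 1 ≤ ‖a' i * ®E / ®g‖ + 2 * ‖a i / ®E‖ := fun i => by
    have key : ®g ≤ E * ‖a' i‖ + ‖a i‖ * (2 * g / E) := by
      have aux : ∀ X Y : ℝ, E * Y ≤ 2 * g → 0 ≤ X → X * Y ≤ X * (2 * g / E) := fun X Y hY hX =>
        mul_le_mul_of_nonneg_left (by rw [le_div_iff₀ hER]; linarith) hX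
      have main : ∀ θ : ℂ, ®g ≤ E * ‖¢b₂ - θ * w₂‖ + ‖¢b - θ * c‖ * (2 * g / E) := fun θ => by
        have h1 : ¢g = c * (b₂ - θ * w₂) - (b - θ * c) * w₂ := by rw [← hdetC]; ring
        have h2 : ®g = ‖¢g‖ := by rw [nI, abs_of_pos hgR]
        have h3 := norm_sub_le (¢c * (b₂ - θ * w₂)) ((b - θ * c) * w₂)
        rw [← h1, ← h2, norm_mul, norm_mul, nI, nI] at h3
        refine h3.trans ?_
        exact add_le_add (mul_le_mul_of_nonneg_right hcR (norm_nonneg _)) (aux _ _ hw2R (norm_nonneg _))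
      fin_cases i
      · exact main _
      · exact main _
      · exact main _
      · show ®g ≤ E * ‖¢w₂‖ + ‖¢c‖ * (2 * g / E)
        rw [nI, nI]
        have h2 : ®g = c * b₂ - b * w₂ := mc hdet.symm
        have h3 : ®c * b₂ ≤ |®c| * |®b₂| := by rw [← abs_mul]; exact le_abs_self _
        have h4 : -(®b * w₂) ≤ |®b| * |®w₂| := by rw [← abs_mul]; exact neg_le_abs _
        have h5 := aux _ _ hb2R (abs_nonneg ®c)
        have h6 : |®b| * |®w₂| ≤ E * |®w₂| := mul_le_mul_of_nonneg_right hbR (abs_nonneg _)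
        linarith
    rw [norm_div, norm_mul, norm_div, Complex.norm_real, Complex.norm_real, Real.norm_of_nonneg hER.le, Real.norm_of_nonneg hgR.le]
    have h7 : ‖a' i‖ * E / g + 2 * (‖a i‖ / E) = (E * ‖a' i‖ + ‖a i‖ * (2 * g / E)) / g := by field_simp
    rw [h7, le_div_iff₀ hgR]; linarith
  obtain ⟨m, hm1, hm5, hm⟩ := form_m hsep
  have var : ∀ s τ : ℤ, ®g ≤ E * s → ®(E * s) ≤ (1 + 1 / (2750 * R)) * g →
      ®(m * E) ≤ τ → ®τ ≤ (1 + 1 / (2750 * R)) * (m * E) → ∀ i, _ := fun s τ h1 h2 h3 h4 i =>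
    form_var hR1 hER hgR (hA i) (hA' i) hm5 (by field_simp) h1 h2 h3 h4 (hm i)
  set v₀ : ℝ := b * (g / E) + b₂ * (m * E)
  set w₀ : ℝ := c * (g / E) + w₂ * (m * E)
  set F₀ : ℝ := v₀ ^ 3 + c₂ * v₀ ^ 2 * w₀ + c₁ * v₀ * w₀ ^ 2 + c₀ * w₀ ^ 3 with hF₀
  have hl0 : ∀ i : Fin 3, (b - θ i * c) * ¢(®(g / E)) + (b₂ - θ i * w₂) * ¢(®(m * E)) = v₀ - θ i * w₀ := fun i => by
    simp only [v₀, w₀]; push_cast; ring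
  refine ⟨m, hm1, hm5, if 0 < F₀ then 1 else -1, by split_ifs <;> simp, fun s τ h1 h2 h3 h4 => ?_⟩
  have hv := var s τ h1 h2 h3 h4
  obtain ⟨ε₀, e0, q0, lo0, up0⟩ := hv 0
  obtain ⟨ε₁, e1, q1, lo1, up1⟩ := hv 1
  obtain ⟨ε₂, e2, q2, lo2, up2⟩ := hv 2
  obtain ⟨-, -, -, lo3, up3⟩ := hv 3
  simp only [ha, ha', Matrix.cons_val_zero, Matrix.cons_val_one, Matrix.cons_val] at q0 lo0 up0 q1 lo1 up1 q2 lo2 up2 lo3 up3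
  have hvw : ∀ i : Fin 3, (¢b - θ i * c) * ¢(®s) + (b₂ - θ i * w₂) * ¢(®τ) =
      (¢(®(b * s + b₂ * τ)) - θ i * ¢(®(c * s + w₂ * τ))) := fun i => by push_cast; ring
  rw [hl0] at q0 q1 q2
  rw [hvw] at q0 q1 q2 lo0 up0 lo1 up1 lo2 up2
  have hFF : (®(FQ (b * s + b₂ * τ) (c * s + w₂ * τ))) =
     ((®(b * s + b₂ * τ) ) ^ 3 + c₂ * (®(b * s + b₂ * τ)) ^ 2 * ®(c * s + w₂ * τ) + c₁ * ®(b * s + b₂ * τ) * ®(c * s + w₂ * τ) ^ 2 + c₀ * ®(c * s + w₂ * τ) ^ 3 : ℝ) := by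
    unfold FF; push_cast; ring
  have hFFc := hFc (b * s + b₂ * τ) (c * s + w₂ * τ)
  rw [← hFF] at hFFc
  set F : ℝ := ®(FQ (b * s + b₂ * τ) (c * s + w₂ * τ))
  have hF0c := hFc v₀ w₀
  rw [← hF₀] at hF0c
  have hlow : ®g ^ 3 / 125000 ≤ |F| := by
    rw [← Real.norm_eq_abs, ← Complex.norm_real, hFFc, norm_mul, norm_mul]
    calc _ = ®(g / 50) * (g / 50) * (g / 50) := rg
      _ ≤ _ := gc
  have hup : |F| ≤ 125000 * R ^ 3 * g ^ 3 := by
    rw [← Real.norm_eq_abs, ← Complex.norm_real, hFFc, norm_mul, norm_mul]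
    calc _ ≤ ®(22 * R * g) * (22 * R * g) * (22 * R * g) := gc
      _ = 10648 * (R ^ 3 * g ^ 3) := rg
      _ ≤ 125000 * (R ^ 3 * g ^ 3) := by gcongr; norm_num
      _ = _ := rg
  have hrat : |F - F₀| < |F₀| := by
    have hF0 : 0 < |F₀| := by
      rw [abs_pos]; intro h0
      have : ¢F = 0 := by
        rw [hFFc, q0, q1, q2]
        calc _ = ¢F₀ * ((1 + ε₀) * (1 + ε₁) * (1 + ε₂)) := by rw [hF0c]; ring
          _ = 0 := by rw [h0]; simp
      have h00 : F = 0 := mc this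
      rw [h00, abs_zero] at hlow
      have : 0 < ®g ^ 3 / 125000 := pv
      linarith
    have h8 : ¢(®(F - F₀)) = F₀ * (ε₀ + ε₁ + ε₂ + (ε₀ * ε₁ + ε₁ * ε₂ + ε₀ * ε₂) + ε₀ * ε₁ * ε₂) := by
      push_cast; rw [hFFc, q0, q1, q2, hF0c]; ring
    have h9 : ‖ε₀ + ε₁ + ε₂ + (ε₀ * ε₁ + ε₁ * ε₂ + ε₀ * ε₂) + ε₀ * ε₁ * ε₂‖ ≤ 1 / 2 := by
      have m2 : ∀ x y : ℂ, ‖x‖ ≤ 1 / 10 → ‖y‖ ≤ 1 / 10 → ‖x * y‖ ≤ 1 / 100 := fun x y hx hy => by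
        rw [norm_mul]; calc _ ≤ ®(1 / 10) * (1 / 10) := gc
          _ = _ := nn
      have m3 : ‖ε₀ * ε₁ * ε₂‖ ≤ 1 / 1000 := by
        rw [norm_mul]; calc _ ≤ ®(1 / 100) * (1 / 10) := by gcongr; exact m2 _ _ e0 e1
          _ = _ := nn
      have k1 := norm_add₃_le (a := ε₀) (b := ε₁) (c := ε₂)
      have k2 := norm_add₃_le (a := ε₀ * ε₁) (b := ε₁ * ε₂) (c := ε₀ * ε₂)
      have k3 := norm_add₃_le (a := ε₀ + ε₁ + ε₂) (b := ε₀ * ε₁ + ε₁ * ε₂ + ε₀ * ε₂) (c := ε₀ * ε₁ * ε₂)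
      have := m2 _ _ e0 e1
      have := m2 _ _ e1 e2
      have := m2 _ _ e0 e2
      linarith
    rw [← Real.norm_eq_abs, ← Complex.norm_real, h8, norm_mul, Complex.norm_real, Real.norm_eq_abs]
    nlinarith
  have hR3 : ®1 ≤ R ^ 3 := one_le_pow₀ hR1
  have hsgn : ((¡(if 0 < F₀ then 1 else -1)) : ℝ) * F = |F| := by
    split_ifs with h0
    · rw [abs_of_pos h0, abs_lt] at hrat
      rw [abs_of_pos ln]; simp
    · have h0' : F₀ ≤ 0 := ln
      rw [abs_of_nonpos h0', abs_lt] at hrat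
      rw [abs_of_neg ln]; simp
  have hs0 : ®0 ≤ s := by
    by_contra! hh; nlinarith
  have hgC3 : ®g / (125000 * R ^ 3) ≤ g / 50 := by gcongr; linarith
  have hC22 : 22 * R ≤ 125000 * R ^ 3 := by
    have : R ≤ R ^ 3 := le_self_pow₀ hR1 nn
    linarith
  have hwn : ‖¢c * ¢(®s) + w₂ * ¢(®τ)‖ = |®(c * s + w₂ * τ)| := by
    rw [← Real.norm_eq_abs, ← Complex.norm_real]; push_cast; rfl
  rw [hwn] at lo3 up3
  rw [hsgn]
  refine ⟨le_trans ?_ hlow, hup, ?_, up3.trans gc, hgC3.trans lo3⟩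
  · gcongr; linarith
  · have ht0 : ®0 ≤ τ := le_trans pv h3
    have hk : 1 / (2750 * R) ≤ 1 := by rw [div_le_one pv]; linarith
    have hm5' : ®m ≤ 5 := mc hm5
    refine (abs_add_le _ _).trans ?_
    rw [abs_mul, abs_mul, abs_of_nonneg hs0, abs_of_nonneg ht0]
    have t1 : |®b| * s ≤ 2 * g := by
      calc _ ≤ E * ®s := gc
        _ ≤ _ := h2.trans (mul_le_mul_of_nonneg_right ln hgR.le)
    have t2 : |®b₂| * τ ≤ 20 * g := by
      calc _ ≤ |®b₂| * (2 * (5 * E)) := by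
            gcongr
            refine h4.trans ?_
            exact mul_le_mul ln gc pv nn
        _ = 10 * (E * |®b₂|) := rg
        _ ≤ _ := ln
    have t3 : ®22 * g ≤ 125000 * R ^ 3 * g := mul_le_mul_of_nonneg_right ln hgR.le
    linarith
structure Geo (c₁ c₂ : ℤ) (κ C : ℝ) (g : ℕ) (r φ y₁ c y₂ w₂ : ℤ) (E m : ℕ) : Prop where
  c0 : c ≠ 0
  det : c * y₂ - y₁ * w₂ = 1
  E1 : 1 ≤ E
  E2 : E ^ 2 ≤ g
  gE : ®g ≤ C * E ^ 3
  cE : |c| ≤ E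
  f0 : dd c₁ c₂ g r φ y₁ c ≠ 0
  f0E : |®(dd c₁ c₂ g r φ y₁ c)| * g ≤ C * E ^ 3
  m1 : 1 ≤ m
  m5 : m ≤ 5
  pt : ∀ s τ : ℤ, ®g ≤ E * s → ®(E * s) ≤ (1 + κ) * g → ®(m * E) ≤ τ → ®τ ≤ (1 + κ) * (m * E) →
    ®g ^ 2 / C ≤ dd c₁ c₂ g r φ (y₁ * s + τ * y₂) (c * s + τ * w₂) ∧
    ®(dd c₁ c₂ g r φ (y₁ * s + τ * y₂) (c * s + τ * w₂)) ≤ C * g ^ 2 ∧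
    |(¡(r * (c * s + τ * w₂) + g * (y₁ * s + τ * y₂)) : ℝ)| ≤ C * g ∧
    |®(¡(c * s + τ * w₂))| ≤ C * g ∧ ®g / C ≤ |®(¡(c * s + τ * w₂))|
lemma geom (hF : ∀ v w, FQ v w = 0 → w = 0) :
    ∃ κ C : ℝ, 0 < κ ∧ κ ≤ 1 ∧ 1 ≤ C ∧ ∀ g : ℕ, 2 ≤ g → ∀ r φ : ℤ, fQ r = g * φ →
      ∃ y₁ c y₂ w₂ : ℤ, ∃ E m : ℕ, Geo c₁ c₂ κ C g r φ y₁ c y₂ w₂ E m := by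
  obtain ⟨κ, C, hκ, hκ1, hC, H⟩ := geom0
  refine ⟨κ, C, hκ, hκ1, hC, fun g hg r φ hr => ?_⟩
  obtain ⟨y₁, c, y₂, w₂, E, hdet, hc0, hE1, hE2, hc, hb, -, hw2, hb2⟩ := basis g hg r
  obtain ⟨E, rfl⟩ := Int.eq_ofNat_of_zero_le (show 0 ≤ E by omega)
  have hgR : ®0 < g := mc (om : 0 < g)
  obtain ⟨h1, m, hm1, hm5, σ, hσ, hpt⟩ := H g E (r * c + g * y₁) c (r * w₂ + g * y₂) w₂ om hE1 hc hb hw2 hb2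
    (by linear_combination (g : ℤ) * hdet)
  have hσ2 : σ * σ = 1 := by rcases hσ with rfl | rfl <;> norm_num
  have hσa : |σ| = 1 := by rcases hσ with rfl | rfl <;> norm_num
  have hFd := FF_dd hr y₁ c
  have hF0 : FQ (r * c + g * y₁) c ≠ 0 := fun h => hc0 (hF _ _ h)
  have hodd : ∀ y w, dQ g r φ (σ * y) (σ * w) = σ * dQ g r φ y w := fun y w => by
    unfold dd; linear_combination (σ * (φ * w ^ 3 + pQ r * y * w ^ 2 + (3 * r + c₂) * g * y ^ 2 * w + g ^ 2 * y ^ 3)) * hσ2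
  have hd0 : dQ g r φ y₁ c ≠ 0 := fun h => hF0 (by rw [hFd, h, mul_zero])
  have hF1 : |®(dQ g r φ y₁ c)| * g ≤ C * E ^ 3 := by
    have h2 : ®(FQ (r * c + g * y₁) c) = g * dQ g r φ y₁ c := mc hFd
    have h3 : |®(FQ (r * c + g * y₁) c)| ≤ C * E ^ 3 := mc h1
    rw [h2, abs_mul, abs_of_pos hgR] at h3
    linarith
  have hd1 : ®1 ≤ |®(dQ g r φ y₁ c)| := mc Int.one_le_abs hd0
  refine ⟨σ * y₁, σ * c, σ * y₂, σ * w₂, E, m, ?_, ?_, mc hE1, mc hE2, nl, ?_, ?_, ?_, hm1, hm5, ?_⟩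
  · exact mul_ne_zero (fun h => by rw [h] at hσ2; omega) hc0
  · linear_combination σ * σ * hdet + hσ2
  · rw [abs_mul, hσa, one_mul]; exact hc
  · rw [hodd]; exact mul_ne_zero (fun h => by rw [h] at hσ2; omega) hd0
  · rw [hodd]; push_cast; rw [abs_mul, show |®σ| = 1 by exact_mod_cast hσa, one_mul]; exact hF1
  · intro s τ a1 a2 a3 a4
    obtain ⟨p1, p2, p3, p4, p5⟩ := hpt s τ (mc a1) (mc a2) (mc a3) (mc a4)
    have e1 : (r * c + g * y₁) * s + (r * w₂ + g * y₂) * τ = r * (c * s + w₂ * τ) + g * (y₁ * s + y₂ * τ) := rg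
    rw [e1, FF_dd hr] at p1 p2
    have e2 : σ * y₁ * s + τ * (σ * y₂) = σ * (y₁ * s + y₂ * τ) := rg
    have e3 : σ * c * s + τ * (σ * w₂) = σ * (c * s + w₂ * τ) := rg
    have hσr : |®σ| = 1 := mc hσa
    rw [e2, e3, hodd]
    set D := dQ g r φ (y₁ * s + y₂ * τ) (c * s + w₂ * τ)
    push_cast at p1 p2 p3 p4 p5 ⊢
    refine ⟨?_, ?_, ?_, ?_, ?_⟩
    · have : ®g ^ 3 / C = g * (g ^ 2 / C) := rg
      rw [this] at p1
      nlinarith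
    · have : C * ®g ^ 3 = g * (C * g ^ 2) := rg
      rw [this] at p2
      nlinarith
    · have : ®r * (σ * (c * s + w₂ * τ)) + g * (σ * (y₁ * s + y₂ * τ)) = σ * ((r * c + g * y₁) * s + (r * w₂ + g * y₂) * τ) := rg
      rw [this, abs_mul, hσr, one_mul]; exact p3
    · rw [abs_mul, hσr, one_mul]; exact p4
    · rw [abs_mul, hσr, one_mul]; exact p5
def md (p : ℕ) (a : ℤ) : ℕ := (a % p).toNat
lemma md_cast {p : ℕ} (hp : 0 < p) (a : ℤ) : ¡(md p a) = a % p :=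
  Int.toNat_of_nonneg (Int.emod_nonneg _ om)
lemma md_lt {p : ℕ} (hp : 0 < p) (a : ℤ) : md p a < p := by
  have := md_cast hp a; have := Int.emod_lt_of_pos a (show ¡0 < p by omega); omega
lemma md_dvd {p : ℕ} (hp : 0 < p) (a : ℤ) : ¡p ∣ md p a - a := by
  rw [md_cast hp]; exact emod_dvd' _ _
lemma md_eq {p : ℕ} (hp : 0 < p) {a b : ℤ} : md p a = md p b ↔ ¡p ∣ a - b := by
  rw [← Int.natCast_inj, md_cast hp, md_cast hp, Int.emod_eq_emod_iff_emod_sub_eq_zero, Int.dvd_iff_emod_eq_zero]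
lemma nat_eq_of_dvd {p a b : ℕ} (ha : a < p) (hb : b < p) (h : ¡p ∣ ¡a - b) : a = b := by
  have := Int.eq_zero_of_abs_lt_dvd h (by rw [abs_lt]; omega); omega
def rho (c₀ c₁ c₂ : ℤ) (p : ℕ) : ℕ := #{n ∈ range p | ¡p ∣ ff c₀ c₁ c₂ (n : ℕ)}
set_option hygiene false in
notation "rQ" => rho c₀ c₁ c₂
lemma ff_congr {m a b : ℤ} (h : m ∣ a - b) : m ∣ fQ a - fQ b := by
  rw [← Int.modEq_iff_dvd] at h ⊢; unfold ff; gcongr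
lemma FF_congr {m a b a' b' : ℤ} (h : m ∣ a - b) (h' : m ∣ a' - b') :
    m ∣ FQ a a' - FQ b b' := by
  rw [← Int.modEq_iff_dvd] at h h' ⊢; unfold FF; gcongr
lemma rho_le_p (p : ℕ) : rQ p ≤ p := (card_filter_le _ _).trans sm
lemma rho_le_three {p : ℕ} (hp : p.Prime) : rQ p ≤ 3 := by
  haveI := Fact.mk hp
  set P : Polynomial (ZMod p) := Polynomial.X ^ 3 + Polynomial.C (c₂ : ZMod p) * Polynomial.X ^ 2 + Polynomial.C (c₁ : ZMod p) * Polynomial.X + Polynomial.C (c₀ : ZMod p) with hP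
  have hdeg : P.natDegree = 3 := by rw [hP]; compute_degree!
  have h0 : P ≠ 0 := fun h => by rw [h] at hdeg; simp at hdeg
  have : rQ p ≤ #P.roots.toFinset := by
    refine card_le_card_of_injOn (fun n : ℕ => (n : ZMod p)) (fun n hn => ?_) (fun a ha b hb hab => ?_)
    · have hn' := (mem_filter.1 hn).2
      rw [← ZMod.intCast_zmod_eq_zero_iff_dvd] at hn'
      simp only [coe_sort_coe, mem_coe, Multiset.mem_toFinset]
      rw [Polynomial.mem_roots h0, Polynomial.IsRoot.def, hP]
      simp only [Polynomial.eval_add, Polynomial.eval_mul, Polynomial.eval_pow, Polynomial.eval_X, Polynomial.eval_C]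
      rw [← hn']; unfold ff; push_cast; ring
    · have ha' := mem_range.1 (mem_filter.1 ha).1
      have hb' := mem_range.1 (mem_filter.1 hb).1
      have := (ZMod.natCast_eq_natCast_iff' a b p).1 hab
      rwa [Nat.mod_eq_of_lt ha', Nat.mod_eq_of_lt hb'] at this
  exact this.trans ((Multiset.toFinset_card_le _).trans ((Polynomial.card_roots' P).trans hdeg.le))
lemma lin_count {p : ℕ} (hp : p.Prime) {α β : ℤ} (h : ¬ (¡p ∣ α ∧ ¡p ∣ β)) (a : ℤ) (l : ℕ) :
    (#{i ∈ range l | ¡p ∣ α * (a + (i : ℕ)) + β} : ℝ) ≤ l / p + 1 := by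
  by_cases hα : ¡p ∣ α
  · have : {i ∈ range l | ¡p ∣ α * (a + (i : ℕ)) + β} = ∅ := by
      rw [filter_eq_empty_iff]; intro i _ hi
      exact h ⟨hα, (dvd_add_right (hα.mul_right _)).1 hi⟩
    rw [this]; simp; positivity
  · have hc : IsCoprime α p := ((Nat.prime_iff_prime_int.1 hp).coprime_iff_not_dvd.2 hα).symm
    refine le_trans ?_ (ap_count_le p hp.pos (a + iv p α * β) l)
    have : #{i ∈ range l | ¡p ∣ α * (a + (i : ℕ)) + β} ≤ #{i ∈ range l | ¡p ∣ a + iv p α * β + (i : ℕ)} := by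
      refine card_le_card fun i hi => ?_
      rw [mem_filter] at hi ⊢
      refine ⟨hi.1, ?_⟩
      obtain ⟨k, hk⟩ := iv_spec hc
      refine hc.symm.dvd_of_dvd_mul_left ?_
      obtain ⟨j, hj⟩ := hi.2
      exact ⟨j + k * β, by linear_combination hj + β * hk⟩
    exact_mod_cast this
lemma lin_count2 {p : ℕ} (hp : p.Prime) {α β : ℤ} (h : ¬ (¡p ∣ α ∧ ¡p ∣ β)) :
    #{q ∈ range p ×ˢ range p | ¡p ∣ α * (q.1 : ℕ) + β * (q.2 : ℕ)} ≤ p := by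
  have hP := Nat.prime_iff_prime_int.1 hp
  have key : ∀ (x y : ℤ) (a b : ℕ), a < p → b < p → ¬ ¡p ∣ x → ¡p ∣ x * a + y → ¡p ∣ x * b + y → a = b := by
    intro x y a b ha hb hx h1 h2
    refine nat_eq_of_dvd ha hb ?_
    have : ¡p ∣ x * (a - b) := by have := dvd_sub h1 h2; rwa [show x * a + y - (x * b + y) = x * (¡a - b) by ring] at this
    exact (hP.dvd_mul.1 this).resolve_left hx
  by_cases hα : ¡p ∣ α
  · have hβ : ¬ ¡p ∣ β := fun hb => h ⟨hα, hb⟩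
    calc _ ≤ #(range p) := card_le_card_of_injOn Prod.fst (fun q hq => (mem_product.1 (mem_filter.1 hq).1).1) ?_
      _ = p := card_range p
    rintro ⟨a, b⟩ hq ⟨a', b'⟩ hq' (rfl : a = a')
    simp only [coe_filter, mem_product, mem_range, Set.mem_ofPred_eq] at hq hq'
    rw [key β (α * a) b b' hq.1.2 hq'.1.2 hβ (by have := hq.2; rwa [add_comm] at this) (by have := hq'.2; rwa [add_comm] at this)]
  · calc _ ≤ #(range p) := card_le_card_of_injOn Prod.snd (fun q hq => (mem_product.1 (mem_filter.1 hq).1).2) ?_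
      _ = p := card_range p
    rintro ⟨a, b⟩ hq ⟨a', b'⟩ hq' (rfl : b = b')
    simp only [coe_filter, mem_product, mem_range, Set.mem_ofPred_eq] at hq hq'
    rw [key α (β * b) a a' hq.1.1 hq'.1.1 hα hq.2 hq'.2]
lemma FF_zeros {p : ℕ} (hp : p.Prime) :
    #{q ∈ range p ×ˢ range p | ¡p ∣ FQ (q.1 : ℕ) (q.2 : ℕ)} ≤ 1 + (p - 1) * rQ p := by
  have hP := Nat.prime_iff_prime_int.1 hp
  set T : Finset (ℕ × ℕ) := {(0, 0)} ∪ (Ico 1 p ×ˢ {n ∈ range p | ¡p ∣ fQ (n : ℕ)}) with hT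
  have hTc : #T ≤ 1 + (p - 1) * rQ p := by
    refine (card_union_le _ _).trans ?_
    rw [card_product, card_singleton, Nat.card_Ico]; rfl
  refine le_trans ?_ hTc
  refine card_le_card_of_injOn (fun q => (q.2, if q.2 = 0 then 0 else md p (q.1 * iv p q.2))) ?_ ?_
  · rintro ⟨v, w⟩ hq
    simp only [coe_filter, mem_product, mem_range, Set.mem_ofPred_eq] at hq
    simp only [hT, coe_union, coe_singleton, Set.mem_union, Set.mem_singleton_iff, coe_product, Set.mem_prod]
    by_cases hw : w = 0
    · left; simp [hw]
    · right
      rw [if_neg hw]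
      have hwp : ¬ ¡p ∣ w := fun hh => by
        have := Int.natCast_dvd_natCast.1 hh; exact hw (Nat.eq_zero_of_dvd_of_lt this hq.1.2)
      have hc : IsCoprime ¡w p := (hP.coprime_iff_not_dvd.2 hwp).symm
      refine ⟨by simp; omega, ?_⟩
      simp only [coe_filter, mem_range, Set.mem_ofPred_eq]
      refine ⟨md_lt hp.pos _, ?_⟩
      refine dvd_ff' (w := w) (v := v) ?_ hq.2 hc.symm
      have h1 := md_dvd hp.pos (¡v * iv p w)
      obtain ⟨k, hk⟩ := iv_spec hc
      obtain ⟨j, hj⟩ := h1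
      exact ⟨w * j + v * k, by linear_combination (w : ℤ) * hj + v * hk⟩
  · rintro ⟨v, w⟩ hq ⟨v', w'⟩ hq' heq
    simp only [coe_filter, mem_product, mem_range, Set.mem_ofPred_eq] at hq hq'
    simp only [Prod.mk.injEq] at heq
    obtain ⟨rfl, heq⟩ := heq
    rw [Prod.mk.injEq]; refine ⟨?_, rfl⟩
    by_cases hw : w = 0
    · subst hw
      have z : ∀ n : ℕ, n < p → ¡p ∣ FQ n (0 : ℕ) → n = 0 := fun n hn h => by
        have : FQ n (0 : ℕ) = ¡n ^ 3 := by unfold FF; push_cast; ring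
        rw [this] at h
        exact Nat.eq_zero_of_dvd_of_lt (Int.natCast_dvd_natCast.1 (hP.dvd_of_dvd_pow h)) hn
      rw [z v hq.1.1 hq.2, z v' hq'.1.1 hq'.2]
    · rw [if_neg hw, if_neg hw, md_eq hp.pos] at heq
      have hwp : ¬ ¡p ∣ w := fun hh => by
        have := Int.natCast_dvd_natCast.1 hh; exact hw (Nat.eq_zero_of_dvd_of_lt this hq.1.2)
      have hc : IsCoprime ¡w p := (hP.coprime_iff_not_dvd.2 hwp).symm
      obtain ⟨k, hk⟩ := iv_spec hc
      obtain ⟨j, hj⟩ := heq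
      refine nat_eq_of_dvd hq.1.1 hq'.1.1 ⟨w * j - k * (v - v'), by linear_combination (w : ℤ) * hj - (¡v - v') * hk⟩
def DD (c₁ c₂ g r φ y₁ c y₂ w₂ t s k : ℤ) : ℤ := dd c₁ c₂ g r φ (y₁ * s + t * k * y₂) (c * s + t * k * w₂)
set_option hygiene false in
notation "DQ" => DD c₁ c₂
lemma DD_per (c₁ c₂ g r φ y₁ c y₂ w₂ t : ℤ) : Per (DQ g r φ y₁ c y₂ w₂ t) := by
  rintro m s k s' k' ⟨a, ha⟩ ⟨b, hb⟩
  exact dd_congr _ _ _ _ _ ⟨y₁ * a + t * b * y₂, by linear_combination y₁ * ha + t * y₂ * hb⟩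
    ⟨c * a + t * b * w₂, by linear_combination c * ha + t * w₂ * hb⟩
lemma DD_tau (c₁ c₂ g r φ y₁ c y₂ w₂ : ℤ) {p t s k : ℤ} (h : p ∣ t * k) :
    p ∣ DQ g r φ y₁ c y₂ w₂ t s k ↔ p ∣ s ^ 3 * dQ g r φ y₁ c := by
  refine dvd_iff_dvd_of_dvd_sub ?_
  rw [show s ^ 3 * dQ g r φ y₁ c = dQ g r φ (y₁ * s) (c * s) by unfold dd; ring]
  obtain ⟨j, hj⟩ := h
  exact dd_congr _ _ _ _ _ ⟨j * y₂, by linear_combination y₂ * hj⟩ ⟨j * w₂, by linear_combination w₂ * hj⟩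
lemma cnt_le_rho {c₀ c₁ c₂ g r φ y₁ c y₂ w₂ t : ℤ} (hr : fQ r = g * φ) (hdet : c * y₂ - y₁ * w₂ = 1)
    {p : ℕ} (hp : p.Prime) (hg : ¬ ¡p ∣ g) (ht : ¬ ¡p ∣ t) :
    cnt (DQ g r φ y₁ c y₂ w₂ t) p ≤ 1 + (p - 1) * rQ p := by
  have hP := Nat.prime_iff_prime_int.1 hp
  refine le_trans ?_ (FF_zeros hp)
  unfold cnt
  set w : ℕ × ℕ → ℤ := fun q => c * q.1 + t * q.2 * w₂ with hw
  set y : ℕ × ℕ → ℤ := fun q => y₁ * q.1 + t * q.2 * y₂ with hy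
  refine card_le_card_of_injOn (fun q => (md p (r * w q + g * y q), md p (w q))) ?_ ?_
  · intro q hq
    simp only [coe_filter, mem_product, mem_range, Set.mem_ofPred_eq] at hq ⊢
    refine ⟨⟨md_lt hp.pos _, md_lt hp.pos _⟩, ?_⟩
    refine (dvd_iff_dvd_of_dvd_sub (FF_congr (md_dvd hp.pos _) (md_dvd hp.pos _))).2 ?_
    rw [FF_dd hr]
    exact hq.2.mul_left _
  · intro q hq q' hq' heq
    simp only [coe_filter, mem_product, mem_range, Set.mem_ofPred_eq] at hq hq'
    simp only [Prod.mk.injEq, md_eq hp.pos] at heq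
    obtain ⟨h1, h2⟩ := heq
    have h3 : ¡p ∣ g * (y q - y q') := by
      have := dvd_sub h1 (h2.mul_left r)
      rwa [show r * w q + g * y q - (r * w q' + g * y q') - r * (w q - w q') = g * (y q - y q') by ring] at this
    have h4 := (hP.dvd_mul.1 h3).resolve_left hg
    have h5 : ¡p ∣ ¡(q.1) - q'.1 := by
      have := dvd_sub (h2.mul_left y₂) (h4.mul_left w₂)
      rwa [show y₂ * (w q - w q') - w₂ * (y q - y q') = ¡(q.1) - q'.1 by
        simp only [hw, hy]; linear_combination (¡(q.1) - q'.1) * hdet] at this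
    have h6 : ¡p ∣ t * (¡(q.2) - q'.2) := by
      have := dvd_sub (h4.mul_left c) (h2.mul_left y₁)
      rwa [show c * (y q - y q') - y₁ * (w q - w q') = t * (¡(q.2) - q'.2) by
        simp only [hw, hy]; linear_combination (t * (¡(q.2) - q'.2)) * hdet] at this
    exact Prod.ext (nat_eq_of_dvd hq.1.1 hq'.1.1 h5) (nat_eq_of_dvd hq.1.2 hq'.1.2 ((hP.dvd_mul.1 h6).resolve_left ht))
lemma form1 {y₁ c y₂ w₂ : ℤ} (hdet : c * y₂ - y₁ * w₂ = 1) {p u : ℤ} (hP : Prime p) (hu : ¬ p ∣ u) :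
    ¬ (p ∣ c ∧ p ∣ u * w₂) := by
  rintro ⟨h1, h2⟩
  have h3 := (hP.dvd_mul.1 h2).resolve_left hu
  exact hP.not_isUnit (isUnit_of_dvd_one (hdet ▸ dvd_sub (h1.mul_right _) (h3.mul_left _)))
lemma form2 {y₁ c y₂ w₂ φ f' : ℤ} (hdet : c * y₂ - y₁ * w₂ = 1) {p u : ℤ} (hP : Prime p) (hu : ¬ p ∣ u) (hf : ¬ p ∣ f') :
    ¬ (p ∣ φ * c + f' * y₁ ∧ p ∣ u * (φ * w₂ + f' * y₂)) := by
  rintro ⟨h1, h2⟩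
  have h3 := (hP.dvd_mul.1 h2).resolve_left hu
  apply hf
  have := dvd_sub (h3.mul_left c) (h1.mul_left w₂)
  rwa [show c * (φ * w₂ + f' * y₂) - w₂ * (φ * c + f' * y₁) = f' by linear_combination f' * hdet] at this
lemma DD_g (c₁ c₂ g r φ y₁ c y₂ w₂ t s k : ℤ) {p : ℤ} (hP : Prime p) (hg : p ∣ g) :
    p ∣ DQ g r φ y₁ c y₂ w₂ t s k ↔ p ∣ c * s + t * k * w₂ ∨
      p ∣ (φ * c + pQ r * y₁) * s + t * k * (φ * w₂ + pQ r * y₂) := by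
  unfold DD
  rw [dd_mod _ _ _ _ _ _ _ hg, hP.dvd_mul, hP.dvd_pow_iff_dvd two_ne_zero]
  rw [show φ * (c * s + t * k * w₂) + pQ r * (y₁ * s + t * k * y₂) =
    (φ * c + pQ r * y₁) * s + t * k * (φ * w₂ + pQ r * y₂) by ring]
lemma cnt_le_two {c₁ c₂ g r φ y₁ c y₂ w₂ t : ℤ} (hdet : c * y₂ - y₁ * w₂ = 1)
    {p : ℕ} (hp : p.Prime) (hg : ¡p ∣ g) (ht : ¬ ¡p ∣ t) (hf : ¬ ¡p ∣ pQ r) :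
    cnt (DQ g r φ y₁ c y₂ w₂ t) p ≤ 2 * p := by
  have hP := Nat.prime_iff_prime_int.1 hp
  have h1 := lin_count2 hp (form1 hdet hP ht)
  have h2 := lin_count2 hp (form2 (φ := φ) hdet hP ht hf)
  rw [two_mul]
  refine le_trans ?_ ((card_union_le _ _).trans (add_le_add h1 h2))
  refine card_le_card fun q hq => ?_
  rw [mem_filter, DD_g _ _ _ _ _ _ _ _ _ _ _ _ hP hg] at hq
  rw [mem_union, mem_filter, mem_filter]
  rcases hq.2 with h | h
  · left; refine ⟨hq.1, ?_⟩; convert h using 1; ring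
  · right; refine ⟨hq.1, ?_⟩; convert h using 1; ring
noncomputable def bigp (z : ℝ) (n : ℕ) : Finset ℕ := {p ∈ n.primeFactors | z ≤ ®p}
lemma mem_bigp {z : ℝ} {n p : ℕ} (hn : n ≠ 0) : p ∈ bigp z n ↔ p.Prime ∧ p ∣ n ∧ z ≤ p := by
  simp [bigp, Nat.mem_primeFactors, hn, and_assoc]
lemma bigp_card {z : ℝ} (hz : 1 < z) {n B : ℕ} (hn : n ≠ 0) (h : ®n < z ^ (B + 1)) : #(bigp z n) ≤ B := by
  have h1 : z ^ #(bigp z n) ≤ n := by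
    calc z ^ #(bigp z n) = ∏ p ∈ bigp z n, z := by rw [prod_const]
      _ ≤ ∏ p ∈ bigp z n, ®p := prod_le_prod (fun _ _ => ln) fun p hp => (mem_filter.1 hp).2
      _ = ((∏ p ∈ bigp z n, p : ℕ) : ℝ) := by rw [Nat.cast_prod]
      _ ≤ ((∏ p ∈ n.primeFactors, p : ℕ) : ℝ) := by
          exact_mod_cast prod_le_prod_of_subset_of_one_le' (filter_subset _ _) fun p hp _ => (Nat.prime_of_mem_primeFactors hp).one_le
      _ ≤ n := mc Nat.le_of_dvd (Nat.pos_of_ne_zero hn) (Nat.prod_primeFactors_dvd n)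
  have h2 := (pow_lt_pow_iff_right₀ hz).1 (h1.trans_lt h)
  omega
lemma union_bound {ι : Type*} (S : Finset ℕ) (A : Finset ι) (F : ℕ → Finset ι) (hA : ∀ i ∈ A, ∃ p ∈ S, i ∈ F p)
    (B : ℕ) (hB : #S ≤ B) (X : ℝ) (hX : 0 ≤ X) (h : ∀ p ∈ S, (#(F p) : ℝ) ≤ X) : (#A : ℝ) ≤ B * X := by
  classical
  have h1 : A ⊆ S.biUnion F := fun i hi => mem_biUnion.2 (hA i hi)
  calc (#A : ℝ) ≤ ∑ p ∈ S, (#(F p) : ℝ) := by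
        exact_mod_cast (card_le_card h1).trans card_biUnion_le
    _ ≤ ∑ p ∈ S, X := sum_le_sum h
    _ = #S * X := by rw [sum_const, nsmul_eq_mul]
    _ ≤ _ := gc
lemma row_count {c₁ c₂ r φ y₁ c y₂ w₂ : ℤ} {g t p k : ℕ} (hdet : c * y₂ - y₁ * w₂ = 1) (hp : p.Prime)
    (hτf : p ∣ t * k → ¬ ¡p ∣ dQ g r φ y₁ c) (hfp : p ∣ g → ¬ ¡p ∣ pQ r)
    (hpM : p ∣ g * (t * k)) (a₁ l₁ : ℕ) :
    (#{i ∈ range l₁ | ¡p ∣ DQ g r φ y₁ c y₂ w₂ t ((a₁ + i : ℕ)) (k : ℕ)} : ℝ) ≤ 2 * (l₁ / p + 1) := by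
  classical
  have hP := Nat.prime_iff_prime_int.1 hp
  have hpos : ®0 ≤ l₁ / p + 1 := pv
  by_cases hτ : ¡p ∣ ¡t * ¡k
  · have hpf := hτf (mc hτ)
    have h1 : #{i ∈ range l₁ | ¡p ∣ DQ g r φ y₁ c y₂ w₂ t ((a₁ + i : ℕ)) (k : ℕ)} ≤ #{i ∈ range l₁ | ¡p ∣ ¡a₁ + (i : ℕ)} := by
      refine card_le_card fun i hi => ?_
      rw [mem_filter] at hi ⊢
      refine ⟨hi.1, ?_⟩
      have h2 := hi.2
      rw [DD_tau _ _ _ _ _ _ _ _ _ hτ] at h2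
      have := hP.dvd_of_dvd_pow ((hP.dvd_mul.1 h2).resolve_right hpf)
      rwa [Nat.cast_add] at this
    have h2 := ap_count_le p hp.pos a₁ l₁
    have h3 : (#{i ∈ range l₁ | ¡p ∣ DQ g r φ y₁ c y₂ w₂ t ((a₁ + i : ℕ)) (k : ℕ)} : ℝ) ≤ #{i ∈ range l₁ | ¡p ∣ ¡a₁ + (i : ℕ)} := Nat.cast_le.2 h1
    linarith
  · have hpg : p ∣ g := by
      rcases hp.dvd_mul.1 hpM with h | h
      · exact h
      · exact absurd (by rw [← Nat.cast_mul]; exact Int.natCast_dvd_natCast.2 h) hτ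
    have h1 := lin_count hp (form1 hdet hP hτ) a₁ l₁
    have h2 := lin_count hp (form2 (φ := φ) hdet hP hτ (hfp hpg)) a₁ l₁
    set A := {i ∈ range l₁ | ¡p ∣ c * (¡a₁ + (i : ℕ)) + t * ¡k * w₂}
    set B := {i ∈ range l₁ | ¡p ∣ (φ * c + pQ r * y₁) * (¡a₁ + (i : ℕ)) + t * ¡k * (φ * w₂ + pQ r * y₂)}
    have h3 : {i ∈ range l₁ | ¡p ∣ DQ g r φ y₁ c y₂ w₂ t ((a₁ + i : ℕ)) (k : ℕ)} ⊆ A ∪ B := fun i hi => by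
      rw [mem_filter] at hi
      have h5 := hi.2
      rw [DD_g _ _ _ _ _ _ _ _ _ _ _ _ hP (Int.natCast_dvd_natCast.2 hpg), Nat.cast_add] at h5
      rw [mem_union, mem_filter, mem_filter]
      exact h5.imp (fun h => ⟨hi.1, h⟩) (fun h => ⟨hi.1, h⟩)
    have h4 : (#{i ∈ range l₁ | ¡p ∣ DQ g r φ y₁ c y₂ w₂ t ((a₁ + i : ℕ)) (k : ℕ)} : ℝ) ≤ #A + #B := by
      rw [← Nat.cast_add]; exact Nat.cast_le.2 ((card_le_card h3).trans (card_union_le A B))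
    linarith
lemma bad_count {c₁ c₂ r φ y₁ c y₂ w₂ : ℤ} {g t : ℕ} (hg : g ≠ 0) (hdet : c * y₂ - y₁ * w₂ = 1) (ht : t ≠ 0)
    (hf0 : dQ g r φ y₁ c ≠ 0) (htf : ∀ p : ℕ, p.Prime → p ∣ t → ¬ ¡p ∣ dQ g r φ y₁ c)
    (hfp : ∀ p : ℕ, p.Prime → p ∣ g → ¬ ¡p ∣ pQ r)
    {z : ℝ} (hz : 1 < z) (B a₁ a₂ l₁ l₂ : ℕ) (ha₂ : 0 < a₂)
    (hB1 : ∀ j < l₂, ((g * (t * (a₂ + j)) : ℕ) : ℝ) < z ^ (B + 1))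
    (hB2 : |®(dQ g r φ y₁ c)| < z ^ (B + 1))
    (D : ℕ × ℕ → ℤ) (hD : D = fun q => DQ g r φ y₁ c y₂ w₂ t ((a₁ + q.1 : ℕ)) ((a₂ + q.2 : ℕ))) (S : Finset (ℕ × ℕ))
    (hS : ∀ q ∈ S, q ∈ range l₁ ×ˢ range l₂ ∧ (∀ p ∈ pz z, ¬ ¡p ∣ D q) ∧ ¬ IsCoprime (D q) ((g * (t * (a₂ + q.2)) ^ 2 : ℕ) : ℤ)) :
    (#S : ℝ) ≤ l₂ * (B * (2 * (l₁ / z + 1))) + l₁ * (B * (l₂ / z + 1)) := by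
  classical
  have hz0 : 0 < z := ln
  set f₀ := dQ g r φ y₁ c with hf₀
  have hfn : f₀.natAbs ≠ 0 := Int.natAbs_ne_zero.2 hf0
  have hfB : ®((f₀.natAbs : ℕ)) < z ^ (B + 1) := by
    rwa [Nat.cast_natAbs, Int.cast_abs]
  set Kx := {j ∈ range l₂ | ∃ p ∈ bigp z f₀.natAbs, ¡p ∣ ¡a₂ + (j : ℕ)} with hKx
  have hKc : (#Kx : ℝ) ≤ B * (l₂ / z + 1) := by
    refine union_bound (bigp z f₀.natAbs) Kx (fun p => {j ∈ range l₂ | ¡p ∣ ¡a₂ + (j : ℕ)}) (fun j hj => ?_) B (bigp_card hz hfn hfB) _ pv fun p hp => ?_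
    · obtain ⟨h1, p, hp, h2⟩ := mem_filter.1 hj
      exact ⟨p, hp, mem_filter.2 ⟨h1, h2⟩⟩
    obtain ⟨hp1, -, hp3⟩ := (mem_bigp hfn).1 hp
    refine (ap_count_le p hp1.pos a₂ l₂).trans ?_
    gcongr
  set G : ℕ → Finset ℕ := fun j => {i ∈ range l₁ | ∃ p ∈ (bigp z (g * (t * (a₂ + j)))).filter (fun p : ℕ => ¬ (¡p ∣ f₀ ∧ ¡p ∣ a₂ + (j : ℕ))), ¡p ∣ D (i, j)} with hG
  have hGc : ∀ j < l₂, (#(G j) : ℝ) ≤ B * (2 * (l₁ / z + 1)) := fun j hj => by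
    have hne : g * (t * (a₂ + j)) ≠ 0 := pv
    refine union_bound ((bigp z (g * (t * (a₂ + j)))).filter (fun p : ℕ => ¬ (¡p ∣ f₀ ∧ ¡p ∣ a₂ + (j : ℕ)))) (G j)
      (fun p => {i ∈ range l₁ | ¡p ∣ D (i, j)}) (fun i hi => ?_) B ((card_filter_le _ _).trans (bigp_card hz hne (hB1 j hj))) _ pv fun p hp => ?_
    · obtain ⟨h1, p, hp, h2⟩ := mem_filter.1 hi
      exact ⟨p, hp, mem_filter.2 ⟨h1, h2⟩⟩
    rw [mem_filter, mem_bigp hne] at hp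
    obtain ⟨⟨hp1, hp2, hp3⟩, hp4⟩ := hp
    have hP := Nat.prime_iff_prime_int.1 hp1
    have hple : ®l₁ / p + 1 ≤ l₁ / z + 1 := gc
    have hpos : ®0 ≤ l₁ / z + 1 := pv
    subst hD
    refine (row_count hdet hp1 (fun hd => ?_) (hfp p hp1) hp2 a₁ l₁).trans ln
    rw [← Int.natCast_dvd_natCast, Nat.cast_mul, hP.dvd_mul] at hd
    rcases hd with h | h
    · exact htf p hp1 (Int.natCast_dvd_natCast.1 h)
    · exact fun h' => hp4 ⟨h', mc h⟩
  have hsub : S ⊆ (range l₁ ×ˢ Kx) ∪ ((range l₂).sigma G).image (fun q => (q.2, q.1)) := fun q hq => by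
    obtain ⟨h1, h2, h3⟩ := hS q hq
    rw [mem_product] at h1
    have hne : g * (t * (a₂ + q.2)) ≠ 0 := pv
    rw [Int.isCoprime_iff_gcd_eq_one] at h3
    obtain ⟨p, hp, hpg⟩ := Nat.exists_prime_and_dvd h3
    have hP := Nat.prime_iff_prime_int.1 hp
    have hpd : ¡p ∣ D q := (Int.natCast_dvd_natCast.2 hpg).trans (Int.gcd_dvd_left _ _)
    have hpM : ¡p ∣ ((g * (t * (a₂ + q.2)) ^ 2 : ℕ) : ℤ) := (Int.natCast_dvd_natCast.2 hpg).trans (Int.gcd_dvd_right _ _)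
    have hpz : z ≤ p := by
      by_contra! hlt; exact h2 p (mem_pz.2 ⟨hp, hlt⟩) hpd
    have hpM' : p ∣ g * (t * (a₂ + q.2)) := by
      have := Int.natCast_dvd_natCast.1 hpM
      rcases hp.dvd_mul.1 this with h | h
      · exact h.mul_right _
      · exact (hp.dvd_of_dvd_pow h).mul_left _
    rw [mem_union, mem_product, mem_image]
    by_cases hx : ¡p ∣ f₀ ∧ ¡p ∣ a₂ + (q.2 : ℕ)
    · left
      exact ⟨h1.1, mem_filter.2 ⟨h1.2, p, (mem_bigp hfn).2 ⟨hp, Int.natCast_dvd.1 hx.1, hpz⟩, hx.2⟩⟩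
    · right
      refine ⟨⟨q.2, q.1⟩, mem_sigma.2 ⟨h1.2, mem_filter.2 ⟨h1.1, p, mem_filter.2 ⟨(mem_bigp hne).2 ⟨hp, hpM', hpz⟩, hx⟩, hpd⟩⟩, rfl⟩
  have hc : (#S : ℝ) ≤ l₁ * #Kx + ∑ j ∈ range l₂, (#(G j) : ℝ) := by
    have := (card_le_card hsub).trans ((card_union_le _ _).trans (add_le_add le_rfl card_image_le))
    rw [card_product, card_range, card_sigma] at this
    exact_mod_cast this
  have hs : ∑ j ∈ range l₂, (#(G j) : ℝ) ≤ ∑ j ∈ range l₂, (B * (2 * (®l₁ / z + 1))) :=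
    sum_le_sum fun j hj => hGc j (mem_range.1 hj)
  rw [sum_const, card_range, nsmul_eq_mul] at hs
  have := mul_le_mul_of_nonneg_left hKc (Nat.cast_nonneg (α := ℝ) l₁)
  linarith
structure Cell (c₀ c₁ c₂ : ℤ) (κ C : ℝ) (G₁ g₂ g₃ g : ℕ) (r φ y₁ c y₂ w₂ : ℤ) (E m t a₁ a₂ l₁ l₂ : ℕ) (z Θ : ℝ) (B : ℕ) : Prop where
  geo : Geo c₁ c₂ κ C g r φ y₁ c y₂ w₂ E m
  hr : ff c₀ c₁ c₂ r = g * φ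
  hg : g = G₁ * g₂ * g₃
  hg0 : g ≠ 0
  tp : t.Prime
  t8 : 8 < t
  tz : z ≤ t
  tc : ¬ ¡t ∣ c
  tf : ¬ ¡t ∣ dd c₁ c₂ g r φ y₁ c
  tg : ¬ t ∣ g
  c12 : G₁.Coprime g₂
  c123 : (G₁ * g₂).Coprime g₃
  ck : ∀ j < l₂, (a₂ + j).Coprime (g₂ * g₃ * t)
  fpr : ∀ p : ℕ, p.Prime → p ∣ g → ¬ ¡p ∣ fp c₁ c₂ r ∧ 3 ≤ p
  z6 : 6 ≤ z
  Θ0 : 0 < Θ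
  Θ1 : Θ ≤ 1
  a₂0 : 0 < a₂
  ΘM : ∀ j < l₂, 2 ≤ Θ * ((g * (t * (a₂ + j)) ^ 2 : ℕ) : ℝ)
  B1 : ∀ j < l₂, ((g * (t * (a₂ + j)) : ℕ) : ℝ) < z ^ (B + 1)
  B2 : |®(dd c₁ c₂ g r φ y₁ c)| < z ^ (B + 1)
lemma cell_wsum {κ C : ℝ} {G₁ g₂ g₃ g : ℕ} {r φ y₁ c y₂ w₂ : ℤ} {E m t a₁ a₂ l₁ l₂ : ℕ} {z Θ : ℝ} {B : ℕ}
    (H : Cell c₀ c₁ c₂ κ C G₁ g₂ g₃ g r φ y₁ c y₂ w₂ E m t a₁ a₂ l₁ l₂ z Θ B) (e j : ℕ) (hj : j < l₂) (he : ¬ t ∣ e)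
    (Q : ℕ) (hQ : 1 ≤ Q) (hK : Q ^ 16 ≤ t) (hl : t * (Q ^ 16) ^ 2 ≤ l₁)
    (hm0 : 2 * (e * (G₁ * (a₂ + j) ^ 2)) * (Q ^ 16) ^ 2 ≤ l₁) (hm1 : 2 * g₂ * (Q ^ 16) ^ 2 ≤ l₁)
    (hm2 : 2 * g₃ * (Q ^ 16) ^ 2 ≤ l₁) (L : ℕ) (hL : 1 ≤ L) (hLM : L ≤ g * (t * (a₂ + j)) ^ 2) (a₀ : ℤ)
    (hLΘ : ((g * (t * (a₂ + j)) ^ 2 : ℕ) : ℝ) / L ≤ 2 / Θ) :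
    |∑ i ∈ range l₁, (if ¡e ∣ DQ g r φ y₁ c y₂ w₂ t (¡a₁ + (i : ℕ)) (¡a₂ + (j : ℕ)) then
      (Wt (g * (t * (a₂ + j)) ^ 2) L a₀ (kQ g r φ y₁ c (y₁ * (¡a₁ + (i : ℕ)) + t * (¡a₂ + (j : ℕ)) * y₂) (c * (¡a₁ + (i : ℕ)) + t * (¡a₂ + (j : ℕ)) * w₂))
        (DQ g r φ y₁ c y₂ w₂ t (¡a₁ + (i : ℕ)) (¡a₂ + (j : ℕ))) - 1) else 0)| ≤
      l₁ * (4 / Q * (2 / Θ) + (2 / Θ) ^ 2 / t) := by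
  have hP := Nat.prime_iff_prime_int.1 H.tp
  have hG0 : G₁ ≠ 0 ∧ g₂ ≠ 0 ∧ g₃ ≠ 0 := by
    have := H.hg0; rw [H.hg] at this; simp only [ne_eq, mul_eq_zero, not_or] at this; exact ⟨this.1.1, this.1.2, this.2⟩
  have hk0 : a₂ + j ≠ 0 := by have := H.a₂0; omega
  have hck := H.ck j hj
  have hck1 : (a₂ + j).Coprime g₂ := hck.coprime_dvd_right ((dvd_mul_right _ _).mul_right _)
  have hck2 : (a₂ + j).Coprime g₃ := hck.coprime_dvd_right ((dvd_mul_left _ _).mul_right _)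
  have hck3 : (a₂ + j).Coprime t := hck.coprime_dvd_right (dvd_mul_left _ _)
  have htg : ∀ d, d ∣ g → d.Coprime t := fun d hd => ((H.tp.coprime_iff_not_dvd).2 fun h => H.tg (h.trans hd)).symm
  set k : ℤ := ¡a₂ + (j : ℕ) with hk
  have hw := wsum H.tp H.t8 H.tc (w₀ := t * k * w₂)
    (fun s => kQ g r φ y₁ c (y₁ * s + t * k * y₂) (c * s + t * k * w₂))
    (fun s => DQ g r φ y₁ c y₂ w₂ t s k)
    (fun m s => kk_congr _ _ _ _ _ _ _ ⟨y₁, rg⟩ ⟨c, rg⟩)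
    (fun m s => DD_per _ _ _ _ _ _ _ _ _ _ _ _ _ _ _ ⟨1, rg⟩ ⟨0, rg⟩)
    (G₁ * (a₂ + j) ^ 2) g₂ g₃ e (mul_ne_zero hG0.1 (pow_ne_zero _ hk0)) hG0.2.1 hG0.2.2
    (Nat.Coprime.mul_left H.c12 (hck1.pow_left 2))
    (by
      have : G₁ * (a₂ + j) ^ 2 * g₂ = G₁ * g₂ * (a₂ + j) ^ 2 := rg
      rw [this]
      exact Nat.Coprime.mul_left H.c123 (hck2.pow_left 2))
    (by
      have : G₁ * (a₂ + j) ^ 2 * g₂ * g₃ = g * (a₂ + j) ^ 2 := by rw [H.hg]; ring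
      rw [this]
      exact (Nat.Coprime.mul_left (htg g dvd_rfl) (hck3.pow_left 2)).pow_right 2)
    he
    (fun s => by
      have := kk_id c₁ c₂ g r φ y₁ c (y₁ * s + t * k * y₂) (c * s + t * k * w₂)
      have h2 : c * (y₁ * s + t * k * y₂) - y₁ * (c * s + t * k * w₂) = t * k := by linear_combination t * k * H.geo.det
      rw [h2] at this
      unfold DD
      beta_reduce
      rw [this]
      exact ⟨(r * (c * s + t * k * w₂) + g * (y₁ * s + t * k * y₂)) * (g * k ^ 2), by push_cast; ring⟩)
    (fun s => by
      beta_reduce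
      rw [DD_tau _ _ _ _ _ _ _ _ _ (dvd_mul_right _ _), hP.dvd_mul, or_iff_left H.tf, hP.dvd_pow_iff_dvd three_ne_zero]
      rw [dvd_add_left (by rw [mul_assoc]; exact dvd_mul_right _ _), hP.dvd_mul, or_iff_right H.tc])
    a₁ l₁ Q hQ hK hl hm0 hm1 hm2 (g * (t * (a₂ + j)) ^ 2) L (by rw [H.hg]; ring) hL hLM a₀
  refine hw.trans ?_
  have hMp : ®0 ≤ ((g * (t * (a₂ + j)) ^ 2 : ℕ) : ℝ) / L := pv
  have ht0 : ®0 < t := mc H.tp.pos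
  calc _ = l₁ * (4 / Q * (((g * (t * (a₂ + j)) ^ 2 : ℕ) : ℝ) / L) + (((g * (t * (a₂ + j)) ^ 2 : ℕ) : ℝ) / L) ^ 2 / t) := rg
    _ ≤ _ := gc
lemma cell_count : ∃ C1 : ℕ, ∀ {c₀ c₁ c₂ : ℤ} {κ C : ℝ} {G₁ g₂ g₃ g : ℕ} {r φ y₁ c y₂ w₂ : ℤ} {E m t a₁ a₂ l₁ l₂ : ℕ} {z Θ : ℝ} {B : ℕ}
    (_ : Cell c₀ c₁ c₂ κ C G₁ g₂ g₃ g r φ y₁ c y₂ w₂ E m t a₁ a₂ l₁ l₂ z Θ B)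
    (Q : ℕ) (_ : 1 ≤ Q) (_ : Q ^ 16 ≤ t) (_ : t * (Q ^ 16) ^ 2 ≤ l₁)
    (_ : ∀ j < l₂, 2 * (z ^ C1 * (G₁ * (®a₂ + (j : ℕ)) ^ 2)) * (®Q ^ 16) ^ 2 ≤ l₁) (_ : 2 * g₂ * (Q ^ 16) ^ 2 ≤ l₁)
    (_ : 2 * g₃ * (Q ^ 16) ^ 2 ≤ l₁) (S : Finset (ℕ × ℕ))
    (_ : ∀ q ∈ range l₁ ×ˢ range l₂, (∀ p ∈ pz z, ¬ ¡p ∣ DQ g r φ y₁ c y₂ w₂ t ((a₁ + q.1 : ℕ)) ((a₂ + q.2 : ℕ))) →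
      IsCoprime (DQ g r φ y₁ c y₂ w₂ t ((a₁ + q.1 : ℕ)) ((a₂ + q.2 : ℕ))) ((g * (t * (a₂ + q.2)) ^ 2 : ℕ) : ℤ) →
      (∃ u : ℤ, ®u ≤ 3 * (Θ * ((g * (t * (a₂ + q.2)) ^ 2 : ℕ) : ℝ)) ∧ Θ * ((g * (t * (a₂ + q.2)) ^ 2 : ℕ) : ℝ) ≤ 2 * u ∧
        ((g * (t * (a₂ + q.2)) ^ 2 : ℕ) : ℤ) ∣ DQ g r φ y₁ c y₂ w₂ t ((a₁ + q.1 : ℕ)) ((a₂ + q.2 : ℕ)) * u +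
          kQ g r φ y₁ c (y₁ * ((a₁ + q.1 : ℕ)) + t * ((a₂ + q.2 : ℕ)) * y₂) (c * ((a₁ + q.1 : ℕ)) + t * ((a₂ + q.2 : ℕ)) * w₂)) → q ∈ S),
    1 / 2 * (∏ p ∈ pz z, (1 - ®(cnt (DQ g r φ y₁ c y₂ w₂ t) p) / p ^ 2)) * (l₁ * l₂)
      - z ^ C1 * (l₂ * (l₁ * (4 / Q * (2 / Θ) + (2 / Θ) ^ 2 / t)) + (z ^ C1 * (l₁ + l₂) + (z ^ C1) ^ 2))
      - (l₂ * (B * (2 * (l₁ / z + 1))) + l₁ * (B * (l₂ / z + 1))) ≤ 2 / Θ * #S := by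
  obtain ⟨C1, hC1⟩ := wsieve
  refine ⟨C1, fun {c₀ c₁ c₂ κ C G₁ g₂ g₃ g r φ y₁ c y₂ w₂ E m t a₁ a₂ l₁ l₂ z Θ B} H Q hQ hK hl hm0 hm1 hm2 S hS => ?_⟩
  classical
  have hz0 : 0 < z := by linarith [H.z6]
  have hΘ0 := H.Θ0
  set Mf : ℕ → ℕ := fun j => g * (t * (a₂ + j)) ^ 2 with hMf
  set Lf : ℕ → ℕ := fun j => ⌊Θ * ®(Mf j)⌋₊ with hLf
  have hL1 : ∀ j < l₂, 1 ≤ Lf j ∧ Lf j ≤ Mf j ∧ ®(Lf j) ≤ Θ * Mf j ∧ Θ * Mf j ≤ 2 * Lf j := fun j hj => by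
    have h2 := H.ΘM j hj
    have h3 : ®(Lf j) ≤ Θ * Mf j := Nat.floor_le ln
    have h4 : Θ * Mf j < Lf j + 1 := Nat.lt_floor_add_one _
    have h5 : ®1 < Lf j := by simp only [hMf] at h4; linarith
    refine ⟨mc h5.le, ?_, h3, ln⟩
    have : ®(Lf j) ≤ Mf j := h3.trans (by nlinarith [H.Θ1, Nat.cast_nonneg (α := ℝ) (Mf j)])
    exact_mod_cast this
  have hML : ∀ j < l₂, ®(Mf j) / Lf j ≤ 2 / Θ := fun j hj => by
    obtain ⟨h1, -, -, h2⟩ := hL1 j hj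
    rw [div_le_div_iff₀ (mc h1) hΘ0]; linarith
  set D : ℤ → ℤ → ℤ := DQ g r φ y₁ c y₂ w₂ t with hD
  set K : ℤ → ℤ → ℤ := fun s k => kQ g r φ y₁ c (y₁ * s + t * k * y₂) (c * s + t * k * w₂) with hKdef
  set W : ℕ × ℕ → ℝ := fun q => Wt (Mf q.2) (Lf q.2) (Lf q.2) (K (¡a₁ + (q.1 : ℕ)) (¡a₂ + (q.2 : ℕ))) (D (¡a₁ + (q.1 : ℕ)) (¡a₂ + (q.2 : ℕ))) with hW
  have hW0 : ∀ q, 0 ≤ W q := fun q => by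
    simp only [hW, Wt]; split_ifs
    · exact wt_nonneg _ _ _ _
    · norm_num
  have hmain := hC1 z H.z6 D (DD_per _ _ _ _ _ _ _ _ _ _) a₁ a₂ l₁ l₂ W hW0 (l₂ * (l₁ * (4 / Q * (2 / Θ) + (2 / Θ) ^ 2 / t)))
    pv (fun e he hez hep => by
      rw [sum_product_right]
      refine (abs_sum_le_sum_abs _ _).trans ?_
      calc _ ≤ ∑ j ∈ range l₂, (l₁ * (4 / Q * (2 / Θ) + (2 / Θ) ^ 2 / t) : ℝ) := sum_le_sum fun j hj => by
            have hj' := mem_range.1 hj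
            obtain ⟨u1, u2, -, -⟩ := hL1 j hj'
            refine cell_wsum H e j hj' (fun hte => ?_) Q hQ hK hl ?_ hm1 hm2 (Lf j) u1 u2 (Lf j) (hML j hj')
            · have := hep t H.tp hte; linarith [H.tz]
            · have h1 := hm0 j hj'
              have h2 : 2 * (®e * (G₁ * (®a₂ + (j : ℕ)) ^ 2)) * (®Q ^ 16) ^ 2 ≤ l₁ := le_trans gc h1
              exact_mod_cast h2
        _ = _ := by rw [sum_const, card_range, nsmul_eq_mul])
    (fun p hp => by
      obtain ⟨hp1, hp2⟩ := mem_pz.1 hp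
      have ht : ¬ ¡p ∣ ¡t := fun h => by
        have := (Nat.prime_dvd_prime_iff_eq hp1 H.tp).1 (Int.natCast_dvd_natCast.1 h)
        rw [this] at hp2; linarith [H.tz]
      have h2 := hp1.two_le
      by_cases hpg : ¡p ∣ ¡g
      · obtain ⟨f1, f2⟩ := H.fpr p hp1 (Int.natCast_dvd_natCast.1 hpg)
        have h1 := cnt_le_two (φ := φ) H.geo.det hp1 hpg ht f1
        constructor
        · have : cnt D p < p ^ 2 := lt_of_le_of_lt h1 nl
          exact_mod_cast this
        · have : cnt D p ≤ 3 * p := h1.trans nl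
          exact_mod_cast this
      · have h1 := cnt_le_rho H.hr H.geo.det hp1 hpg ht
        obtain ⟨p', rfl⟩ : ∃ p', p = p' + 1 := ⟨p - 1, om⟩
        rw [Nat.add_sub_cancel] at h1
        constructor
        · have : cnt D (p' + 1) < (p' + 1) ^ 2 := lt_of_le_of_lt h1 (by nlinarith [(rho_le_p _ : rQ (p' + 1) ≤ _)])
          exact_mod_cast this
        · have : cnt D (p' + 1) ≤ 3 * (p' + 1) := h1.trans (by nlinarith [(rho_le_three hp1 : rQ _ ≤ _)])
          exact_mod_cast this)
  set R := (range l₁ ×ˢ range l₂).filter (fun q : ℕ × ℕ => ∀ p ∈ pz z, ¬ ¡p ∣ D (¡a₁ + (q.1 : ℕ)) (¡a₂ + (q.2 : ℕ))) with hR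
  have hsum : ∑ q ∈ R, W q ≤
      2 / Θ * #S + #(R.filter fun q => ¬ IsCoprime (D (¡a₁ + (q.1 : ℕ)) (¡a₂ + (q.2 : ℕ))) ¡(Mf q.2)) := by
    rw [← sum_filter_add_sum_filter_not R (fun q => IsCoprime (D (¡a₁ + (q.1 : ℕ)) (¡a₂ + (q.2 : ℕ))) ¡(Mf q.2))]
    refine add_le_add ?_ ?_
    · have hle : ∀ q ∈ R.filter (fun q => IsCoprime (D (¡a₁ + (q.1 : ℕ)) (¡a₂ + (q.2 : ℕ))) ¡(Mf q.2)),
          W q ≤ if q ∈ S then 2 / Θ else 0 := fun q hq => by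
        rw [mem_filter, hR, mem_filter, mem_product, mem_range, mem_range] at hq
        obtain ⟨⟨⟨hq1, hq2⟩, hq3⟩, hq4⟩ := hq
        obtain ⟨u1, u2, u3, u4⟩ := hL1 q.2 hq2
        simp only [hW, Wt, if_pos hq4]
        split_ifs with hqS
        · exact (wt_le _ _ u2 _ _).trans (hML q.2 hq2)
        · by_contra! hpos
          obtain ⟨n, hn1, hn2⟩ := wt_pos hpos
          apply hqS
          refine hS q (mem_product.2 ⟨mem_range.2 hq1, mem_range.2 hq2⟩) (by push_cast; exact hq3) (by push_cast; push_cast [hMf] at hq4; exact hq4) ⟨¡(Lf q.2) + n, ?_, ?_, ?_⟩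
          · have : ®n ≤ 2 * Lf q.2 := mc hn1
            push_cast; simp only [hMf] at u3; push_cast at u3; linarith
          · have : ®0 ≤ n := Nat.cast_nonneg n
            push_cast; simp only [hMf] at u4; push_cast at u4; linarith
          · have h5 := Em_spec hq4 (K (¡a₁ + (q.1 : ℕ)) (¡a₂ + (q.2 : ℕ)))
            have h6 := dvd_add h5 (hn2.mul_left (D (¡a₁ + (q.1 : ℕ)) (¡a₂ + (q.2 : ℕ))))
            push_cast [hMf] at h6 ⊢
            obtain ⟨q0, h7⟩ := h6
            exact ⟨q0, by rw [← h7]; ring⟩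
      refine (sum_le_sum hle).trans ?_
      rw [← sum_filter, sum_const, nsmul_eq_mul, mul_comm]
      have : #((R.filter (fun q => IsCoprime (D (¡a₁ + (q.1 : ℕ)) (¡a₂ + (q.2 : ℕ))) ¡(Mf q.2))).filter (fun q => q ∈ S)) ≤ #S :=
        card_le_card fun q hq => (mem_filter.1 hq).2
      gcongr
    · rw [card_eq_sum_ones, Nat.cast_sum]
      refine sum_le_sum fun q hq => ?_
      simp only [hW, Wt, if_neg (mem_filter.1 hq).2]; simp
  have hbad := bad_count (D := fun q => DQ g r φ y₁ c y₂ w₂ t ((a₁ + q.1 : ℕ)) ((a₂ + q.2 : ℕ))) H.hg0 H.geo.det H.tp.ne_zero H.geo.f0 (fun p hp hpt => by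
      rw [(Nat.prime_dvd_prime_iff_eq hp H.tp).1 hpt]; exact H.tf) (fun p hp hpg => (H.fpr p hp hpg).1) (by linarith [H.z6]) B a₁ a₂ l₁ l₂ H.a₂0 H.B1 H.B2 rfl
      (R.filter fun q => ¬ IsCoprime (D (¡a₁ + (q.1 : ℕ)) (¡a₂ + (q.2 : ℕ))) ¡(Mf q.2)) (fun q hq => by
        rw [mem_filter, hR, mem_filter] at hq
        push_cast [hMf] at hq ⊢
        exact ⟨hq.1.1, hq.1.2, hq.2⟩)
  linarith
lemma cell_err {Z C Q t Θ V l₁ l₂ : ℝ} {C1 B : ℕ} (hC : 1 ≤ C) (hZ : 1000 * C ^ 2 + 24 * B ≤ Z)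
    (hQ : Z ^ (8 * C1 + 20) ≤ 2 * Q) (ht : Z ^ (8 * C1 + 20) ≤ t) (hΘ0 : 0 < Θ) (hΘ : 1 ≤ 6 * C * Z ^ 6 * Θ)
    (hl₁ : Z ^ (16 * C1 + 8) ≤ l₁) (hl₂ : Z ^ (16 * C1 + 8) ≤ l₂) (hV : 1 ≤ V * Z) :
    V / 4 * (l₁ * l₂) ≤ 1 / 2 * V * (l₁ * l₂)
      - (Z ^ 8) ^ C1 * (l₂ * (l₁ * (4 / Q * (2 / Θ) + (2 / Θ) ^ 2 / t)) + ((Z ^ 8) ^ C1 * (l₁ + l₂) + ((Z ^ 8) ^ C1) ^ 2))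
      - (l₂ * (B * (2 * (l₁ / Z ^ 8 + 1))) + l₁ * (B * (l₂ / Z ^ 8 + 1))) := by
  have hB : ®0 ≤ B := Nat.cast_nonneg B
  have hC2 : 1 ≤ C ^ 2 := one_le_pow₀ hC
  have hCC : C ≤ C ^ 2 := le_self_pow₀ hC two_ne_zero
  have hZ1 : 1 ≤ Z := ln
  have hZ0 : 0 < Z := ln
  rw [show 8 * C1 + 20 = 8 * C1 + 6 + 14 by ring, pow_add, pow_add, pow_mul] at hQ ht
  rw [show 16 * C1 + 8 = 8 * C1 * 2 + 8 by ring, pow_add, pow_mul, pow_mul] at hl₁ hl₂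
  set P := (Z ^ 8) ^ C1 with hP
  have hP1 : 1 ≤ P := one_le_pow₀ (one_le_pow₀ hZ1)
  have h8 : 1 ≤ Z ^ 8 := one_le_pow₀ hZ1
  have hP2 : 1 ≤ P ^ 2 := one_le_pow₀ hP1
  have hQ0 : 0 < Q := by have : 0 < P * Z ^ 6 * Z ^ 14 := pv
                         linarith
  have ht0 : 0 < t := lt_of_lt_of_le pv ht
  have hPZ : 1 ≤ P ^ 2 * Z ^ 8 := one_le_mul_of_one_le_of_one_le hP2 h8
  have hl10 : 1 ≤ l₁ := hPZ.trans hl₁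
  have hl20 : 1 ≤ l₂ := hPZ.trans hl₂
  set L := l₁ * l₂ / Z ^ 8 with hL
  have hLe : l₁ * l₂ = L * Z ^ 8 := by rw [hL]; field_simp
  have e1 : 1 / Θ ≤ 6 * C * Z ^ 6 := by rw [div_le_iff₀ hΘ0]; exact hΘ
  have e1' : 0 < 1 / Θ := pv
  have e2 : P * (4 / Q * (2 / Θ)) ≤ 96 * C / Z ^ 8 := by
    have : 1 / Q ≤ 2 / (P * Z ^ 6 * Z ^ 14) := by rw [div_le_div_iff₀ hQ0 pv]; linarith
    calc P * (4 / Q * (2 / Θ)) = 8 * P * (1 / Q) * (1 / Θ) := rg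
      _ ≤ 8 * P * (2 / (P * Z ^ 6 * Z ^ 14)) * (6 * C * Z ^ 6) := gc
      _ = 96 * C / Z ^ 14 := by field_simp; ring
      _ ≤ 96 * C / Z ^ 8 := by gcongr <;> first | exact hZ1 | norm_num
  have e3 : P * ((2 / Θ) ^ 2 / t) ≤ 144 * C ^ 2 / Z ^ 8 := by
    calc P * ((2 / Θ) ^ 2 / t) = 4 * P * (1 / Θ) ^ 2 * (1 / t) := rg
      _ ≤ 4 * P * (6 * C * Z ^ 6) ^ 2 * (1 / (P * Z ^ 6 * Z ^ 14)) := gc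
      _ = 144 * C ^ 2 / Z ^ 8 := by field_simp; ring
  have e4 : P * (l₂ * (l₁ * (4 / Q * (2 / Θ) + (2 / Θ) ^ 2 / t))) ≤ (240 * C ^ 2) * L := by
    calc _ = l₁ * l₂ * (P * (4 / Q * (2 / Θ)) + P * ((2 / Θ) ^ 2 / t)) := rg
      _ ≤ l₁ * l₂ * (96 * C / Z ^ 8 + 144 * C ^ 2 / Z ^ 8) := gc
      _ = (96 * C + 144 * C ^ 2) * L := by rw [hL]; ring
      _ ≤ _ := by gcongr; linarith
  have e5 : P ^ 2 * l₁ ≤ L := by rw [hL, le_div_iff₀ pv]; calc _ = P ^ 2 * Z ^ 8 * l₁ := rg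
      _ ≤ l₂ * l₁ := gc
      _ = _ := rg
  have e6 : P ^ 2 * l₂ ≤ L := by rw [hL, le_div_iff₀ pv]; calc _ = P ^ 2 * Z ^ 8 * l₂ := rg
      _ ≤ l₁ * l₂ := gc
  have e7 : l₁ ≤ L := (le_mul_of_one_le_left ln hP2).trans e5
  have e8 : l₂ ≤ L := (le_mul_of_one_le_left ln hP2).trans e6
  have e9 : P ^ 2 ≤ L := (le_mul_of_one_le_right ln hl20).trans e6
  have eA : l₂ * (B * (2 * (l₁ / Z ^ 8 + 1))) + l₁ * (B * (l₂ / Z ^ 8 + 1)) = B * (3 * L + 2 * l₂ + l₁) := by rw [hL]; ring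
  have eB : B * (3 * L + 2 * l₂ + l₁) ≤ B * (6 * L) := mul_le_mul_of_nonneg_left ln hB
  have hL0 : 0 ≤ L := ln
  have eC : (240 * C ^ 2 + 3 + 6 * B) * L ≤ V / 4 * (l₁ * l₂) := by
    rw [hLe]
    have h1 : Z ≤ V * Z ^ 8 := by
      have : Z ≤ Z ^ 7 := le_self_pow₀ hZ1 nn
      calc Z ≤ 1 * Z ^ 7 := ln
        _ ≤ V * Z * Z ^ 7 := gc
        _ = _ := rg
    have h2 : 240 * C ^ 2 + 3 + 6 * B ≤ V * Z ^ 8 / 4 := ln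
    calc _ ≤ V * Z ^ 8 / 4 * L := gc
      _ = _ := rg
  have h3 : P * P ^ 2 ≤ L := by
    refine le_trans ?_ e5
    rw [mul_comm]
    refine mul_le_mul_of_nonneg_left ?_ pv
    refine le_trans ?_ hl₁
    calc P ≤ P ^ 2 := le_self_pow₀ hP1 two_ne_zero
      _ ≤ P ^ 2 * Z ^ 8 := le_mul_of_one_le_right pv h8
  rw [eA, mul_add P, mul_add P]
  have : P * (P * (l₁ + l₂)) = P ^ 2 * l₁ + P ^ 2 * l₂ := rg
  rw [this]
  linarith
structure Fam (c₀ c₁ c₂ : ℤ) (κ C Z : ℝ) (M C3 G₁ g₂ g₃ g : ℕ) (r φ y₁ c y₂ w₂ : ℤ) (E m t : ℕ) : Prop where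
  geo : Geo c₁ c₂ κ C g r φ y₁ c y₂ w₂ E m
  hr : ff c₀ c₁ c₂ r = g * φ
  hg : g = G₁ * g₂ * g₃
  gl : Z ^ (3 * M + 1) ≤ g
  gu : g ≤ Z ^ (3 * M + 3)
  Gu : G₁ ≤ Z ^ M
  p2 : g₂.Prime
  p3 : g₃.Prime
  l2 : Z ^ M ≤ g₂
  l3 : Z ^ M ≤ g₃
  u2 : g₂ ≤ Z ^ (M + 5)
  u3 : g₃ ≤ Z ^ (M + 5)
  c12 : G₁.Coprime g₂
  c123 : (G₁ * g₂).Coprime g₃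
  fpr : ∀ p : ℕ, p.Prime → p ∣ g → ¬ ¡p ∣ fp c₁ c₂ r ∧ 3 ≤ p
  tp : t.Prime
  tl : ®(m * E) ≤ t * Z ^ (C3 + 1)
  tu : t * Z ^ C3 ≤ ®(m * E)
  tc : ¬ ¡t ∣ c
  tf : ¬ ¡t ∣ dd c₁ c₂ g r φ y₁ c
  tg : ¬ t ∣ g
lemma le_of_cube_le {a b : ℝ} (hb : 0 ≤ b) (h : a ^ 3 ≤ b ^ 3) : a ≤ b := le_of_pow_le_pow_left₀ three_ne_zero hb h
lemma Fam.bds {κ C Z : ℝ} {M C3 G₁ g₂ g₃ g : ℕ} {r φ y₁ c y₂ w₂ : ℤ} {E m t : ℕ} (hC : 1 ≤ C)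
    (H : Fam c₀ c₁ c₂ κ C Z M C3 G₁ g₂ g₃ g r φ y₁ c y₂ w₂ E m t) (hZ : C ≤ Z) (hM : C3 + 1 ≤ M) :
    Z ^ M ≤ E ∧ Z ^ (M - (C3 + 1)) ≤ t := by
  have hZ0 : 0 < Z := ln
  have h1 : Z ^ M ≤ E := by
    refine le_of_cube_le (Nat.cast_nonneg E) ?_
    have h2 := H.gl.trans H.geo.gE
    rw [pow_succ] at h2
    have h3 : (Z ^ M) ^ 3 * Z ≤ E ^ 3 * Z := by
      calc (Z ^ M) ^ 3 * Z = Z ^ (3 * M) * Z := rg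
        _ ≤ C * E ^ 3 := h2
        _ ≤ E ^ 3 * Z := by rw [mul_comm]; gcongr
    exact le_of_mul_le_mul_right h3 hZ0
  refine ⟨h1, ?_⟩
  have hm : ®1 ≤ m := mc H.geo.m1
  have h2 : Z ^ (M - (C3 + 1)) * Z ^ (C3 + 1) ≤ t * Z ^ (C3 + 1) := by
    rw [← pow_add, Nat.sub_add_cancel hM]
    refine le_trans ?_ H.tl
    calc Z ^ M ≤ 1 * E := ln
      _ ≤ m * E := gc
  exact le_of_mul_le_mul_right h2 pv
set_option maxHeartbeats 1000000 in
lemma cell_good : ∃ C3 : ℕ, ∀ M : ℕ, 10 * C3 + 100 ≤ M → ∀ κ C : ℝ, 0 < κ → κ ≤ 1 → 1 ≤ C → ∃ Z₀ : ℝ, ∀ Z : ℝ, Z₀ ≤ Z →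
    ∀ {c₀ c₁ c₂ : ℤ} {G₁ g₂ g₃ g : ℕ} {r φ y₁ c y₂ w₂ : ℤ} {E m t : ℕ},
    Fam c₀ c₁ c₂ κ C Z M C3 G₁ g₂ g₃ g r φ y₁ c y₂ w₂ E m t →
    1 ≤ (∏ p ∈ pz (Z ^ 8), (1 - ®(cnt (DQ g r φ y₁ c y₂ w₂ t) p) / p ^ 2)) * Z →
    ∀ S : Finset (ℕ × ℕ), (∀ s k : ℕ, ®g ≤ E * s → ®(E * s) ≤ (1 + κ) * g → ®(m * E) ≤ t * k →
      ®(t * k) ≤ (1 + κ) * (m * E) → (∀ p ∈ pz (Z ^ 8), ¬ ¡p ∣ DQ g r φ y₁ c y₂ w₂ t s k) →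
      IsCoprime (DQ g r φ y₁ c y₂ w₂ t s k) ((g * (t * k) ^ 2 : ℕ) : ℤ) →
      (∃ u : ℤ, ®u ≤ 3 * (Z ^ (6 * M) / (6 * C * g ^ 2) * ((g * (t * k) ^ 2 : ℕ) : ℝ)) ∧
        Z ^ (6 * M) / (6 * C * g ^ 2) * ((g * (t * k) ^ 2 : ℕ) : ℝ) ≤ 2 * u ∧
        ((g * (t * k) ^ 2 : ℕ) : ℤ) ∣ DQ g r φ y₁ c y₂ w₂ t s k * u +
          kQ g r φ y₁ c (y₁ * s + t * k * y₂) (c * s + t * k * w₂)) → (s, k) ∈ S) →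
    κ ^ 2 / (192 * C) * (Z ^ (6 * M) / (g * t)) * (∏ p ∈ pz (Z ^ 8), (1 - ®(cnt (DQ g r φ y₁ c y₂ w₂ t) p) / p ^ 2)) ≤ #S := by
  classical
  obtain ⟨C1, hcell⟩ := cell_count
  set q := 8 * C1 + 20 with hq
  refine ⟨32 * q + 1, fun M hM κ C hκ hκ1 hC => ⟨1000 * C ^ 2 / κ + 24 * (6 * M : ℕ), fun Z hZ₀ c₀ c₁ c₂ G₁ g₂ g₃ g r φ y₁ c y₂ w₂ E m t H hV S hS => ?_⟩⟩
  set C3 := 32 * q + 1 with hC3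
  clear_value C3 q
  have hC2 : 1 ≤ C ^ 2 := one_le_pow₀ hC
  have hCC : C ≤ C ^ 2 := le_self_pow₀ hC two_ne_zero
  have hκC : 1000 * C ^ 2 ≤ 1000 * C ^ 2 / κ := by rw [le_div_iff₀ hκ]; exact mul_le_of_le_one_right pv hκ1
  have hB0 : ®0 ≤ 24 * (6 * M : ℕ) := pv
  have hZC : 1000 * C ^ 2 ≤ Z := ln
  have hZκ : 1000 ≤ κ * Z := by
    have : 1000 * C ^ 2 / κ ≤ Z := ln
    rw [div_le_iff₀ hκ] at this; linarith
  have hZn : ∀ a : ℝ, a ≤ 1000 → a ≤ Z := fun a ha => ln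
  have hZ1 : 1 ≤ Z := hZn _ nn
  have hZ0 : 0 < Z := ln
  obtain ⟨hE, ht⟩ := H.bds hC ln om
  have hpw : ∀ {a b : ℕ}, a ≤ b → Z ^ a ≤ Z ^ b := fun h => pow_le_pow_right₀ hZ1 h
  have hm1 : ®1 ≤ m := mc H.geo.m1
  have hm5 : ®m ≤ 5 := mc H.geo.m5
  have hE0 : ®0 < E := lt_of_lt_of_le pv hE
  have ht0 : ®0 < t := lt_of_lt_of_le pv ht
  have hg0 : ®0 < g := lt_of_lt_of_le pv H.gl
  have hEg : ®E ^ 2 ≤ g := mc H.geo.E2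
  set l₁ := ⌊κ * (g / E)⌋₊ with hl₁
  set l₂ := ⌊κ * (m * E / t)⌋₊ with hl₂
  set a₁ := ⌈®(g / E)⌉₊ with ha₁
  set a₂ := ⌈®(m * E / t)⌉₊ with ha₂
  have ha₁l : ®(g / E) ≤ a₁ := Nat.le_ceil _
  have ha₁u : ®a₁ < g / E + 1 := Nat.ceil_lt_add_one pv
  have ha₂l : ®(m * E / t) ≤ a₂ := Nat.le_ceil _
  have ha₂u : ®a₂ < m * E / t + 1 := Nat.ceil_lt_add_one pv
  have hlu1 : ®l₁ ≤ κ * (g / E) := Nat.floor_le pv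
  have hlu2 : ®l₂ ≤ κ * (m * E / t) := Nat.floor_le pv
  have hp : 0 < a₂ := Nat.ceil_pos.2 pv
  set Θ := Z ^ (6 * M) / (6 * C * g ^ 2) with hΘ
  have hΘ0 : 0 < Θ := pv
  have hgE : ®E ≤ g / E := by rw [le_div_iff₀ hE0]; linarith [sq ®E]
  have hmt : Z ^ C3 ≤ m * E / t := by rw [le_div_iff₀ ht0]; linarith [H.tu]
  have hmt' : m * E / t ≤ Z ^ (C3 + 1) := by rw [div_le_iff₀ ht0]; linarith [H.tl]
  have hZE : Z ≤ E := (le_self_pow₀ hZ1 om).trans hE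
  have half : ∀ y : ℝ, 2 ≤ y → y / 2 ≤ ⌊y⌋₊ := fun y hy => by have := Nat.lt_floor_add_one y; linarith
  have hZC3 : Z ≤ Z ^ C3 := le_self_pow₀ hZ1 om
  have L1 : κ * (g / E) / 2 ≤ l₁ := half _ (by
    have : κ * Z ≤ κ * (g / E) := by gcongr; linarith only [hgE, hZE, hmt, hZC3]
    linarith only [this, hZκ])
  have L2 : κ * (m * E / t) / 2 ≤ l₂ := half _ (by
    have : κ * Z ≤ κ * (m * E / t) := by gcongr; linarith only [hgE, hZE, hmt, hZC3]
    linarith only [this, hZκ])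
  clear_value l₁ l₂ a₁ a₂ Θ
  have hA : ∀ A : ℝ, 0 ≤ A → A ≤ Z ^ (M + (4 * C3 + 10)) → A ≤ l₁ := fun A hA0 hA => by
    refine le_trans ?_ L1
    have h1 : A * 2 / κ ≤ g / E := by
      rw [le_div_iff₀ hE0]
      have h2 : A * 2 / κ ≤ Z ^ (M + (4 * C3 + 10) + 1) := by
        rw [div_le_iff₀ hκ, pow_succ]
        calc A * 2 ≤ Z ^ (M + (4 * C3 + 10)) * (κ * Z) := by gcongr; linarith only [hZκ]
          _ = _ := rg
      have h3 : (A * 2 / κ) ^ 2 ≤ g := by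
        calc (A * 2 / κ) ^ 2 ≤ (Z ^ (M + (4 * C3 + 10) + 1)) ^ 2 := gc
          _ = Z ^ ((M + (4 * C3 + 10) + 1) * 2) := by rw [pow_mul]
          _ ≤ Z ^ (3 * M + 1) := hpw om
          _ ≤ g := H.gl
      refine le_of_pow_le_pow_left₀ (n := 2) two_ne_zero hg0.le ?_
      calc (A * 2 / κ * ®E) ^ 2 = (A * 2 / κ) ^ 2 * ®E ^ 2 := rg
        _ ≤ ®g * g := gc
        _ = _ := rg
    rw [div_le_iff₀ hκ] at h1; linarith only [h1]
  have hs : ∀ i < l₁, ®g ≤ E * (®a₁ + (i : ℕ)) ∧ (E * (®a₁ + (i : ℕ)) : ℝ) ≤ (1 + κ) * g := fun i hi => by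
    have h1 : ®i + 1 ≤ l₁ := mc hi
    have h3 : ®a₁ + i ≤ (1 + κ) * (g / E) := by linarith only [h1, hlu1, ha₁u]
    have h4 : ®(g / E) ≤ a₁ + i := by linarith only [ha₁l, Nat.cast_nonneg (α := ℝ) i]
    rw [div_le_iff₀ hE0] at h4
    rw [mul_div_assoc', le_div_iff₀ hE0] at h3
    constructor <;> linarith only [h3, h4]
  have hk : ∀ j < l₂, ®(m * E) ≤ t * (®a₂ + (j : ℕ)) ∧ (t * (®a₂ + (j : ℕ)) : ℝ) ≤ (1 + κ) * (m * E) ∧ ®a₂ + (j : ℕ) ≤ 2 * Z ^ (C3 + 1) := fun i hi => by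
    have h1 : ®i + 1 ≤ l₂ := mc hi
    have h3 : ®a₂ + i ≤ (1 + κ) * (m * E / t) := by linarith only [h1, hlu2, ha₂u]
    have h4 : ®(m * E / t) ≤ a₂ + i := by linarith only [ha₂l, Nat.cast_nonneg (α := ℝ) i]
    have h5 : ®a₂ + i ≤ 2 * Z ^ (C3 + 1) := by
      refine h3.trans ?_
      gcongr; linarith only [hκ1]
    rw [div_le_iff₀ ht0] at h4
    rw [mul_div_assoc', le_div_iff₀ ht0] at h3
    refine ⟨by linarith only [h4], by linarith only [h3], h5⟩
  have h2Z : 2 * Z ^ (C3 + 1) < Z ^ (C3 + 2) := by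
    rw [pow_succ Z (C3 + 1), mul_comm]; gcongr; first | exact hZn _ nn | linarith only [hZC, hCC, hC2]
  have hsmall : ∀ j < l₂, ∀ p : ℕ, p.Prime → Z ^ (C3 + 2) ≤ p → (a₂ + j).Coprime p := fun j hj p hp hpl => by
    have h1 := (hk j hj).2.2
    have h2 : (a₂ + j : ℕ) < p := by
      have : ®((a₂ + j : ℕ)) < p := by push_cast; linarith only [h1, hpl, h2Z]
      exact_mod_cast this
    have h3 : a₂ + j ≠ 0 := om
    exact (Nat.coprime_of_lt_prime h3 h2 hp).symm
  have hΘ1 : 1 ≤ 6 * C * Z ^ 6 * Θ := by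
    rw [hΘ, mul_div_assoc', le_div_iff₀ pv, one_mul]
    calc 6 * C * ®g ^ 2 ≤ 6 * C * (Z ^ (3 * M + 3)) ^ 2 := by gcongr; exact H.gu
      _ = _ := rg
  have hgl' : Z ^ (6 * M) ≤ ®g ^ 2 := by
    calc Z ^ (6 * M) ≤ Z ^ ((3 * M + 1) * 2) := hpw om
      _ = (Z ^ (3 * M + 1)) ^ 2 := by rw [pow_mul]
      _ ≤ g ^ 2 := by gcongr; exact H.gl
  have hB2 : ∀ A : ℝ, A ≤ 10 * g ^ 2 ∨ A ≤ C * g → A < (Z ^ 8) ^ (6 * M + 1) := fun A h => by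
    have h1 : ®g ^ 2 * Z < (Z ^ 8) ^ (6 * M + 1) := by
      calc ®g ^ 2 * Z ≤ (Z ^ (3 * M + 3)) ^ 2 * Z := by gcongr; exact H.gu
        _ = Z ^ (6 * M + 7) := rg
        _ < Z ^ (8 * (6 * M + 1)) := pow_lt_pow_right₀ ln om
        _ = _ := by rw [pow_mul]
    have hg1 : ®1 ≤ g := (one_le_pow₀ hZ1).trans H.gl
    have hg2 : ®g ≤ g ^ 2 := le_self_pow₀ hg1 two_ne_zero
    rcases h with h | h
    · refine lt_of_le_of_lt (h.trans ?_) h1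
      rw [mul_comm]; gcongr; first | exact hZn _ nn | linarith only [hZC, hCC, hC2]
    · refine lt_of_le_of_lt (h.trans ?_) h1
      rw [mul_comm]; gcongr; linarith only [hZC, hCC, hC2]
  set Q := ⌊Z ^ q⌋₊ with hQ
  have hZq : Z ≤ Z ^ q := le_self_pow₀ hZ1 om
  have hQl : Z ^ q / 2 ≤ Q := half _ ln
  have hQu : ®Q ≤ Z ^ q := Nat.floor_le pv
  have hQ1 : 1 ≤ Q := Nat.one_le_floor_iff _ |>.2 ln
  clear_value Q
  have hQ16 : ®Q ^ 16 ≤ Z ^ (16 * q) := by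
    calc ®Q ^ 16 ≤ (Z ^ q) ^ 16 := gc
      _ = _ := by rw [← pow_mul, mul_comm]
  have hQ32 : (®Q ^ 16) ^ 2 ≤ Z ^ (32 * q) := by
    calc (®Q ^ 16) ^ 2 ≤ (Z ^ (16 * q)) ^ 2 := gc
      _ = _ := by rw [← pow_mul]; ring_nf
  have hcellH : Cell c₀ c₁ c₂ κ C G₁ g₂ g₃ g r φ y₁ c y₂ w₂ E m t a₁ a₂ l₁ l₂ (Z ^ 8) Θ (6 * M) := {
    geo := H.geo, hr := H.hr, hg := H.hg
    hg0 := mc hg0.ne'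
    tp := H.tp
    t8 := by
      have : ®8 < t := lt_of_lt_of_le ln ((le_self_pow₀ hZ1 om).trans ht)
      exact_mod_cast this
    tz := (hpw om).trans ht
    tc := H.tc, tf := H.tf, tg := H.tg, c12 := H.c12, c123 := H.c123
    ck := fun j hj => Nat.Coprime.mul_right (Nat.Coprime.mul_right (hsmall j hj _ H.p2 ((hpw om).trans H.l2))
        (hsmall j hj _ H.p3 ((hpw om).trans H.l3))) (hsmall j hj _ H.tp ((hpw om).trans ht))
    fpr := H.fpr
    z6 := by linarith [le_self_pow₀ hZ1 (show 8 ≠ 0 by norm_num)]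
    Θ0 := hΘ0
    Θ1 := by
      rw [hΘ, div_le_one pv]
      refine hgl'.trans (le_mul_of_one_le_left pv ln)
    a₂0 := hp
    ΘM := fun j hj => by
      push_cast
      have h1 := (hk j hj).1
      have h2 : Z ^ M ≤ t * (®a₂ + j) := by
        calc Z ^ M ≤ 1 * E := ln
          _ ≤ m * E := gc
          _ ≤ _ := h1
      calc ®2 ≤ Z / (6 * C) := by rw [le_div_iff₀ pv]; linarith
        _ ≤ Z ^ (6 * M) / (6 * C * g ^ 2) * (g * (Z ^ M) ^ 2) := by
          rw [div_mul_eq_mul_div, div_le_div_iff₀ pv pv]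
          have h3 : Z * g ≤ Z ^ (6 * M) * (Z ^ M) ^ 2 := by
            calc Z * g ≤ Z * Z ^ (3 * M + 3) := by gcongr; exact H.gu
              _ = Z ^ (3 * M + 4) := rg
              _ ≤ Z ^ (8 * M) := hpw om
              _ = _ := rg
          calc Z * (6 * C * g ^ 2) = (Z * g) * (6 * C * g) := rg
            _ ≤ Z ^ (6 * M) * (Z ^ M) ^ 2 * (6 * C * g) := gc
            _ = _ := rg
        _ ≤ Θ * (g * (t * (®a₂ + j)) ^ 2) := by rw [hΘ]; gcongr
    B1 := fun j hj => by
      apply hB2; left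
      push_cast
      have h1 := (hk j hj).2.1
      have hE1 : ®1 ≤ E := hZ1.trans hZE
      calc (g * (t * (®a₂ + j)) : ℝ) ≤ g * ((1 + κ) * (m * E)) := gc
        _ ≤ g * ((1 + 1) * (5 * (E * E))) := by gcongr; exact le_mul_of_one_le_left hE0.le hE1
        _ ≤ g * ((1 + 1) * (5 * g)) := by gcongr; linarith only [sq ®E, hEg]
        _ = _ := rg
    B2 := by
      apply hB2; right
      have h1 := H.geo.f0E
      refine le_of_mul_le_mul_right (h1.trans ?_) hg0
      have hE1 : ®1 ≤ E := hZ1.trans hZE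
      calc C * ®E ^ 3 ≤ C * E ^ 4 := by gcongr; norm_num
        _ = C * (E ^ 2 * E ^ 2) := rg
        _ ≤ C * (g * g) := gc
        _ = _ := by ring }
  have key := hcell hcellH Q hQ1
    (by
      have : ®Q ^ 16 ≤ t := hQ16.trans ((hpw om).trans ht)
      exact_mod_cast this)
    (by
      have : ®t * (Q ^ 16) ^ 2 ≤ l₁ := by
        refine le_trans ?_ L1
        have h1 : ®t * Z ^ C3 ≤ 5 * (g / E) := H.tu.trans gc
        rw [hC3, pow_succ] at h1
        have h2 : ®t * Z ^ (32 * q) * 2 ≤ κ * (g / E) := by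
          have h3 : ®t * Z ^ (32 * q) * (κ * Z) ≤ κ * (5 * (g / E)) := by
            calc _ = κ * (t * (Z ^ (32 * q) * Z)) := rg
              _ ≤ _ := gc
          have h4 : ®t * Z ^ (32 * q) * 1000 ≤ ®t * Z ^ (32 * q) * (κ * Z) := gc
          have h5 : 0 < κ * (g / E) := pv
          linarith only [h3, h4, h5]
        have h6 : ®t * (Q ^ 16) ^ 2 ≤ t * Z ^ (32 * q) := gc
        linarith only [h2, h6]
      exact_mod_cast this)
    (fun j hj => by
      refine hA _ pv ?_
      have h1 := (hk j hj).2.2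
      calc 2 * ((Z ^ 8) ^ C1 * (G₁ * (®a₂ + j) ^ 2)) * (®Q ^ 16) ^ 2
          ≤ 2 * ((Z ^ 8) ^ C1 * (Z ^ M * (2 * Z ^ (C3 + 1)) ^ 2)) * Z ^ (32 * q) := by
            gcongr
            exact H.Gu
        _ = 8 * Z ^ (8 * C1 + M + 2 * (C3 + 1) + 32 * q) := rg
        _ ≤ Z * Z ^ (8 * C1 + M + 2 * (C3 + 1) + 32 * q) := by gcongr; exact hZn _ nn
        _ = Z ^ (8 * C1 + M + 2 * (C3 + 1) + 32 * q + 1) := rg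
        _ ≤ _ := hpw om)
    (by
      have : ®(2 * g₂ * (Q ^ 16) ^ 2) ≤ l₁ := by
        refine hA _ pv ?_
        calc ®(2 * g₂ * (Q ^ 16) ^ 2) ≤ Z * Z ^ (M + 5) * Z ^ (32 * q) := by gcongr; exact hZn _ nn; exact H.u2
          _ = Z ^ (1 + (M + 5) + 32 * q) := rg
          _ ≤ _ := hpw om
      exact_mod_cast this)
    (by
      have : ®(2 * g₃ * (Q ^ 16) ^ 2) ≤ l₁ := by
        refine hA _ pv ?_
        calc ®(2 * g₃ * (Q ^ 16) ^ 2) ≤ Z * Z ^ (M + 5) * Z ^ (32 * q) := by gcongr; exact hZn _ nn; exact H.u3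
          _ = Z ^ (1 + (M + 5) + 32 * q) := rg
          _ ≤ _ := hpw om
      exact_mod_cast this)
    ((range l₁ ×ˢ range l₂).filter fun q : ℕ × ℕ => (a₁ + q.1, a₂ + q.2) ∈ S)
    (fun q hq h1 h2 h3 => by
      refine mem_filter.2 ⟨hq, ?_⟩
      simp only [mem_product, mem_range] at hq
      have e1 := hs _ hq.1
      have e2 := hk _ hq.2
      exact hS _ _ (by push_cast; exact e1.1) (by push_cast; exact e1.2) (by push_cast; exact e2.1) (by push_cast; exact e2.2.1) h1 h2 h3)
  set V := ∏ p ∈ pz (Z ^ 8), (1 - ®(cnt (DQ g r φ y₁ c y₂ w₂ t) p) / p ^ 2) with hVdef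
  clear_value V
  have hLL : Z ^ (16 * C1 + 8) ≤ ®l₂ := by
    refine le_trans ?_ L2
    have : κ * Z ^ C3 ≤ κ * (m * E / t) := gc
    have h2 : Z ^ (16 * C1 + 8) * 2 ≤ κ * Z ^ C3 := by
      calc Z ^ (16 * C1 + 8) * 2 ≤ Z ^ (16 * C1 + 8) * (κ * Z) := by gcongr; linarith only [hZκ]
        _ = κ * Z ^ (16 * C1 + 9) := rg
        _ ≤ _ := by gcongr; omega
    linarith only [this, h2]
  have herr := cell_err (Z := Z) (C := C) (Q := Q) (t := t) (Θ := Θ) (V := V) (l₁ := l₁) (l₂ := l₂) (C1 := C1) (B := 6 * M) hC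
    (by linarith only [hZ₀, hκC]) (by rw [← hq]; linarith only [hQl]) ((hpw om).trans ht) hΘ0 hΘ1 (hA _ pv (hpw om)) hLL hV
  have hcard : #((range l₁ ×ˢ range l₂).filter fun q : ℕ × ℕ => (a₁ + q.1, a₂ + q.2) ∈ S) ≤ #S := by
    refine card_le_card_of_injOn (fun q => (a₁ + q.1, a₂ + q.2)) (fun q hq => (mem_filter.1 hq).2) ?_
    rintro ⟨a, b⟩ - ⟨a', b'⟩ - h
    simp only [Prod.mk.injEq, Nat.add_left_cancel_iff] at h
    exact Prod.ext h.1 h.2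
  have hV0 : 0 ≤ V := by
    by_contra! h
    have := mul_neg_of_neg_of_pos h hZ0
    linarith
  have h1 : V / 4 * (l₁ * l₂) ≤ 2 / Θ * #S := by
    refine (herr.trans key).trans ?_
    gcongr
  have h2 : V / 4 * ((κ * (g / E) / 2) * (κ * (m * E / t) / 2)) ≤ 2 / Θ * #S := le_trans gc h1
  have h3 : Θ / 2 * (V / 4 * ((κ * (g / E) / 2) * (κ * (m * E / t) / 2))) ≤ #S := by
    calc _ ≤ Θ / 2 * (2 / Θ * #S) := gc
      _ = #S := by field_simp
  refine le_trans ?_ h3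
  have h4 : Θ / 2 * (V / 4 * ((κ * (g / E) / 2) * (κ * (m * E / t) / 2))) = m * (κ ^ 2 / (192 * C) * (Z ^ (6 * M) / (g * t)) * V) := by
    rw [hΘ]; field_simp; ring
  rw [h4]
  exact le_mul_of_one_le_left pv hm1
lemma kk_bd {c₁ c₂ : ℤ} {κ C : ℝ} {g : ℕ} {r φ y₁ c y₂ w₂ : ℤ} {E m : ℕ} (G : Geo c₁ c₂ κ C g r φ y₁ c y₂ w₂ E m)
    (hC : 1 ≤ C) (hg : 0 < g) {s τ : ℤ} (h1 : ®g ≤ E * s) (h2 : ®(E * s) ≤ (1 + κ) * g) (h3 : ®(m * E) ≤ τ)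
    (h4 : ®τ ≤ (1 + κ) * (m * E)) :
    |®(kQ g r φ y₁ c (y₁ * s + τ * y₂) (c * s + τ * w₂))| ≤ 2 * C ^ 2 * (g * τ ^ 2) := by
  obtain ⟨p1, p2, p3, p4, p5⟩ := G.pt s τ h1 h2 h3 h4
  have hid := kk_id c₁ c₂ g r φ y₁ c (y₁ * s + τ * y₂) (c * s + τ * w₂)
  rw [show c * (y₁ * s + τ * y₂) - y₁ * (c * s + τ * w₂) = τ by linear_combination τ * G.det] at hid
  set y := y₁ * s + τ * y₂
  set w := c * s + τ * w₂
  set v := r * w + g * y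
  set d := dQ g r φ y w
  set k := kQ g r φ y₁ c y w
  have hg0 : ®0 < g := mc hg
  have hm1 : ®1 ≤ m := mc G.m1
  have hE0 : ®0 ≤ E := Nat.cast_nonneg E
  have hτE : ®E ≤ τ := le_trans (le_mul_of_one_le_left hE0 hm1) h3
  have hcE : |®c| ≤ E := mc G.cE
  have hd0 : ®0 ≤ d := le_trans pv p1
  have hw : |®w| * |®k| ≤ g / C * (2 * C ^ 2 * (g * τ ^ 2)) := by
    rw [← abs_mul]
    have : ®(w * k) = v * (g * τ ^ 2) - c ^ 2 * d := mc hid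
    rw [this]
    calc |®(v * (g * τ ^ 2) - c ^ 2 * d)| ≤ |®(v * (g * τ ^ 2))| + |®(c ^ 2 * d)| := abs_sub _ _
      _ = |®v| * (g * τ ^ 2) + |®c| ^ 2 * d := by
        rw [abs_mul, abs_of_nonneg (show ®0 ≤ g * τ ^ 2 by positivity), abs_mul, abs_pow, abs_of_nonneg hd0]
      _ ≤ (C * g) * (g * τ ^ 2) + ®τ ^ 2 * (C * g ^ 2) := by
        have : |®c| ≤ τ := hcE.trans hτE
        gcongr
      _ = _ := by field_simp; ring
  have hpos : ®0 < g / C := pv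
  have h5 : g / C * |®k| ≤ g / C * (2 * C ^ 2 * (g * τ ^ 2)) := le_trans gc hw
  exact le_of_mul_le_mul_left h5 hpos
lemma pt_n {κ C x : ℝ} {g : ℕ} {r φ y₁ c y₂ w₂ : ℤ} {E m : ℕ} (G : Geo c₁ c₂ κ C g r φ y₁ c y₂ w₂ E m)
    (hr : fQ r = g * φ) (hC : 1 ≤ C) (hg : 0 < g) (hx : 100 * C ^ 4 ≤ x)
    {s τ u : ℤ} (h1 : ®g ≤ E * s) (h2 : ®(E * s) ≤ (1 + κ) * g) (h3 : ®(m * E) ≤ τ)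
    (h4 : ®τ ≤ (1 + κ) * (m * E))
    (hcop : IsCoprime (dQ g r φ (y₁ * s + τ * y₂) (c * s + τ * w₂)) (g * τ ^ 2))
    (hu1 : ®u ≤ 3 * (x / (6 * C * g ^ 2) * (g * τ ^ 2))) (hu2 : x / (6 * C * g ^ 2) * (g * τ ^ 2) ≤ 2 * u)
    (hu : ¡(g * τ ^ 2) ∣ dQ g r φ (y₁ * s + τ * y₂) (c * s + τ * w₂) * u +
      kQ g r φ y₁ c (y₁ * s + τ * y₂) (c * s + τ * w₂)) :
    ∃ n : ℕ, 1 ≤ n ∧ ®n ≤ x ∧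
      dQ g r φ (y₁ * s + τ * y₂) (c * s + τ * w₂) ∣ (c * s + τ * w₂) * n - (r * (c * s + τ * w₂) + g * (y₁ * s + τ * y₂)) ∧
      dQ g r φ (y₁ * s + τ * y₂) (c * s + τ * w₂) ∣ fQ n := by
  have hk := kk_bd G hC hg h1 h2 h3 h4
  obtain ⟨p1, p2, -, -, -⟩ := G.pt s τ h1 h2 h3 h4
  obtain ⟨n, hn⟩ := hu
  have hτ : c * (y₁ * s + τ * y₂) - y₁ * (c * s + τ * w₂) = τ := by linear_combination τ * G.det
  have hcw := cop_w hr G.det hcop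
  have hm1 : ®1 ≤ m := mc G.m1
  have hE1 : ®1 ≤ E := mc G.E1
  have hτ0 : ®0 < τ := lt_of_lt_of_le pv h3
  have hg0 : ®0 < g := mc hg
  have hM0 : ®0 < g * τ ^ 2 := pv
  have hM0z : ¡(g * τ ^ 2) ≠ 0 := by
    have : ®(¡(g * τ ^ 2)) ≠ 0 := by push_cast; exact hM0.ne'
    exact_mod_cast this
  have hd1 := dvd_ff (y₁ := y₁) (c := c) (u := u) (n := n) hr (by rw [hτ]; exact hM0z) (by rw [hτ]; exact hcop) (by rw [hτ]; exact hn)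
  have hd2 := dvd_ff' hd1 (by rw [FF_dd hr]; exact dvd_mul_left _ _) hcw
  set d := dQ g r φ (y₁ * s + τ * y₂) (c * s + τ * w₂)
  set k := kQ g r φ y₁ c (y₁ * s + τ * y₂) (c * s + τ * w₂)
  have hnR : ®(d * u + k) = g * τ ^ 2 * n := mc hn
  obtain ⟨k1, k2⟩ := abs_le.1 hk
  set Mr : ℝ := g * τ ^ 2 with hMr
  have hC4 : C ^ 2 ≤ C ^ 4 := pow_le_pow_right₀ hC nn
  have hC2 : 1 ≤ C ^ 2 := one_le_pow₀ hC
  have hx0 : 0 < x := ln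
  have hΘ : 0 < x / (6 * C * g ^ 2) * Mr := pv
  have hu0 : ®0 < u := ln
  have hd0 : ®0 ≤ d := le_trans pv p1
  have up : ®(d * u) ≤ Mr * (x / 2) := by
    calc ®(d * u) ≤ (C * g ^ 2) * (3 * (x / (6 * C * g ^ 2) * Mr)) := gc
      _ = _ := by field_simp; ring
  have lo : Mr * (x / (12 * C ^ 2)) ≤ ®(d * u) := by
    calc Mr * (x / (12 * C ^ 2)) = (g ^ 2 / C) * ((x / (6 * C * g ^ 2) * Mr) / 2) := by field_simp; ring
      _ ≤ ®d * u := by gcongr; linarith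
  have n1 : ®n ≤ x / 2 + 2 * C ^ 2 := by
    refine le_of_mul_le_mul_left ?_ hM0
    linarith
  have n2 : x / (12 * C ^ 2) - 2 * C ^ 2 ≤ n := by
    refine le_of_mul_le_mul_left ?_ hM0
    linarith
  have n3 : 4 * C ^ 2 ≤ x / (12 * C ^ 2) := by
    rw [le_div_iff₀ pv]; linarith [show 4 * C ^ 2 * (12 * C ^ 2) = 48 * C ^ 4 by ring]
  have n4 : ®1 ≤ n := ln
  have n5 : ¡1 ≤ n := mc n4
  lift n to ℕ using by omega
  refine ⟨n, mc n5, ?_, hd1, hd2⟩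
  have : ®(¡n) = n := by norm_cast
  rw [this] at n1
  linarith
lemma abs_le_of_sq {a b m : ℤ} (hm : 0 ≤ m) (ha : a ^ 2 ≤ m) (hb : b ^ 2 ≤ m) : |a * b| ≤ m := by
  rw [← sq_le_sq₀ (abs_nonneg _) hm, sq_abs, mul_pow]
  calc a ^ 2 * b ^ 2 ≤ m * m := gc
    _ = m ^ 2 := rg
lemma lat_count (K : ℕ) (n d : ℤ) (hd : 0 < d) (W : Finset (ℤ × ℤ)) (h : ∀ P ∈ W, d ∣ P.2 * n - P.1 ∧ IsCoprime P.1 P.2 ∧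
    P.1 ^ 2 ≤ K * d ∧ P.2 ^ 2 ≤ K * d ∧ d ≤ K * P.2 ^ 2) : #W ≤ (4 * K ^ 2 + 1) * (4 * K + 1) := by
  classical
  rcases W.eq_empty_or_nonempty with rfl | ⟨⟨v₀, w₀⟩, hP₀⟩
  · simp
  obtain ⟨a1, a2, a3, a4, a5⟩ := h _ hP₀
  dsimp only at a1 a2 a3 a4 a5
  have hKd : ¡0 ≤ K * d := pv
  have hw0 : w₀ ≠ 0 := by rintro rfl; simp at a5; omega
  have hIc : ∀ b : ℕ, #(Icc (-¡(2 * b)) (2 * b)) = 4 * b + 1 := fun b => by rw [Int.card_Icc]; omega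
  set f : ℤ × ℤ → ℤ := fun P => (P.1 * w₀ - v₀ * P.2) / d with hf
  have hfd : ∀ P ∈ W, d * f P = P.1 * w₀ - v₀ * P.2 := fun P hP => Int.mul_ediv_cancel' (by
    obtain ⟨⟨j, hj⟩, -⟩ := h P hP
    obtain ⟨i, hi⟩ := a1
    exact ⟨P.2 * i - j * w₀, by linear_combination P.2 * hi - w₀ * hj⟩)
  have him : W.image f ⊆ Icc (-¡(2 * K)) (2 * K) := by
    intro q hq
    obtain ⟨P, hP, rfl⟩ := mem_image.1 hq
    obtain ⟨b1, b2, b3, b4, b5⟩ := h P hP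
    have h1 : |d * f P| ≤ d * (2 * K) := by
      rw [hfd P hP]
      have := abs_sub (P.1 * w₀) (v₀ * P.2)
      have := abs_le_of_sq hKd b3 a4
      have := abs_le_of_sq hKd a3 b4
      linarith
    rw [abs_mul, abs_of_pos hd] at h1
    exact mem_Icc.2 (abs_le.1 (le_of_mul_le_mul_left h1 hd))
  have hfib : ∀ q ∈ W.image f, #{P ∈ W | f P = q} ≤ 4 * K ^ 2 + 1 := by
    intro q hq
    obtain ⟨P', hP', rfl⟩ := mem_image.1 hq
    have hj : ∀ P ∈ W, f P = f P' → ∃ j : ℤ, P.1 = P'.1 + j * v₀ ∧ P.2 = P'.2 + j * w₀ ∧ j ∈ Icc (-¡(2 * (K ^ 2 : ℕ))) (2 * (K ^ 2 : ℕ)) := by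
      intro P hP hPf
      have e : (P.1 - P'.1) * w₀ = v₀ * (P.2 - P'.2) := by
        have h1 := hfd P hP; have h2 := hfd P' hP'
        rw [hPf] at h1; linear_combination h2 - h1
      obtain ⟨j, hj⟩ : w₀ ∣ P.2 - P'.2 := a2.symm.dvd_of_dvd_mul_left ⟨P.1 - P'.1, by linear_combination -e⟩
      refine ⟨j, ?_, by linear_combination hj, ?_⟩
      · have : (P.1 - P'.1) * w₀ = (j * v₀) * w₀ := by rw [e, hj]; ring
        linear_combination mul_right_cancel₀ hw0 this
      · obtain ⟨-, -, -, b4, -⟩ := h P hP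
        obtain ⟨-, -, -, b4', -⟩ := h P' hP'
        have h1 := abs_le_of_sq hKd b4 a4
        have h2 := abs_le_of_sq hKd b4' a4
        have h3 : |j| * w₀ ^ 2 ≤ (2 * K ) * (K * w₀ ^ 2) := by
          calc |j| * w₀ ^ 2 = |P.2 * w₀ - P'.2 * w₀| := by
                rw [← abs_of_nonneg (sq_nonneg w₀), ← abs_mul]; congr 1; linear_combination (-w₀) * hj
            _ ≤ |P.2 * w₀| + |P'.2 * w₀| := abs_sub _ _
            _ ≤ 2 * K * d := ln
            _ ≤ _ := gc
        have h4 : |j| * w₀ ^ 2 ≤ (2 * (K ^ 2 : ℕ)) * w₀ ^ 2 := by push_cast; linarith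
        exact mem_Icc.2 (abs_le.1 (le_of_mul_le_mul_right h4 pv))
    rw [← hIc (K ^ 2)]
    refine (card_le_card (t := (Icc (-¡(2 * (K ^ 2 : ℕ))) (2 * (K ^ 2 : ℕ))).image fun j => (P'.1 + j * v₀, P'.2 + j * w₀)) fun P hP => ?_).trans card_image_le
    obtain ⟨hP, hPf⟩ := mem_filter.1 hP
    obtain ⟨j, e1, e2, e3⟩ := hj P hP hPf
    exact mem_image.2 ⟨j, e3, Prod.ext e1.symm e2.symm⟩
  have := card_le_mul_card_image W (4 * K ^ 2 + 1) hfib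
  refine this.trans (Nat.mul_le_mul_left _ ((card_le_card him).trans (hIc K).le))
lemma rough_div {z : ℝ} (hz : 1 < z) {F B : ℕ} (hF : F ≠ 0) (h : ®F < z ^ (B + 1)) (S : Finset ℕ)
    (hS : ∀ d ∈ S, d ∣ F ∧ ∀ p : ℕ, p.Prime → p ∣ d → z ≤ p) : #S ≤ 2 ^ B := by
  classical
  set L : Multiset ℕ := (F.primeFactorsList : Multiset ℕ).filter fun p : ℕ => z ≤ ®p with hL
  have hc : L.card ≤ B := by
    have h1 : L.prod ≤ F := Nat.le_of_dvd (Nat.pos_of_ne_zero hF) (by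
      have := Multiset.prod_dvd_prod_of_le (Multiset.filter_le (fun p : ℕ => z ≤ ®p) (F.primeFactorsList : Multiset ℕ))
      rwa [Multiset.prod_coe, Nat.prod_primeFactorsList hF] at this)
    have h2 : ∀ T : Multiset ℕ, (∀ p ∈ T, z ≤ ®p) → z ^ T.card ≤ ®((T.prod : ℕ)) := by
      intro T
      induction T using Multiset.induction with
      | empty => simp
      | cons a T ih =>
        intro hT
        have := ih fun p hp => hT p (Multiset.mem_cons_of_mem hp)
        have h3 := hT a (Multiset.mem_cons_self a T)
        rw [Multiset.card_cons, Multiset.prod_cons, pow_succ', Nat.cast_mul]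
        gcongr
    have h3 := h2 L fun p hp => (Multiset.mem_filter.1 hp).2
    have h4 : z ^ L.card < z ^ (B + 1) := h3.trans_lt (lt_of_le_of_lt (mc h1) h)
    have := (pow_lt_pow_iff_right₀ hz).1 h4
    omega
  have hinj : Set.InjOn (fun d : ℕ => (d.primeFactorsList : Multiset ℕ)) S := fun a ha b hb hab => by
    have h0 : ∀ d ∈ S, d ≠ 0 := fun d hd => ne_zero_of_dvd_ne_zero hF (hS d hd).1
    have := congrArg Multiset.prod hab
    simpa [Nat.prod_primeFactorsList (h0 a ha), Nat.prod_primeFactorsList (h0 b hb)] using this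
  calc #S = #(S.image fun d : ℕ => (d.primeFactorsList : Multiset ℕ)) := (card_image_of_injOn hinj).symm
    _ ≤ #L.powerset.toFinset := card_le_card fun T hT => by
        obtain ⟨d, hd, rfl⟩ := mem_image.1 hT
        rw [Multiset.mem_toFinset, Multiset.mem_powerset, hL, Multiset.le_filter]
        exact ⟨(Nat.primeFactorsList_sublist_of_dvd (hS d hd).1 hF).subperm, fun p hp =>
          (hS d hd).2 p (Nat.prime_of_mem_primeFactorsList hp) (Nat.dvd_of_mem_primeFactorsList hp)⟩
    _ ≤ L.powerset.card := Multiset.toFinset_card_le _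
    _ = 2 ^ L.card := Multiset.card_powerset L
    _ ≤ 2 ^ B := Nat.pow_le_pow_right two_pos hc
lemma recover {c₀ c₁ c₂ r φ r' φ' y w y' : ℤ} {g g' : ℕ} (h : fQ r = g * φ) (h' : fQ r' = g' * φ')
    (hD0 : 0 < dQ g r φ y w) (hD : dQ g r φ y w = dQ g' r' φ' y' w) (hV : r * w + g * y = r' * w + g' * y')
    (hg0 : g ≠ 0) (hcw : IsCoprime w (r * w + g * y)) (h1 : 0 ≤ r) (h2 : r < g) (h3 : 0 ≤ r') (h4 : r' < g') : g = g' ∧ r = r' ∧ y = y' := by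
  have e1 := FF_dd h y w
  have e2 := FF_dd h' y' w
  rw [← hV, ← hD, e1] at e2
  have e3 : ¡g = g' := mul_right_cancel₀ hD0.ne' e2
  have e4 : g = g' := mc e3
  subst e4
  have hg : ¡g ≠ 0 := mc hg0
  have hwg : IsCoprime ¡g w := by
    obtain ⟨a, b, hab⟩ := hcw
    exact ⟨b * y, a + b * r, by linear_combination hab⟩
  have hr : r = r' := by
    have : ¡g ∣ r - r' := hwg.dvd_of_dvd_mul_right ⟨y' - y, by linear_combination hV⟩
    have h5 := Int.eq_zero_of_abs_lt_dvd this (by rw [abs_lt]; constructor <;> linarith)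
    linarith
  subst hr
  exact ⟨rfl, rfl, mul_left_cancel₀ hg ln⟩
lemma cop_vw {c₀ c₁ c₂ r φ y w : ℤ} {g : ℕ} (h : fQ r = g * φ) (hs : Squarefree g)
    (hcw : IsCoprime (dQ g r φ y w) w) : IsCoprime w (r * w + g * y) := by
  rw [Int.isCoprime_iff_gcd_eq_one]
  by_contra hne
  obtain ⟨p, hp, hpd⟩ := Nat.exists_prime_and_dvd hne
  have hP := Nat.prime_iff_prime_int.1 hp
  have hpw : ¡p ∣ w := (Int.natCast_dvd_natCast.2 hpd).trans (Int.gcd_dvd_left ..)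
  have hpv : ¡p ∣ r * w + g * y := (Int.natCast_dvd_natCast.2 hpd).trans (Int.gcd_dvd_right ..)
  have h3 : (¡p ^ 2) ∣ g * dQ g r φ y w := by
    rw [← FF_dd h]; generalize r * w + g * y = v at *
    obtain ⟨a, rfl⟩ := hpw; obtain ⟨b, rfl⟩ := hpv
    exact ⟨p * FQ b a, by unfold FF; ring⟩
  have h4 : IsCoprime (¡p ^ 2) (dQ g r φ y w) := (hcw.symm.of_isCoprime_of_dvd_left hpw).pow_left
  have h5 : (p ^ 2 : ℕ) ∣ g := mc h4.dvd_of_dvd_mul_right h3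
  exact hp.one_lt.ne' (Nat.isUnit_iff.1 (hs p (by rwa [← sq])))
lemma mult {ι : Type*} (A : Finset ι) {z : ℝ} (hz : 1 < z) {K B : ℕ} (φ y₁ c y₂ w₂ : ℕ → ℕ → ℤ)
    (g r τ s n : ι → ℕ) (pr : ι → ℕ × ℕ × ℕ × ℕ) (y w D : ι → ℤ)
    (hinj : ∀ i ∈ A, ∀ j ∈ A, g i = g j → r i = r j → τ i = τ j → s i = s j → pr i = pr j → i = j)
    (h : ∀ i ∈ A, fQ (r i) = g i * φ (g i) (r i) ∧ c (g i) (r i) * y₂ (g i) (r i) - y₁ (g i) (r i) * w₂ (g i) (r i) = 1 ∧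
      y i = y₁ (g i) (r i) * s i + τ i * y₂ (g i) (r i) ∧ w i = c (g i) (r i) * s i + τ i * w₂ (g i) (r i) ∧
      D i = dQ (g i) (r i) (φ (g i) (r i)) (y i) (w i) ∧ r i < g i ∧ Squarefree (g i) ∧ IsCoprime (D i) (g i * τ i ^ 2) ∧
      0 < D i)
    (hD : ∀ i ∈ A, D i ∣ w i * n i - (r i * w i + g i * y i) ∧ D i ∣ fQ (n i) ∧ (r i * w i + g i * y i) ^ 2 ≤ K * D i ∧
      w i ^ 2 ≤ K * D i ∧ D i ≤ K * w i ^ 2 ∧ ∀ p : ℕ, p.Prime → ¡p ∣ D i → z ≤ p)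
    (hb : ∀ i ∈ A, ®(g i) < z ^ (B + 1) ∧ τ i ≠ 0 ∧ ®(τ i) < z ^ (B + 1) ∧ fQ (n i) ≠ 0 ∧
      ((fQ (n i)).natAbs : ℝ) < z ^ (B + 1))
    (hp : ∀ i ∈ A, (pr i).1 ∈ bigp z (g i) ∧ (pr i).2.1 ∈ bigp z (g i) ∧ (pr i).2.2.1 ∈ bigp z (g i) ∧ (pr i).2.2.2 ∈ bigp z (τ i)) :
    #A ≤ B ^ 4 * ((4 * K ^ 2 + 1) * (4 * K + 1) * (2 ^ B * #(A.image n))) := by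
  classical
  set f1 : ι → ℕ × ℤ × ℤ × ℤ := fun i => (n i, D i, r i * w i + g i * y i, w i) with hf1
  have hcop : ∀ i ∈ A, IsCoprime (w i) (r i * w i + g i * y i) := fun i hi => by
    obtain ⟨a1, a2, a3, a4, a5, a6, a7, a8, a9⟩ := h i hi
    refine cop_vw a1 a7 ?_
    rw [a5, a3, a4] at a8
    rw [a4, a3]; exact cop_w a1 a2 a8
  have s1 : #A ≤ B ^ 4 * #(A.image f1) := by
    refine card_le_mul_card_image A _ fun b hb' => ?_
    obtain ⟨i, hi, rfl⟩ := mem_image.1 hb'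
    have key : ∀ j ∈ A, f1 j = f1 i → g j = g i ∧ r j = r i ∧ τ j = τ i ∧ s j = s i := by
      intro j hj hji
      simp only [hf1, Prod.mk.injEq] at hji
      obtain ⟨-, e1, e2, e3⟩ := hji
      obtain ⟨a1, a2, a3, a4, a5, a6, a7, a8, a9⟩ := h i hi
      obtain ⟨b1, b2, b3, b4, b5, b6, b7, b8, b9⟩ := h j hj
      have hh := recover (y := y i) (w := w i) (y' := y j) a1 b1 (by rw [← a5]; exact a9) (by rw [← a5, ← e1, b5, e3])
        (by rw [← e2, e3]) om (hcop i hi) om om om om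
      obtain ⟨q1, q2, q3⟩ := hh
      have q2 : r i = r j := mc q2
      rw [← q1, ← q2] at b3 b4 b2
      rw [← q3] at b3; rw [e3] at b4
      refine ⟨q1.symm, q2.symm, ?_, ?_⟩ <;> zify
      · linear_combination (-τ j + τ i : ℤ) * a2 + c (g i) (r i) * (a3 - b3) - y₁ (g i) (r i) * (a4 - b4)
      · linear_combination (-s j + s i : ℤ) * a2 + y₂ (g i) (r i) * (a4 - b4) - w₂ (g i) (r i) * (a3 - b3)
    have hB := hb i hi
    have hgi : g i ≠ 0 := by have := (h i hi).2.2.2.2.2.1; omega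
    have c1 := bigp_card hz hgi hB.1
    have c2 := bigp_card hz hB.2.1 hB.2.2.1
    calc #{j ∈ A | f1 j = f1 i} ≤ #(bigp z (g i) ×ˢ bigp z (g i) ×ˢ bigp z (g i) ×ˢ bigp z (τ i)) := by
          refine card_le_card_of_injOn pr (fun j hj => ?_) fun j hj j' hj' e => ?_
          · obtain ⟨hj, e⟩ := mem_filter.1 (mem_coe.1 hj)
            obtain ⟨k1, k2, k3, k4⟩ := key j hj e
            have := hp j hj
            rw [k1, k3] at this
            simp only [mem_coe, mem_product]; exact this
          · obtain ⟨hj, e1⟩ := mem_filter.1 (mem_coe.1 hj)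
            obtain ⟨hj', e2⟩ := mem_filter.1 (mem_coe.1 hj')
            obtain ⟨k1, k2, k3, k4⟩ := key j hj e1
            obtain ⟨l1, l2, l3, l4⟩ := key j' hj' e2
            exact hinj j hj j' hj' (k1.trans l1.symm) (k2.trans l2.symm) (k3.trans l3.symm) (k4.trans l4.symm) e
      _ ≤ B * (B * (B * B)) := by rw [card_product, card_product, card_product]; gcongr
      _ = B ^ 4 := rg
  have s2 : #(A.image f1) ≤ (4 * K ^ 2 + 1) * (4 * K + 1) * #((A.image f1).image fun q => (q.1, q.2.1)) := by
    refine card_le_mul_card_image _ _ fun b hb' => ?_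
    obtain ⟨b1, hb1, rfl⟩ := mem_image.1 hb'
    obtain ⟨i, hi, rfl⟩ := mem_image.1 hb1
    refine le_trans (card_le_card_of_injOn (t := (A.filter fun j => n j = n i ∧ D j = D i).image fun j => (¡(r j * w j + g j * y j), w j))
      (fun q => q.2.2) (fun q hq => ?_) fun q hq q' hq' e => ?_) (lat_count K (n i) (D i) (h i hi).2.2.2.2.2.2.2.2 _ ?_)
    · obtain ⟨hq, e⟩ := mem_filter.1 (mem_coe.1 hq)
      obtain ⟨j, hj, rfl⟩ := mem_image.1 hq
      simp only [hf1, Prod.mk.injEq] at e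
      exact mem_coe.2 (mem_image.2 ⟨j, mem_filter.2 ⟨hj, e⟩, rfl⟩)
    · have e1 := (mem_filter.1 (mem_coe.1 hq)).2
      have e2 := (mem_filter.1 (mem_coe.1 hq')).2
      simp only [Prod.mk.injEq] at e1 e2
      exact Prod.ext (e1.1.trans e2.1.symm) (Prod.ext (e1.2.trans e2.2.symm) e)
    · intro P hP
      obtain ⟨j, hj, rfl⟩ := mem_image.1 hP
      obtain ⟨hj, e1, e2⟩ := mem_filter.1 hj
      obtain ⟨d1, -, d3, d4, d5, -⟩ := hD j hj
      rw [e2] at d1 d3 d4 d5; rw [e1] at d1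
      exact ⟨d1, (hcop j hj).symm, d3, d4, d5⟩
  have s3 : #((A.image f1).image fun q => (q.1, q.2.1)) ≤ 2 ^ B * #(A.image n) := by
    rw [image_image]
    have : A.image n = (A.image ((fun q : ℕ × ℤ × ℤ × ℤ => (q.1, q.2.1)) ∘ f1)).image Prod.fst := by
      rw [image_image]; rfl
    rw [this]
    refine card_le_mul_card_image _ _ fun b hb' => ?_
    obtain ⟨b1, hb1, rfl⟩ := mem_image.1 hb'
    obtain ⟨i, hi, rfl⟩ := mem_image.1 hb1
    have hB := hb i hi
    refine le_trans (card_le_card_of_injOn (t := (A.filter fun j => n j = n i).image fun j => (D j).natAbs)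
      (fun q => q.2.natAbs) (fun q hq => ?_) fun q hq q' hq' e => ?_)
      (rough_div hz (Int.natAbs_ne_zero.2 hB.2.2.2.1) hB.2.2.2.2 _ ?_)
    · obtain ⟨hq, e⟩ := mem_filter.1 (mem_coe.1 hq)
      obtain ⟨j, hj, rfl⟩ := mem_image.1 hq
      exact mem_coe.2 (mem_image.2 ⟨j, mem_filter.2 ⟨hj, e⟩, rfl⟩)
    · obtain ⟨hq, e1⟩ := (mem_filter.1 (mem_coe.1 hq))
      obtain ⟨hq', e2⟩ := (mem_filter.1 (mem_coe.1 hq'))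
      obtain ⟨j, hj, rfl⟩ := mem_image.1 hq
      obtain ⟨j', hj', rfl⟩ := mem_image.1 hq'
      have p1 := (h j hj).2.2.2.2.2.2.2.2
      have p2 := (h j' hj').2.2.2.2.2.2.2.2
      have e : (D j).natAbs = (D j').natAbs := e
      exact Prod.ext (e1.trans e2.symm) (show D j = D j' by omega)
    · intro d hd
      obtain ⟨j, hj, rfl⟩ := mem_image.1 hd
      obtain ⟨hj, e1⟩ := mem_filter.1 hj
      obtain ⟨-, d2, -, -, -, d6⟩ := hD j hj
      rw [e1] at d2
      exact ⟨Int.natAbs_dvd_natAbs.2 d2, fun p hp hpd => d6 p hp (Int.natCast_dvd.2 hpd)⟩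
  calc #A ≤ _ := s1
    _ ≤ _ := by gcongr; exact s2.trans (Nat.mul_le_mul_left _ s3)
end
section
open Finset Real NumberField
variable {c₀ c₁ c₂ : ℤ}
noncomputable def SI (K : Type) [Field K] [NumberField K] (y : ℕ) : Finset (Ideal (𝓞 K)) :=
  haveI := Classical.decEq (Ideal (𝓞 K))
  (Ideal.finite_setOfPred_absNorm_le (S := 𝓞 K) y).toFinset.erase ⊥
section
variable {K : Type} [Field K] [NumberField K]
lemma mem_SI {y : ℕ} {I : Ideal (𝓞 K)} : I ∈ SI K y ↔ I ≠ ⊥ ∧ Ideal.absNorm I ≤ y := by simp [SI]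
lemma SI_asymp (K : Type) [Field K] [NumberField K] : ∃ κ : ℝ, 0 < κ ∧ ∀ ε : ℝ, 0 < ε → ∃ u₀ : ℝ, 1 ≤ u₀ ∧ ∀ y N : ℕ, u₀ ≤ ®y / N →
    |(#(SI K (y / N)) : ℝ) - κ * (®y / N)| ≤ ε * (®y / N) := by
  obtain ⟨κ, hκ, ht⟩ : ∃ κ : ℝ, 0 < κ ∧ Filter.Tendsto (fun s : ℝ =>
      (Nat.card {I : nonZeroDivisors (Ideal (𝓞 K)) // (Ideal.absNorm (I : Ideal (𝓞 K)) : ℝ) ≤ s} : ℝ) / s) Filter.atTop (nhds κ) := by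
    refine ⟨_, ?_, NumberField.Ideal.tendsto_norm_le_div_atTop₀ K⟩
    have := Units.regulator_pos K
    have h2 := NumberField.discr_ne_zero K
    have h3 : 0 < classNumber K := Fintype.card_pos
    have h4 := Units.torsionOrder_pos K
    positivity
  refine ⟨κ, hκ, fun ε hε => ?_⟩
  obtain ⟨u, hu⟩ := Metric.tendsto_atTop.1 ht ε hε
  refine ⟨max u 1, le_max_right _ _, fun y N hyN => ?_⟩
  have h := hu _ ((le_max_left _ _).trans hyN)
  have hpos : ®0 < y / N := lt_of_lt_of_le one_pos ((le_max_right _ _).trans hyN)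
  have hcard : Nat.card {I : nonZeroDivisors (Ideal (𝓞 K)) // (Ideal.absNorm (I : Ideal (𝓞 K)) : ℝ) ≤ ®y / N} = #(SI K (y / N)) := by
    have hle : ∀ n : ℕ, ®n ≤ ®y / N ↔ n ≤ y / N := fun n => by
      rw [← Nat.floor_div_eq_div (K := ℝ), Nat.le_floor_iff hpos.le]
    rw [← Nat.card_eq_finsetCard]
    refine Nat.card_congr (Equiv.ofBijective (fun I => ⟨I.1.1, mem_SI.2 ⟨nonZeroDivisors.ne_zero I.1.2, (hle _).1 I.2⟩⟩)
      ⟨fun I J h => ?_, fun I => ?_⟩)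
    · exact Subtype.ext (Subtype.ext (by simpa using h))
    · obtain ⟨h1, h2⟩ := mem_SI.1 I.2
      exact ⟨⟨⟨I.1, mem_nonZeroDivisors_of_ne_zero h1⟩, (hle _).2 h2⟩, rfl⟩
  rw [hcard, Real.dist_eq, div_sub' hpos.ne', abs_div, abs_of_pos hpos, div_lt_iff₀ hpos, mul_comm (®y / N)] at h
  exact h.le
open Classical in
lemma SI_dvd (y : ℕ) {J : Ideal (𝓞 K)} (hJ : J ≠ ⊥) : #{I ∈ SI K y | J ∣ I} = #(SI K (y / Ideal.absNorm J)) := by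
  have hN : 0 < Ideal.absNorm J := Nat.pos_of_ne_zero fun h => hJ (Ideal.absNorm_eq_zero_iff.1 h)
  refine (card_bij (fun I _ => J * I) (fun I hI => ?_) (fun I _ I' _ h => mul_left_cancel₀ hJ h) fun I hI => ?_).symm
  · obtain ⟨h1, h2⟩ := mem_SI.1 hI
    refine mem_filter.2 ⟨mem_SI.2 ⟨mul_ne_zero hJ h1, ?_⟩, dvd_mul_right _ _⟩
    rw [map_mul, mul_comm]; exact (Nat.le_div_iff_mul_le hN).1 h2
  · obtain ⟨hI, I', rfl⟩ := mem_filter.1 hI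
    obtain ⟨h1, h2⟩ := mem_SI.1 hI
    refine ⟨I', mem_SI.2 ⟨right_ne_zero_of_mul h1, ?_⟩, rfl⟩
    rw [map_mul, mul_comm] at h2; exact (Nat.le_div_iff_mul_le hN).2 h2
lemma absNorm_pos' {I : Ideal (𝓞 K)} (h : I ≠ ⊥) : 0 < Ideal.absNorm I :=
  Nat.pos_of_ne_zero fun h' => h (Ideal.absNorm_eq_zero_iff.1 h')
lemma prime_of_norm {P : Ideal (𝓞 K)} (h : (Ideal.absNorm P).Prime) : Prime P :=
  UniqueFactorizationMonoid.irreducible_iff_prime.1 (Ideal.irreducible_of_irreducible_absNorm h)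
lemma T_lower (y : ℕ) : ∑ P ∈ SI K y with (Ideal.absNorm P).Prime, log (Ideal.absNorm P) * #(SI K (y / Ideal.absNorm P)) ≤
    ∑ I ∈ SI K y, log (Ideal.absNorm I) := by
  classical
  calc _ = ∑ P ∈ SI K y with (Ideal.absNorm P).Prime, ∑ I ∈ SI K y with P ∣ I, log (Ideal.absNorm P) := sum_congr rfl fun P hP => by
        rw [sum_const, SI_dvd y (mem_SI.1 (mem_filter.1 hP).1).1, nsmul_eq_mul, mul_comm]
    _ = ∑ I ∈ SI K y, ∑ P ∈ ((SI K y).filter fun P => (Ideal.absNorm P).Prime) with P ∣ I, log (Ideal.absNorm P) := by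
        simp_rw [sum_filter (fun I => _ ∣ I), sum_filter (fun P => P ∣ _)]; exact sum_comm
    _ ≤ _ := sum_le_sum fun I hI => by
        obtain ⟨h1, h2⟩ := mem_SI.1 hI
        rw [← log_prod fun P hP => by
          have := (mem_filter.1 (mem_filter.1 hP).1).2.pos; positivity]
        refine log_le_log (prod_pos fun P hP => by
          have := (mem_filter.1 (mem_filter.1 hP).1).2.pos; positivity) ?_
        have h3 := Finset.prod_primes_dvd I (s := ((SI K y).filter fun P => (Ideal.absNorm P).Prime).filter fun P => P ∣ I)
          (fun P hP => prime_of_norm (mem_filter.1 (mem_filter.1 hP).1).2) (fun P hP => (mem_filter.1 hP).2)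
        have h4 := Nat.le_of_dvd (absNorm_pos' h1) (map_dvd Ideal.absNorm h3)
        rw [map_prod] at h4
        exact_mod_cast h4
open Classical in
lemma T_upper (y : ℕ) : ∑ I ∈ SI K y, log (Ideal.absNorm I) ≤
    ∑ P ∈ SI K y with Prime P, ∑ k ∈ Icc 1 y, log (Ideal.absNorm P) * #(SI K (y / Ideal.absNorm P ^ k)) := by
  calc _ ≤ ∑ I ∈ SI K y, ∑ P ∈ SI K y with Prime P, ∑ k ∈ Icc 1 y, if P ^ k ∣ I then log (Ideal.absNorm P) else 0 := sum_le_sum fun I hI => by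
        obtain ⟨h1, h2⟩ := mem_SI.1 hI
        set m := UniqueFactorizationMonoid.normalizedFactors I with hm
        have hprod : m.prod = I := Ideal.prod_normalizedFactors_eq_self h1
        have hPm : ∀ P ∈ m, Prime P ∧ P ∈ SI K y := fun P hP => by
          have hp := UniqueFactorizationMonoid.prime_of_normalized_factor P hP
          exact ⟨hp, mem_SI.2 ⟨hp.ne_zero, (Nat.le_of_dvd (absNorm_pos' h1) (map_dvd Ideal.absNorm
            (UniqueFactorizationMonoid.dvd_of_mem_normalizedFactors hP))).trans h2⟩⟩
        have h2P : ∀ P ∈ m, 2 ≤ Ideal.absNorm P := fun P hP => by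
          have h3 := absNorm_pos' (mem_SI.1 (hPm P hP).2).1
          have h4 : Ideal.absNorm P ≠ 1 := fun h => (hPm P hP).1.not_unit (Ideal.isUnit_iff.2 (Ideal.absNorm_eq_one_iff.1 h))
          omega
        have e1 : log (Ideal.absNorm I) = ∑ P ∈ m.toFinset, ®(m.count P) * log (Ideal.absNorm P) := by
          conv_lhs => rw [← hprod, map_multiset_prod, Finset.prod_multiset_map_count]
          push_cast
          rw [log_prod fun P hP => by have := h2P P (Multiset.mem_toFinset.1 hP); positivity]
          simp
        rw [e1]
        refine (sum_le_sum fun P hP => ?_).trans (sum_le_sum_of_subset_of_nonneg (s := m.toFinset) (fun P hP => ?_) fun P _ _ =>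
          sum_nonneg fun k _ => by split_ifs; exacts [log_natCast_nonneg _, le_rfl])
        · replace hP := Multiset.mem_toFinset.1 hP
          rw [← sum_filter, sum_const, nsmul_eq_mul]
          gcongr
          have hd : ∀ k ≤ m.count P, P ^ k ∣ I := fun k hk => by
            have := Multiset.prod_dvd_prod_of_le (Multiset.le_count_iff_replicate_le.1 hk)
            rwa [Multiset.prod_replicate, hprod] at this
          have hc : m.count P ≤ y := by
            have h5 := Nat.le_of_dvd (absNorm_pos' h1) (map_dvd Ideal.absNorm (hd _ le_rfl))
            rw [map_pow] at h5
            have h6 := Nat.pow_le_pow_left (h2P P hP) (m.count P)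
            have h7 := (m.count P).lt_two_pow_self
            omega
          calc m.count P = #(Icc 1 (m.count P)) := sm
            _ ≤ _ := card_le_card fun k hk => by
                obtain ⟨a, b⟩ := mem_Icc.1 hk
                exact mem_filter.2 ⟨mem_Icc.2 ⟨a, b.trans hc⟩, hd k b⟩
        · obtain ⟨a, b⟩ := hPm P (Multiset.mem_toFinset.1 hP)
          exact mem_filter.2 ⟨b, a⟩
    _ = ∑ P ∈ SI K y with Prime P, ∑ k ∈ Icc 1 y, ∑ I ∈ SI K y, if P ^ k ∣ I then log (Ideal.absNorm P) else 0 := by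
        rw [sum_comm]; exact sum_congr rfl fun P _ => sum_comm
    _ = _ := sum_congr rfl fun P hP => sum_congr rfl fun k _ => by
        rw [← sum_filter, sum_const, SI_dvd y (pow_ne_zero _ (mem_SI.1 (mem_filter.1 hP).1).1), nsmul_eq_mul, mul_comm, map_pow]
end
lemma geo_tail {n : ℕ} (hn : 2 ≤ n) (a y : ℕ) : ∑ k ∈ Icc a y, ®1 / ®n ^ k ≤ 2 / ®n ^ a := by
  have hn' : ®2 ≤ n := mc hn
  have hx : (1 / ®n) ≤ 1 / 2 := one_div_le_one_div_of_le two_pos hn'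
  rw [← Finset.Ico_succ_right_eq_Icc]
  simp_rw [← one_div_pow]
  refine (geom_sum_Ico_le_of_lt_one pv ln).trans ?_
  rw [div_le_iff₀ ln, one_div_pow, div_mul_eq_mul_div]
  gcongr; linarith
section
variable {K : Type} [Field K] [NumberField K]
noncomputable def nu (K : Type) [Field K] [NumberField K] (p : ℕ) : ℕ := #{P ∈ SI K p | Ideal.absNorm P = p}
lemma sum_nu (y : ℕ) (h : ℕ → ℝ) : ∑ P ∈ SI K y with (Ideal.absNorm P).Prime, h (Ideal.absNorm P) =
    ∑ p ∈ (range (y + 1)).filter Nat.Prime, ®(nu K p) * h p := by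
  rw [← sum_fiberwise_of_maps_to (t := (range (y + 1)).filter Nat.Prime) (g := fun P => Ideal.absNorm P) fun P hP => by
    obtain ⟨h1, h2⟩ := mem_filter.1 hP
    exact mem_filter.2 ⟨mem_range.2 (Nat.lt_succ_of_le (mem_SI.1 h1).2), h2⟩]
  refine sum_congr rfl fun p hp => ?_
  obtain ⟨h1, h2⟩ := mem_filter.1 hp
  rw [sum_congr rfl fun P hP => by rw [(mem_filter.1 hP).2], sum_const, nsmul_eq_mul, nu]
  congr 3
  ext P
  simp only [mem_filter, mem_SI]
  have := mem_range.1 h1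
  constructor
  · rintro ⟨⟨⟨a, b⟩, c⟩, d⟩; exact ⟨⟨a, d.le⟩, d⟩
  · rintro ⟨⟨a, b⟩, d⟩; exact ⟨⟨⟨a, om⟩, d ▸ h2⟩, d⟩
lemma over_p {P : Ideal (𝓞 K)} (hP : Prime P) : (Ideal.absNorm P).minFac.Prime ∧
    P ∣ Ideal.span {((Ideal.absNorm P).minFac : 𝓞 K)} ∧ ∃ f, 1 ≤ f ∧ Ideal.absNorm P = (Ideal.absNorm P).minFac ^ f := by
  have hP' : P.IsPrime := Ideal.isPrime_of_prime hP
  have hn1 : Ideal.absNorm P ≠ 1 := fun h => hP.not_unit (Ideal.isUnit_iff.2 (Ideal.absNorm_eq_one_iff.1 h))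
  have hn0 : Ideal.absNorm P ≠ 0 := (absNorm_pos' hP.ne_zero).ne'
  obtain ⟨p, hp, hpP⟩ : ∃ p : ℕ, p.Prime ∧ (p : 𝓞 K) ∈ P := by
    by_contra hcon; push Not at hcon
    have : ∀ n : ℕ, n ≠ 0 → (n : 𝓞 K) ∉ P := by
      intro n
      induction n using Nat.recOnMul with
      | zero => simp
      | one => intro _ h; exact hP'.ne_top ((Ideal.eq_top_iff_one _).2 (by simpa using h))
      | prime p hp => exact fun _ => hcon p hp
      | mul a b ha hb =>
        intro hab h; push_cast at h
        rcases hP'.mem_or_mem h with h | h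
        · exact ha (left_ne_zero_of_mul hab) h
        · exact hb (right_ne_zero_of_mul hab) h
    exact this _ hn0 (Ideal.absNorm_mem P)
  have hd : P ∣ Ideal.span {(p : 𝓞 K)} := Ideal.dvd_span_singleton.2 hpP
  have h1 := map_dvd Ideal.absNorm hd
  rw [Ideal.absNorm_span_natCast] at h1
  obtain ⟨f, -, hf⟩ := (Nat.dvd_prime_pow hp).1 h1
  have hf1 : 1 ≤ f := by rcases Nat.eq_zero_or_pos f with rfl | h; · simp at hf; exact absurd (by simpa using hf) hn1
                         · exact h
  have hm : (Ideal.absNorm P).minFac = p := by rw [hf, hp.pow_minFac om]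
  rw [hm]; exact ⟨hp, hd, f, hf1, hf⟩
open Classical in
lemma fib_le (y p : ℕ) (hp : p.Prime) : #{P ∈ SI K y | Prime P ∧ (Ideal.absNorm P).minFac = p} ≤ Module.finrank ℤ (𝓞 K) := by
  set S := (SI K y).filter fun P => Prime P ∧ (Ideal.absNorm P).minFac = p
  have h1 : ∏ P ∈ S, P ∣ Ideal.span {(p : 𝓞 K)} := Finset.prod_primes_dvd _ (fun P hP => (mem_filter.1 hP).2.1) fun P hP => by
    obtain ⟨-, h1, h2⟩ := mem_filter.1 hP
    rw [← h2]; exact (over_p h1).2.1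
  have h2 := map_dvd Ideal.absNorm h1
  rw [map_prod, Ideal.absNorm_span_natCast] at h2
  have h3 : p ^ #S ≤ ∏ P ∈ S, Ideal.absNorm P := by
    rw [← prod_const]
    refine prod_le_prod' fun P hP => ?_
    obtain ⟨-, h1, h2⟩ := mem_filter.1 hP
    obtain ⟨-, -, f, hf, h⟩ := over_p h1
    rw [h, h2]; exact Nat.le_self_pow om p
  exact (Nat.pow_le_pow_iff_right hp.one_lt).1 (h3.trans (Nat.le_of_dvd (pow_pos hp.pos _) h2))
lemma nu_le (p : ℕ) (hp : p.Prime) : nu K p ≤ Module.finrank ℤ (𝓞 K) := by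
  classical
  refine (card_le_card fun P hP => ?_).trans (fib_le (K := K) p p hp)
  obtain ⟨h1, h2⟩ := mem_filter.1 hP
  exact mem_filter.2 ⟨h1, prime_of_norm (h2 ▸ hp), by rw [h2, hp.minFac_eq]⟩
open Classical in
lemma bad_one (y : ℕ) {P : Ideal (𝓞 K)} (hP : Prime P) : ∑ k ∈ Icc 1 y with ¬ (k = 1 ∧ (Ideal.absNorm P).Prime),
    log (Ideal.absNorm P) / ®(Ideal.absNorm P) ^ k ≤ 8 * (1 / ®((Ideal.absNorm P).minFac) ^ ®(3 / 2)) := by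
  obtain ⟨hp, -, f, hf, hN⟩ := over_p hP
  set p := (Ideal.absNorm P).minFac
  set n := Ideal.absNorm P
  have hp2 : ®2 ≤ p := mc hp.two_le
  have hn2 : 2 ≤ n := by rw [hN]; exact hp.two_le.trans (Nat.le_self_pow om p)
  have hn0 : ®0 < n := pv
  have hlog : 0 ≤ log n := log_natCast_nonneg n
  have key : ∀ a : ℕ, (∀ k ∈ Icc 1 y, ¬ (k = 1 ∧ n.Prime) → a ≤ k) → log n * (2 / ®n ^ a) ≤ 8 * (1 / ®p ^ ®(3 / 2)) →
      ∑ k ∈ Icc 1 y with ¬ (k = 1 ∧ n.Prime), log n / ®n ^ k ≤ 8 * (1 / ®p ^ ®(3 / 2)) := fun a ha hb => by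
    refine le_trans ?_ hb
    calc _ ≤ ∑ k ∈ Icc a y, log n / ®n ^ k := sum_le_sum_of_subset_of_nonneg (fun k hk => by
          obtain ⟨h1, h2⟩ := mem_filter.1 hk
          exact mem_Icc.2 ⟨ha k h1 h2, (mem_Icc.1 h1).2⟩) fun k _ _ => pv
      _ = log n * ∑ k ∈ Icc a y, 1 / ®n ^ k := by rw [mul_sum]; exact sum_congr rfl fun k _ => rg
      _ ≤ _ := by gcongr; exact geo_tail hn2 a y
  by_cases h : n.Prime
  · refine key 2 (fun k hk h' => ?_) ?_
    · have := (mem_Icc.1 hk).1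
      by_contra h3; exact h' ⟨om, h⟩
    · have hnp : n = p := h.minFac_eq.symm
      rw [← hnp]
      have h1 := log_le_rpow_div hn0.le (show ®0 < 1 / 2 by norm_num)
      have h2 : ®n ^ 2 = ®n ^ ®(1 / 2) * ®n ^ ®(3 / 2) := by
        rw [← rpow_add hn0, ← rpow_natCast]; norm_num
      have h3 : ®0 < ®n ^ ®(1 / 2) := pv
      have h4 : ®0 < ®n ^ ®(3 / 2) := pv
      rw [h2]
      calc _ ≤ (®n ^ ®(1 / 2) / (1 / 2)) * (2 / (®n ^ ®(1 / 2) * ®n ^ ®(3 / 2))) := gc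
        _ = 4 * (1 / ®n ^ ®(3 / 2)) := by field_simp; norm_num
        _ ≤ _ := by gcongr; norm_num
  · refine key 1 (fun k hk _ => (mem_Icc.1 hk).1) ?_
    have hf2 : 2 ≤ f := by
      rcases eq_or_lt_of_le hf with rfl | h'
      · exact absurd (by rw [hN, pow_one]; exact hp) h
      · exact h'
    have hpn : ®p ^ 2 ≤ n := by rw [hN]; push_cast; exact pow_le_pow_right₀ ln hf2
    have h1 := log_le_rpow_div hn0.le (show ®0 < 1 / 4 by norm_num)
    have h2 : ®n ^ 1 = ®n ^ ®(1 / 4) * ®n ^ ®(3 / 4) := by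
      rw [← rpow_add hn0, ← rpow_natCast]; norm_num
    have h3 : ®0 < ®n ^ ®(1 / 4) := pv
    have h4 : ®p ^ ®(3 / 2) ≤ ®n ^ ®(3 / 4) := by
      calc ®p ^ ®(3 / 2) = (®p ^ 2) ^ ®(3 / 4) := by
            rw [← rpow_natCast, ← rpow_mul pv]; norm_num
        _ ≤ _ := gc
    rw [h2]
    calc _ ≤ (®n ^ ®(1 / 4) / (1 / 4)) * (2 / (®n ^ ®(1 / 4) * ®n ^ ®(3 / 4))) := gc
      _ = 8 * (1 / ®n ^ ®(3 / 4)) := by field_simp; norm_num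
      _ ≤ _ := gc
open Classical in
lemma bad_all (K : Type) [Field K] [NumberField K] : ∃ Cb : ℝ, 0 ≤ Cb ∧ ∀ y : ℕ, ∑ P ∈ SI K y with Prime P, ∑ k ∈ Icc 1 y with ¬ (k = 1 ∧ (Ideal.absNorm P).Prime),
    log (Ideal.absNorm P) / ®(Ideal.absNorm P) ^ k ≤ Cb := by
  have hs : Summable fun n : ℕ => 8 * (1 / ®n ^ ®(3 / 2)) := (Real.summable_one_div_nat_rpow.2 nn).mul_left 8
  refine ⟨Module.finrank ℤ (𝓞 K) * ∑' n : ℕ, 8 * (1 / ®n ^ ®(3 / 2)), mul_nonneg pv (tsum_nonneg fun n => pv), fun y => ?_⟩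
  have hm : ∀ P ∈ (SI K y).filter fun P => Prime P, (Ideal.absNorm P).minFac ∈ (range (y + 1)).filter Nat.Prime := fun P hP => by
    obtain ⟨h1, h2⟩ := mem_filter.1 hP
    have := (Nat.minFac_le (absNorm_pos' h2.ne_zero)).trans (mem_SI.1 h1).2
    exact mem_filter.2 ⟨mem_range.2 om, (over_p h2).1⟩
  calc _ ≤ ∑ P ∈ SI K y with Prime P, 8 * (1 / ®((Ideal.absNorm P).minFac) ^ ®(3 / 2)) := sum_le_sum fun P hP => bad_one y (mem_filter.1 hP).2
    _ = ∑ p ∈ (range (y + 1)).filter Nat.Prime, ∑ P ∈ ((SI K y).filter fun P => Prime P) with (Ideal.absNorm P).minFac = p,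
        8 * (1 / ®((Ideal.absNorm P).minFac) ^ ®(3 / 2)) := (sum_fiberwise_of_maps_to hm _).symm
    _ ≤ ∑ p ∈ (range (y + 1)).filter Nat.Prime, Module.finrank ℤ (𝓞 K) * (8 * (1 / ®p ^ ®(3 / 2))) := sum_le_sum fun p hp => by
        rw [sum_congr rfl fun P hP => by rw [(mem_filter.1 hP).2], sum_const, nsmul_eq_mul, filter_filter]
        gcongr
        exact fib_le y p (mem_filter.1 hp).2
    _ ≤ _ := by
        rw [← mul_sum]
        gcongr
        exact hs.sum_le_tsum _ fun n _ => pv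
end
end
section
open Finset Real NumberField Filter
variable {c₀ c₁ c₂ : ℤ}
section
variable (K : Type) [Field K] [NumberField K]
noncomputable def Wn (y : ℕ) : ℝ := ∑ p ∈ (range (y + 1)).filter Nat.Prime, ®(nu K p) * (log p / p)
lemma SI_mono {a b : ℕ} (h : a ≤ b) : SI K a ⊆ SI K b := fun I hI => by
  rw [mem_SI] at *; exact ⟨hI.1, hI.2.trans h⟩
lemma SI_bd {κ η u₀ : ℝ} (hκ : 0 < κ) (hη : 0 < η)
    (hu : ∀ y N : ℕ, u₀ ≤ ®y / N → |(#(SI K (y / N)) : ℝ) - κ * (®y / N)| ≤ η * (®y / N)) :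
    ∃ C : ℝ, 0 < C ∧ ∀ y N : ℕ, (#(SI K (y / N)) : ℝ) ≤ C * (®y / N) := by
  refine ⟨κ + η + #(SI K ⌈u₀⌉₊), pv, fun y N => ?_⟩
  rcases le_or_gt u₀ (®y / N) with h | h
  · have h1 := (abs_le.1 (hu y N h)).2
    have : 0 ≤ (#(SI K ⌈u₀⌉₊) : ℝ) * (®y / N) := pv
    linarith
  · rcases Nat.eq_zero_or_pos (y / N) with h0 | h0
    · have : SI K 0 = ∅ := by
        ext I; simp only [mem_SI, nonpos_iff_eq_zero, notMem_empty, iff_false]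
        exact fun h => h.1 (Ideal.absNorm_eq_zero_iff.1 h.2)
      rw [h0, this, card_empty]; push_cast; positivity
    · have h1 : ®((y / N : ℕ)) ≤ ®y / N := Nat.cast_div_le
      have h2 : ®1 ≤ (y / N : ℕ) := mc h0
      have h3 : y / N ≤ ⌈u₀⌉₊ := mc (h1.trans h.le).trans (Nat.le_ceil _)
      have h4 : (#(SI K (y / N)) : ℝ) ≤ #(SI K ⌈u₀⌉₊) := mc card_le_card (SI_mono K h3)
      calc (#(SI K (y / N)) : ℝ) ≤ #(SI K ⌈u₀⌉₊) * 1 := ln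
        _ ≤ (κ + η + #(SI K ⌈u₀⌉₊)) * (®y / N) := by gcongr <;> linarith
lemma log_ev (A : ℝ) {δ : ℝ} (hδ : 0 < δ) : ∀ᶠ y : ℕ in atTop, A ≤ δ * log y := by
  have := (Real.tendsto_log_atTop.comp tendsto_natCast_atTop_atTop).const_mul_atTop hδ
  exact this.eventually_ge_atTop A
lemma M1_up {ε : ℝ} (hε : 0 < ε) (hε1 : ε ≤ 1) : ∀ᶠ y : ℕ in atTop, Wn K y ≤ (1 + ε) * log y := by
  obtain ⟨κ, hκ, h⟩ := SI_asymp K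
  obtain ⟨u₀, hu0, hu⟩ := h (κ * (ε / 8)) pv
  set U := ⌈u₀⌉₊
  have hU : u₀ ≤ U := Nat.le_ceil _
  have hU0 : 0 < ®U := ln
  filter_upwards [log_ev (log U) (show 0 < ε / 4 by positivity), eventually_ge_atTop 1] with y hy hy1
  have hy1' : ®1 ≤ y := mc hy1
  set x := y * U with hx
  have hx' : ®x = y * U := by rw [hx]; push_cast; ring
  have hx0 : ®0 < x := by rw [hx']; positivity
  have hyx : y ≤ x := Nat.le_mul_of_pos_right y (mc hU0)
  have hl : log x = log y + log U := by rw [hx', log_mul pv pv]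
  have t1 : ∑ I ∈ SI K x, log (Ideal.absNorm I) ≤ (κ + κ * (ε / 8)) * x * log x := by
    have h1 := (abs_le.1 (hu x 1 (by rw [Nat.cast_one, div_one, hx']; nlinarith))).2
    rw [Nat.div_one, Nat.cast_one, div_one] at h1
    calc _ ≤ ∑ I ∈ SI K x, log x := sum_le_sum fun I hI => by
          obtain ⟨h1, h2⟩ := mem_SI.1 hI
          have := absNorm_pos' h1
          exact log_le_log pv (mc h2)
      _ = #(SI K x) * log x := by rw [sum_const, nsmul_eq_mul]
      _ ≤ _ := by gcongr; linarith
  have t2 : (κ - κ * (ε / 8)) * x * Wn K y ≤ ∑ I ∈ SI K x, log (Ideal.absNorm I) := by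
    refine le_trans ?_ (T_lower x)
    rw [Wn, ← sum_nu y (fun n => log n / n), mul_sum]
    refine (sum_le_sum fun P hP => ?_).trans (sum_le_sum_of_subset_of_nonneg (filter_subset_filter _ (SI_mono K hyx)) fun P _ _ => ?_)
    · obtain ⟨h1, h2⟩ := mem_filter.1 hP
      obtain ⟨h3, h4⟩ := mem_SI.1 h1
      have hN : ®0 < Ideal.absNorm P := by have := h2.pos; positivity
      have h5 := (abs_le.1 (hu x (Ideal.absNorm P) (by
        rw [le_div_iff₀ hN, hx', mul_comm ®y]
        have : ®(Ideal.absNorm P) ≤ y := mc h4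
        gcongr))).1
      have h6 : 0 ≤ log (Ideal.absNorm P) := log_natCast_nonneg _
      calc _ = log (Ideal.absNorm P) * ((κ - κ * (ε / 8)) * (x / Ideal.absNorm P)) := rg
        _ ≤ _ := by gcongr; linarith
    · have := log_natCast_nonneg (Ideal.absNorm P); positivity
  have t3 := t2.trans t1
  have hly : 0 ≤ log y := log_natCast_nonneg y
  have t4 : (1 - ε / 8) * Wn K y ≤ (1 + ε / 8) * log x := by
    refine le_of_mul_le_mul_left (a := κ * x) ?_ pv
    linarith
  have t5 : (1 - ε / 8) * Wn K y ≤ (1 - ε / 8) * ((1 + ε) * log y) := by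
    refine t4.trans ?_
    rw [hl]
    nlinarith [mul_nonneg (mul_nonneg hε.le hly) (sub_nonneg.2 hε1)]
  exact le_of_mul_le_mul_left t5 ln
lemma M1_lo {ε : ℝ} (hε : 0 < ε) (hε1 : ε ≤ 1) : ∀ᶠ y : ℕ in atTop, (1 - ε) * log y ≤ Wn K y := by
  classical
  obtain ⟨κ, hκ, h⟩ := SI_asymp K
  obtain ⟨u₀, hu0, hu⟩ := h (κ * (ε / 16)) pv
  obtain ⟨C, hC, hCb⟩ := SI_bd K hκ pv hu
  obtain ⟨Cb, hCb0, hbad⟩ := bad_all K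
  set U := ⌈u₀⌉₊
  have hU : u₀ ≤ U := Nat.le_ceil _
  have hU0 : 0 < ®U := ln
  set D := ⌈16 / ε⌉₊
  have hD : 16 / ε ≤ D := Nat.le_ceil _
  have hDp : ®0 < D := lt_of_lt_of_le pv hD
  set R := C * Module.finrank ℤ (𝓞 K) * (U * log 4) + C * Cb with hR
  filter_upwards [log_ev (log D + R / κ) (show 0 < ε / 4 by positivity), eventually_ge_atTop (U * D), eventually_ge_atTop 1] with y hy hyU hy1
  have hy1' : ®1 ≤ y := mc hy1
  have hyU' : ®U * D ≤ y := mc hyU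
  have hly : 0 ≤ log y := log_natCast_nonneg y
  have hD1 : ®1 ≤ D := le_trans (by rw [le_div_iff₀ hε]; linarith) hD
  have t1 : κ * (1 - 3 * ε / 16) * y * (log y - log D) ≤ ∑ I ∈ SI K y, log (Ideal.absNorm I) := by
    have h1 := (abs_le.1 (hu y 1 (by rw [Nat.cast_one, div_one]; nlinarith))).1
    have h2 := (abs_le.1 (hu y D (by rw [le_div_iff₀ hDp]; nlinarith))).2
    rw [Nat.div_one, Nat.cast_one, div_one] at h1
    have h3 : ®y / D ≤ y * (ε / 16) := by
      rw [div_le_iff₀ hDp, mul_assoc]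
      have : 1 ≤ ε / 16 * D := by
        calc ®1 = ε / 16 * (16 / ε) := by field_simp
          _ ≤ _ := gc
      nlinarith
    have hll : log D ≤ log y := log_le_log hDp nl
    calc _ ≤ (#(SI K y) - #(SI K (y / D)) : ℝ) * (log y - log D) := by
          gcongr
          · have : κ * (1 + ε / 16) * (y / D) ≤ κ * (1 + ε / 16) * (y * (ε / 16)) := gc
            have h5 : κ * (ε / 16) * y * (ε / 16) ≤ κ * (ε / 16) * y * 1 := by gcongr; linarith
            linarith
      _ = ∑ I ∈ SI K y \ SI K (y / D), (log y - log D) := by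
          rw [sum_const, nsmul_eq_mul, card_sdiff_of_subset (SI_mono K (Nat.div_le_self _ _)), Nat.cast_sub (card_le_card (SI_mono K (Nat.div_le_self _ _)))]
      _ ≤ ∑ I ∈ SI K y \ SI K (y / D), log (Ideal.absNorm I) := sum_le_sum fun I hI => by
          obtain ⟨h1, h2⟩ := mem_sdiff.1 hI
          obtain ⟨h3, h4⟩ := mem_SI.1 h1
          have h5 : y / D < Ideal.absNorm I := by by_contra hc; exact h2 (mem_SI.2 ⟨h3, om⟩)
          rw [← log_div pv hDp.ne']
          refine log_le_log pv ?_
          rw [div_le_iff₀ hDp]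
          exact_mod_cast ((Nat.div_lt_iff_lt_mul (mc hDp)).1 h5).le
      _ ≤ _ := sum_le_sum_of_subset_of_nonneg sdiff_subset fun I _ _ => log_natCast_nonneg _
  have t2 : ∑ I ∈ SI K y, log (Ideal.absNorm I) ≤ κ * (1 + ε / 16) * y * Wn K y + y * R := by
    refine (T_upper y).trans ?_
    have e1 : ∀ P ∈ (SI K y).filter fun P => Prime P, ∑ k ∈ Icc 1 y, log (Ideal.absNorm P) * #(SI K (y / Ideal.absNorm P ^ k)) ≤
        (if (Ideal.absNorm P).Prime then log (Ideal.absNorm P) * #(SI K (y / Ideal.absNorm P)) else 0) +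
        C * y * ∑ k ∈ Icc 1 y with ¬ (k = 1 ∧ (Ideal.absNorm P).Prime), log (Ideal.absNorm P) / ®(Ideal.absNorm P) ^ k := fun P hP => by
      rw [← sum_filter_add_sum_filter_not _ (fun k => k = 1 ∧ (Ideal.absNorm P).Prime), mul_sum]
      have hlP := log_natCast_nonneg (Ideal.absNorm P)
      refine add_le_add ?_ (sum_le_sum fun k _ => ?_)
      · split_ifs with hp
        · rw [show (Icc 1 y).filter (fun k => k = 1 ∧ (Ideal.absNorm P).Prime) = {1} by
            ext k; simp only [mem_filter, mem_Icc, mem_singleton]; exact ⟨fun h => h.2.1, fun h => ⟨om, h, hp⟩⟩]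
          simp
        · rw [filter_false_of_mem fun k _ h => hp h.2, sum_empty]
      · have := hCb y (Ideal.absNorm P ^ k)
        push_cast at this
        calc _ ≤ log (Ideal.absNorm P) * (C * (®y / ®(Ideal.absNorm P) ^ k)) := gc
          _ = _ := rg
    refine (sum_le_sum e1).trans ?_
    rw [sum_add_distrib, ← mul_sum, ← sum_filter, filter_filter]
    have e2 : (SI K y).filter (fun P => Prime P ∧ (Ideal.absNorm P).Prime) = (SI K y).filter fun P => (Ideal.absNorm P).Prime :=
      filter_congr fun P _ => ⟨fun h => h.2, fun h => ⟨prime_of_norm h, h⟩⟩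
    rw [e2]
    have e3 := hbad y
    have e4 : ∑ P ∈ SI K y with (Ideal.absNorm P).Prime, log (Ideal.absNorm P) * #(SI K (y / Ideal.absNorm P)) ≤
        κ * (1 + ε / 16) * y * Wn K y + y * (C * Module.finrank ℤ (𝓞 K) * (U * log 4)) := by
      rw [sum_nu y (fun n => log n * #(SI K (y / n))), Wn]
      have e5 : ∀ p ∈ (range (y + 1)).filter Nat.Prime, ®(nu K p) * (log p * #(SI K (y / p))) ≤
          κ * (1 + ε / 16) * y * (nu K p * (log p / p)) + C * Module.finrank ℤ (𝓞 K) * (U * log p) := fun p hp => by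
        obtain ⟨h1, h2⟩ := mem_filter.1 hp
        have hp0 : ®0 < p := mc h2.pos
        have hlp : 0 ≤ log p := log_natCast_nonneg p
        rcases le_or_gt u₀ (®y / p) with h | h
        · have h3 := (abs_le.1 (hu y p h)).2
          calc _ ≤ ®(nu K p) * (log p * (κ * (1 + ε / 16) * (y / p))) := by gcongr; linarith
            _ = κ * (1 + ε / 16) * y * (nu K p * (log p / p)) := rg
            _ ≤ _ := le_add_of_nonneg_right pv
        · have h3 : ®(nu K p) ≤ Module.finrank ℤ (𝓞 K) := mc nu_le p h2
          calc _ ≤ ®(Module.finrank ℤ (𝓞 K)) * (log p * (C * U)) := by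
                gcongr; exact (hCb y p).trans (by gcongr; linarith)
            _ = C * Module.finrank ℤ (𝓞 K) * (U * log p) := rg
            _ ≤ _ := le_add_of_nonneg_left pv
      refine (sum_le_sum e5).trans ?_
      rw [sum_add_distrib, ← mul_sum, ← mul_sum, ← mul_sum]
      have e6 : ∑ p ∈ (range (y + 1)).filter Nat.Prime, log p ≤ log 4 * y := by
        have := Chebyshev.theta_le_log4_mul_x (x := ®y) pv
        rw [Chebyshev.theta_eq_sum_Icc, Nat.floor_natCast] at this
        rwa [range_eq_Ico, show Ico 0 (y + 1) = Icc 0 y from rfl]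
      have : C * Module.finrank ℤ (𝓞 K) * (U * ∑ p ∈ (range (y + 1)).filter Nat.Prime, log p) ≤
        C * Module.finrank ℤ (𝓞 K) * (U * (log 4 * y)) := gc
      linarith
    have : C * y * (∑ P ∈ SI K y with Prime P, ∑ k ∈ Icc 1 y with ¬ (k = 1 ∧ (Ideal.absNorm P).Prime),
      log (Ideal.absNorm P) / ®(Ideal.absNorm P) ^ k) ≤ C * y * Cb := gc
    rw [hR]; linarith
  have t3 := t1.trans t2
  have t4 : (1 - 3 * ε / 16) * (log y - log D) ≤ (1 + ε / 16) * Wn K y + R / κ := by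
    refine le_of_mul_le_mul_left (a := κ * y) ?_ pv
    have : κ * y * (R / κ) = y * R := by field_simp
    rw [mul_add, this]; linarith
  have hlD : 0 ≤ log D := log_natCast_nonneg D
  have t5 : (1 + ε / 16) * ((1 - ε) * log y) ≤ (1 + ε / 16) * Wn K y := by
    nlinarith [mul_nonneg hε.le hly, mul_nonneg hε.le hlD, mul_nonneg (mul_nonneg hε.le hε.le) hly]
  exact le_of_mul_le_mul_left t5 pv
end
section
open Polynomial
variable {K : Type} [Field K] [NumberField K]
lemma nu_eq (θ : 𝓞 K) (hθ : minpoly ℤ θ = X ^ 3 + C c₂ * X ^ 2 + C c₁ * X + C c₀)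
    {p : ℕ} (hp : p.Prime) (hpe : ¬ p ∣ RingOfIntegers.exponent θ) : nu K p = rQ p := by
  classical
  haveI := Fact.mk hp
  set e := NumberField.Ideal.primesOverSpanEquivMonicFactorsMod hpe
  set F := (minpoly ℤ θ).map (Int.castRingHom (ZMod p)) with hF
  have hF0 : F ≠ 0 := map_monic_ne_zero (minpoly.monic θ.isIntegral)
  have hmem : ∀ Q, Q ∈ RingOfIntegers.monicFactorsMod θ p ↔ Irreducible Q ∧ Q.Monic ∧ Q ∣ F := fun Q => by
    rw [RingOfIntegers.monicFactorsMod, Multiset.mem_toFinset, Polynomial.mem_normalizedFactors_iff hF0]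
  have hev : ∀ n : ℕ, X - C (n : ZMod p) ∣ F ↔ ¡p ∣ fQ n := fun n => by
    rw [dvd_iff_isRoot, IsRoot, hF, hθ, ← ZMod.intCast_zmod_eq_zero_iff_dvd, ff]; simp
  have hdeg : ∀ Q (hQ : Q ∈ RingOfIntegers.monicFactorsMod θ p), Ideal.absNorm (e.symm ⟨Q, hQ⟩ : Ideal (𝓞 K)) = p ^ Q.natDegree := fun Q hQ => by
    have h1 := (e.symm ⟨Q, hQ⟩).2
    haveI := h1.1
    haveI := h1.2
    have h0 : (Ideal.span {¡p}) ≠ ⊥ := by simpa using hp.ne_zero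
    haveI : (Ideal.span {¡p}).IsMaximal := Int.ideal_span_isMaximal_of_prime p
    haveI : (e.symm ⟨Q, hQ⟩ : Ideal (𝓞 K)).IsMaximal := Ideal.IsMaximal.of_liesOver_isMaximal _ (Ideal.span {¡p})
    rw [Ideal.absNorm_eq_pow_inertiaDeg' (p := p) _ hp, Ideal.inertiaDeg'_eq_inertiaDeg,
      NumberField.Ideal.inertiaDeg_primesOverSpanEquivMonicFactorsMod_symm_apply' hpe hQ]
  have hX : ∀ n : ℕ, ¡p ∣ fQ n → X - C (n : ZMod p) ∈ RingOfIntegers.monicFactorsMod θ p := fun n hn =>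
    (hmem _).2 ⟨irreducible_X_sub_C _, monic_X_sub_C _, (hev n).2 hn⟩
  symm
  refine card_bij (fun n hn => (e.symm ⟨X - C ((n : ℕ) : ZMod p), hX n (mem_filter.1 hn).2⟩ : Ideal (𝓞 K))) ?_ ?_ ?_
  · intro n hn
    have h1 := hdeg _ (hX n (mem_filter.1 hn).2)
    rw [natDegree_X_sub_C, pow_one] at h1
    refine mem_filter.2 ⟨mem_SI.2 ⟨?_, h1.le⟩, h1⟩
    intro h; rw [h] at h1; simp at h1; exact hp.ne_zero h1.symm
  · intro a ha b hb h
    have := congrArg Subtype.val (e.symm.injective (Subtype.ext h))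
    have := C_injective (sub_right_injective this)
    rw [ZMod.natCast_eq_natCast_iff] at this
    exact Nat.ModEq.eq_of_lt_of_lt this (mem_range.1 (mem_filter.1 ha).1) (mem_range.1 (mem_filter.1 hb).1)
  · intro P hP
    have hn := (mem_filter.1 hP).2
    have hPp := prime_of_norm (hn ▸ hp)
    have hP' : P.IsPrime := Ideal.isPrime_of_prime hPp
    have hover : P ∈ Ideal.primesOver (Ideal.span {¡p}) (𝓞 K) := by
      refine ⟨hP', (Ideal.liesOver_iff _ _).2 ?_⟩
      refine (Int.ideal_span_isMaximal_of_prime p).eq_of_le (Ideal.IsPrime.under ℤ P).ne_top ?_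
      rw [Ideal.span_singleton_le_iff_mem, Ideal.mem_comap, map_natCast]
      have := Ideal.absNorm_mem P
      rwa [hn] at this
    set Q := e ⟨P, hover⟩ with hQ
    have hQP : e.symm Q = ⟨P, hover⟩ := by rw [hQ, Equiv.symm_apply_apply]
    have h1 := hdeg Q.1 Q.2
    rw [hQP] at h1
    change Ideal.absNorm P = _ at h1
    rw [hn] at h1
    have hd : Q.1.natDegree = 1 := Nat.pow_right_injective hp.two_le (by simpa using h1.symm)
    obtain ⟨-, hm, hdv⟩ := (hmem _).1 Q.2
    have hQX : Q.1 = X - C (-(Q.1.coeff 0)) := by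
      conv_lhs => rw [Polynomial.eq_X_add_C_of_natDegree_le_one hd.le]
      have : Q.1.coeff 1 = 1 := by rw [← hd]; exact hm
      rw [this]; simp
    set a := -(Q.1.coeff 0)
    have ha : ((a.val : ℕ) : ZMod p) = a := ZMod.natCast_zmod_val a
    refine ⟨a.val, mem_filter.2 ⟨mem_range.2 a.val_lt, (hev _).1 (by rw [ha, ← hQX]; exact hdv)⟩, ?_⟩
    have : (⟨X - C ((a.val : ℕ) : ZMod p), hX _ ((hev _).1 (by rw [ha, ← hQX]; exact hdv))⟩ : RingOfIntegers.monicFactorsMod θ p) = Q :=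
      Subtype.ext ((congrArg (fun b => X - C b) ha).trans hQX.symm)
    simp only [this, hQP]
lemma bridge_aux [inst : Algebra ℚ K] (B : PowerBasis ℚ K)
    (hf : IrQ)
    (hroot : aeval B.gen (X ^ 3 + C c₂ * X ^ 2 + C c₁ * X + C c₀ : ℤ[X]) = 0) :
    ∃ d : ℕ, d ≠ 0 ∧ ∀ p : ℕ, p.Prime → ¬ p ∣ d → nu K p = rQ p := by
  obtain rfl : inst = DivisionRing.toRatAlgebra := Subsingleton.elim _ _
  set f : ℤ[X] := X ^ 3 + C c₂ * X ^ 2 + C c₁ * X + C c₀ with hfd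
  have hm : f.Monic := by rw [hfd]; monicity!
  set a : K := B.gen with had
  have hint : IsIntegral ℤ a := ⟨f, hm, hroot⟩
  set θ : 𝓞 K := ⟨a, hint⟩ with hθ
  have hmin : minpoly ℤ θ = f := by
    have h1 : aeval θ f = 0 := by
      apply RingOfIntegers.ext
      have := aeval_algebraMap_apply K θ f
      rw [show (algebraMap (𝓞 K) K) θ = a from rfl, hroot] at this
      simpa using this.symm
    have h2 := minpoly.isIntegrallyClosed_dvd θ.isIntegral h1
    exact eq_of_monic_of_associated (minpoly.monic θ.isIntegral) hm (((minpoly.irreducible θ.isIntegral).dvd_symm hf h2 |> fun h => associated_of_dvd_dvd h2 h))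
  refine ⟨RingOfIntegers.exponent θ, ?_, fun p hp hd => nu_eq θ hmin hp hd⟩
  have hz := fun z : 𝓞 K => Algebra.discr_mul_isIntegral_mem_adjoin (R := ℤ) ℚ (B := B) hint z.2
  have hdint : IsIntegral ℤ (Algebra.discr ℚ B.basis) := Algebra.discr_isIntegral ℚ fun i => by
    rw [B.basis_eq_pow]; exact hint.pow _
  obtain ⟨D, hD⟩ := IsIntegrallyClosed.isIntegral_iff.1 hdint
  have hD0 : D ≠ 0 := by
    rintro rfl
    exact Algebra.discr_not_zero_of_basis ℚ B.basis (by rw [← hD]; simp)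
  intro h0
  rw [RingOfIntegers.exponent_eq_sInf, Nat.sInf_eq_zero] at h0
  rcases h0 with h0 | h0
  · exact absurd h0.1 (lt_irrefl _)
  · refine (Set.ext_iff.1 h0 D.natAbs).1 ⟨Int.natAbs_pos.2 hD0, ?_⟩
    have key : (D : 𝓞 K) ∈ conductor ℤ θ := by
      rw [mem_conductor_iff]
      intro z
      have h := hz z
      rw [← hD, Algebra.smul_def] at h
      have h2 : algebraMap (𝓞 K) K ((D : 𝓞 K) * z) ∈ Algebra.adjoin ℤ {a} := by
        convert h using 1
        simp; exact Or.inl rfl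
      have h3 : Algebra.adjoin ℤ {a} = (Algebra.adjoin ℤ {θ}).map (IsScalarTower.toAlgHom ℤ (𝓞 K) K) := by
        rw [AlgHom.map_adjoin, Set.image_singleton]; rfl
      rw [h3] at h2
      obtain ⟨w, hw, hw2⟩ := h2
      have : w = (D : 𝓞 K) * z := RingOfIntegers.ext hw2
      rw [← this]; exact hw
    rcases Int.natAbs_eq D with h | h
    · rw [h] at key; simpa using key
    · rw [h] at key; simpa using key
end
section
open Polynomial
lemma bridge (hf : IrQ) :
    ∃ (K : Type) (_ : Field K) (_ : NumberField K), ∃ d : ℕ, d ≠ 0 ∧ ∀ p : ℕ, p.Prime → ¬ p ∣ d → nu K p = rQ p := by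
  have hm : (X ^ 3 + C c₂ * X ^ 2 + C c₁ * X + C c₀ : ℤ[X]).Monic := by monicity!
  have hq := (hm.irreducible_iff_irreducible_map_fraction_map (K := ℚ)).1 hf
  haveI := Fact.mk hq
  have h1 := (AdjoinRoot.powerBasis hq.ne_zero).finite
  have h2 := charZero_of_injective_algebraMap (algebraMap ℚ (AdjoinRoot ((X ^ 3 + C c₂ * X ^ 2 + C c₁ * X + C c₀ : ℤ[X]).map (algebraMap ℤ ℚ)))).injective
  refine ⟨AdjoinRoot _, inferInstance, @NumberField.mk _ _ h2 (by convert h1), ?_⟩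
  · refine bridge_aux (AdjoinRoot.powerBasis hq.ne_zero) hf ?_
    have := AdjoinRoot.eval₂_root ((X ^ 3 + C c₂ * X ^ 2 + C c₁ * X + C c₀ : ℤ[X]).map (algebraMap ℤ ℚ))
    rw [AdjoinRoot.powerBasis_gen]
    simp only [Polynomial.map_add, Polynomial.map_mul, Polynomial.map_pow, map_X, map_C, eval₂_add, eval₂_mul, eval₂_pow, eval₂_X, eval₂_C] at this
    simpa using this
open Finset NumberField Filter in
lemma M1 (hf : IrQ) {ε : ℝ} (hε : 0 < ε) (hε1 : ε ≤ 1) :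
    ∀ᶠ y : ℕ in atTop, |∑ p ∈ (range (y + 1)).filter Nat.Prime, ®(rQ p) * (log p / p) - log y| ≤ ε * log y := by
  obtain ⟨K, _, _, d, hd, h⟩ := bridge hf
  set B := ∑ p ∈ d.divisors, (®(nu K p) + rQ p) * (log p / p)
  filter_upwards [M1_up K (half_pos hε) ln, M1_lo K (half_pos hε) ln, log_ev B (half_pos hε)] with y h1 h2 h3
  have h4 : |∑ p ∈ (range (y + 1)).filter Nat.Prime, ®(rQ p) * (log p / p) - Wn K y| ≤ B := by
    rw [Wn, ← sum_sub_distrib]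
    refine (abs_sum_le_sum_abs _ _).trans ?_
    have hn : ∀ p : ℕ, 0 ≤ log p / p := fun p => div_nonneg (log_natCast_nonneg p) pv
    have e1 : ∀ p ∈ (range (y + 1)).filter Nat.Prime, |®(rQ p) * (log p / p) - ®(nu K p) * (log p / p)| ≤
        if p ∣ d then (®(nu K p) + rQ p) * (log p / p) else 0 := fun p hp => by
      split_ifs with hpd
      · rw [← sub_mul, abs_mul, abs_of_nonneg (hn p)]
        refine mul_le_mul_of_nonneg_right ?_ (hn p)
        refine (abs_sub _ _).trans ?_
        simp [add_comm]
      · rw [h p (mem_filter.1 hp).2 hpd]; simp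
    refine (sum_le_sum e1).trans ?_
    rw [← sum_filter]
    refine sum_le_sum_of_subset_of_nonneg (fun p hp => Nat.mem_divisors.2 ⟨(mem_filter.1 hp).2, hd⟩) fun p _ _ => mul_nonneg pv (hn p)
  rw [abs_le] at h4 ⊢
  constructor <;> linarith
end
end
section
open Finset Real Filter
variable {c₀ c₁ c₂ : ℤ}
noncomputable def pI (y w : ℝ) : Finset ℕ := (range (⌊w⌋₊ + 1)).filter fun p : ℕ => p.Prime ∧ y < p
lemma mem_pI {y w : ℝ} (hw : 0 ≤ w) {p : ℕ} : p ∈ pI y w ↔ p.Prime ∧ y < p ∧ ®p ≤ w := by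
  rw [pI, mem_filter, mem_range, Nat.lt_succ_iff, Nat.le_floor_iff hw]; tauto
section
open Polynomial
lemma M1_int (hf : IrQ) (N : ℕ) :
    ∃ Z₀ : ℝ, ∀ Z : ℝ, Z₀ ≤ Z → ∀ y : ℝ, Z ≤ y → y ≤ Z ^ N →
      1 / (2 * (N + 1)) ≤ ∑ p ∈ pI y (y * Z), ®(rQ p) / p := by
  have hN : ®0 < 2 * N + 1 := pv
  obtain ⟨y₀, hy₀⟩ := eventually_atTop.1 (M1 hf (ε := 1 / (4 * (2 * N + 1))) pv
    (by rw [div_le_one pv]; linarith [(Nat.cast_nonneg N : ®0 ≤ N)]))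
  refine ⟨max (y₀ + 1) (2 ^ 4), fun Z hZ y hy hyN => ?_⟩
  have h1 : ®y₀ + 1 ≤ Z := (le_max_left _ _).trans hZ
  have h2 : ®2 ^ 4 ≤ Z := (le_max_right _ _).trans hZ
  have hlZ : 4 * log 2 ≤ log Z := by
    rw [show 4 * log 2 = log (2 ^ 4) by rw [log_pow]; norm_num]
    exact log_le_log nn h2
  have hl2 : 0 < log 2 := log_pos nn
  norm_num at h2
  have hyZ : y ≤ y * Z := nl
  have hfl : ⌊y⌋₊ ≤ ⌊y * Z⌋₊ := Nat.floor_mono hyZ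
  have hly : log y ≤ N * log Z := by
    rw [← log_pow]; exact log_le_log ln hyN
  have a1 := (abs_le.1 (hy₀ ⌊y⌋₊ (Nat.le_floor ln))).2
  have a2 := (abs_le.1 (hy₀ ⌊y * Z⌋₊ (Nat.le_floor ln))).1
  set η := 1 / (4 * (2 * ®N + 1)) with hη
  have hη0 : 0 < η := pv
  have hfy1 : ®1 ≤ ⌊y⌋₊ := mc Nat.le_floor (by push_cast; linarith)
  have b1 : log ⌊y⌋₊ ≤ log y := log_le_log ln (Nat.floor_le ln)
  have b3 : log ⌊y * Z⌋₊ ≤ log y + log Z := by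
    rw [← log_mul ln ln]
    exact log_le_log (lt_of_lt_of_le ln (Nat.cast_le.2 hfl)) (Nat.floor_le nl)
  have b2 : log y + log Z - log 2 ≤ log ⌊y * Z⌋₊ := by
    rw [← log_mul ln ln, ← log_div nl nn]
    exact log_le_log (div_pos nl nn) (by linarith [Nat.lt_floor_add_one (y * Z)])
  have key : log Z / 2 ≤ ∑ p ∈ pI y (y * Z), ®(rQ p) * (log p / p) := by
    have e : pI y (y * Z) = (range (⌊y * Z⌋₊ + 1)).filter Nat.Prime \ (range (⌊y⌋₊ + 1)).filter Nat.Prime := by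
      ext p
      rw [pI, Finset.mem_sdiff, mem_filter, mem_filter, mem_filter, mem_range, mem_range, ← Nat.floor_lt (ln : 0 ≤ y)]
      constructor
      · rintro ⟨u, v, w⟩; exact ⟨⟨u, v⟩, fun h => om⟩
      · rintro ⟨⟨u, v⟩, w⟩; exact ⟨u, v, by by_contra hc; exact w ⟨om, v⟩⟩
    have hs := sum_sdiff (f := fun p : ℕ => ®(rQ p) * (log p / p))
      (filter_subset_filter Nat.Prime (range_subset_range.2 (Nat.succ_le_succ hfl)))
    rw [← e] at hs
    have c1 : η * log ⌊y⌋₊ ≤ η * (N * log Z) := by gcongr; linarith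
    have c2 : η * log ⌊y * Z⌋₊ ≤ η * (N * log Z + log Z) := by gcongr; linarith
    have c3 : η * (N * log Z) + η * (N * log Z + log Z) = log Z / 4 := by rw [hη]; field_simp; ring
    linarith
  have hub : ∑ p ∈ pI y (y * Z), ®(rQ p) * (log p / p) ≤ (∑ p ∈ pI y (y * Z), ®(rQ p) / p) * ((N + 1) * log Z) := by
    rw [sum_mul]
    refine sum_le_sum fun p hp => ?_
    obtain ⟨q1, q2, q3⟩ := (mem_pI nl).1 hp
    have : log p ≤ (N + 1) * log Z := by
      have := log_le_log (mc q1.pos) q3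
      rw [log_mul ln ln] at this
      linarith
    calc _ = ®(rQ p) / p * log p := rg
      _ ≤ _ := gc
  rw [div_le_iff₀ pv]
  refine le_of_mul_le_mul_right (a := log Z / 2) ?_ ln
  linarith
end
lemma markov {W : Finset ℕ} {a b : ℕ → ℝ} (ha : ∀ p ∈ W, 0 ≤ a p) (hb : ∀ p ∈ W, 0 ≤ b p) :
    ∑ s ∈ W.powerset, (∏ p ∈ s, a p) * ∑ p ∈ s, b p ≤ (∑ p ∈ W, a p * b p) * ∏ p ∈ W, (1 + a p) := by
  classical
  induction W using Finset.induction_on with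
  | empty => simp
  | insert q W hq ih =>
    have ha' : ∀ p ∈ W, 0 ≤ a p := fun p hp => ha p (mem_insert_of_mem hp)
    have hb' : ∀ p ∈ W, 0 ≤ b p := fun p hp => hb p (mem_insert_of_mem hp)
    have ih := ih ha' hb'
    have hP : 0 ≤ ∏ p ∈ W, (1 + a p) := prod_nonneg fun p hp => by linarith [ha' p hp]
    have hq1 := ha q (mem_insert_self _ _)
    have hq2 := hb q (mem_insert_self _ _)
    rw [sum_powerset_insert hq, sum_insert hq, prod_insert hq]
    have e : ∑ s ∈ W.powerset, (∏ p ∈ insert q s, a p) * ∑ p ∈ insert q s, b p =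
        a q * ∑ s ∈ W.powerset, (∏ p ∈ s, a p) * ∑ p ∈ s, b p + a q * b q * ∏ p ∈ W, (1 + a p) := by
      rw [prod_one_add, mul_sum, mul_sum, ← sum_add_distrib]
      refine sum_congr rfl fun s hs => ?_
      have : q ∉ s := fun h => hq (mem_powerset.1 hs h)
      rw [prod_insert this, sum_insert this]; ring
    rw [e]
    nlinarith [mul_nonneg hq1 (sub_nonneg.2 ih), mul_nonneg (mul_nonneg (mul_nonneg hq1 hq2) hP) hq1]
lemma markov' {W : Finset ℕ} {a b : ℕ → ℝ} {L : ℝ} (hL : 0 < L) (ha : ∀ p ∈ W, 0 ≤ a p) (hb : ∀ p ∈ W, 0 ≤ b p)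
    (h : ∑ p ∈ W, a p * b p ≤ L / 2) :
    (∏ p ∈ W, (1 + a p)) / 2 ≤ ∑ s ∈ W.powerset with ∑ p ∈ s, b p ≤ L, ∏ p ∈ s, a p := by
  have hP : 0 ≤ ∏ p ∈ W, (1 + a p) := prod_nonneg fun p hp => by linarith [ha p hp]
  have h1 := sum_filter_add_sum_filter_not W.powerset (fun s => ∑ p ∈ s, b p ≤ L) (fun s => ∏ p ∈ s, a p)
  rw [← prod_one_add] at h1
  have h2 : (∑ s ∈ W.powerset with ¬ ∑ p ∈ s, b p ≤ L, ∏ p ∈ s, a p) * L ≤ L / 2 * ∏ p ∈ W, (1 + a p) := by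
    refine le_trans ?_ ((markov ha hb).trans (mul_le_mul_of_nonneg_right h hP))
    rw [sum_mul]
    have hn : ∀ s ∈ W.powerset, 0 ≤ ∏ p ∈ s, a p := fun s hs => prod_nonneg fun p hp => ha p (mem_powerset.1 hs hp)
    refine (sum_le_sum fun s hs => ?_).trans (sum_le_sum_of_subset_of_nonneg (filter_subset _ _) fun s hs _ =>
      mul_nonneg (hn s hs) (sum_nonneg fun p hp => hb p (mem_powerset.1 hs hp)))
    obtain ⟨u, v⟩ := mem_filter.1 hs
    exact mul_le_mul_of_nonneg_left ln (hn s u)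
  have h3 : ∑ s ∈ W.powerset with ¬ ∑ p ∈ s, b p ≤ L, ∏ p ∈ s, a p ≤ (∏ p ∈ W, (1 + a p)) / 2 := by
    refine le_of_mul_le_mul_right (a := L) ?_ hL
    linarith
  linarith
noncomputable def vv (c₀ c₁ c₂ : ℤ) (p : ℕ) : ℝ := 1 - (1 + (®p - 1) * rho c₀ c₁ c₂ p) / ®p ^ 2
noncomputable def aa (c₀ c₁ c₂ : ℤ) (p : ℕ) : ℝ := rho c₀ c₁ c₂ p / p * (1 - 2 / p)
noncomputable def WW (p₀ : ℕ) (Z : ℝ) : Finset ℕ := (pz (Z ^ 8)).filter fun p : ℕ => p₀ ≤ p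
set_option hygiene false in
notation "vQ" => vv c₀ c₁ c₂
set_option hygiene false in
notation "aQ" => aa c₀ c₁ c₂
lemma vv_pos {p : ℕ} (hp : p.Prime) : 0 < vQ p := by
  have h2 : ®2 ≤ p := mc hp.two_le
  have h3 : ®(rQ p) ≤ p := mc rho_le_p p
  rw [vv, sub_pos, div_lt_one pv]
  nlinarith [mul_nonneg (show ®0 ≤ p - 1 by linarith) (sub_nonneg.2 h3)]
lemma vv_le {p : ℕ} (hp : p.Prime) : vQ p ≤ 1 := by
  have h2 : ®2 ≤ p := mc hp.two_le
  rw [vv, sub_le_self_iff]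
  exact div_nonneg (add_nonneg zero_le_one (mul_nonneg ln pv)) pv
lemma exp_le_one_sub {u : ℝ} (h0 : 0 ≤ u) (h1 : u ≤ 1 / 2) : exp (-(2 * u)) ≤ 1 - u := by
  rw [exp_neg, inv_le_iff_one_le_mul₀ (exp_pos _)]
  nlinarith [add_one_le_exp (2 * u)]
lemma vv_bds {p : ℕ} (hp : p.Prime) (hp0 : 200 ≤ p) :
    exp (-(12 * (1 / p))) ≤ vQ p * (1 - 2 / p) ∧ exp (-(40 * (®p ^ 2)⁻¹)) ≤ vQ p * (1 + aQ p) := by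
  have hp0' : ®200 ≤ p := mc hp0
  have h3 : ®(rQ p) ≤ 3 := mc rho_le_three hp
  have hq : ®p⁻¹ ≤ 1 / 200 := by rw [inv_le_comm₀ ln nn]; linarith
  have hq0 : 0 < ®p⁻¹ := pv
  have hv : vQ p = 1 - rQ p * ®p⁻¹ - (1 - rQ p) * ®p⁻¹ ^ 2 := by
    rw [vv]; field_simp; ring
  have ha : aQ p = rQ p * ®p⁻¹ - 2 * rQ p * ®p⁻¹ ^ 2 := by
    rw [aa]; field_simp
  have hr0 : ®0 ≤ rQ p := pv
  rw [hv, ha, one_div, div_eq_mul_inv, ← inv_pow]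
  set q := ®p⁻¹
  set ρ : ℝ := ®(rQ p)
  constructor
  · refine le_trans (le_of_eq (by ring_nf)) ((exp_le_one_sub (u := 6 * q) ln ln).trans ?_)
    have h4 : 1 - 4 * q ≤ 1 - ρ * q - (1 - ρ) * q ^ 2 := by nlinarith [mul_nonneg hr0 hq0.le]
    nlinarith
  · refine le_trans (le_of_eq (by ring_nf)) ((exp_le_one_sub (u := 20 * q ^ 2) pv nl).trans ?_)
    have h5 : (1 - ρ) * (1 + ρ * q - 2 * ρ * q ^ 2) ≤ 2 := by
      have a1 : 0 ≤ ρ * q - 2 * ρ * q ^ 2 := by nlinarith [mul_nonneg hr0 hq0.le]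
      have a2 : ρ * q - 2 * ρ * q ^ 2 ≤ 1 := by nlinarith [mul_nonneg hr0 (sq_nonneg q)]
      nlinarith
    have h6 : (1 - ρ * q - (1 - ρ) * q ^ 2) * (1 + (ρ * q - 2 * ρ * q ^ 2)) =
      1 - q ^ 2 * (2 * ρ + ρ ^ 2 + (1 - ρ) * (1 + ρ * q - 2 * ρ * q ^ 2)) + 2 * ρ ^ 2 * q ^ 3 := rg
    rw [h6]
    have h7 : 2 * ρ + ρ ^ 2 + (1 - ρ) * (1 + ρ * q - 2 * ρ * q ^ 2) ≤ 20 := nl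
    have := mul_le_mul_of_nonneg_left h7 (sq_nonneg q)
    have h8 : 0 ≤ 2 * ρ ^ 2 * q ^ 3 := pv
    linarith
lemma WW_log {p₀ : ℕ} {Z : ℝ} (hZ : 1 ≤ Z) : ∑ p ∈ WW p₀ Z, log p / p ≤ 8 * log Z + log 4 := by
  have h1 : 1 ≤ Z ^ 8 := one_le_pow₀ hZ
  have hf : 0 < ⌊Z ^ 8⌋₊ := Nat.floor_pos.2 h1
  refine (sum_le_sum_of_subset_of_nonneg (fun p hp => ?_) fun p _ _ => div_nonneg (log_natCast_nonneg p) pv).trans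
    ((log_sum_le ⌊Z ^ 8⌋₊ hf).trans ?_)
  · obtain ⟨h2, h3⟩ := mem_pz.1 (mem_filter.1 hp).1
    exact mem_filter.2 ⟨mem_range.2 (Nat.lt_succ_of_le (Nat.le_floor h3.le)), h2⟩
  · have := log_le_log (mc hf) (Nat.floor_le (ln : 0 ≤ Z ^ 8))
    rw [log_pow] at this; push_cast at this; linarith
lemma gsum {p₀ : ℕ} (hp₀ : exp 200 ≤ p₀) : ∃ η > 0, ∃ Z₀ : ℝ, ∀ Z, Z₀ ≤ Z →
    (η ≤ (∏ p ∈ pz (Z ^ 8), vQ p) * ∑ s ∈ (WW p₀ Z).powerset with (((∏ p ∈ s, p : ℕ) : ℝ) ≤ Z ^ 60), ∏ p ∈ s, aQ p) ∧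
    ∀ s ⊆ WW p₀ Z, 1 ≤ (∏ p ∈ pz (Z ^ 8), vQ p) * (∏ p ∈ s, (1 - 2 / ®p)) * Z := by
  have hp200 : 200 ≤ p₀ := by
    have := add_one_le_exp 200
    exact_mod_cast (show ®200 ≤ p₀ by linarith)
  have hpr : ®0 < p₀ := mc (om : 0 < p₀)
  set e := ∏ p ∈ pz p₀, vQ p with he
  have he0 : 0 < e := prod_pos fun p hp => vv_pos (mem_pz.1 hp).1
  refine ⟨e * exp (-80) / 2, pv, max (exp (4 / e)) (p₀ + 4), fun Z hZ => ?_⟩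
  have hZ1 : exp (4 / e) ≤ Z := (le_max_left _ _).trans hZ
  have hZ2 : ®p₀ + 4 ≤ Z := (le_max_right _ _).trans hZ
  have hZ0 : 4 ≤ Z := ln
  have hlZ : 4 / e ≤ log Z := (Real.le_log_iff_exp_le ln).2 hZ1
  have hl4 : log 4 ≤ log Z := log_le_log nn hZ0
  have hl0 : 0 < log Z := log_pos ln
  have hZ8 : Z ≤ Z ^ 8 := le_self_pow₀ ln nn
  have hsplit : ∏ p ∈ pz (Z ^ 8), vQ p = e * ∏ p ∈ WW p₀ Z, vQ p := by
    rw [← prod_filter_mul_prod_filter_not (pz (Z ^ 8)) (fun p : ℕ => ¬ p₀ ≤ p), he, WW]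
    congr 2
    · ext p; rw [mem_filter, mem_pz, mem_pz, not_le, Nat.cast_lt]
      exact ⟨fun h => ⟨h.1.1, h.2⟩, fun h => ⟨⟨h.1, lt_of_lt_of_le (Nat.cast_lt.2 h.2) ln⟩, h.2⟩⟩
    · simp
  have hW : ∀ p ∈ WW p₀ Z, p.Prime ∧ p₀ ≤ p ∧ ®200 ≤ p := fun p hp => by
    obtain ⟨h1, h2⟩ := mem_filter.1 hp
    exact ⟨(mem_pz.1 h1).1, h2, mc hp200.trans h2⟩
  have h2p : ∀ p ∈ WW p₀ Z, 0 ≤ 1 - 2 / ®p ∧ 1 - 2 / ®p ≤ 1 := fun p hp => by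
    have := (hW p hp).2.2
    exact ⟨by rw [sub_nonneg, div_le_one ln]; linarith, by rw [sub_le_self_iff]; positivity⟩
  have ha0 : ∀ p ∈ WW p₀ Z, 0 ≤ aQ p := fun p hp => mul_nonneg pv (h2p p hp).1
  constructor
  · have h1 := markov' (W := WW p₀ Z) (a := aQ) (b := fun p => log p) (L := 60 * log Z) ln ha0
      (fun p _ => log_natCast_nonneg p) (by
        calc _ ≤ ∑ p ∈ WW p₀ Z, 3 * (log p / p) := sum_le_sum fun p hp => by
              have h3 : ®(rQ p) ≤ 3 := mc rho_le_three (hW p hp).1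
              have := log_natCast_nonneg p
              calc _ ≤ 3 / ®p * 1 * log p := by
                    rw [aa]; have := h2p p hp; gcongr
                    · exact this.1
                    · exact this.2
                _ = _ := rg
          _ ≤ _ := by rw [← mul_sum]; linarith [WW_log (p₀ := p₀) (ln : 1 ≤ Z)])
    have h2 : ∑ s ∈ (WW p₀ Z).powerset with ∑ p ∈ s, log (p : ℕ) ≤ 60 * log Z, ∏ p ∈ s, aQ p ≤
        ∑ s ∈ (WW p₀ Z).powerset with (((∏ p ∈ s, p : ℕ) : ℝ) ≤ Z ^ 60), ∏ p ∈ s, aQ p := by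
      refine sum_le_sum_of_subset_of_nonneg (fun s hs => ?_) fun s hs _ => prod_nonneg fun p hp => ha0 p (mem_powerset.1 (mem_filter.1 hs).1 hp)
      obtain ⟨u, v⟩ := mem_filter.1 hs
      refine mem_filter.2 ⟨u, ?_⟩
      have hne : ∀ p ∈ s, ®p ≠ 0 := fun p hp => by have := (hW p (mem_powerset.1 u hp)).2.2; linarith
      push_cast
      rw [← log_le_log_iff (prod_pos fun p hp => lt_of_le_of_ne pv (hne p hp).symm) pv, log_prod hne, log_pow]
      exact_mod_cast v
    have h3 : exp (-80) ≤ ∏ p ∈ WW p₀ Z, (vQ p * (1 + aQ p)) := by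
      refine le_trans ?_ (prod_le_prod (fun p _ => (exp_pos _).le) fun p hp => (vv_bds (hW p hp).1 (hp200.trans (hW p hp).2.1)).2)
      rw [← exp_sum, exp_le_exp, sum_neg_distrib, neg_le_neg_iff, ← mul_sum]
      have : ∑ p ∈ WW p₀ Z, (®p ^ 2)⁻¹ ≤ 2 / ((0 : ℕ) + 1) := by
        refine (sum_le_sum_of_subset_of_nonneg (fun p hp => ?_) fun p _ _ => pv).trans (sum_Ioo_inv_sq_le 0 (⌈Z ^ 8⌉₊ + 1))
        have := (mem_pz.1 (mem_filter.1 hp).1).2.le.trans (Nat.le_ceil _)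
        exact mem_Ioo.2 ⟨(hW p hp).1.pos, Nat.lt_succ_of_le (mc this)⟩
      norm_num at this
      linarith
    rw [prod_mul_distrib] at h3
    have hv0 : 0 ≤ ∏ p ∈ WW p₀ Z, vQ p := prod_nonneg fun p hp => (vv_pos (hW p hp).1).le
    rw [hsplit]
    calc e * exp (-80) / 2 ≤ e * ((∏ p ∈ WW p₀ Z, vQ p) * ∏ p ∈ WW p₀ Z, (1 + aQ p)) / 2 := gc
      _ = e * (∏ p ∈ WW p₀ Z, vQ p) * ((∏ p ∈ WW p₀ Z, (1 + aQ p)) / 2) := rg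
      _ ≤ _ := by gcongr; exact h1.trans h2
  · intro s hs
    have h1 : ∏ p ∈ WW p₀ Z, (1 - 2 / ®p) ≤ ∏ p ∈ s, (1 - 2 / ®p) := by
      rw [← prod_sdiff hs]
      exact mul_le_of_le_one_left (prod_nonneg fun p hp => (h2p p (hs hp)).1)
        (prod_le_one (fun p hp => (h2p p (sdiff_subset hp)).1) fun p hp => (h2p p (sdiff_subset hp)).2)
    have h2 : exp (-(0.54 * log Z)) ≤ ∏ p ∈ WW p₀ Z, (vQ p * (1 - 2 / ®p)) := by
      refine le_trans ?_ (prod_le_prod (fun p _ => (exp_pos _).le) fun p hp => (vv_bds (hW p hp).1 (hp200.trans (hW p hp).2.1)).1)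
      rw [← exp_sum, exp_le_exp, sum_neg_distrib, neg_le_neg_iff, ← mul_sum]
      have h3 : (∑ p ∈ WW p₀ Z, 1 / ®p) * 200 ≤ ∑ p ∈ WW p₀ Z, log p / p := by
        rw [sum_mul]
        refine sum_le_sum fun p hp => ?_
        have : 200 ≤ log p := (Real.le_log_iff_exp_le (by linarith [(hW p hp).2.2])).2 (hp₀.trans (mc (hW p hp).2.1))
        calc _ = 200 / ®p := rg
          _ ≤ _ := gc
      linarith [WW_log (p₀ := p₀) (ln : 1 ≤ Z)]
    rw [prod_mul_distrib] at h2
    have hv0 : 0 ≤ ∏ p ∈ WW p₀ Z, vQ p := prod_nonneg fun p hp => (vv_pos (hW p hp).1).le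
    have h4 : 1 ≤ e * (0.46 * log Z + 1) := by
      rw [div_le_iff₀ he0] at hlZ; nlinarith
    rw [hsplit]
    calc ®1 ≤ e * exp (0.46 * log Z) := h4.trans (by gcongr; exact add_one_le_exp _)
      _ = e * (exp (-(0.54 * log Z))) * Z := by
          rw [mul_assoc]; congr 1
          nth_rw 3 [← exp_log (ln : 0 < Z)]
          rw [← exp_add]; ring_nf
      _ ≤ e * ((∏ p ∈ WW p₀ Z, vQ p) * ∏ p ∈ WW p₀ Z, (1 - 2 / ®p)) * Z := gc
      _ ≤ e * ((∏ p ∈ WW p₀ Z, vQ p) * ∏ p ∈ s, (1 - 2 / ®p)) * Z := gc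
      _ = _ := rg
lemma rho_prod (A : Finset ℕ) (hA : ∀ p ∈ A, p.Prime) : rQ (∏ p ∈ A, p) = ∏ p ∈ A, rQ p := by
  have h : ∀ e, cnt (fun s _ => fQ s) e = rQ e * e := fun e => by
    have : (range e ×ˢ range e).filter (fun q : ℕ × ℕ => ¡e ∣ fQ (q.1 : ℕ)) =
        (range e).filter (fun n : ℕ => ¡e ∣ fQ (n : ℕ)) ×ˢ range e := by
      ext q; simp only [mem_filter, mem_product]; tauto
    rw [cnt, this, card_product, card_range, rho]
  have h1 := cnt_prod (d := fun s _ => fQ s) (fun m s t s' t' h1 h2 => by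
    have : fQ s - fQ s' = (s - s') * (s ^ 2 + s * s' + s' ^ 2 + c₂ * (s + s') + c₁) := by unfold ff; ring
    simp only [this]
    exact h1.mul_right _) A hA
  simp only [h] at h1
  rw [prod_mul_distrib] at h1
  exact Nat.eq_of_mul_eq_mul_right (prod_pos fun p hp => (hA p hp).pos) h1
section
open Polynomial
lemma FF_ne (hf : IrQ) (v w : ℤ)
    (h : FQ v w = 0) : w = 0 := by
  by_contra hw
  have hm : (X ^ 3 + C c₂ * X ^ 2 + C c₁ * X + C c₀ : ℤ[X]).Monic := by monicity!
  have hq := (hm.irreducible_iff_irreducible_map_fraction_map (K := ℚ)).1 hf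
  have hwq : (w : ℚ) ≠ 0 := mc hw
  have hd : ((X ^ 3 + C c₂ * X ^ 2 + C c₁ * X + C c₀ : ℤ[X]).map (algebraMap ℤ ℚ)).degree = 3 := by
    rw [hm.degree_map]; compute_degree!
  have := degree_eq_one_of_irreducible_of_root hq (x := (v / w : ℚ)) (by
    rw [IsRoot]
    have h' : (v : ℚ) ^ 3 + c₂ * v ^ 2 * w + c₁ * v * w ^ 2 + c₀ * w ^ 3 = 0 := by rw [FF] at h; exact_mod_cast h
    simp
    field_simp
    linear_combination h')
  rw [hd] at this
  norm_cast at this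
lemma bez (hf : IrQ) :
    ∃ D : ℤ, D ≠ 0 ∧ ∀ n : ℤ, ∃ a b : ℤ, D = a * fQ n + b * pQ n := by
  have hm : (X ^ 3 + C c₂ * X ^ 2 + C c₁ * X + C c₀ : ℤ[X]).Monic := by monicity!
  have hq := (hm.irreducible_iff_irreducible_map_fraction_map (K := ℚ)).1 hf
  obtain ⟨a, b, hab⟩ := hq.separable
  obtain ⟨d, hd⟩ := IsLocalization.integerNormalization_map_to_map (nonZeroDivisors ℤ) a
  obtain ⟨e, he⟩ := IsLocalization.integerNormalization_map_to_map (nonZeroDivisors ℤ) b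
  set a' := IsLocalization.integerNormalization (nonZeroDivisors ℤ) a
  set b' := IsLocalization.integerNormalization (nonZeroDivisors ℤ) b
  refine ⟨d * e, mul_ne_zero (nonZeroDivisors.ne_zero d.2) (nonZeroDivisors.ne_zero e.2), fun n => ⟨e * a'.eval n, d * b'.eval n, ?_⟩⟩
  have h1 := congrArg (Polynomial.eval (n : ℚ)) hab
  have h2 := congrArg (Polynomial.eval (n : ℚ)) hd
  have h3 := congrArg (Polynomial.eval (n : ℚ)) he
  rw [eval_intCast_map] at h2 h3
  simp [derivative_map] at h1 h2 h3
  have : (¡d * ¡e : ℚ) = (¡e : ℚ) * ¡(a'.eval n) * ¡(fQ n) + (¡d : ℚ) * ¡(b'.eval n) * ¡(pQ n) := by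
    rw [h2, h3, ff, fp]; push_cast
    linear_combination (-¡d * ¡e : ℚ) * h1
  exact_mod_cast this
end
lemma pk_core {c₀ c₁ c₂ D : ℤ} (hD : ∀ n : ℤ, ∃ a b, D = a * fQ n + b * pQ n) {p : ℕ} (hp : p.Prime)
    {j k : ℕ} (hj : 1 ≤ j) (hjk : j ≤ k) (hpD : ¬ ¡p ^ j ∣ D) {n m : ℤ} (hn : ¡p ^ k ∣ fQ n)
    (hm : ¡p ^ k ∣ fQ m) (h : ¡p ^ j ∣ n - m) : ¡p ^ (k - j + 1) ∣ n - m := by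
  obtain ⟨a, b, hab⟩ := hD m
  have h1 : ¡p ^ k ∣ (n - m) * (pQ m + (n - m) * (n + 2 * m + c₂)) := by
    have := dvd_sub hn hm
    rwa [show fQ n - fQ m = (n - m) * (pQ m + (n - m) * (n + 2 * m + c₂)) by unfold ff fp; ring] at this
  obtain ⟨u, v, hu, hv, huv⟩ := exists_dvd_and_dvd_of_dvd_mul h1
  have hq := congrArg Int.natAbs huv
  rw [Int.natAbs_pow, Int.natAbs_natCast, Int.natAbs_mul] at hq
  obtain ⟨i, hi, hi'⟩ := (Nat.dvd_prime_pow hp).1 (⟨_, hq⟩ : u.natAbs ∣ p ^ k)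
  obtain ⟨l, hl, hl'⟩ := (Nat.dvd_prime_pow hp).1 (⟨_, hq.trans (mul_comm _ _)⟩ : v.natAbs ∣ p ^ k)
  rw [hi', hl', ← pow_add] at hq
  have hil := Nat.pow_right_injective hp.two_le hq
  have hlj : l < j := by
    by_contra hc
    push Not at hc
    apply hpD
    have : ¡p ^ j ∣ v := Int.natAbs_dvd_natAbs.1 (by rw [Int.natAbs_pow, Int.natAbs_natCast, hl']; exact pow_dvd_pow _ hc)
    have h2 : ¡p ^ j ∣ pQ m := (dvd_add_left (h.mul_right _)).1 (this.trans hv)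
    rw [hab]
    exact dvd_add (((pow_dvd_pow _ hjk).trans hm).mul_left _) (h2.mul_left _)
  refine dvd_trans (Int.natAbs_dvd_natAbs.1 ?_) hu
  rw [Int.natAbs_pow, Int.natAbs_natCast, hi']
  exact pow_dvd_pow _ om
lemma fibq {q X : ℕ} (hq : 0 < q) (S : Finset ℕ) (hS : S ⊆ Icc 1 X) (h : ∀ n ∈ S, ∀ m ∈ S, ¡q ∣ ¡n - m) :
    #S ≤ X / q + 1 := by
  rw [← card_range (X / q + 1)]
  refine card_le_card_of_injOn (· / q) (fun n hn => ?_) fun n hn m hm e => ?_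
  · have := mem_Icc.1 (hS hn)
    simpa [Nat.lt_succ_iff] using Nat.div_le_div_right this.2
  · have h1 := h m hm n hn
    rw [← Int.modEq_iff_dvd, Int.natCast_modEq_iff] at h1
    have e : n / q = m / q := e
    rw [← Nat.div_add_mod n q, ← Nat.div_add_mod m q, e, h1]
lemma pk_count (c₀ c₁ c₂ D : ℤ) (h0 : D ≠ 0) (hD : ∀ n : ℤ, ∃ a b, D = a * fQ n + b * pQ n) :
    ∃ C : ℕ, ∀ p : ℕ, p.Prime → ∀ k, 1 ≤ k → ∀ X : ℕ,
      (#((Icc 1 X).filter fun n : ℕ => ¡p ^ k ∣ fQ n) : ℝ) ≤ C * (X / p ^ k + 1) := by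
  have key : ∀ p : ℕ, p.Prime → ∀ j k, 1 ≤ j → j ≤ k → ¬ ¡p ^ j ∣ D → ∀ X R : ℕ,
      #(((Icc 1 X).filter fun n : ℕ => ¡p ^ k ∣ fQ n).image (· % p ^ j)) ≤ R →
      (#((Icc 1 X).filter fun n : ℕ => ¡p ^ k ∣ fQ n) : ℝ) ≤ R * p ^ (j - 1) * (X / p ^ k + 1) := by
    intro p hp j k hj hjk hpD X R hR
    have hp1 : ®1 ≤ p := mc hp.one_le
    have h1 : #((Icc 1 X).filter fun n : ℕ => ¡p ^ k ∣ fQ n) ≤ (X / p ^ (k - j + 1) + 1) * R := by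
      refine (card_le_mul_card_image _ (X / p ^ (k - j + 1) + 1) fun a _ => ?_).trans gc
      refine fibq (pow_pos hp.pos _) _ ((filter_subset _ _).trans (filter_subset _ _)) fun n hn m hm => ?_
      simp only [mem_filter] at hn hm
      push_cast
      refine pk_core hD hp hj hjk hpD hn.1.2 hm.1.2 ?_
      have := Nat.modEq_iff_dvd.1 (hm.2.trans hn.2.symm : m ≡ n [MOD p ^ j])
      exact_mod_cast this
    have h2 : ((X / p ^ (k - j + 1) : ℕ) : ℝ) ≤ p ^ (j - 1) * (X / p ^ k) := by
      refine Nat.cast_div_le.trans ?_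
      have : ®p ^ k ≤ p ^ (j - 1) * p ^ (k - j + 1) := by
        rw [← pow_add]; exact pow_le_pow_right₀ hp1 om
      push_cast
      rw [mul_div_assoc', div_le_div_iff₀ pv pv]
      nlinarith [mul_le_mul_of_nonneg_left this (Nat.cast_nonneg (α := ℝ) X)]
    calc ®_ ≤ (((X / p ^ (k - j + 1) + 1) * R : ℕ) : ℝ) := mc h1
      _ = R * ((X / p ^ (k - j + 1) : ℕ) + 1) := by push_cast; ring
      _ ≤ R * (p ^ (j - 1) * (X / p ^ k) + p ^ (j - 1) * 1) := by
          gcongr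
          rw [mul_one]; exact one_le_pow₀ hp1
      _ = _ := rg
  set d := D.natAbs with hd
  have hd0 : 0 < d := om
  have hlt : ∀ p j : ℕ, d < p ^ j → ¬ ¡p ^ j ∣ D := fun p j h h' => by
    have := Int.natAbs_dvd_natAbs.2 h'
    rw [Int.natAbs_pow, Int.natAbs_natCast] at this
    exact absurd (Nat.le_of_dvd hd0 this) om
  obtain ⟨B, hB⟩ : ∃ B : ℕ, B = d ^ (d + 1) := ⟨_, rfl⟩
  refine ⟨3 * 1 + B + B * B, fun p hp k hk X => ?_⟩
  have hX : ®0 ≤ X / p ^ k + 1 := pv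
  rcases lt_or_ge d p with h | h
  · have h3 : #(((Icc 1 X).filter fun n : ℕ => ¡p ^ k ∣ fQ n).image (· % p)) ≤ 3 := by
      refine le_trans (card_le_card ?_) (rho_le_three hp : rQ p ≤ _)
      intro a ha
      obtain ⟨n, hn, rfl⟩ := mem_image.1 ha
      refine mem_filter.2 ⟨mem_range.2 (Nat.mod_lt _ hp.pos), ?_⟩
      have h1 : ¡p ∣ fQ n := (dvd_pow_self _ om).trans (mem_filter.1 hn).2
      exact (dvd_sub_right h1).1 (ff_congr (by rw [Int.natCast_mod]; exact Int.dvd_self_sub_emod))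
    refine (key p hp 1 k le_rfl hk (hlt p 1 (by simpa)) X 3 (by simpa using h3)).trans ?_
    push_cast
    gcongr
    rw [pow_zero]
    nlinarith [Nat.cast_nonneg (α := ℝ) B]
  · have hpj : p ^ (d + 1) ≤ B := hB ▸ Nat.pow_le_pow_left h _
    have hpj' : ®p ^ (d + 1) ≤ B := mc hpj
    rcases lt_or_ge k (d + 1) with hkj | hkj
    · have h1 : (#((Icc 1 X).filter fun n : ℕ => ¡p ^ k ∣ fQ n) : ℝ) ≤ X := by
        exact_mod_cast (card_filter_le _ _).trans sm
      have hp1 : ®1 ≤ p := mc hp.one_le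
      have h2 : ®X ≤ B * (X / p ^ k) := by
        have : ®p ^ k ≤ B := (pow_le_pow_right₀ hp1 hkj.le).trans hpj'
        rw [mul_div_assoc', le_div_iff₀ pv]
        nlinarith [Nat.cast_nonneg (α := ℝ) X]
      push_cast
      have : ®0 ≤ X / p ^ k := pv
      nlinarith [Nat.cast_nonneg (α := ℝ) B, mul_nonneg (mul_nonneg (Nat.cast_nonneg (α := ℝ) B) (Nat.cast_nonneg (α := ℝ) B)) hX]
    · refine (key p hp (d + 1) k om hkj (hlt p _ ?_) X B ?_).trans ?_
      · exact (Nat.lt_pow_self hp.one_lt).trans (Nat.pow_lt_pow_right hp.one_lt om)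
      · refine le_trans (card_le_card (t := range (p ^ (d + 1))) ?_) (by simpa using hpj)
        intro a ha
        obtain ⟨n, hn, rfl⟩ := mem_image.1 ha
        exact mem_range.2 (Nat.mod_lt _ (pow_pos hp.pos _))
      · have hpj2 : ®p ^ d ≤ B :=
          le_trans (pow_le_pow_right₀ (mc hp.one_le) om) hpj'
        push_cast
        gcongr
        have := mul_le_mul_of_nonneg_left hpj2 (Nat.cast_nonneg (α := ℝ) B)
        linarith [Nat.cast_nonneg (α := ℝ) B]
lemma p1_count {p : ℕ} (hp : p.Prime) (X : ℕ) :
    (#((Icc 1 X).filter fun n : ℕ => ¡p ∣ fQ n) : ℝ) ≤ rQ p * (X / p) + 3 := by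
  have h1 : #((Icc 1 X).filter fun n : ℕ => ¡p ∣ fQ n) ≤ (X / p + 1) * rQ p := by
    refine (card_le_mul_card_image (f := (· % p)) _ (X / p + 1) fun a _ => ?_).trans (Nat.mul_le_mul_left _ (card_le_card ?_))
    · refine fibq hp.pos _ ((filter_subset _ _).trans (filter_subset _ _)) fun n hn m hm => ?_
      simp only [mem_filter] at hn hm
      exact Nat.modEq_iff_dvd.1 (hm.2.trans hn.2.symm : m ≡ n [MOD p])
    · intro a ha
      obtain ⟨n, hn, rfl⟩ := mem_image.1 ha
      refine mem_filter.2 ⟨mem_range.2 (Nat.mod_lt _ hp.pos), ?_⟩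
      exact (dvd_sub_right (mem_filter.1 hn).2).1 (ff_congr (by rw [Int.natCast_mod]; exact Int.dvd_self_sub_emod))
  have h2 : ®(rQ p) ≤ 3 := mc rho_le_three hp
  calc ®_ ≤ (((X / p + 1) * rQ p : ℕ) : ℝ) := mc h1
    _ = rQ p * (X / p : ℕ) + rQ p := by push_cast; ring
    _ ≤ _ := by gcongr; exact Nat.cast_div_le
lemma pp_bd {C X T p : ℕ} (hp : p.Prime) (hT : ∀ n ∈ Icc 1 X, (fQ (n : ℕ)).natAbs ≤ T)
    (h0 : ∀ n : ℤ, fQ n ≠ 0) (hT1 : 1 ≤ T)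
    (hC : ∀ k, 1 ≤ k → (#((Icc 1 X).filter fun n : ℕ => ¡p ^ k ∣ fQ n) : ℝ) ≤ C * (X / p ^ k + 1)) :
    ∑ n ∈ Icc 1 X, ((fQ (n : ℕ)).natAbs.factorization p : ℝ) * log p ≤
      X * (rQ p * (log p / p)) + 3 * log p + 2 * C * X * (log p / p ^ 2) + C * log T := by
  have hl : 0 < log p := log_pos (mc hp.one_lt)
  set K := Nat.log p T with hK
  have hb : T < p ^ (K + 1) := Nat.lt_pow_succ_log_self hp.one_lt T
  have hKl : K * log p ≤ log T := by
    rw [← log_pow]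
    have := hp.pos
    exact log_le_log pv (mc Nat.pow_log_le_self p om)
  have h1 : ∑ n ∈ Icc 1 X, ((fQ (n : ℕ)).natAbs.factorization p : ℝ) ≤
      ∑ k ∈ Ico 1 (K + 1), (#((Icc 1 X).filter fun n : ℕ => ¡p ^ k ∣ fQ n) : ℝ) := by
    have : ∀ n ∈ Icc 1 X, (fQ (n : ℕ)).natAbs.factorization p = ∑ k ∈ Ico 1 (K + 1), if ¡p ^ k ∣ fQ (n : ℕ) then 1 else 0 := by
      intro n hn
      rw [Nat.factorization_eq_card_pow_dvd_of_lt hp (Int.natAbs_pos.2 (h0 n)) ((hT n hn).trans_lt hb), card_filter]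
      refine sum_congr rfl fun k _ => ?_
      simp only [← Int.natCast_dvd, Nat.cast_pow]
    rw [← Nat.cast_sum, ← Nat.cast_sum, sum_congr rfl this, sum_comm]
    simp only [card_filter]
    rfl
  have h2 : ∑ k ∈ Ico 1 (K + 1), (#((Icc 1 X).filter fun n : ℕ => ¡p ^ k ∣ fQ n) : ℝ) ≤
      (rQ p * (X / p) + 3) + C * (X * (2 / p ^ 2) + K) := by
    have hpos : ®0 ≤ (rQ p * (X / p) + 3) := pv
    rcases Nat.eq_zero_or_pos K with h | h
    · rw [h]; simp only [zero_add, Ico_self, sum_empty]; positivity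
    rw [sum_eq_sum_Ico_succ_bot om, pow_one]
    refine add_le_add (p1_count hp X) ?_
    refine (sum_le_sum fun k hk => hC k (by simp at hk; omega)).trans ?_
    rw [← mul_sum, sum_add_distrib]
    gcongr
    · simp only [div_eq_mul_one_div ®X]
      rw [← mul_sum]
      have := geo_tail hp.two_le 2 K
      rw [← Finset.Ico_succ_right_eq_Icc] at this
      gcongr
      exact this
    · simp only [sum_const, Nat.card_Ico, mul_one, nsmul_eq_mul]
      exact_mod_cast (om : K + 1 - (1 + 1) ≤ K)
  rw [← sum_mul]
  calc _ ≤ ((rQ p * (X / p) + 3) + C * (X * (2 / p ^ 2) + K)) * log p := by gcongr; exact h1.trans h2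
    _ = X * (rQ p * (log p / p)) + 3 * log p + 2 * C * X * (log p / p ^ 2) + C * (K * log p) := rg
    _ ≤ _ := gc
lemma sum_log_sq : ∃ S : ℝ, ∀ A : Finset ℕ, ∑ p ∈ A, log p / ®p ^ 2 ≤ S := by
  have hs := (Real.summable_one_div_nat_rpow.2 (show ®1 < 3 / 2 by norm_num)).mul_left 2
  refine ⟨_, fun A => (sum_le_sum fun p _ => ?_).trans (hs.sum_le_tsum A fun p _ => pv)⟩
  rcases Nat.eq_zero_or_pos p with h | h
  · subst h; simp
  have hp : ®0 < p := mc h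
  have h1 := log_le_rpow_div hp.le (show ®0 < 1 / 2 by norm_num)
  have h2 : ®p ^ 2 = ®p ^ ®(1 / 2) * ®p ^ ®(3 / 2) := by
    rw [← rpow_add hp]; norm_num
  have h3 : ®0 < ®p ^ ®(1 / 2) := pv
  rw [h2, div_le_iff₀ pv]
  calc _ ≤ _ := h1
    _ = _ := by field_simp
noncomputable def Lf (c₀ c₁ c₂ : ℤ) (Y n : ℕ) : ℝ :=
  ∑ p ∈ (range (Y + 1)).filter Nat.Prime, ®((ff c₀ c₁ c₂ n).natAbs.factorization p) * log p
set_option hygiene false in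
notation "LQ" => Lf c₀ c₁ c₂
section
open Polynomial
lemma ff_ne (hf : IrQ) (n : ℤ) : fQ n ≠ 0 :=
  fun h => one_ne_zero (FF_ne hf n 1 (by rw [← h]; unfold FF ff; ring))
lemma upA (hf : IrQ) {B : ℕ} (hB1 : 1 ≤ B)
    (hB : ∀ n : ℕ, 1 ≤ n → (fQ n).natAbs ≤ B * n ^ 3) {ε : ℝ} (hε : 0 < ε) (hε1 : ε ≤ 1) :
    ∀ᶠ x : ℕ in atTop, ∑ n ∈ Icc 1 x, LQ (B * x) n ≤ (1 + ε) * (x * log x) := by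
  obtain ⟨D, hD0, hD⟩ := bez hf
  obtain ⟨C, hC⟩ := pk_count c₀ c₁ c₂ D hD0 hD
  obtain ⟨S, hS⟩ := sum_log_sq
  have hBx : Tendsto (fun x : ℕ => B * x) atTop atTop := tendsto_id.const_mul_atTop' om
  have hpi := (hBx.eventually (tendsto_natCast_atTop_atTop.eventually (Chebyshev.eventually_primeCounting_le one_pos)))
  filter_upwards [hBx.eventually (M1 hf (half_pos hε) ln), hpi, eventually_ge_atTop B, eventually_ge_atTop 2,
    log_ev (2 * log B + (3 * log 4 * B + 2 * C * S + C * ((log 4 + 1) * B * 4))) (half_pos hε)] with x h1 h2 hxB hx2 h3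
  have hx0 : ®0 < x := mc (om : 0 < x)
  have hB0 : ®0 < B := mc hB1
  have hxB' : ®B ≤ x := mc hxB
  have hl : 0 < log x := log_pos (mc (om : 1 < x))
  have hlB : 0 ≤ log B := log_nonneg (mc hB1)
  have hlY : log ®((B * x : ℕ)) = log B + log x := by
    push_cast; exact log_mul hB0.ne' hx0.ne'
  have hlT : log ®((B * x ^ 3 : ℕ)) ≤ 4 * log ®((B * x : ℕ)) := by
    rw [hlY]; push_cast
    rw [log_mul hB0.ne' pv, log_pow]; push_cast; linarith
  have h4 : ∑ p ∈ (range (B * x + 1)).filter Nat.Prime, log p ≤ log 4 * (B * x) := by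
    have := Chebyshev.theta_le_log4_mul_x (x := ®((B * x : ℕ))) pv
    rw [Chebyshev.theta_eq_sum_Icc, Nat.floor_natCast] at this
    convert this using 2
    · congr 1; ext; simp
    · push_cast; ring
  have h5 : (#((range (B * x + 1)).filter Nat.Prime) : ℝ) * log ®((B * x ^ 3 : ℕ)) ≤ (log 4 + 1) * B * 4 * x := by
    rw [Nat.floor_natCast, Nat.primeCounting, Nat.primeCounting', Nat.count_eq_card_filter_range] at h2
    have hY : 0 < log ®((B * x : ℕ)) := by rw [hlY]; linarith
    calc _ ≤ ((log 4 + 1) * ®((B * x : ℕ)) / log ®((B * x : ℕ))) * (4 * log ®((B * x : ℕ))) := by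
          gcongr
      _ = _ := by field_simp; push_cast; ring
  calc ∑ n ∈ Icc 1 x, LQ (B * x) n
      ≤ ∑ p ∈ (range (B * x + 1)).filter Nat.Prime, (x * (rQ p * (log p / p)) + 3 * log p +
          2 * C * x * (log p / p ^ 2) + C * log ®((B * x ^ 3 : ℕ))) := by
        unfold Lf
        rw [sum_comm]
        refine sum_le_sum fun p hp => pp_bd (mem_filter.1 hp).2 (fun n hn => ?_) (ff_ne hf)
          (Nat.one_le_iff_ne_zero.2 pv) fun k hk => hC p (mem_filter.1 hp).2 k hk x
        rw [mem_Icc] at hn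
        exact (hB n hn.1).trans (Nat.mul_le_mul_left _ (Nat.pow_le_pow_left hn.2 3))
    _ = x * ∑ p ∈ (range (B * x + 1)).filter Nat.Prime, (rQ p * (log p / p)) +
        3 * ∑ p ∈ (range (B * x + 1)).filter Nat.Prime, log p +
        2 * C * x * ∑ p ∈ (range (B * x + 1)).filter Nat.Prime, (log p / p ^ 2) +
        C * (#((range (B * x + 1)).filter Nat.Prime) * log ®((B * x ^ 3 : ℕ))) := by
        simp only [sum_add_distrib, ← mul_sum, sum_const, nsmul_eq_mul]
    _ ≤ x * ((1 + ε / 2) * (log B + log x)) + 3 * (log 4 * (B * x)) + 2 * C * x * S +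
        C * ((log 4 + 1) * B * 4 * x) := by
        gcongr
        · have := (abs_le.1 h1).2
          rw [hlY] at this
          linarith
        · exact hS _
    _ ≤ _ := by
        have : (1 + ε / 2) * log B ≤ 2 * log B := by gcongr; linarith
        have := mul_le_mul_of_nonneg_left (show (1 + ε / 2) * (log B + log x) +
          (3 * log 4 * B + 2 * C * S + C * ((log 4 + 1) * B * 4)) ≤ (1 + ε) * log x by linarith) hx0.le
        linarith
end
end
section
open Finset Real Filter Polynomial
variable {c₀ c₁ c₂ : ℤ}
lemma tset (hf : IrQ) (N B : ℕ) :
    ∃ Z₀ : ℝ, ∀ Z : ℝ, Z₀ ≤ Z → ∀ y : ℝ, Z ≤ y → y ≤ Z ^ N → ∀ n : ℕ, n ≠ 0 → ®n < Z ^ (B + 1) →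
      1 / (12 * (®N + 1)) ≤ ∑ t ∈ (pI y (y * Z)).filter (fun t : ℕ => ¬ t ∣ n), 1 / ®t := by
  obtain ⟨Z₀, h⟩ := M1_int hf N
  refine ⟨max Z₀ (max 2 (12 * (N + 1) * B)), fun Z hZ y h1 h2 n hn hB => ?_⟩
  have hZ2 : 2 ≤ Z := (le_max_left _ _).trans ((le_max_right _ _).trans hZ)
  have hZB : 12 * (N + 1) * B ≤ Z := (le_max_right _ _).trans ((le_max_right _ _).trans hZ)
  have h3 := h Z ((le_max_left _ _).trans hZ) y h1 h2
  have hw : 0 ≤ y * Z := mul_nonneg ln ln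
  have h4 : ∑ p ∈ pI y (y * Z), ®(rQ p) / p ≤ 3 * ∑ p ∈ pI y (y * Z), 1 / ®p := by
    rw [mul_sum]
    refine sum_le_sum fun p hp => ?_
    have : ®(rQ p) ≤ 3 := mc rho_le_three ((mem_pI hw).1 hp).1
    rw [mul_one_div]; gcongr
  have h5 : ∑ t ∈ (pI y (y * Z)).filter (fun t : ℕ => ¬ ¬ t ∣ n), 1 / ®t ≤ B * (1 / Z) := by
    have hsub : (pI y (y * Z)).filter (fun t : ℕ => ¬ ¬ t ∣ n) ⊆ bigp Z n := fun t ht => by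
      rw [mem_filter, mem_pI hw, not_not] at ht
      exact (mem_bigp hn).2 ⟨ht.1.1, ht.2, by linarith [ht.1.2.1]⟩
    calc _ ≤ ∑ t ∈ bigp Z n, 1 / ®t := sum_le_sum_of_subset_of_nonneg hsub fun _ _ _ => pv
      _ ≤ ∑ t ∈ bigp Z n, 1 / Z := sum_le_sum fun t ht => by
          have := ((mem_bigp hn).1 ht).2.2
          gcongr
      _ ≤ _ := by
          rw [sum_const, nsmul_eq_mul]
          gcongr
          exact bigp_card ln hn hB
  have h6 : ®B * (1 / Z) ≤ 1 / (12 * (N + 1)) := by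
    rw [mul_one_div, div_le_div_iff₀ ln pv]; linarith
  have h7 := sum_filter_add_sum_filter_not (pI y (y * Z)) (fun t : ℕ => ¬ t ∣ n) fun t => 1 / ®t
  have h8 : 1 / (2 * (®N + 1)) = 6 * (1 / (12 * (N + 1))) := by field_simp; norm_num
  rw [h8] at h3
  linarith
lemma vbd {g r φ y₁ c y₂ w₂ t : ℤ} (hr : fQ r = g * φ) (hdet : c * y₂ - y₁ * w₂ = 1) {z : ℝ} {s : Finset ℕ}
    (hs : s ⊆ pz z) (ht : ∀ p ∈ pz z, ¬ ¡p ∣ t) (hg : ∀ p ∈ pz z, ¡p ∣ g ↔ p ∈ s) (hf : ∀ p ∈ s, ¬ ¡p ∣ pQ r) :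
    (∏ p ∈ pz z, vQ p) * ∏ p ∈ s, (1 - 2 / ®p) ≤
      ∏ p ∈ pz z, (1 - ®(cnt (DQ g r φ y₁ c y₂ w₂ t) p) / p ^ 2) := by
  classical
  rw [← inter_eq_right.2 hs, ← prod_ite_mem, ← prod_mul_distrib]
  have h2 : ∀ p : ℕ, p.Prime → 0 ≤ 1 - 2 / ®p := fun p hp => by
    have : ®2 ≤ p := mc hp.two_le
    rw [sub_nonneg, div_le_one ln]; exact this
  refine prod_le_prod (fun p hp => ?_) fun p hp => ?_
  · have hp := (mem_pz.1 hp).1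
    refine mul_nonneg (vv_pos hp).le ?_
    split_ifs
    exacts [h2 p hp, zero_le_one]
  · have hpp := (mem_pz.1 hp).1
    have hp0 : ®0 < p := mc hpp.pos
    split_ifs with h
    · have h3 : ®(cnt (DQ g r φ y₁ c y₂ w₂ t) p) ≤ 2 * p := by
        exact_mod_cast cnt_le_two hdet hpp ((hg p hp).2 h) (ht p hp) (hf p h)
      refine (mul_le_of_le_one_left (h2 p hpp) (vv_le hpp)).trans ?_
      have : ®(cnt (DQ g r φ y₁ c y₂ w₂ t) p) / p ^ 2 ≤ 2 / p := by
        rw [div_le_div_iff₀ pv hp0]; nlinarith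
      linarith
    · have h3 := cnt_le_rho (y₁ := y₁) hr hdet hpp (fun h' => h ((hg p hp).1 h')) (ht p hp)
      have h4 : ®(cnt (DQ g r φ y₁ c y₂ w₂ t) p) ≤ 1 + (p - 1) * rQ p := by
        have := Nat.cast_le (α := ℝ).2 h3
        rwa [Nat.cast_add, Nat.cast_mul, Nat.cast_sub hpp.one_le, Nat.cast_one] at this
      rw [mul_one, vv]
      gcongr
lemma geom_fun (hf : IrQ) :
    ∃ κ C : ℝ, 0 < κ ∧ κ ≤ 1 ∧ 1 ≤ C ∧ ∃ φ y₁ c y₂ w₂ : ℕ → ℕ → ℤ, ∃ E m : ℕ → ℕ → ℕ, ∀ g r : ℕ, 2 ≤ g → ¡g ∣ fQ r →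
      fQ r = g * φ g r ∧ Geo c₁ c₂ κ C g r (φ g r) (y₁ g r) (c g r) (y₂ g r) (w₂ g r) (E g r) (m g r) := by
  obtain ⟨κ, C, h1, h2, h3, H⟩ := geom (FF_ne hf)
  have : ∀ g r : ℕ, ∃ φ y₁ c y₂ w₂ : ℤ, ∃ E m : ℕ, 2 ≤ g → ¡g ∣ fQ r →
      fQ r = g * φ ∧ Geo c₁ c₂ κ C g r φ y₁ c y₂ w₂ E m := fun g r => by
    by_cases h : 2 ≤ g ∧ ¡g ∣ fQ r
    · obtain ⟨φ, hφ⟩ := h.2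
      obtain ⟨y₁, c, y₂, w₂, E, m, G⟩ := H g h.1 r φ hφ
      exact ⟨φ, y₁, c, y₂, w₂, E, m, fun _ _ => ⟨hφ, G⟩⟩
    · exact ⟨0, 0, 0, 0, 0, 0, 0, fun a b => absurd ⟨a, b⟩ h⟩
  choose φ y₁ c y₂ w₂ E m hh using this
  exact ⟨κ, C, h1, h2, h3, φ, y₁, c, y₂, w₂, E, m, hh⟩
end
section
open Finset Real Filter Polynomial
variable {c₀ c₁ c₂ : ℤ}
variable {D : ℤ}
structure Qd (Z : ℝ) (M p₀ : ℕ) (s : Finset ℕ) (g₁ g₂ g₃ g : ℕ) : Prop where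
  hs : s ⊆ WW p₀ Z
  p1 : g₁.Prime
  p2 : g₂.Prime
  p3 : g₃.Prime
  l1 : Z ^ 8 ≤ g₁
  l2 : Z ^ M ≤ g₂
  u3 : g₃ ≤ Z ^ (M + 5)
  h12 : g₁ < g₂
  h23 : g₂ < g₃
  hg : g = (∏ p ∈ s, p) * g₁ * g₂ * g₃
  gl : Z ^ (3 * M + 1) ≤ g
  gu : g ≤ Z ^ (3 * M + 2)
  Gu : ((∏ p ∈ s, p) * g₁ : ℕ) ≤ Z ^ M
namespace Qd
variable {Z : ℝ} {M p₀ : ℕ} {s : Finset ℕ} {g₁ g₂ g₃ g : ℕ} (H : Qd Z M p₀ s g₁ g₂ g₃ g)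
include H
lemma sp {p : ℕ} (hp : p ∈ s) : p.Prime ∧ ®p < Z ^ 8 ∧ p₀ ≤ p := by
  have := mem_filter.1 (H.hs hp)
  exact ⟨(mem_pz.1 this.1).1, (mem_pz.1 this.1).2, this.2⟩
lemma dvd {p : ℕ} (hp : p.Prime) : p ∣ g ↔ p ∈ s ∨ p = g₁ ∨ p = g₂ ∨ p = g₃ := by
  rw [H.hg, hp.dvd_mul, hp.dvd_mul, hp.dvd_mul, Nat.prime_dvd_prime_iff_eq hp H.p1, Nat.prime_dvd_prime_iff_eq hp H.p2,
    Nat.prime_dvd_prime_iff_eq hp H.p3, hp.prime.dvd_finset_prod_iff]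
  constructor
  · rintro (((⟨q, hq, h⟩ | h) | h) | h)
    · exact Or.inl ((Nat.prime_dvd_prime_iff_eq hp (H.sp hq).1).1 h ▸ hq)
    all_goals simp [h]
  · rintro (h | h | h | h)
    · exact Or.inl (Or.inl (Or.inl ⟨p, h, dvd_rfl⟩))
    all_goals simp [h]
lemma lt {p : ℕ} (hp : p ∈ s) : p < g₁ := mc (H.sp hp).2.1.trans_le H.l1
lemma le0 (h0 : ®p₀ ≤ Z ^ 8) {p : ℕ} (hp : p.Prime) (h : p ∣ g) : p₀ ≤ p := by
  have h1 : p₀ ≤ g₁ := mc h0.trans H.l1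
  have := H.h12; have := H.h23
  rcases (H.dvd hp).1 h with h | h | h | h
  · exact (H.sp h).2.2
  all_goals omega
lemma cop1 : (∏ p ∈ s, p).Coprime g₁ := Nat.Coprime.prod_left fun _ hp => (Nat.coprime_primes (H.sp hp).1 H.p1).2 (H.lt hp).ne
lemma cop2 : ((∏ p ∈ s, p) * g₁).Coprime g₂ := Nat.Coprime.mul_left
  (Nat.Coprime.prod_left fun _ hp => (Nat.coprime_primes (H.sp hp).1 H.p2).2 ((H.lt hp).trans H.h12).ne)
  ((Nat.coprime_primes H.p1 H.p2).2 H.h12.ne)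
lemma cop3 : ((∏ p ∈ s, p) * g₁ * g₂).Coprime g₃ := Nat.Coprime.mul_left (Nat.Coprime.mul_left
  (Nat.Coprime.prod_left fun _ hp => (Nat.coprime_primes (H.sp hp).1 H.p3).2 (((H.lt hp).trans H.h12).trans H.h23).ne)
  ((Nat.coprime_primes H.p1 H.p3).2 (H.h12.trans H.h23).ne)) ((Nat.coprime_primes H.p2 H.p3).2 H.h23.ne)
lemma sqf : Squarefree g := by
  rw [H.hg, Nat.squarefree_mul_iff, Nat.squarefree_mul_iff, Nat.squarefree_mul_iff]
  refine ⟨H.cop3, ⟨H.cop2, ⟨H.cop1, ?_, H.p1.squarefree⟩, H.p2.squarefree⟩, H.p3.squarefree⟩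
  refine Finset.squarefree_prod_of_pairwise_isCoprime (fun p hp q hq h => ?_) fun p hp => (H.sp hp).1.squarefree
  exact Nat.coprime_iff_isRelPrime.1 ((Nat.coprime_primes (H.sp hp).1 (H.sp hq).1).2 h)
lemma rho_eq : rQ g = (∏ p ∈ s, rQ p) * rQ g₁ * rQ g₂ * rQ g₃ := by
  classical
  have n1 : g₁ ∉ s := fun h => lt_irrefl _ (H.lt h)
  have n2 : g₂ ∉ insert g₁ s := fun h => by
    rcases mem_insert.1 h with h | h
    exacts [H.h12.ne' h, (H.lt h).not_gt H.h12]
  have n3 : g₃ ∉ insert g₂ (insert g₁ s) := fun h => by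
    rcases mem_insert.1 h with h | h
    · exact H.h23.ne' h
    rcases mem_insert.1 h with h | h
    exacts [(H.h12.trans H.h23).ne' h, (H.lt h).not_gt (H.h12.trans H.h23)]
  have : rQ _ = _ := rho_prod (insert g₃ (insert g₂ (insert g₁ s))) (by
    simp only [mem_insert]
    rintro p (rfl | rfl | rfl | h)
    exacts [H.p3, H.p2, H.p1, (H.sp h).1])
  rw [prod_insert n3, prod_insert n2, prod_insert n1, prod_insert n3, prod_insert n2, prod_insert n1] at this
  rw [show g = g₃ * (g₂ * (g₁ * ∏ p ∈ s, p)) by rw [H.hg]; ring, this]; ring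
lemma fpr (hD0 : D ≠ 0) (hD : ∀ n : ℤ, ∃ a b, D = a * fQ n + b * pQ n) (hp₀ : D.natAbs < p₀) (h3 : 3 ≤ p₀)
    (h0 : ®p₀ ≤ Z ^ 8) {r φ : ℤ} (hr : fQ r = g * φ) (p : ℕ) (hp : p.Prime) (h : p ∣ g) :
    ¬ ¡p ∣ pQ r ∧ 3 ≤ p := by
  have hle := H.le0 h0 hp h
  refine ⟨fun h' => ?_, h3.trans hle⟩
  obtain ⟨a, b, hab⟩ := hD r
  have : ¡p ∣ D := by
    rw [hab, hr]
    exact dvd_add (((Int.natCast_dvd_natCast.2 h).mul_right _).mul_left _) (h'.mul_left _)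
  have := Nat.le_of_dvd (Int.natAbs_pos.2 hD0) (Int.natCast_dvd.1 this)
  omega
end Qd
def Sp (c₁ c₂ : ℤ) (κ C Z : ℝ) (M g : ℕ) (r φ y₁ c y₂ w₂ : ℤ) (E m t s k : ℕ) : Prop :=
  ®g ≤ E * s ∧ ®(E * s) ≤ (1 + κ) * g ∧ ®(m * E) ≤ t * k ∧
      ®(t * k) ≤ (1 + κ) * (m * E) ∧ (∀ p ∈ pz (Z ^ 8), ¬ ¡p ∣ DD c₁ c₂ g r φ y₁ c y₂ w₂ t s k) ∧
      IsCoprime (DD c₁ c₂ g r φ y₁ c y₂ w₂ t s k) ((g * (t * k) ^ 2 : ℕ) : ℤ) ∧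
      ∃ u : ℤ, ®u ≤ 3 * (Z ^ (6 * M) / (6 * C * g ^ 2) * ((g * (t * k) ^ 2 : ℕ) : ℝ)) ∧
        Z ^ (6 * M) / (6 * C * g ^ 2) * ((g * (t * k) ^ 2 : ℕ) : ℝ) ≤ 2 * u ∧
        ((g * (t * k) ^ 2 : ℕ) : ℤ) ∣ DD c₁ c₂ g r φ y₁ c y₂ w₂ t s k * u +
          kk c₁ c₂ g r φ y₁ c (y₁ * s + t * k * y₂) (c * s + t * k * w₂)
open Classical in
noncomputable def Sf (c₁ c₂ : ℤ) (κ C Z : ℝ) (M g : ℕ) (r φ y₁ c y₂ w₂ : ℤ) (E m t : ℕ) : Finset (ℕ × ℕ) :=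
  (range (2 * g + 1) ×ˢ range (2 * (m * E) + 1)).filter fun q : ℕ × ℕ => Sp c₁ c₂ κ C Z M g r φ y₁ c y₂ w₂ E m t q.1 q.2
noncomputable def Tf (c₁ c₂ : ℤ) (Z : ℝ) (C3 g : ℕ) (r φ y₁ c : ℤ) (E m : ℕ) : Finset ℕ :=
  (pI (m * E / Z ^ (C3 + 1)) (m * E / Z ^ (C3 + 1) * Z)).filter fun t : ℕ => ¬ t ∣ (c * dd c₁ c₂ g r φ y₁ c * g).natAbs
lemma inner (hf : IrQ) (hD0 : D ≠ 0)
    (hD : ∀ n : ℤ, ∃ a b, D = a * fQ n + b * pQ n) {p₀ : ℕ} (hp₀ : D.natAbs < p₀) (h3 : 3 ≤ p₀) :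
    ∃ C3 : ℕ, ∀ M : ℕ, 10 * C3 + 100 ≤ M → ∀ κ C : ℝ, 0 < κ → κ ≤ 1 → 1 ≤ C → ∃ Z₀ : ℝ, ∀ Z : ℝ, Z₀ ≤ Z →
    ∀ {s g₁ g₂ g₃ g}, Qd Z M p₀ s g₁ g₂ g₃ g →
    1 ≤ (∏ p ∈ pz (Z ^ 8), vQ p) * (∏ p ∈ s, (1 - 2 / ®p)) * Z → ∀ {r φ y₁ c y₂ w₂ : ℤ} {E m : ℕ},
    Geo c₁ c₂ κ C g r φ y₁ c y₂ w₂ E m → fQ r = g * φ →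
    1 / (12 * (®((6 * M : ℕ)) + 1)) ≤ ∑ t ∈ Tf c₁ c₂ Z C3 g r φ y₁ c E m, 1 / ®t ∧ ∀ t ∈ Tf c₁ c₂ Z C3 g r φ y₁ c E m,
      t.Prime ∧ Z ^ 8 ≤ t ∧ κ ^ 2 / (192 * C) * (Z ^ (6 * M) / (g * t)) * ((∏ p ∈ pz (Z ^ 8), vQ p) * (∏ p ∈ s, (1 - 2 / ®p))) ≤
        #(Sf c₁ c₂ κ C Z M g r φ y₁ c y₂ w₂ E m t) := by
  obtain ⟨C3, hcg⟩ := cell_good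
  refine ⟨C3, fun M hM κ C hκ hκ1 hC => ?_⟩
  obtain ⟨Z₁, hcg⟩ := hcg M hM κ C hκ hκ1 hC
  obtain ⟨Z₂, hts⟩ := tset hf (6 * M) (12 * M + 9)
  refine ⟨max (max Z₁ Z₂) (max (C + 5) p₀), fun Z hZ s g₁ g₂ g₃ g Q hV r φ y₁ c y₂ w₂ E m G hr => ?_⟩
  simp only [max_le_iff] at hZ
  obtain ⟨⟨hZ1, hZ2⟩, hZC, hZp⟩ := hZ
  have hZ1' : 1 < Z := ln
  have hZ0 : 0 < Z := ln
  have hp0Z : ®p₀ ≤ Z ^ 8 := hZp.trans (le_self_pow₀ hZ1'.le nn)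
  have hE0 : ®1 ≤ E := mc G.E1
  have hm1 : ®1 ≤ m := mc G.m1
  have hm5 : ®m ≤ 5 := mc G.m5
  have hE : Z ^ M ≤ E := by
    refine le_of_cube_le ln ?_
    have h1 := Q.gl.trans G.gE
    rw [pow_succ, mul_comm 3 M, pow_mul] at h1
    have : C * ®E ^ 3 ≤ ®E ^ 3 * Z := by rw [mul_comm]; gcongr; linarith
    exact le_of_mul_le_mul_right (h1.trans this) hZ0
  have hg1 : ®1 ≤ g := (one_le_pow₀ hZ1'.le).trans Q.gl
  have hgpos : 0 < g := mc hg1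
  have hEg : ®E ≤ g := by
    have : ®E ^ 2 ≤ g := mc G.E2
    nlinarith
  have hmE : Z ^ M ≤ m * E := hE.trans (le_mul_of_one_le_left ln hm1)
  set y : ℝ := m * E / Z ^ (C3 + 1) with hy
  have hyl : Z ^ 8 ≤ y := by
    rw [hy, le_div_iff₀ pv, ← pow_add]
    exact (pow_le_pow_right₀ hZ1'.le om).trans hmE
  have hyu : y ≤ Z ^ (6 * M) := by
    calc y ≤ m * E := div_le_self pv (one_le_pow₀ hZ1'.le)
      _ ≤ Z * Z ^ (3 * M + 2) := by gcongr <;> linarith [Q.gu]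
      _ = Z ^ (3 * M + 3) := rg
      _ ≤ _ := pow_le_pow_right₀ hZ1'.le om
  have hn0 : (c * dQ g r φ y₁ c * g).natAbs ≠ 0 := Int.natAbs_ne_zero.2 (mul_ne_zero (mul_ne_zero G.c0 G.f0) (mc hgpos.ne'))
  have hnu : ®((c * dQ g r φ y₁ c * g).natAbs) < Z ^ (12 * M + 9 + 1) := by
    have h1 : |®c| ≤ E := mc G.cE
    rw [Nat.cast_natAbs, Int.cast_abs]
    push_cast
    rw [mul_assoc, abs_mul, abs_mul, abs_of_pos (show ®0 < g by linarith)]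
    calc _ ≤ ®g * (C * g ^ 3) := by
          refine mul_le_mul (h1.trans hEg) (G.f0E.trans gc) pv ln
      _ < Z * (Z ^ (3 * M + 2)) ^ 4 := by
          have := Q.gu
          have h4 : ®g ^ 4 ≤ (Z ^ (3 * M + 2)) ^ 4 := gc
          have : ®0 < g ^ 4 := pv
          nlinarith
      _ = Z ^ (12 * M + 9) := rg
      _ ≤ _ := pow_le_pow_right₀ hZ1'.le om
  have hZ8 : Z ≤ Z ^ 8 := le_self_pow₀ hZ1'.le nn
  refine ⟨hts Z hZ2 y (hZ8.trans hyl) hyu _ hn0 hnu, fun t ht => ?_⟩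
  rw [Tf, ← hy, mem_filter, mem_pI (mul_nonneg ((pv : ®0 ≤ Z ^ 8).trans hyl) hZ0.le)] at ht
  obtain ⟨⟨tp, t1, t2⟩, t3⟩ := ht
  have t8 : Z ^ 8 ≤ t := hyl.trans t1.le
  rw [Int.natAbs_mul, Int.natAbs_mul, tp.dvd_mul, tp.dvd_mul, not_or, not_or, ← Int.natCast_dvd, ← Int.natCast_dvd, Int.natAbs_natCast] at t3
  have hfpr := Q.fpr hD0 hD hp₀ h3 hp0Z hr
  have F : Fam c₀ c₁ c₂ κ C Z M C3 ((∏ p ∈ s, p) * g₁) g₂ g₃ g r φ y₁ c y₂ w₂ E m t :=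
    { geo := G, hr := hr, hg := Q.hg, gl := Q.gl, gu := Q.gu.trans (pow_le_pow_right₀ hZ1'.le om), Gu := Q.Gu, p2 := Q.p2, p3 := Q.p3
      l2 := Q.l2, l3 := Q.l2.trans (mc Q.h23.le), u2 := le_trans (mc Q.h23.le) Q.u3, u3 := Q.u3
      c12 := Q.cop2, c123 := Q.cop3, fpr := hfpr, tp := tp, tc := t3.1.1, tf := t3.1.2, tg := t3.2
      tl := by rw [← div_le_iff₀ pv]; exact t1.le
      tu := by
        rw [hy, pow_succ, div_mul_eq_mul_div, mul_div_mul_right _ _ hZ0.ne', le_div_iff₀ pv] at t2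
        exact t2 }
  have hvb := vbd (t := t) (y₁ := y₁) (c := c) (y₂ := y₂) (w₂ := w₂) hr G.det (s := s) (z := Z ^ 8) (fun p hp => (mem_filter.1 (Q.hs hp)).1)
    (fun p hp h => by
      rw [Int.natCast_dvd_natCast, Nat.prime_dvd_prime_iff_eq (mem_pz.1 hp).1 tp] at h
      exact absurd (h ▸ (mem_pz.1 hp).2) t8.not_gt)
    (fun p hp => by
      rw [Int.natCast_dvd_natCast, Q.dvd (mem_pz.1 hp).1]
      have h1 : p < g₁ := mc (mem_pz.1 hp).2.trans_le Q.l1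
      have := Q.h12; have := Q.h23
      refine ⟨fun h => ?_, Or.inl⟩
      rcases h with h | h | h | h
      · exact h
      all_goals omega)
    fun p hp => (hfpr p (Q.sp hp).1 ((Q.dvd (Q.sp hp).1).2 (Or.inl hp))).1
  refine ⟨tp, t8, le_trans ?_ (hcg Z hZ1 F (hV.trans gc) (Sf c₁ c₂ κ C Z M g r φ y₁ c y₂ w₂ E m t) ?_)⟩
  · gcongr
  · intro a k a1 a2 a3 a4 a5 a6 a7
    classical
    rw [Sf, mem_filter, mem_product, mem_range, mem_range]
    refine ⟨⟨?_, ?_⟩, a1, a2, a3, a4, a5, a6, a7⟩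
    · have : ®a ≤ 2 * g := by nlinarith [Nat.cast_nonneg (α := ℝ) a]
      have : a ≤ 2 * g := mc this
      simp only; omega
    · have ht1 : ®1 ≤ t := mc tp.one_le
      have : ®k ≤ 2 * (m * E) := by nlinarith [Nat.cast_nonneg (α := ℝ) k]
      have : k ≤ 2 * (m * E) := mc this
      simp only; omega
lemma sig_le {I : Type*} {α : I → Type*} {S : Finset I} {F : ∀ i, Finset (α i)} {a : I → ℝ} {H L : ℝ} (hH : H ≤ ∑ i ∈ S, a i) (hL : 0 ≤ L)
    (h : ∀ i ∈ S, a i * L ≤ #(F i)) : H * L ≤ #(S.sigma F) := by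
  rw [card_sigma, Nat.cast_sum]
  exact (mul_le_mul_of_nonneg_right hH hL).trans (by rw [sum_mul]; exact sum_le_sum h)
lemma Ybd {Z : ℝ} {M : ℕ} (hM : 100 ≤ M) (hZ : 1 < Z) {P g₂ g₃ : ℕ} (hP1 : 1 ≤ P) (hP : ®P ≤ Z ^ 60)
    (h2 : Z ^ (M + 3) < g₂) (h2' : g₂ ≤ Z ^ (M + 3) * Z) (h3 : Z ^ (M + 4) < g₃) (h3' : g₃ ≤ Z ^ (M + 4) * Z) :
    Z ^ 8 ≤ Z ^ (3 * M + 1) / (P * g₂ * g₃) ∧ Z ^ (3 * M + 1) / (P * g₂ * g₃) ≤ Z ^ (M - 6) := by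
  have hP1' : ®1 ≤ P := mc hP1
  have hZ0 : 0 < Z := ln
  have a2 : ®0 < g₂ := (pv : 0 < Z ^ (M + 3)).trans h2
  have a3 : ®0 < g₃ := (pv : 0 < Z ^ (M + 4)).trans h3
  constructor
  · rw [le_div_iff₀ pv]
    calc Z ^ 8 * (P * g₂ * g₃) ≤ Z ^ 8 * (Z ^ 60 * (Z ^ (M + 3) * Z) * (Z ^ (M + 4) * Z)) := gc
      _ = Z ^ (2 * M + 77) := rg
      _ ≤ _ := pow_le_pow_right₀ hZ.le om
  · rw [div_le_iff₀ pv]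
    calc Z ^ (3 * M + 1) = Z ^ (M - 6) * (1 * Z ^ (M + 3) * Z ^ (M + 4)) := by
          rw [one_mul, ← pow_add, ← pow_add]; congr 1; omega
      _ ≤ _ := gc
lemma Qmk {Z : ℝ} {M p₀ : ℕ} (hM : 100 ≤ M) (hZ : 1 < Z) {s : Finset ℕ} (hs : s ⊆ WW p₀ Z) (hP : ((∏ p ∈ s, p : ℕ) : ℝ) ≤ Z ^ 60) {g₁ g₂ g₃ : ℕ}
    (h2 : g₂ ∈ pI (Z ^ (M + 3)) (Z ^ (M + 3) * Z)) (h3 : g₃ ∈ pI (Z ^ (M + 4)) (Z ^ (M + 4) * Z))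
    (h1 : g₁ ∈ pI (Z ^ (3 * M + 1) / ((∏ p ∈ s, p : ℕ) * g₂ * g₃)) (Z ^ (3 * M + 1) / ((∏ p ∈ s, p : ℕ) * g₂ * g₃) * Z)) :
    Qd Z M p₀ s g₁ g₂ g₃ ((∏ p ∈ s, p) * g₁ * g₂ * g₃) := by
  have hP1 : 1 ≤ ∏ p ∈ s, p := prod_pos fun p hp => (mem_pz.1 (mem_filter.1 (hs hp)).1).1.pos
  set P := ∏ p ∈ s, p with hPd
  have hP1' : ®1 ≤ P := mc hP1
  have hZ0 : 0 < Z := ln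
  rw [mem_pI pv] at h1 h2 h3
  obtain ⟨p1, l1, u1⟩ := h1
  obtain ⟨p2, l2, u2⟩ := h2
  obtain ⟨p3, l3, u3⟩ := h3
  obtain ⟨Yl, Yu⟩ := Ybd hM hZ hP1 hP l2 u2 l3 u3
  have a2 : ®0 < g₂ := mc p2.pos
  have a3 : ®0 < g₃ := mc p3.pos
  have h12 : ®g₁ < g₂ := by
    calc ®g₁ ≤ Z ^ (M - 6) * Z := u1.trans gc
      _ = Z ^ (M - 6 + 1) := rg
      _ ≤ Z ^ (M + 3) := pow_le_pow_right₀ hZ.le om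
      _ < _ := l2
  have h23 : ®g₂ < g₃ := u2.trans_lt (by rw [← pow_succ]; exact l3)
  rw [div_mul_eq_mul_div, le_div_iff₀ pv] at u1
  rw [div_lt_iff₀ pv] at l1
  have gu : ®(P * g₁ * g₂ * g₃) ≤ Z ^ (3 * M + 2) := by
    calc _ = ®g₁ * (P * g₂ * g₃) := rg
      _ ≤ _ := u1
      _ = _ := rg
  refine ⟨hs, p1, p2, p3, ?_, (pow_le_pow_right₀ hZ.le om).trans l2.le, by rw [pow_succ]; exact u3, mc h12, mc h23,
    rfl, ?_, by push_cast; exact gu, ?_⟩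
  · exact Yl.trans (by rw [div_le_iff₀ pv]; exact l1.le)
  · push_cast
    linarith
  · have h5 : ®(P * g₁) * (Z ^ (M + 3) * Z ^ (M + 4)) ≤ Z ^ M * (Z ^ (M + 3) * Z ^ (M + 4)) := by
      calc _ ≤ ®(P * g₁) * (g₂ * g₃) := gc
        _ = P * g₁ * g₂ * g₃ := rg
        _ ≤ _ := gu
        _ ≤ Z ^ (3 * M + 7) := pow_le_pow_right₀ hZ.le om
        _ = _ := rg
    rw [Nat.cast_mul]
    exact le_of_mul_le_mul_right h5 pv
abbrev Ix : Type := Σ _ : Finset ℕ, Σ _ : ℕ, Σ _ : ℕ, Σ _ : ℕ, Σ _ : ℕ, Σ _ : ℕ, ℕ × ℕ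
lemma bigA (hf : IrQ) {κ C : ℝ} (hκ : 0 < κ) (hκ1 : κ ≤ 1) (hC : 1 ≤ C)
    (φ y₁ c y₂ w₂ : ℕ → ℕ → ℤ) (E m : ℕ → ℕ → ℕ) (hG : ∀ g r : ℕ, 2 ≤ g → ¡g ∣ fQ r →
      fQ r = g * φ g r ∧ Geo c₁ c₂ κ C g r (φ g r) (y₁ g r) (c g r) (y₂ g r) (w₂ g r) (E g r) (m g r)) :
    ∃ M p₀ : ℕ, 100 ≤ M ∧ ∃ δ > 0, ∃ Z₀ : ℝ, ∀ Z ≥ Z₀, ∃ A : Finset Ix, δ * Z ^ (6 * M) ≤ #A ∧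
      ∀ s g₁ g₂ g₃ r t a k, (⟨s, g₂, g₃, g₁, r, t, a, k⟩ : Ix) ∈ A → ∃ g, g = (∏ p ∈ s, p) * g₁ * g₂ * g₃ ∧ Qd Z M p₀ s g₁ g₂ g₃ g ∧
        r < g ∧ fQ r = g * φ g r ∧ Geo c₁ c₂ κ C g r (φ g r) (y₁ g r) (c g r) (y₂ g r) (w₂ g r) (E g r) (m g r) ∧
        t.Prime ∧ Z ^ 8 ≤ t ∧ Sp c₁ c₂ κ C Z M g r (φ g r) (y₁ g r) (c g r) (y₂ g r) (w₂ g r) (E g r) (m g r) t a k := by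
  classical
  obtain ⟨D, hD0, hD⟩ := bez hf
  set p₀ := D.natAbs + 3 + ⌈exp 200⌉₊ with hp₀
  obtain ⟨η, hη, Z₁, hgs⟩ := gsum (c₀ := c₀) (c₁ := c₁) (c₂ := c₂) (p₀ := p₀) (by
    refine (Nat.le_ceil _).trans ?_
    exact_mod_cast (om : ⌈exp 200⌉₊ ≤ p₀))
  obtain ⟨C3, hin⟩ := inner hf hD0 hD (p₀ := p₀) om om
  set M := 10 * C3 + 100 with hMd
  obtain ⟨Z₂, hin⟩ := hin M le_rfl κ C hκ hκ1 hC
  obtain ⟨Z₃, hM1⟩ := M1_int hf (6 * M)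
  clear_value M p₀
  set h : ℝ := 1 / (2 * (®((6 * M : ℕ)) + 1)) with hh
  set τ : ℝ := 1 / (12 * (®((6 * M : ℕ)) + 1)) with hτ
  have hh0 : 0 < h := pv
  have hτ0 : 0 < τ := pv
  refine ⟨M, p₀, om, h ^ 3 * η * (τ * (κ ^ 2 / (192 * C))), pv, max (max Z₁ Z₂) (max Z₃ 2), fun Z hZ => ?_⟩
  simp only [ge_iff_le, max_le_iff] at hZ
  obtain ⟨⟨hZ1, hZ2⟩, hZ3, hZ4⟩ := hZ
  have hZ0 : 0 < Z := ln
  have hZ1' : 1 < Z := ln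
  obtain ⟨hg1, hg2⟩ := hgs Z hZ1
  set Pv := ∏ p ∈ pz (Z ^ 8), vQ p
  have hPv : 0 < Pv := prod_pos fun p hp => vv_pos (mem_pz.1 hp).1
  set Y : Finset ℕ → ℕ → ℕ → ℝ := fun s g₂ g₃ => Z ^ (3 * M + 1) / ((∏ p ∈ s, p : ℕ) * g₂ * g₃) with hY
  set F6 : ℕ → ℕ → ℕ → Finset (ℕ × ℕ) := fun g r t => Sf c₁ c₂ κ C Z M g r (φ g r) (y₁ g r) (c g r) (y₂ g r) (w₂ g r) (E g r) (m g r) t with hF6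
  set F5 : ℕ → ℕ → Finset (Σ _ : ℕ, ℕ × ℕ) := fun g r => (Tf c₁ c₂ Z C3 g r (φ g r) (y₁ g r) (c g r) (E g r) (m g r)).sigma fun t => F6 g r t with hF5
  set F4 : ℕ → Finset (Σ _ : ℕ, Σ _ : ℕ, ℕ × ℕ) := fun g => ((range g).filter fun r : ℕ => ¡g ∣ fQ r).sigma fun r => F5 g r with hF4
  set A : Finset Ix := ((WW p₀ Z).powerset.filter fun s => (((∏ p ∈ s, p : ℕ) : ℝ) ≤ Z ^ 60)).sigma fun s =>
    (pI (Z ^ (M + 3)) (Z ^ (M + 3) * Z)).sigma fun g₂ => (pI (Z ^ (M + 4)) (Z ^ (M + 4) * Z)).sigma fun g₃ =>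
    (pI (Y s g₂ g₃) (Y s g₂ g₃ * Z)).sigma fun g₁ => F4 ((∏ p ∈ s, p) * g₁ * g₂ * g₃) with hA
  have hge : ∀ {s g₁ g₂ g₃ g}, Qd Z M p₀ s g₁ g₂ g₃ g → 2 ≤ g := fun Q => by
    have := Q.gl
    have h1 : Z ≤ Z ^ (3 * M + 1) := le_self_pow₀ hZ1'.le om
    exact_mod_cast hZ4.trans (h1.trans this)
  have hrp : ∀ n : ℕ, ®0 ≤ ®(rQ n) / n := fun n => pv
  refine ⟨A, ?_, ?_⟩
  · set K0 := τ * (κ ^ 2 / (192 * C)) * Z ^ (6 * M) with hK0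
    have hK00 : 0 < K0 := pv
    suffices h1 : η / Pv * (h ^ 3 * Pv * K0) ≤ #A by
      refine le_trans (le_of_eq ?_) h1
      rw [hK0]; field_simp
    refine sig_le (a := fun s => ∏ p ∈ s, aQ p) (by rw [div_le_iff₀' hPv]; exact hg1) pv fun s hs => ?_
    obtain ⟨hs, hP⟩ := mem_filter.1 hs
    rw [mem_powerset] at hs
    have ha : 0 ≤ ∏ p ∈ s, aQ p := prod_nonneg fun p hp => by
      have : ®2 ≤ p := mc (mem_pz.1 (mem_filter.1 (hs hp)).1).1.two_le
      exact mul_nonneg (hrp p) (by rw [sub_nonneg, div_le_one ln]; exact this)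
    have hP1 : 1 ≤ ∏ p ∈ s, p := prod_pos fun p hp => (mem_pz.1 (mem_filter.1 (hs hp)).1).1.pos
    obtain ⟨L, hL⟩ : ∃ L, L = (∏ p ∈ s, aQ p) * Pv * K0 := ⟨_, rfl⟩
    have hL0 : 0 ≤ L := by rw [hL]; positivity
    rw [show (∏ p ∈ s, aQ p) * (h ^ 3 * Pv * K0) = h * (h * (h * L)) by rw [hL]; ring]
    have hZz : Z ≤ Z ^ 8 := le_self_pow₀ hZ1'.le nn
    have hmo : ∀ a b : ℕ, a ≤ b → Z ^ a ≤ Z ^ b := fun a b hab => pow_le_pow_right₀ hZ1'.le hab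
    refine sig_le (hM1 Z hZ3 _ (le_self_pow₀ hZ1'.le om) (hmo _ _ om)) pv fun g₂ h2 => ?_
    rw [show ®(rQ g₂) / g₂ * (h * (h * L)) = h * (h * (rQ g₂ / g₂ * L)) by ring]
    refine sig_le (hM1 Z hZ3 _ (le_self_pow₀ hZ1'.le om) (hmo _ _ om)) pv fun g₃ h3 => ?_
    rw [show ®(rQ g₃) / g₃ * (h * (rQ g₂ / g₂ * L)) = h * (rQ g₃ / g₃ * (rQ g₂ / g₂ * L)) by ring]
    have b2 := (mem_pI pv).1 h2
    have b3 := (mem_pI pv).1 h3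
    obtain ⟨Yl, Yu⟩ := Ybd (om : 100 ≤ M) hZ1' hP1 hP b2.2.1 b2.2.2 b3.2.1 b3.2.2
    refine sig_le (hM1 Z hZ3 _ (hZz.trans Yl) (Yu.trans (hmo _ _ om))) pv fun g₁ h1 => ?_
    have Q := Qmk (om : 100 ≤ M) hZ1' hs hP h2 h3 h1
    obtain ⟨g, hg⟩ : ∃ g, g = (∏ p ∈ s, p) * g₁ * g₂ * g₃ := ⟨_, rfl⟩
    rw [← hg] at Q ⊢
    have hg0 : ®0 < g := mc (by have := hge Q; omega : 0 < g)
    have hPs : ®0 < (∏ p ∈ s, p : ℕ) := mc hP1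
    obtain ⟨W, hW⟩ : ∃ W, W = ∏ p ∈ s, (1 - 2 / ®p) := ⟨_, rfl⟩
    have e1 : (∏ p ∈ s, aQ p) = (∏ p ∈ s, rQ p : ℕ) / (∏ p ∈ s, p : ℕ) * W := by
      simp only [aa, prod_mul_distrib, prod_div_distrib, hW]; push_cast; rfl
    have hW0 : 0 ≤ W := by
      rw [hW]
      exact prod_nonneg fun p hp => by
        have : ®2 ≤ p := mc (Q.sp hp).1.two_le
        rw [sub_nonneg, div_le_one ln]; exact this
    rw [show ®(rQ g₁) / g₁ * (rQ g₃ / g₃ * (rQ g₂ / g₂ * L)) =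
      rQ g * (τ * (κ ^ 2 / (192 * C) * (Z ^ (6 * M) / g) * (Pv * W))) by
        have : ®0 < g₁ := mc Q.p1.pos
        have : ®0 < g₂ := mc Q.p2.pos
        have : ®0 < g₃ := mc Q.p3.pos
        rw [hL, e1, hK0, Q.rho_eq, hg, Nat.cast_mul, Nat.cast_mul, Nat.cast_mul, Nat.cast_mul _ g₃, Nat.cast_mul _ g₂, Nat.cast_mul _ g₁]
        field_simp]
    refine sig_le (a := fun _ => 1) (by rw [sum_const, nsmul_eq_mul, mul_one]; exact le_rfl) pv fun r hr => ?_
    obtain ⟨hr1, hr2⟩ := mem_filter.1 hr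
    obtain ⟨hr3, G⟩ := hG g r (hge Q) hr2
    obtain ⟨i1, i2⟩ := hin Z hZ2 Q (hg2 s hs) G hr3
    rw [one_mul]
    refine sig_le i1 pv fun t ht => ?_
    obtain ⟨tp, -, i3⟩ := i2 t ht
    have : ®0 < t := mc tp.pos
    refine le_trans (le_of_eq ?_) i3
    rw [← hW]
    field_simp
    exact mul_comm _ _
  · intro s g₁ g₂ g₃ r t a k hi
    simp only [hA, mem_sigma, hF4, hF5] at hi
    obtain ⟨hs, h2, h3, h1, hr, ht, hq⟩ := hi
    obtain ⟨hs, hP⟩ := mem_filter.1 hs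
    rw [mem_powerset] at hs
    have Q := Qmk (om : 100 ≤ M) hZ1' hs hP h2 h3 h1
    refine ⟨_, rfl, Q, ?_⟩
    obtain ⟨g, hg⟩ : ∃ g, g = (∏ p ∈ s, p) * g₁ * g₂ * g₃ := ⟨_, rfl⟩
    rw [← hg] at hr ht hq Q ⊢
    obtain ⟨hr1, hr2⟩ := mem_filter.1 hr
    obtain ⟨hr3, G⟩ := hG g r (hge Q) hr2
    obtain ⟨i1, i2⟩ := hin Z hZ2 Q (hg2 s hs) G hr3
    obtain ⟨tp, t8, -⟩ := i2 t ht
    simp only [hF6, Sf] at hq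
    exact ⟨mem_range.1 hr1, hr3, G, tp, t8, (mem_filter.1 hq).2⟩
end
section
open Finset Real Filter Polynomial
variable {c₀ c₁ c₂ : ℤ}
lemma propB (hf : IrQ) {Bf : ℕ}
    (hBf : ∀ n : ℕ, 1 ≤ n → (fQ n).natAbs ≤ Bf * n ^ 3) :
    ∃ N : ℕ, 1 ≤ N ∧ ∃ δ > 0, ∃ Z₀ : ℝ, ∀ Z ≥ Z₀, ∃ S : Finset ℕ, δ * Z ^ N ≤ #S ∧ ∀ n ∈ S, 1 ≤ n ∧ ®n ≤ Z ^ N ∧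
      ∃ d : ℕ, d ∣ (fQ n).natAbs ∧ Z ^ (N + 1) ≤ d ∧ d ≤ Z ^ (N + 5) ∧ ∀ p : ℕ, p.Prime → p ∣ d → Z ^ 8 ≤ p := by
  obtain ⟨κ, C, hκ, hκ1, hC, φ, y₁, c, y₂, w₂, E, m, hG⟩ := geom_fun hf
  obtain ⟨M, p₀, hM, δ, hδ, Z₁, hA⟩ := bigA hf hκ hκ1 hC φ y₁ c y₂ w₂ E m hG
  obtain ⟨K, hK⟩ : ∃ K : ℕ, C ^ 3 ≤ K := exists_nat_ge _
  set B := 18 * M with hB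
  set Q : ℕ := B ^ 4 * ((4 * K ^ 2 + 1) * (4 * K + 1) * 2 ^ B) with hQ
  have hQ0 : ®0 < Q := by
    have : 0 < Q := pv
    exact_mod_cast this
  have hC4 : 1 ≤ C ^ 4 := one_le_pow₀ hC
  have hC4' : C ≤ C ^ 4 := le_self_pow₀ hC nn
  refine ⟨6 * M, om, δ / Q, pv, max Z₁ (100 * C ^ 4 + Bf), fun Z hZ => ?_⟩
  simp only [ge_iff_le, max_le_iff] at hZ
  obtain ⟨hZ1, hZ2⟩ := hZ
  have hBf0 : ®0 ≤ Bf := Nat.cast_nonneg _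
  have hZ100 : 100 * C ^ 4 ≤ Z := ln
  have hZ1' : 1 < Z := ln
  have hZ0 : 0 < Z := ln
  have hmo : ∀ a b : ℕ, a ≤ b → Z ^ a ≤ Z ^ b := fun a b hab => pow_le_pow_right₀ hZ1'.le hab
  obtain ⟨A, hA1, hA2⟩ := hA Z hZ1
  set g : Ix → ℕ := fun i => (∏ p ∈ i.1, p) * i.2.2.2.1 * i.2.1 * i.2.2.1 with hg
  set r : Ix → ℕ := fun i => i.2.2.2.2.1 with hr
  set τ : Ix → ℕ := fun i => i.2.2.2.2.2.1 * i.2.2.2.2.2.2.2 with hτ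
  set a : Ix → ℕ := fun i => i.2.2.2.2.2.2.1 with ha
  set y : Ix → ℤ := fun i => y₁ (g i) (r i) * a i + τ i * y₂ (g i) (r i) with hy
  set w : Ix → ℤ := fun i => c (g i) (r i) * a i + τ i * w₂ (g i) (r i) with hw
  set D : Ix → ℤ := fun i => dQ (g i) (r i) (φ (g i) (r i)) (y i) (w i) with hD
  have key : ∀ i ∈ A, Qd Z M p₀ i.1 i.2.2.2.1 i.2.1 i.2.2.1 (g i) ∧ r i < g i ∧ fQ (r i) = g i * φ (g i) (r i) ∧
      c (g i) (r i) * y₂ (g i) (r i) - y₁ (g i) (r i) * w₂ (g i) (r i) = 1 ∧ i.2.2.2.2.2.1.Prime ∧ Z ^ 8 ≤ i.2.2.2.2.2.1 ∧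
      (∀ p : ℕ, p.Prime → ¡p ∣ D i → Z ^ 8 ≤ p) ∧ IsCoprime (D i) (g i * τ i ^ 2) ∧ τ i ≠ 0 ∧ ®(τ i) ≤ 10 * g i ∧
      (®(g i) ^ 2 / C ≤ D i ∧ ®(D i) ≤ C * g i ^ 2 ∧ |®(¡(r i * w i + g i * y i))| ≤ C * g i ∧
        |®(w i)| ≤ C * g i ∧ ®(g i) / C ≤ |®(w i)|) ∧
      ∃ n : ℕ, 1 ≤ n ∧ ®n ≤ Z ^ (6 * M) ∧ D i ∣ w i * n - (r i * w i + g i * y i) ∧ D i ∣ fQ n := by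
    rintro ⟨s, g₂, g₃, g₁, r', t, b, k⟩ hi
    obtain ⟨g', hg', q, h1, h2, G, h4, h5, p1, p2, p3, p4, p5, p6, u, u1, u2, u3⟩ := hA2 _ _ _ _ _ _ _ _ hi
    simp only [hD, hy, hw, hτ, hr, ha, hg, ← hg']
    have hgp : 0 < g' := om
    have e1 : (((g' * (t * k) ^ 2 : ℕ) : ℤ)) = ¡g' * (¡t * k) ^ 2 := by push_cast; ring
    have e2 : (((g' * (t * k) ^ 2 : ℕ) : ℝ)) = ®g' * (¡(¡t * k) : ℝ) ^ 2 := by push_cast; ring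
    rw [e1] at p6 u3
    rw [e2] at u1 u2
    have c3 : ®(m g' r' * E g' r') ≤ (¡(¡t * k) : ℝ) := by push_cast; exact p3
    have c4 : (¡(¡t * k) : ℝ) ≤ (1 + κ) * (m g' r' * E g' r') := by push_cast; exact p4
    have hmE : ®1 ≤ m g' r' * E g' r' := mc Nat.mul_pos G.m1 G.E1
    have hEg : ®(E g' r') ≤ g' := by
      have := G.E1
      exact_mod_cast (Nat.le_self_pow two_ne_zero _).trans G.E2
    have hm5 : ®(m g' r') ≤ 5 := mc G.m5
    simp only [Nat.cast_mul]
    refine ⟨q, h1, h2, G.det, h4, h5, fun p hp hpd => ?_, p6, fun h0 => ?_, ?_, G.pt b (t * k) (mc p1) (mc p2) c3 c4,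
      pt_n G h2 hC hgp (hZ100.trans (le_self_pow₀ hZ1'.le om)) (mc p1) (mc p2) c3 c4 p6 u1 u2 u3⟩
    · by_contra hlt
      exact p5 p (mem_pz.2 ⟨hp, not_le.1 hlt⟩) hpd
    · have : ®(t * k) = 0 := mc h0
      linarith
    · calc ®(t * k) ≤ (1 + κ) * (m g' r' * E g' r') := p4
        _ ≤ 2 * (5 * g') := by gcongr; linarith
        _ = _ := rg
  have hex : ∀ i, ∃ n : ℕ, i ∈ A → 1 ≤ n ∧ ®n ≤ Z ^ (6 * M) ∧ D i ∣ w i * n - (r i * w i + g i * y i) ∧ D i ∣ fQ n := fun i => by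
    by_cases hi : i ∈ A
    · obtain ⟨n, hn⟩ := (key i hi).2.2.2.2.2.2.2.2.2.2.2
      exact ⟨n, fun _ => hn⟩
    · exact ⟨0, fun h => absurd h hi⟩
  choose n hn using hex
  have hDl : ∀ i ∈ A, Z ^ (6 * M + 1) ≤ D i := fun i hi => by
    obtain ⟨q, -, -, -, -, -, -, -, -, -, b1, -⟩ := key i hi
    refine le_trans ?_ b1.1
    rw [le_div_iff₀ ln]
    calc Z ^ (6 * M + 1) * C ≤ Z ^ (6 * M + 1) * Z := by gcongr; linarith
      _ = (Z ^ (3 * M + 1)) ^ 2 := rg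
      _ ≤ _ := by have := q.gl; gcongr
  have hDu : ∀ i ∈ A, ®(D i) ≤ Z ^ (6 * M + 5) := fun i hi => by
    obtain ⟨q, -, -, -, -, -, -, -, -, -, b1, -⟩ := key i hi
    refine b1.2.1.trans ?_
    have := q.gu
    calc C * ®(g i) ^ 2 ≤ Z * (Z ^ (3 * M + 2)) ^ 2 := by gcongr; linarith
      _ = _ := rg
  have hDp : ∀ i ∈ A, 0 < D i := fun i hi => by
    have : ®0 < D i := (pv : 0 < Z ^ (6 * M + 1)).trans_le (hDl i hi)
    exact_mod_cast this
  refine ⟨A.image n, ?_, ?_⟩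
  · have hz8 : (Z ^ 8) ^ (B + 1) = Z ^ (8 * (B + 1)) := (pow_mul _ _ _).symm
    have := mult A (c₀ := c₀) (c₁ := c₁) (c₂ := c₂) (z := Z ^ 8) (one_lt_pow₀ hZ1' nn) (K := K) (B := B) φ y₁ c y₂ w₂ g r τ a n
      (fun i => (i.2.2.2.1, i.2.1, i.2.2.1, i.2.2.2.2.2.1)) y w D ?_ ?_ ?_ ?_ ?_
    · rw [div_mul_eq_mul_div, div_le_iff₀ hQ0]
      refine hA1.trans ?_
      have h' : #A ≤ #(A.image n) * Q := this.trans (le_of_eq (by rw [hQ]; ring))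
      exact_mod_cast h'
    · rintro ⟨s, g₂, g₃, g₁, r', t, b, k⟩ hi ⟨s', g₂', g₃', g₁', r'', t', b', k'⟩ hj e1 e2 e3 e4 e5
      have q := (key _ hi).1
      have q' := (key _ hj).1
      have tp := (key _ hi).2.2.2.2.1
      simp only [hg, hr, hτ, ha, Prod.mk.injEq] at e1 e2 e3 e4 e5 q q' tp
      obtain ⟨rfl, rfl, rfl, rfl⟩ := e5
      subst e2 e4
      have ek := Nat.eq_of_mul_eq_mul_left tp.pos e3
      have es : ∏ p ∈ s, p = ∏ p ∈ s', p := Nat.eq_of_mul_eq_mul_right q.p1.pos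
        (Nat.eq_of_mul_eq_mul_right q.p2.pos (Nat.eq_of_mul_eq_mul_right q.p3.pos e1))
      have : s = s' := by
        rw [← Nat.primeFactors_prod fun p hp => (q.sp hp).1, ← Nat.primeFactors_prod fun p hp => (q'.sp hp).1, es]
      subst this ek
      rfl
    · intro i hi
      obtain ⟨q, b1, b2, b3, b4, b5, b6, b7, b8, b9, b10, b11⟩ := key i hi
      exact ⟨b2, b3, rfl, rfl, rfl, b1, q.sqf, b7, hDp i hi⟩
    · intro i hi
      obtain ⟨q, b1, b2, b3, b4, b5, b6, b7, b8, b9, ⟨d1, d2, d3, d4, d5⟩, b11⟩ := key i hi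
      obtain ⟨-, -, n3, n4⟩ := hn i hi
      have hg0 : ®0 ≤ g i := Nat.cast_nonneg _
      have hD0 : ®0 < D i := mc hDp i hi
      rw [div_le_iff₀ ln] at d1 d5
      have sq : ∀ x : ℝ, |x| ≤ C * g i → x ^ 2 ≤ K * D i := fun x hx => by
        rw [← sq_abs]
        calc |x| ^ 2 ≤ (C * g i) ^ 2 := gc
          _ = C ^ 2 * g i ^ 2 := rg
          _ ≤ C ^ 2 * (D i * C) := gc
          _ = C ^ 3 * D i := rg
          _ ≤ _ := gc
      refine ⟨n3, n4, ?_, ?_, ?_, b6⟩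
      · have := sq _ d3; exact_mod_cast this
      · have := sq _ d4; exact_mod_cast this
      · have : ®(D i) ≤ K * w i ^ 2 := by
          rw [← sq_abs]
          calc ®(D i) ≤ C * g i ^ 2 := d2
            _ ≤ C * (|®(w i)| * C) ^ 2 := gc
            _ = C ^ 3 * |®(w i)| ^ 2 := rg
            _ ≤ _ := gc
        exact_mod_cast this
    · intro i hi
      obtain ⟨q, b1, b2, b3, b4, b5, b6, b7, b8, b9, b10, b11⟩ := key i hi
      obtain ⟨n1, n2, n3, n4⟩ := hn i hi
      have hgu := q.gu
      rw [hz8]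
      refine ⟨hgu.trans_lt (pow_lt_pow_right₀ hZ1' om), b8, ?_, ff_ne hf _, ?_⟩
      · calc ®(τ i) ≤ 10 * g i := b9
          _ ≤ Z * Z ^ (3 * M + 2) := by gcongr; linarith
          _ = Z ^ (3 * M + 3) := rg
          _ < _ := pow_lt_pow_right₀ hZ1' om
      · calc ((fQ (n i)).natAbs : ℝ) ≤ Bf * ®(n i) ^ 3 := mc hBf _ n1
          _ ≤ Z * (Z ^ (6 * M)) ^ 3 := by gcongr; linarith
          _ = Z ^ (18 * M + 1) := rg
          _ < _ := pow_lt_pow_right₀ hZ1' om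
    · intro i hi
      obtain ⟨q, b1, b2, b3, b4, b5, b6, b7, b8, b9, b10, b11⟩ := key i hi
      have hg0 : g i ≠ 0 := om
      have l2 : Z ^ 8 ≤ ®(i.2.1) := (hmo _ _ om).trans q.l2
      refine ⟨(mem_bigp hg0).2 ⟨q.p1, (q.dvd q.p1).2 sm, q.l1⟩, (mem_bigp hg0).2 ⟨q.p2, (q.dvd q.p2).2 sm, l2⟩,
        (mem_bigp hg0).2 ⟨q.p3, (q.dvd q.p3).2 sm, l2.trans (mc q.h23.le)⟩, (mem_bigp b8).2 ⟨b4, dvd_mul_right _ _, b5⟩⟩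
  · intro x hx
    obtain ⟨i, hi, rfl⟩ := mem_image.1 hx
    obtain ⟨n1, n2, n3, n4⟩ := hn i hi
    have hc : (((D i).natAbs : ℕ) : ℝ) = D i := by
      rw [Nat.cast_natAbs, abs_of_pos (hDp i hi)]
    refine ⟨n1, n2, (D i).natAbs, Int.natAbs_dvd_natAbs.2 n4, by rw [hc]; exact hDl i hi, by rw [hc]; exact hDu i hi, fun p hp hpd => ?_⟩
    exact (key i hi).2.2.2.2.2.2.1 p hp (Int.natCast_dvd.2 hpd)
end
section
open Finset Real Filter
variable {c₀ c₁ c₂ : ℤ}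
lemma sm_lo {m B X : ℕ} (hm : m ≠ 0) (hX : 1 ≤ X) (hB : 1 ≤ B) (hmB : m ≤ B * X ^ 3) {L : ℝ} (hL : 0 ≤ L)
    (h : ∀ p : ℕ, p.Prime → p ∣ m → log p ≤ L) :
    log m ≤ (∑ p ∈ (range (B * X + 1)).filter Nat.Prime, ®(m.factorization p) * log p) + 2 * L := by
  rw [log_nat_eq_sum_factorization, Finsupp.sum, Nat.support_factorization,
    ← sum_filter_add_sum_filter_not m.primeFactors (fun p : ℕ => p < B * X + 1)]
  refine add_le_add (sum_le_sum_of_subset_of_nonneg (fun p hp => ?_) fun p _ _ => pv) ?_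
  · simp only [mem_filter, Nat.mem_primeFactors, mem_range] at hp ⊢
    exact ⟨hp.2, hp.1.1⟩
  set A := m.primeFactors.filter fun p : ℕ => ¬ p < B * X + 1
  have hK : ∑ p ∈ A, m.factorization p ≤ 2 := by
    by_contra! hK
    have h1 : (B * X + 1) ^ (∑ p ∈ A, m.factorization p) ≤ m := by
      rw [← prod_pow_eq_pow_sum]
      calc _ ≤ ∏ p ∈ A, p ^ m.factorization p := prod_le_prod' fun p hp => Nat.pow_le_pow_left (not_lt.1 (mem_filter.1 hp).2) _
        _ ≤ ∏ p ∈ m.primeFactors, p ^ m.factorization p := prod_le_prod_of_subset_of_one_le' (filter_subset _ _) fun p hp _ =>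
          Nat.one_le_pow _ _ (Nat.pos_of_mem_primeFactors hp)
        _ = m := Nat.prod_factorization_pow_eq_self hm
    have h2 : (B * X + 1) ^ 3 ≤ (B * X + 1) ^ (∑ p ∈ A, m.factorization p) := Nat.pow_le_pow_right om hK
    have h3 : (B * X) ^ 3 < (B * X + 1) ^ 3 := Nat.pow_lt_pow_left om om
    have h4 : B * X ^ 3 ≤ (B * X) ^ 3 := by rw [mul_pow]; exact Nat.mul_le_mul_right _ (Nat.le_self_pow om B)
    omega
  calc _ ≤ ∑ p ∈ A, ®(m.factorization p) * L := sum_le_sum fun p hp => by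
        have := Nat.mem_primeFactors.1 (mem_filter.1 hp).1
        exact mul_le_mul_of_nonneg_left (h p this.1 this.2.1) pv
    _ = ((∑ p ∈ A, m.factorization p : ℕ) : ℝ) * L := by push_cast; rw [sum_mul]
    _ ≤ _ := by gcongr; exact_mod_cast hK
lemma sm_dv {m d Y : ℕ} (hm : m ≠ 0) (hd : d ∣ m) (h : ∀ p : ℕ, p.Prime → p ∣ d → p ≤ Y) :
    log d ≤ ∑ p ∈ (range (Y + 1)).filter Nat.Prime, ®(m.factorization p) * log p := by
  rw [log_nat_eq_sum_factorization, Finsupp.sum, Nat.support_factorization]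
  refine (sum_le_sum fun p _ => ?_).trans (sum_le_sum_of_subset_of_nonneg (fun p hp => ?_) fun p _ _ => pv)
  · have := (Nat.factorization_le_iff_dvd (ne_zero_of_dvd_ne_zero hm hd) hm).2 hd p
    gcongr
  · have hp := Nat.mem_primeFactors.1 hp
    exact mem_filter.2 ⟨mem_range.2 (Nat.lt_succ_of_le (h p hp.1 hp.2.1)), hp.1⟩
lemma slog (X : ℕ) : X * log X - X ≤ ∑ n ∈ Icc 1 X, log (n : ℕ) := by
  rcases Nat.eq_zero_or_pos X with h | h
  · simp [h]
  have h0 : ®0 < X := mc h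
  have h1 := pow_div_factorial_le_exp ®X h0.le X
  rw [div_le_iff₀ pv] at h1
  have h2 := log_le_log pv h1
  rw [log_pow, log_mul pv pv, log_exp, ← prod_Ico_id_eq_factorial, Nat.cast_prod,
    log_prod (fun i hi => by have := (mem_Ico.1 hi).1; positivity)] at h2
  exact sub_le_iff_le_add'.2 h2
lemma ff_lo {B : ℕ} (hB : B = 1 + c₂.natAbs + c₁.natAbs + c₀.natAbs) {n : ℕ} (hn : 1 ≤ n) :
    (fQ n).natAbs ≤ B * n ^ 3 ∧ (fQ n ≠ 0 → n ^ 3 ≤ (2 * B) ^ 3 * (fQ n).natAbs) := by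
  have hn' : ¡1 ≤ n := mc hn
  have e : |c₂ * ¡n ^ 2 + c₁ * n + c₀| ≤ (B - 1) * ¡n ^ 2 := by
    have a1 := abs_add_three (c₂ * ¡n ^ 2) (c₁ * n) c₀
    rw [abs_mul, abs_mul, abs_of_nonneg (pv : ¡0 ≤ ¡n ^ 2), abs_of_nonneg (pv : ¡0 ≤ ¡n)] at a1
    have : ¡B = 1 + |c₂| + |c₁| + |c₀| := by rw [hB]; push_cast; ring
    rw [this]
    nlinarith only [a1, hn', mul_nonneg (abs_nonneg c₁) (by nlinarith only [hn'] : ¡0 ≤ ¡n ^ 2 - n), mul_nonneg (abs_nonneg c₀) (by nlinarith only [hn'] : ¡0 ≤ ¡n ^ 2 - 1)]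
  have hB1 : ¡1 ≤ B := om
  have hf : fQ n = ¡n ^ 3 + (c₂ * ¡n ^ 2 + c₁ * n + c₀) := by unfold ff; ring
  have hc : ¡((fQ n).natAbs) = |fQ n| := Int.natCast_natAbs _
  have e2 := abs_le.1 e
  constructor
  · zify
    rw [hf]
    refine (abs_add_le _ _).trans ?_
    rw [abs_of_nonneg (pv : ¡0 ≤ ¡n ^ 3)]
    nlinarith only [e, hn', mul_nonneg (mul_nonneg (om : ¡0 ≤ B - 1) (sq_nonneg ¡n)) (om : ¡0 ≤ n - 1)]
  · intro h0
    rcases le_or_gt n (2 * B) with h | h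
    · exact (Nat.pow_le_pow_left h 3).trans (Nat.le_mul_of_pos_right _ (Int.natAbs_pos.2 h0))
    · have h' : ¡(2 * B) ≤ n := mc h.le
      have h1 : ¡n ^ 3 ≤ 2 * |fQ n| := by
        have := le_abs_self (fQ n)
        nlinarith only [this, hf, e2.1, h', mul_nonneg (sq_nonneg ¡n) (by linarith only [h'] : ¡0 ≤ n - 2 * B), sq_nonneg ¡n]
      have h2 : n ^ 3 ≤ 2 * (fQ n).natAbs := by zify; exact h1
      refine h2.trans (Nat.mul_le_mul_right _ ?_)
      have : 2 * 1 ≤ 2 * B := om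
      exact this.trans (Nat.le_self_pow om _)
lemma big_d {N X Y d : ℕ} {Z : ℝ} (hZ : 1 < Z) (hZX : Z ^ N = X) (hXY : X ≤ Y) (hd : ®d ≤ Z ^ (N + 5))
    (hp : ∀ p : ℕ, p.Prime → p ∣ d → Z ^ 8 ≤ p) (hd0 : d ≠ 0) {p : ℕ} (hpp : p.Prime) (hpd : p ∣ d) (hY : Y < p) : d = p := by
  obtain ⟨k, rfl⟩ := hpd
  by_contra hk
  have hk1 : k ≠ 1 := fun h => hk (by rw [h, mul_one])
  obtain ⟨q, hq, hqk⟩ := Nat.exists_prime_and_dvd hk1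
  have h1 := hp q hq (hqk.mul_left p)
  have h2 : ®q ≤ k := mc Nat.le_of_dvd (Nat.pos_of_ne_zero fun h => hd0 (by simp [h])) hqk
  have h3 : Z ^ N ≤ p := by rw [hZX]; exact_mod_cast (hXY.trans hY.le)
  have h4 : Z ^ N * Z ^ 8 ≤ Z ^ (N + 5) := by
    refine le_trans ?_ hd
    push_cast
    exact mul_le_mul h3 (h1.trans h2) pv pv
  rw [← pow_add] at h4
  exact absurd h4 (not_le.2 (pow_lt_pow_right₀ hZ om))
open Polynomial
theorem fin1
    (hf : IrQ) :
    ∃ c > ®0, ∃ x₀ : ℝ, 1 ≤ x₀ ∧ ∀ x : ℝ, x₀ ≤ x →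
      ∃ n : ℕ, 1 ≤ n ∧ ®n ≤ x ∧ ∃ p : ℕ, p.Prime ∧ p ∣ (fQ n).natAbs ∧ x ^ (1 + c) ≤ ®p := by
  obtain ⟨B, hB⟩ : ∃ B, B = 1 + c₂.natAbs + c₁.natAbs + c₀.natAbs := ⟨_, rfl⟩
  have hB1 : 1 ≤ B := om
  obtain ⟨N, hN, δ, hδ, Z₀, hP⟩ := propB hf (fun n hn => (ff_lo hB hn).1)
  have hN0 : ®0 < N := mc hN
  obtain ⟨ε, hε, h1, h2⟩ : ∃ ε : ℝ, 0 < ε ∧ 4 * ε ≤ δ / N ∧ 4 * ε ≤ 1 / N :=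
    ⟨min δ 1 / N / 4, by have := lt_min hδ one_pos; positivity, by rw [mul_div_cancel₀ _ four_ne_zero]; gcongr; exact min_le_left _ _,
      by rw [mul_div_cancel₀ _ four_ne_zero]; gcongr; exact min_le_right _ _⟩
  have h3 : 1 / ®N ≤ 1 := by rw [div_le_one hN0]; exact_mod_cast hN
  set C' := log (((2 * B) ^ 3 : ℕ) : ℝ) with hC'
  have hC0 : 0 ≤ C' := log_natCast_nonneg _
  have hup := upA hf hB1 (fun n hn => (ff_lo hB hn).1) hε ln
  have hz : ∀ᶠ y : ℕ in atTop, max Z₀ 2 ^ N ≤ ®y := tendsto_natCast_atTop_atTop.eventually_ge_atTop _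
  obtain ⟨X₀, hX₀⟩ := eventually_atTop.1 ((hup.and (log_ev (C' + 8) hε)).and hz)
  refine ⟨ε, hε, X₀ + 1, by linarith [X₀.cast_nonneg (α := ℝ)], fun x hx => ?_⟩
  set X := ⌊x⌋₊ with hXd
  have hx1 : 1 ≤ x := by linarith [X₀.cast_nonneg (α := ℝ)]
  have hXx : ®X ≤ x := Nat.floor_le ln
  have hxX : x < X + 1 := Nat.lt_floor_add_one x
  have hX1 : 1 ≤ X := Nat.le_floor (by simpa using hx1)
  have hX1' : ®1 ≤ X := mc hX1
  obtain ⟨⟨hU, hT⟩, hZ⟩ := hX₀ X (Nat.le_floor ln)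
  set T := log X with hTd
  have hT0 : 0 ≤ T := log_nonneg hX1'
  by_contra! hno
  have hlx : log x ≤ T + 1 := by
    have : x ≤ X * exp 1 := by nlinarith [add_one_le_exp 1]
    have := log_le_log ln this
    rwa [log_mul pv pv, log_exp] at this
  have hL : ∀ n ∈ Icc 1 X, ∀ p : ℕ, p.Prime → p ∣ (fQ n).natAbs → log p ≤ (1 + ε) * T + 2 := by
    intro n hn p hp hpd
    have hn := mem_Icc.1 hn
    have h := hno n hn.1 (le_trans (mc hn.2) hXx) p hp hpd
    have := log_le_log (mc hp.pos) h.le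
    rw [log_rpow ln] at this
    nlinarith
  obtain ⟨Z, hZX, hZ2⟩ : ∃ Z : ℝ, Z ^ N = X ∧ max Z₀ 2 ≤ Z := by
    refine ⟨®X ^ (1 / ®N), ?_, ?_⟩
    · rw [one_div, rpow_inv_natCast_pow pv om]
    · rw [one_div]
      refine le_trans (le_of_eq ?_) (rpow_le_rpow pv hZ pv)
      rw [pow_rpow_inv_natCast pv om]
  have hZ1 : 1 < Z := by linarith [le_max_right Z₀ 2]
  have hlZ : N * log Z = T := by rw [← log_pow, hZX]
  obtain ⟨S, hS, hSn⟩ := hP Z ((le_max_left _ _).trans hZ2)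
  rw [hZX] at hS
  have hSX : S ⊆ Icc 1 X := fun n hn => by
    have := hSn n hn
    rw [hZX] at this
    exact mem_Icc.2 ⟨this.1, mc this.2.1⟩
  have hbase : ∀ n ∈ Icc 1 X, 3 * log (n : ℕ) - (2 * (1 + ε) * T + C' + 4) + (if n ∈ S then T / N else 0) ≤ LQ (B * X) n := by
    intro n hn
    have hn1 := mem_Icc.1 hn
    have hn0 : ®0 < n := mc hn1.1
    have hlo := ff_lo hB hn1.1
    have hne := Int.natAbs_ne_zero.2 (ff_ne hf n)
    split_ifs with hs
    · obtain ⟨-, -, d, hd, hd1, hd2, hdp⟩ := hSn n hs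
      have hd0 : d ≠ 0 := ne_zero_of_dvd_ne_zero hne hd
      have hld : T + T / N ≤ log d := by
        have := log_le_log pv hd1
        rw [log_pow] at this
        refine le_trans (le_of_eq ?_) this
        rw [← hlZ]; field_simp; push_cast; ring
      have hln : log n ≤ T := log_le_log hn0 (mc hn1.2)
      have h := sm_dv (Y := B * X) hne hd fun p hp hpd => by
        by_contra! hY
        have e := big_d hZ1 hZX (Nat.le_mul_of_pos_left X hB1) hd2 hdp hd0 hp hpd hY
        have := hL n hn p hp (hpd.trans hd)
        rw [← e] at this
        have h5 : T / N = 1 / N * T := rg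
        nlinarith
      unfold Lf
      nlinarith
    · have h := sm_lo hne hX1 hB1 (hlo.1.trans (Nat.mul_le_mul_left _ (Nat.pow_le_pow_left hn1.2 3))) pv (hL n hn)
      have h6 : log ®((n ^ 3 : ℕ)) ≤ log (((2 * B) ^ 3 * (fQ n).natAbs : ℕ) : ℝ) :=
        log_le_log (by push_cast; positivity) (mc hlo.2 (ff_ne hf n))
      rw [Nat.cast_mul, log_mul pv pv, Nat.cast_pow, log_pow, ← hC'] at h6
      unfold Lf
      push_cast at h6
      linarith
  have hsum := (sum_le_sum hbase).trans hU
  rw [sum_add_distrib, sum_sub_distrib, ← mul_sum, sum_const, Nat.card_Icc, sum_ite_mem, inter_eq_right.2 hSX, sum_const, nsmul_eq_mul, nsmul_eq_mul,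
    Nat.add_sub_cancel] at hsum
  have h7 := slog X
  have h8 : δ * X * (T / N) ≤ #S * (T / N) := gc
  have h9 : 4 * ε * (X * T) ≤ δ * X * (T / N) := by
    calc _ ≤ δ / N * (X * T) := gc
      _ = _ := rg
  have h10 : ®X * (C' + 8) ≤ X * (ε * T) := gc
  nlinarith
end
open Polynomial
theorem stmt_1 (c₀ c₁ c₂ : ℤ)
    (hf : Irreducible (X ^ 3 + C c₂ * X ^ 2 + C c₁ * X + C c₀ : ℤ[X])) :
    ∃ c > (0 : ℝ), ∃ Cc > (0 : ℝ), ∃ x₀ : ℝ, 1 ≤ x₀ ∧ ∀ x : ℝ, x₀ ≤ x →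
      ∃ n : ℤ, 1 ≤ n ∧ (n : ℝ) ≤ x ∧
        ∃ p : ℕ, p.Prime ∧ (p : ℤ) ∣ (X ^ 3 + C c₂ * X ^ 2 + C c₁ * X + C c₀ : ℤ[X]).eval n ∧
          Cc * x ^ (1 + c) ≤ (p : ℝ) := by
  obtain ⟨c, hc, x₀, h1, h⟩ := fin1 hf
  refine ⟨c, hc, 1, one_pos, x₀, h1, fun x hx => ?_⟩
  obtain ⟨n, hn, hnx, p, hp, hd, hpx⟩ := h x hx
  refine ⟨n, by exact_mod_cast hn, by exact_mod_cast hnx, p, hp, ?_, by rwa [one_mul]⟩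
  simp only [eval_add, eval_mul, eval_pow, eval_X, eval_C]
  exact Int.natCast_dvd.2 hd
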